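/- Fix an integer d ≥ 3, a finite set M, an integer r ≥ 1 and p ∈ I_{d,r}(M). If for every coupling q ∈ I_{d,r}(M×M) of p and p one has Σ(q) ≤ 2 Σ(p), then h̲(μ(p)) = h̄(μ(p)) = Σ(p) and the r-Markov process μ(p) is strongly typical. -/

import Mathlib

open MeasureTheory Filter Topology
open scoped ENNReal Classical

noncomputable section

namespace TreeEntropy

@[ext]
structure RCG (M : Type*) where
  col : List ℕ → Option M
  adj : List ℕ × List ℕ → Bool

variable {M : Type*}

def resS (r : ℕ) (g : RCG M) : RCG M where
  col l := if l.length ≤ r then g.col l else none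
  adj p := if p.1.length ≤ r ∧ p.2.length ≤ r then g.adj p else false

def rcgDist (g g' : RCG M) : ℝ :=
  ∑' r : ℕ, if resS r g = resS r g' then 0 else (2:ℝ)⁻¹ ^ r

private lemma rcg_summable (a b : RCG M) : Summable
    (fun r : ℕ => if resS r a = resS r b then (0:ℝ) else (2:ℝ)⁻¹ ^ r) := by
  refine Summable.of_nonneg_of_le (fun r => ?_) (fun r => ?_)
    (summable_geometric_of_lt_one (by norm_num) (by norm_num : (2:ℝ)⁻¹ < 1))
  · split
    · exact le_rfl
    · positivity
  · split
    · positivity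
    · exact le_rfl

private lemma rcg_nonneg (a b : RCG M) (r : ℕ) :
    (0:ℝ) ≤ if resS r a = resS r b then (0:ℝ) else (2:ℝ)⁻¹ ^ r := by
  split
  · exact le_rfl
  · positivity

private lemma rcgDist_self (g : RCG M) : rcgDist g g = 0 := by simp [rcgDist]

private lemma rcgDist_comm (g g' : RCG M) : rcgDist g g' = rcgDist g' g :=
  tsum_congr fun r => if_congr eq_comm rfl rfl

private lemma rcgDist_triangle (g₁ g₂ g₃ : RCG M) :
    rcgDist g₁ g₃ ≤ rcgDist g₁ g₂ + rcgDist g₂ g₃ := by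
  unfold rcgDist
  rw [← Summable.tsum_add (rcg_summable _ _) (rcg_summable _ _)]
  refine Summable.tsum_le_tsum (fun r => ?_) (rcg_summable _ _)
    ((rcg_summable _ _).add (rcg_summable _ _))
  have hx : (0:ℝ) ≤ (2:ℝ)⁻¹ ^ r := by positivity
  by_cases h12 : resS r g₁ = resS r g₂
  · by_cases h23 : resS r g₂ = resS r g₃
    · rw [if_pos h12, if_pos h23, if_pos (h12.trans h23)]; linarith
    · rw [if_pos h12, if_neg h23, zero_add]
      split_ifs <;> linarith
  · by_cases h23 : resS r g₂ = resS r g₃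
    · rw [if_neg h12, if_pos h23, add_zero]
      split_ifs <;> linarith
    · rw [if_neg h12, if_neg h23]
      split_ifs <;> linarith

private lemma rcgDist_eq_zero (g g' : RCG M) (h : rcgDist g g' = 0) : g = g' := by
  unfold rcgDist at h
  have hr : ∀ r : ℕ, resS r g = resS r g' := by
    intro r
    by_contra hne
    have hpos : (0:ℝ) <
        ∑' r : ℕ, if resS r g = resS r g' then (0:ℝ) else (2:ℝ)⁻¹ ^ r :=
      Summable.tsum_pos (rcg_summable g g') (rcg_nonneg g g') r
        (by rw [if_neg hne]; positivity)
    exact absurd h hpos.ne'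
  have hc : g.col = g'.col := by
    funext l
    have h1 := congrFun (congrArg RCG.col (hr l.length)) l
    simpa [resS] using h1
  have ha : g.adj = g'.adj := by
    funext p
    have h1 := congrFun (congrArg RCG.adj (hr (max p.1.length p.2.length))) p
    simpa [resS, le_max_left, le_max_right] using h1
  exact RCG.ext hc ha

instance : MetricSpace (RCG M) where
  dist := rcgDist
  dist_self := rcgDist_self
  dist_comm := rcgDist_comm
  dist_triangle := rcgDist_triangle
  eq_of_dist_eq_zero := rcgDist_eq_zero _ _

instance : MeasurableSpace (RCG M) := borel _
instance : BorelSpace (RCG M) := ⟨rfl⟩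


/-! ### The `d`-regular tree `T_d` -/

/-- A list `l = [i_k, …, i_1]` (deepest step first) is the breadth-first-search label of a
vertex of the `d`-regular tree `T_d` iff its first (root-side) step lies in `{1, …, d}` and all
subsequent steps lie in `{1, …, d-1}`. -/
def ValidTd (d : ℕ) (l : List ℕ) : Prop :=
  (∀ i ∈ l.dropLast, 1 ≤ i ∧ i ≤ d - 1) ∧ (∀ i ∈ l.getLast?, 1 ≤ i ∧ i ≤ d)

/-- The vertex set of the `d`-regular tree `T_d`. -/
def TdVertex (d : ℕ) : Type := {l : List ℕ // ValidTd d l}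

/-- The root `o` of `T_d`. -/
def rootTd (d : ℕ) : TdVertex d := ⟨[], by constructor <;> simp [List.getLast?]⟩

/-- The first neighbor `1` of the root of `T_d` (defined as the root for the degenerate case
`d = 0`, which never occurs below). -/
def node1 (d : ℕ) : TdVertex d :=
  if h : 1 ≤ d then ⟨[1], by constructor <;> simp [List.getLast?, h]⟩ else rootTd d

/-- The graph structure of the `d`-regular tree: two vertices are adjacent iff one is obtained
from the other by adding one step. -/
def TdGraph (d : ℕ) : SimpleGraph (TdVertex d) where
  Adj v w := (∃ i, w.1 = i :: v.1) ∨ (∃ i, v.1 = i :: w.1)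
  symm := ⟨by intro v w h; tauto⟩
  loopless := ⟨by
    rintro v (⟨i, h⟩ | ⟨i, h⟩) <;>
      · have := congrArg List.length h
        simp at this⟩

/-- Graph distance between two vertices of a tree encoded by their BFS labels: the nearest
common ancestor corresponds to the longest common suffix. -/
def treeDist (u w : List ℕ) : ℕ :=
  ((u.reverse.zip w.reverse).takeWhile (fun p => p.1 = p.2)).length |> fun c =>
    (u.length - c) + (w.length - c)

/-- The ball `S_r = B_r(o)` of radius `r` around the root of `T_d`. -/
def SrSet (d r : ℕ) : Set (TdVertex d) := {v | v.1.length ≤ r}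

/-- The set `E_r = B_{r-1}({o,1})` of vertices at distance at most `r-1` from the edge `{o,1}`
of `T_d` (for `r ≥ 1`). -/
def ErSet (d r : ℕ) : Set (TdVertex d) :=
  {v | v.1.length + 1 ≤ r ∨ (v.1.getLast? = some 1 ∧ v.1.length ≤ r)}

lemma ErSet_subset_SrSet (d r : ℕ) : ErSet d r ⊆ SrSet d r := by
  rintro v (h | ⟨-, h⟩) <;> simp only [SrSet, Set.mem_setOf_eq] <;> omega

/-! ### Invariant processes on `T_d` and their entropies -/

variable (d : ℕ) (M : Type*)

/-- `I_d(M)`: the set of probability measures on `M^{T_d}` invariant under all automorphisms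
of the tree `T_d`. -/
def InvMeas [MeasurableSpace M] : Set (Measure (TdVertex d → M)) :=
  {μ | IsProbabilityMeasure μ ∧
    ∀ φ : TdGraph d ≃g TdGraph d, μ.map (fun x => fun v => x (φ v)) = μ}

variable {d M}

/-- The Shannon entropy of (the distribution of) a random variable with law `μ`, a measure
with countable support on a discrete space. -/
def shannon {α : Type*} [MeasurableSpace α] (μ : Measure α) : ℝ :=
  ∑' a : α, Real.negMulLog (μ {a}).toReal

/-- The restriction `X_S` of a process `X` on `T_d` to a subset `S` of the vertices:
the pushforward of its law. -/
def restrictTo [MeasurableSpace M] (S : Set (TdVertex d))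
    (μ : Measure (TdVertex d → M)) : Measure (↥S → M) :=
  μ.map (fun x => fun v => x v.1)

/-- The annealed entropy `Σ_r(μ) = H(X_{S_r}) - (d/2) H(X_{E_r})`. -/
def SigmaR [MeasurableSpace M] (d : ℕ) (r : ℕ) (μ : Measure (TdVertex d → M)) : ℝ :=
  shannon (restrictTo (SrSet d r) μ) - (d / 2 : ℝ) * shannon (restrictTo (ErSet d r) μ)

/-- The annealed entropy `Σ(μ) = lim_r Σ_r(μ)`: the limit of the non-increasing sequence
`r ↦ Σ_r(μ)` (`r ≥ 1`), as an extended real (the limit may be `-∞`). -/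
def SigmaInf [MeasurableSpace M] (d : ℕ) (μ : Measure (TdVertex d → M)) : EReal :=
  ⨅ r : ℕ, ((SigmaR d (r + 1) μ : ℝ) : EReal)

/-- `Σ_e(X) = (d/2) H(X_{E_1}) - (d-1) H(X_o)`. -/
def SigmaE [MeasurableSpace M] (d : ℕ) (μ : Measure (TdVertex d → M)) : ℝ :=
  (d / 2 : ℝ) * shannon (restrictTo (ErSet d 1) μ)
    - ((d : ℝ) - 1) * shannon (restrictTo ({rootTd d} : Set (TdVertex d)) μ)

/-! ### Markov processes on `T_d` -/

/-- The elementary cylinder event: the coloring takes the values prescribed by `y` on `S`. -/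
def cylEvent (S : Set (TdVertex d)) (y : TdVertex d → M) : Set (TdVertex d → M) :=
  {x | ∀ v ∈ S, x v = y v}

/-- The side of the edge `{u,w}` containing `u`, in the tree `T_d`. -/
def sideOf (u w : TdVertex d) : Set (TdVertex d) :=
  {v | treeDist v.1 u.1 < treeDist v.1 w.1}

/-- `B_{r-1}({u,w})`: the set of vertices at distance at most `r-1` from the edge `{u,w}`. -/
def edgeBall (r : ℕ) (u w : TdVertex d) : Set (TdVertex d) :=
  {v | treeDist v.1 u.1 + 1 ≤ r ∨ treeDist v.1 w.1 + 1 ≤ r}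

/-- A probability measure on `M^{T_d}` is `r`-Markov on a subset `A` of `T_d` if, for every
edge `{u,w}` of `A`, conditioned on the value on the `(r-1)`-neighborhood of the edge
(within `A`), the processes on the two sides of the edge (within `A`) are independent;
equivalently, the corresponding products of cylinder probabilities agree.  For `A` the whole
tree and `r = 1` this is the edge-Markov property. -/
def rMarkovOn [MeasurableSpace M] (r : ℕ) (A : Set (TdVertex d))
    (μ : Measure (TdVertex d → M)) : Prop :=
  ∀ u w : TdVertex d, u ∈ A → w ∈ A → (TdGraph d).Adj u w →
    ∀ F₁ F₂ : Finset (TdVertex d), ↑F₁ ⊆ sideOf u w ∩ A → ↑F₂ ⊆ sideOf w u ∩ A →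
      ∀ y : TdVertex d → M,
        μ (cylEvent (↑F₁ ∪ ↑F₂ ∪ (edgeBall r u w ∩ A)) y)
            * μ (cylEvent (edgeBall r u w ∩ A) y)
          = μ (cylEvent (↑F₁ ∪ (edgeBall r u w ∩ A)) y)
            * μ (cylEvent (↑F₂ ∪ (edgeBall r u w ∩ A)) y)

/-- A probability measure on `M^{T_d}` is `r`-Markov if, conditioned on the value on the
`(r-1)`-neighborhood of any edge, the processes on the two sides of the edge are
independent. -/
def rMarkov [MeasurableSpace M] (r : ℕ) (μ : Measure (TdVertex d → M)) : Prop :=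
  rMarkovOn r Set.univ μ

/-- A probability measure on `M^{T_d}` is vertex-Markov if, conditioned on the value at a
vertex, the processes on the pending subtrees of that vertex are independent. -/
def vertexMarkov [MeasurableSpace M] (μ : Measure (TdVertex d → M)) : Prop :=
  ∀ v : TdVertex d, ∀ k : ℕ, ∀ u : Fin k → TdVertex d,
    Function.Injective u → (∀ i, (TdGraph d).Adj v (u i)) →
    ∀ F : Fin k → Finset (TdVertex d), (∀ i, ↑(F i) ⊆ sideOf (u i) v) →
      ∀ y : TdVertex d → M,
        μ (cylEvent ((⋃ i, ↑(F i)) ∪ {v}) y) * (μ (cylEvent {v} y)) ^ (k - 1)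
          = ∏ i : Fin k, μ (cylEvent (↑(F i) ∪ {v}) y)

/-- `X_{S_1}` is a vertex-Markov process on `S_1`: the values at the `d` neighbors of the
root are conditionally independent given the value at the root. -/
def vertexMarkovOnS1 [MeasurableSpace M] (d : ℕ) (μ : Measure (TdVertex d → M)) : Prop :=
  ∀ y : TdVertex d → M,
    μ (cylEvent (SrSet d 1) y) * (μ (cylEvent ({rootTd d} : Set (TdVertex d)) y)) ^ (d - 1)
      = ∏ i ∈ Finset.Icc 1 d,
          μ (cylEvent {v : TdVertex d | v = rootTd d ∨ v.1 = [i]} y)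


/-! ### The randomly labeled rooted colored graph associated to a finite colored graph

Given a finite colored graph `(G,f)` and a vertex `v`, the associated randomly labeled rooted
colored graph is obtained by a breadth-first search exploration of the connected component of
`v` started at `v`, ties between vertices being broken uniformly at random.  We implement the
uniformly random tie-breaking by a uniformly random priority permutation `σ`. -/

variable {M : Type*} {n : ℕ}

/-- The `k`-th layer of the breadth-first search of `G` started at `v`, ordered according to
the position of the parents in the previous layer, ties being broken by the priority `σ`. -/
def bfsLayer (G : SimpleGraph (Fin n)) (v : Fin n) (σ : Equiv.Perm (Fin n)) :
    ℕ → List (Fin n)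
  | 0 => [v]
  | (k + 1) =>
    let prev := bfsLayer G v σ k
    let key : Fin n → ℕ := fun w =>
      (prev.idxOf (((prev.find? (fun u => decide (G.Adj u w))).getD v))) * n + (σ w : ℕ)
    ((List.finRange n).filter
        (fun w => decide (G.Reachable v w ∧ G.dist v w = k + 1))).mergeSort
      (fun a b => key a ≤ key b)

/-- The breadth-first-search label of the vertex `w` lying in layer `k` of the exploration of
`G` started at `v` with tie-breaking priority `σ`. -/
def bfsPathAux (G : SimpleGraph (Fin n)) (v : Fin n) (σ : Equiv.Perm (Fin n)) :
    ℕ → Fin n → Option (List ℕ)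
  | 0, w => if w = v then some [] else none
  | (k + 1), w =>
    match (bfsLayer G v σ k).find? (fun u => decide (G.Adj u w)) with
    | none => none
    | some p =>
      let L := bfsLayer G v σ (k + 1)
      let j := 1 + ((L.takeWhile (fun w' => w' ≠ w)).filter
        (fun w' => (bfsLayer G v σ k).find? (fun u => decide (G.Adj u w')) = some p)).length
      (bfsPathAux G v σ k p).map (fun pl => j :: pl)

/-- The breadth-first-search label of the vertex `w` in the exploration of the connected
component of `v` in `G`, with tie-breaking priority `σ` (`none` if `w` is not in the component
of `v`). -/
def bfsPath (G : SimpleGraph (Fin n)) (v : Fin n) (σ : Equiv.Perm (Fin n)) (w : Fin n) :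
    Option (List ℕ) :=
  if G.Reachable v w then bfsPathAux G v σ (G.dist v w) w else none

/-- The rooted colored graph obtained from the colored graph `(G,f)` by the breadth-first
search exploration of the connected component of `v` rooted at `v`, with tie-breaking
priority `σ`. -/
def bfsRCG (G : SimpleGraph (Fin n)) (f : Fin n → M) (v : Fin n) (σ : Equiv.Perm (Fin n)) :
    RCG M where
  col l := if h : ∃ w, bfsPath G v σ w = some l then some (f h.choose) else none
  adj p :=
    if (∃ w₁ w₂, bfsPath G v σ w₁ = some p.1 ∧ bfsPath G v σ w₂ = some p.2 ∧ G.Adj w₁ w₂)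
    then true else false

/-- `distr_{G,v}(f)`: the law of the randomly labeled rooted colored graph obtained from the
connected component of `v` in the colored graph `(G,f)`, rooted at `v`. -/
def distrAt (G : SimpleGraph (Fin n)) (f : Fin n → M) (v : Fin n) : Measure (RCG M) :=
  ((Nat.factorial n : ℝ≥0∞))⁻¹ •
    ∑ σ : Equiv.Perm (Fin n), Measure.dirac (bfsRCG G f v σ)

/-- `distr_G(f) = (1/|V|) ∑_{v ∈ V} distr_{G,v}(f)`. -/
def distrG (G : SimpleGraph (Fin n)) (f : Fin n → M) : Measure (RCG M) :=
  ((n : ℝ≥0∞))⁻¹ • ∑ v : Fin n, distrAt G f v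

/-! ### Random regular graphs -/

/-- The set `𝓖_n(d)` of simple `d`-regular graphs on the vertex set `{1, …, n}`. -/
def regularGraphs (d n : ℕ) : Set (SimpleGraph (Fin n)) :=
  {G | ∀ v, (G.neighborSet v).ncard = d}

/-- The probability that a uniformly distributed random `d`-regular graph `G_n` on `n`
vertices belongs to `A`. -/
def PrG (d n : ℕ) (A : Set (SimpleGraph (Fin n))) : ℝ :=
  ((regularGraphs d n ∩ A).ncard : ℝ) / ((regularGraphs d n).ncard : ℝ)

/-- The expectation of `F(G_n)` for a uniformly distributed random `d`-regular graph `G_n`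
on `n` vertices. -/
def ExG (d n : ℕ) (F : SimpleGraph (Fin n) → ℝ) : ℝ :=
  (∑ᶠ G ∈ regularGraphs d n, F G) / ((regularGraphs d n).ncard : ℝ)

/-- The integers `n` for which the set of simple `d`-regular graphs on `n` vertices is
non-empty: `n ≥ d + 1` and `nd` even.  Limits `n → ∞` are taken along this set. -/
def goodN (d : ℕ) : Set ℕ := {n | d + 1 ≤ n ∧ Even (n * d)}

/-- The filter `n → ∞` along `{n : n ≥ d+1, nd even}`. -/
def goodFilter (d : ℕ) : Filter ℕ := Filter.atTop ⊓ Filter.principal (goodN d)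

/-! ### The embedding of invariant processes into rooted colored graphs -/

/-- The rooted colored graph `(T_d, x, o)` associated to a coloring `x` of `T_d` (the
canonical labeling of `T_d` is a breadth-first-search labeling; for an invariant process the
resulting law is that of the randomly labeled rooted colored graph). -/
def iotaTd (d : ℕ) (x : TdVertex d → M) : RCG M where
  col l := if h : ValidTd d l then some (x ⟨l, h⟩) else none
  adj p :=
    if (ValidTd d p.1 ∧ ValidTd d p.2 ∧ ((∃ i, p.2 = i :: p.1) ∨ (∃ i, p.1 = i :: p.2)))
    then true else false

/-- The law, as a probability measure on rooted colored graphs, of the randomly labeled rooted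
colored tree `(T_d, X, o)` where `X` has law `μ`. -/
def lawTd (d : ℕ) [MeasurableSpace M] (μ : Measure (TdVertex d → M)) : Measure (RCG M) :=
  μ.map (iotaTd d)

/-! ### Micro-state (sofic) entropy -/

/-- `𝓕_G(μ,r,ε)`: the set of colorings `f` of `G` whose radius-`r` local statistics are
`ε`-close (in the Lévy-Prokhorov distance, which generates the weak topology) to the
radius-`r` restriction of `μ`. -/
def FSet (d : ℕ) [MeasurableSpace M] (μ : Measure (TdVertex d → M)) (r : ℕ) (ε : ℝ)
    (G : SimpleGraph (Fin n)) : Set (Fin n → M) :=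
  {f | levyProkhorovDist ((distrG G f).map (resS r)) ((lawTd d μ).map (resS r)) ≤ ε}

/-- `H_{G}(μ,r,ε) = (1/n) log |𝓕_G(μ,r,ε)| ∈ {-∞} ∪ [0,∞)`. -/
def HG (d : ℕ) [MeasurableSpace M] (μ : Measure (TdVertex d → M)) (r : ℕ) (ε : ℝ)
    (G : SimpleGraph (Fin n)) : EReal :=
  if FSet d μ r ε G = ∅ then ⊥
  else ((Real.log ((FSet d μ r ε G).ncard) / n : ℝ) : EReal)

/-- `h_n(μ,r,ε,α)`: the `α`-quantile
`sup { h ∈ {-∞} ∪ [0,∞) : ℙ(H_{G_n}(μ,r,ε) ≥ h) ≥ α }`. -/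
def hquant (d : ℕ) [MeasurableSpace M] (μ : Measure (TdVertex d → M)) (r : ℕ) (ε : ℝ)
    (α : ℝ) (n : ℕ) : EReal :=
  sSup {h : EReal | (h = ⊥ ∨ 0 ≤ h) ∧
    α ≤ PrG d n {G : SimpleGraph (Fin n) | h ≤ HG d μ r ε G}}

/-- The upper entropy `h̄(μ,r,α) = lim_{ε → 0} limsup_n h_n(μ,r,ε,α)` (the limit over `ε`
of a quantity non-decreasing in `ε`, i.e. the infimum over `ε > 0`). -/
def hbarA (d : ℕ) [MeasurableSpace M] (μ : Measure (TdVertex d → M)) (r : ℕ) (α : ℝ) :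
    EReal :=
  ⨅ ε : {e : ℝ // 0 < e}, (goodFilter d).limsup (fun n => hquant d μ r ε.1 α n)

/-- The lower entropy `h̲(μ,r,α) = lim_{ε → 0} liminf_n h_n(μ,r,ε,α)`. -/
def hlowA (d : ℕ) [MeasurableSpace M] (μ : Measure (TdVertex d → M)) (r : ℕ) (α : ℝ) :
    EReal :=
  ⨅ ε : {e : ℝ // 0 < e}, (goodFilter d).liminf (fun n => hquant d μ r ε.1 α n)

/-- `h̄(μ,r)`: the common value of `h̄(μ,r,α)`, `0 < α < 1`. -/
def hbarR (d : ℕ) [MeasurableSpace M] (μ : Measure (TdVertex d → M)) (r : ℕ) : EReal :=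
  hbarA d μ r (1 / 2)

/-- `h̲(μ,r)`: the common value of `h̲(μ,r,α)`, `0 < α < 1`. -/
def hlowR (d : ℕ) [MeasurableSpace M] (μ : Measure (TdVertex d → M)) (r : ℕ) : EReal :=
  hlowA d μ r (1 / 2)

/-- The upper sofic entropy `h̄(μ) = lim_{r → ∞} h̄(μ,r)` (the limit of a non-increasing
sequence, i.e. the infimum over `r`). -/
def hbar (d : ℕ) [MeasurableSpace M] (μ : Measure (TdVertex d → M)) : EReal :=
  ⨅ r : ℕ, hbarR d μ r

/-- The lower sofic entropy `h̲(μ) = lim_{r → ∞} h̲(μ,r)`. -/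
def hlow (d : ℕ) [MeasurableSpace M] (μ : Measure (TdVertex d → M)) : EReal :=
  ⨅ r : ℕ, hlowR d μ r

/-! ### Typical processes -/

/-- The probability that the random `d`-regular graph `G_n` admits a coloring whose local
statistics are `ε`-close to `μ`. -/
def typicalPr (d : ℕ) [MeasurableSpace M] (μ : Measure (TdVertex d → M)) (ε : ℝ) (n : ℕ) :
    ℝ :=
  PrG d n {G : SimpleGraph (Fin n) |
    ∃ f : Fin n → M, levyProkhorovDist (distrG G f) (lawTd d μ) ≤ ε}

/-- `μ ∈ I_d(M)` is weakly typical if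
`lim_{ε → 0} limsup_{n → ∞} ℙ(∃ f : d(distr_{G_n}(f), μ) ≤ ε) = 1`. -/
def WeaklyTypical (d : ℕ) [MeasurableSpace M] (μ : Measure (TdVertex d → M)) : Prop :=
  Tendsto (fun ε => (goodFilter d).limsup (fun n => typicalPr d μ ε n))
    (nhdsWithin 0 (Set.Ioi 0)) (nhds 1)

/-- `μ ∈ I_d(M)` is strongly typical if
`lim_{ε → 0} lim_{n → ∞} ℙ(∃ f : d(distr_{G_n}(f), μ) ≤ ε) = 1` (in particular the inner
limits along `n → ∞` exist). -/
def StronglyTypical (d : ℕ) [MeasurableSpace M] (μ : Measure (TdVertex d → M)) : Prop :=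
  ∃ L : ℝ → ℝ,
    (∀ ε : ℝ, 0 < ε → Tendsto (fun n => typicalPr d μ ε n) (goodFilter d) (nhds (L ε))) ∧
    Tendsto L (nhdsWithin 0 (Set.Ioi 0)) (nhds 1)


/-! ### Processes on balls of `T_d` and the sets `I_{d,r}(M)`, `I_e(M)` -/

/-- The ball `S_r` of `T_d` as an induced subgraph. -/
def SrGraph (d r : ℕ) : SimpleGraph ↥(SrSet d r) := (TdGraph d).induce (SrSet d r)

/-- The set `E_r` of `T_d` as an induced subgraph. -/
def ErGraph (d r : ℕ) : SimpleGraph ↥(ErSet d r) := (TdGraph d).induce (ErSet d r)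

lemma root_mem_Er (d r : ℕ) (hr : 1 ≤ r) : rootTd d ∈ ErSet d r := by
  left; simpa [rootTd] using hr

lemma node1_mem_Er (d r : ℕ) (hr : 1 ≤ r) : node1 d ∈ ErSet d r := by
  by_cases h : 1 ≤ d
  · right
    constructor <;> simp [node1, h, List.getLast?, hr]
  · simpa [node1, h] using root_mem_Er d r hr

variable {M : Type*}

/-- The restriction to `E_r ⊆ S_r` of a probability measure on `M^{S_r}`. -/
def restrictErOfSr [MeasurableSpace M] (d r : ℕ) (p : Measure (↥(SrSet d r) → M)) :
    Measure (↥(ErSet d r) → M) :=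
  p.map (fun x => fun v : ↥(ErSet d r) => x ⟨v.1, ErSet_subset_SrSet d r v.2⟩)

/-- `I_{d,r}(M)`: the set of probability measures on `M^{S_r}` which are invariant under the
automorphisms of `S_r` and whose restriction to `E_r` is invariant under switching the two
sides of the edge `{o,1}`. -/
def IdrMeas (d r : ℕ) (M : Type*) [MeasurableSpace M] :
    Set (Measure (↥(SrSet d r) → M)) :=
  {p | IsProbabilityMeasure p ∧
    (∀ φ : SrGraph d r ≃g SrGraph d r, p.map (fun x => fun v => x (φ v)) = p) ∧
    (∀ ψ : ErGraph d r ≃g ErGraph d r,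
      (∀ hv : rootTd d ∈ ErSet d r, ((ψ ⟨rootTd d, hv⟩ : ↥(ErSet d r)) : TdVertex d) = node1 d) →
      (restrictErOfSr d r p).map (fun x => fun v => x (ψ v)) = restrictErOfSr d r p)}

/-- The annealed entropy `Σ(p) = H(X_{S_r}) - (d/2) H(X_{E_r})` of `p ∈ I_{d,r}(M)`. -/
def SigmaP [MeasurableSpace M] (d r : ℕ) (p : Measure (↥(SrSet d r) → M)) : ℝ :=
  shannon p - (d / 2 : ℝ) * shannon (restrictErOfSr d r p)

/-- The involution of `E_1 = {o, 1}` switching the two sides of the edge `{o,1}`. -/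
def swapE1 (d : ℕ) : ↥(ErSet d 1) → ↥(ErSet d 1) := fun v =>
  if (v : TdVertex d) = rootTd d then ⟨node1 d, node1_mem_Er d 1 le_rfl⟩
  else ⟨rootTd d, root_mem_Er d 1 le_rfl⟩

/-- `I_e(M)`: the set of probability measures on `M^{E_1}` invariant under switching the two
sides of the edge `{o,1}`. -/
def IeMeas (d : ℕ) (M : Type*) [MeasurableSpace M] : Set (Measure (↥(ErSet d 1) → M)) :=
  {p | IsProbabilityMeasure p ∧ p.map (fun x => fun v => x (swapE1 d v)) = p}

/-- The annealed entropy `Σ(p) = (d/2) H(X_{E_1}) - (d-1) H(X_o)` of `p ∈ I_e(M)`. -/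
def SigmaPe [MeasurableSpace M] (d : ℕ) (p : Measure (↥(ErSet d 1) → M)) : ℝ :=
  (d / 2 : ℝ) * shannon p
    - ((d : ℝ) - 1) * shannon (p.map (fun x => x ⟨rootTd d, root_mem_Er d 1 le_rfl⟩))

/-! ### Factor graphs: functions of rooted unlabeled colored graphs of radius `r` -/

/-- The vertex set of a rooted colored graph. -/
def vertsOf (g : RCG M) : Set (List ℕ) := {l | g.col l ≠ none}

/-- An isomorphism of rooted colored graphs (a color- and adjacency-preserving bijection of
the vertex sets mapping root to root). -/
def RCGRootedIso (g g' : RCG M) : Prop :=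
  ∃ e : ↥(vertsOf g) ≃ ↥(vertsOf g'),
    (∀ v, g'.col ((e v) : List ℕ) = g.col (v : List ℕ)) ∧
    (∀ v w, g'.adj (((e v) : List ℕ), ((e w) : List ℕ)) = g.adj ((v : List ℕ), (w : List ℕ))) ∧
    (∀ h : [] ∈ vertsOf g, ∀ _ : [] ∈ vertsOf g', ((e ⟨[], h⟩) : List ℕ) = [])

/-- A function on rooted unlabeled colored graphs of radius `r`: a function of rooted colored
graphs which only depends on the isomorphism class of the ball of radius `r` around the
root. -/
def IsRadiusRFn (r : ℕ) (ψ : RCG M → ℝ) : Prop :=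
  ∀ g g' : RCG M, RCGRootedIso (resS r g) (resS r g') → ψ g = ψ g'

/-- The value `ψ((G,f,v)_r)` of `ψ` at the rooted unlabeled colored graph given by the ball of
radius `r` around `v` in `(G,f)` (computed as the average over the random labelings, which is
the constant value of `ψ` on them when `ψ` is a function of the unlabeled graph). -/
def psiAt {n : ℕ} (G : SimpleGraph (Fin n)) (f : Fin n → M) (v : Fin n) (ψ : RCG M → ℝ) :
    ℝ :=
  ∫ g, ψ g ∂(distrAt G f v)

/-- The partition function `Z_G = ∑_f ∏_v exp(ψ((G,f,v)_r))` of the factor model `ψ`. -/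
def ZG {n : ℕ} [Fintype M] (G : SimpleGraph (Fin n)) (ψ : RCG M → ℝ) : ℝ :=
  ∑ f : Fin n → M, Real.exp (∑ v : Fin n, psiAt G f v ψ)

/-- The ground-state energy `L_G = max_f ∑_v ψ((G,f,v)_r)`. -/
def LG {n : ℕ} (G : SimpleGraph (Fin n)) (ψ : RCG M → ℝ) : ℝ :=
  sSup {x : ℝ | ∃ f : Fin n → M, x = ∑ v : Fin n, psiAt G f v ψ}

/-- The canonical rooted colored graph associated to a coloring of the ball `S_r` of `T_d`. -/
def iotaSr (d r : ℕ) (x : ↥(SrSet d r) → M) : RCG M where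
  col l := if h : ValidTd d l ∧ l.length ≤ r then some (x ⟨⟨l, h.1⟩, h.2⟩) else none
  adj p := if (ValidTd d p.1 ∧ ValidTd d p.2 ∧ p.1.length ≤ r ∧ p.2.length ≤ r ∧
      ((∃ i, p.2 = i :: p.1) ∨ (∃ i, p.1 = i :: p.2))) then true else false

/-- `⟨p, ψ⟩ = E[ψ(X)]` where `X` has law `p ∈ I_{d,r}(M)`. -/
def pairing [MeasurableSpace M] (d r : ℕ) (p : Measure (↥(SrSet d r) → M))
    (ψ : RCG M → ℝ) : ℝ :=
  ∫ x, ψ (iotaSr d r x) ∂p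

/-! ### Annealed quantities for random regular graphs -/

/-- `log` with the convention `log 0 = -∞`, with values in the extended reals. -/
def elog (x : ℝ) : EReal := if x ≤ 0 then ⊥ else ((Real.log x : ℝ) : EReal)

/-- The set `𝓖_n(μ,r,ε)` of pairs `(G,f)` of a `d`-regular graph together with a coloring
whose radius-`r` local statistics are `ε`-close to `μ_r`. -/
def GnPairs (d : ℕ) [MeasurableSpace M] (μ : Measure (TdVertex d → M)) (r : ℕ) (ε : ℝ)
    (n : ℕ) : Set (SimpleGraph (Fin n) × (Fin n → M)) :=
  {Gf | Gf.1 ∈ regularGraphs d n ∧ Gf.2 ∈ FSet d μ r ε Gf.1}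

/-- The annealed entropy
`Σ_n(μ,r,ε) = (1/n) (log |𝓖_n(μ,r,ε)| - log |𝓖_n(d)|) = (1/n) log E |𝓕_{G_n}(μ,r,ε)|`. -/
def SigmaN (d : ℕ) [MeasurableSpace M] (μ : Measure (TdVertex d → M)) (r : ℕ) (ε : ℝ)
    (n : ℕ) : EReal :=
  (((n : ℝ)⁻¹ : ℝ) : EReal) *
    elog (((GnPairs d μ r ε n).ncard : ℝ) / ((regularGraphs d n).ncard : ℝ))

/-- The relaxed partition function `Z_G(β) = ∑_f exp(-nβ d(distr_G(f)_r, μ_r))`. -/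
def ZGbeta (d : ℕ) [MeasurableSpace M] {n : ℕ} [Fintype M] (μ : Measure (TdVertex d → M))
    (r : ℕ) (β : ℝ) (G : SimpleGraph (Fin n)) : ℝ :=
  ∑ f : Fin n → M, Real.exp (-(n : ℝ) * β *
    levyProkhorovDist ((distrG G f).map (resS r)) ((lawTd d μ).map (resS r)))


/-! ### Processes on unimodular Galton-Watson trees

A colored rooted tree `(T, X, o)` with `T` a subtree of the label set, rooted at `[]` and
with the children of a vertex `v` labeled `1 :: v, …, N_v :: v`, is encoded as a rooted
colored graph in `RCG M`. -/

/-- `g` is a canonically labeled colored rooted tree. -/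
def IsCanonTree (g : RCG M) : Prop :=
  g.col [] ≠ none ∧
  (∀ l : List ℕ, g.col l ≠ none → g.col l.tail ≠ none) ∧
  (∀ (v : List ℕ) (i : ℕ), 1 ≤ i → g.col ((i + 1) :: v) ≠ none → g.col (i :: v) ≠ none) ∧
  (∀ v : List ℕ, g.col (0 :: v) = none) ∧
  (∀ p : List ℕ × List ℕ, g.adj p = true ↔
    (g.col p.1 ≠ none ∧ g.col p.2 ≠ none ∧
      ((∃ i, p.2 = i :: p.1) ∨ (∃ i, p.1 = i :: p.2))))

/-- A finite canonically labeled tree. -/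
def IsFinTree (t : Finset (List ℕ)) : Prop :=
  [] ∈ t ∧ (∀ l ∈ t, l.tail ∈ t) ∧
  (∀ (v : List ℕ) (i : ℕ), 1 ≤ i → ((i + 1) :: v) ∈ t → (i :: v) ∈ t) ∧
  (∀ v : List ℕ, (0 :: v) ∉ t)

/-- The number of children of the vertex `v` in the finite tree `t`. -/
def childCountF (t : Finset (List ℕ)) (v : List ℕ) : ℕ :=
  (t.filter (fun w => w ≠ [] ∧ w.tail = v)).card

/-- The size-biased version `π̂(k) = (k+1) π(k+1) / d` of the offspring distribution `π`. -/
def sizeBiased (π : ℕ → ℝ) (dd : ℝ) (k : ℕ) : ℝ := (k + 1 : ℝ) * π (k + 1) / dd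

/-- The probability that the unimodular Galton-Watson tree with degree distribution `π`,
truncated at depth `k`, equals the finite tree `t`. -/
def treeWeight (π : ℕ → ℝ) (dd : ℝ) (k : ℕ) (t : Finset (List ℕ)) : ℝ :=
  π (childCountF t []) *
    ∏ v ∈ t.filter (fun v => v ≠ [] ∧ v.length < k), sizeBiased π dd (childCountF t v)

/-- The law of the underlying tree is the unimodular Galton-Watson law `UGW(π)`:
all finite-depth truncations have the prescribed distribution. -/
def IsUGWTreeLaw (π : ℕ → ℝ) (dd : ℝ) (μ : Measure (RCG M)) : Prop :=
  ∀ (k : ℕ) (t : Finset (List ℕ)), IsFinTree t → (∀ v ∈ t, v.length ≤ k) →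
    (μ {g | ∀ l : List ℕ, l.length ≤ k → (g.col l ≠ none ↔ l ∈ t)}).toReal
      = treeWeight π dd k t

/-- `e` realizes an isomorphism (not necessarily root-preserving) of the colored graphs `g`
and `g'`. -/
def IsIsoVia (g g' : RCG M) (e : List ℕ → List ℕ) : Prop :=
  Set.BijOn e (vertsOf g) (vertsOf g') ∧
  (∀ l ∈ vertsOf g, g'.col (e l) = g.col l) ∧
  (∀ l ∈ vertsOf g, ∀ l' ∈ vertsOf g, g'.adj (e l, e l') = g.adj (l, l'))

/-- A function on doubly rooted colored graphs, invariant under isomorphisms. -/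
def PairInvariant (F : RCG M → List ℕ → List ℕ → ℝ≥0∞) : Prop :=
  ∀ g g' e, IsIsoVia g g' e → ∀ u ∈ vertsOf g, ∀ v ∈ vertsOf g, F g' (e u) (e v) = F g u v

/-- Unimodularity (the mass-transport principle):
`E ∑_v F(G,o,v) = E ∑_v F(G,v,o)` for all isomorphism-invariant `F ≥ 0`. -/
def Unimodular (μ : Measure (RCG M)) : Prop :=
  ∀ F : RCG M → List ℕ → List ℕ → ℝ≥0∞, PairInvariant F →
    ∫⁻ g, (∑' v : ↥(vertsOf g), F g [] (v : List ℕ)) ∂μ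
      = ∫⁻ g, (∑' v : ↥(vertsOf g), F g (v : List ℕ) []) ∂μ

/-- `I_π(M)`: the laws of invariant (unimodular) processes `(T,X)` with colors in `M` over
the unimodular Galton-Watson tree with degree distribution `π` (of mean `dd`). -/
def IPiMeas (π : ℕ → ℝ) (dd : ℝ) (M : Type*) [MeasurableSpace M] :
    Set (Measure (RCG M)) :=
  {μ | IsProbabilityMeasure μ ∧ μ {g | IsCanonTree g} = 1 ∧ Unimodular μ ∧
    IsUGWTreeLaw π dd μ}

/-- The root degree `deg(o)` of a canonically labeled tree (the number of children of the
root). -/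
def rootDeg (g : RCG M) : ℕ := {i : ℕ | g.col [i] ≠ none}.ncard

/-- The edge-biased law `→μ(⬝) = (1/d) E[deg(o) 1{(T,X,(o,1)) ∈ ⬝}]` on colored edge-rooted
trees (the root edge being `([], [1])`). -/
def vecLaw (dd : ℝ) [MeasurableSpace M] (μ : Measure (RCG M)) : Measure (RCG M) :=
  (ENNReal.ofReal dd)⁻¹ • μ.withDensity (fun g => (rootDeg g : ℝ≥0∞))

/-- Membership in `E_r = B_{r-1}({o,1})` for a vertex of a canonically labeled tree. -/
def inErL (r : ℕ) (l : List ℕ) : Prop :=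
  l.length + 1 ≤ r ∨ (l.getLast? = some 1 ∧ l.length ≤ r)

/-- The restriction of a colored edge-rooted tree to `E_r = B_{r-1}({o,1})`. -/
def resE (r : ℕ) (g : RCG M) : RCG M where
  col l := if inErL r l then g.col l else none
  adj p := if inErL r p.1 ∧ inErL r p.2 then g.adj p else false

/-- The Shannon entropy `H(π)` of the probability mass function `π`. -/
def Hpmf (π : ℕ → ℝ) : ℝ := ∑' k : ℕ, Real.negMulLog (π k)

/-- The annealed entropy `Σ_r(μ) = H(X_{S_r}) - (d/2) H(→X_{E_r}) - H(π)` of an invariant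
process over the unimodular Galton-Watson tree. -/
def SigmaUGW (π : ℕ → ℝ) (dd : ℝ) [MeasurableSpace M] (r : ℕ) (μ : Measure (RCG M)) : ℝ :=
  shannon (μ.map (resS r)) - (dd / 2) * shannon ((vecLaw dd μ).map (resE r)) - Hpmf π

/-- `Σ(μ) = lim_{r → ∞} Σ_r(μ)` (the limit of a non-increasing sequence). -/
def SigmaUGWInf (π : ℕ → ℝ) (dd : ℝ) [MeasurableSpace M] (μ : Measure (RCG M)) : EReal :=
  ⨅ r : ℕ, ((SigmaUGW π dd (r + 1) μ : ℝ) : EReal)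

/-- `Σ_e(X) = (d/2) H(→X_{E_1}) - d H(→X_o) + H(X_o) - H(π)`. -/
def SigmaEUGW (π : ℕ → ℝ) (dd : ℝ) [MeasurableSpace M] (μ : Measure (RCG M)) : ℝ :=
  (dd / 2) * shannon ((vecLaw dd μ).map (resE 1))
    - dd * shannon ((vecLaw dd μ).map (resS 0))
    + shannon (μ.map (resS 0)) - Hpmf π

/-! ### Markov processes on random trees -/

/-- The side of the (potential) edge `{u,w}` containing `u`, among the labels. -/
def sideL (u w : List ℕ) : Set (List ℕ) := {v | treeDist v u < treeDist v w}

/-- `B_{r-1}({u,w})` among the labels. -/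
def edgeBallL (r : ℕ) (u w : List ℕ) : Set (List ℕ) :=
  {v | treeDist v u + 1 ≤ r ∨ treeDist v w + 1 ≤ r}

/-- The event that the tree structure agrees with that of `y` on `S` and that the colored
tree agrees with `y` on `B`. -/
def treeCylEvent (S B : Set (List ℕ)) (y : RCG M) : Set (RCG M) :=
  {g | (∀ l ∈ S, (g.col l ≠ none ↔ y.col l ≠ none)) ∧ (∀ l ∈ B, g.col l = y.col l)}

/-- A random colored tree is `r`-Markov on the ambient set `A` if, conditioned on the tree
and on the value on the `(r-1)`-neighborhood of an edge, the processes on the two sides of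
the edge are independent (conditioning on the tree is expressed through arbitrary finite
windows `S`). -/
def rMarkovTreeOn [MeasurableSpace M] (r : ℕ) (A : Set (List ℕ)) (μ : Measure (RCG M)) :
    Prop :=
  ∀ (u : List ℕ) (i : ℕ), 1 ≤ i → u ∈ A → (i :: u) ∈ A →
    ∀ F₁ F₂ : Finset (List ℕ), ↑F₁ ⊆ sideL u (i :: u) ∩ A → ↑F₂ ⊆ sideL (i :: u) u ∩ A →
    ∀ S : Finset (List ℕ), ↑S ⊆ A → ∀ y : RCG M,
      μ (treeCylEvent ↑S (edgeBallL r u (i :: u) ∩ A) y ∩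
          treeCylEvent ∅ ↑F₁ y ∩ treeCylEvent ∅ ↑F₂ y)
        * μ (treeCylEvent ↑S (edgeBallL r u (i :: u) ∩ A) y)
      = μ (treeCylEvent ↑S (edgeBallL r u (i :: u) ∩ A) y ∩ treeCylEvent ∅ ↑F₁ y)
        * μ (treeCylEvent ↑S (edgeBallL r u (i :: u) ∩ A) y ∩ treeCylEvent ∅ ↑F₂ y)

/-- A random colored tree is `r`-Markov if the above holds with ambient set everything. -/
def rMarkovTree [MeasurableSpace M] (r : ℕ) (μ : Measure (RCG M)) : Prop :=
  rMarkovTreeOn r Set.univ μ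

/-- A random colored tree is vertex-Markov on the ambient set `A` if, conditioned on the tree
and on the value at a vertex, the processes on the pending subtrees of that vertex are
independent. -/
def vertexMarkovTreeOn [MeasurableSpace M] (A : Set (List ℕ)) (μ : Measure (RCG M)) :
    Prop :=
  ∀ v ∈ A, ∀ (k : ℕ) (u : Fin k → List ℕ), Function.Injective u →
    (∀ j, u j ∈ A ∧ ((∃ i, 1 ≤ i ∧ u j = i :: v) ∨ (v ≠ [] ∧ u j = v.tail))) →
    ∀ F : Fin k → Finset (List ℕ), (∀ j, ↑(F j) ⊆ sideL (u j) v ∩ A) →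
    ∀ S : Finset (List ℕ), ↑S ⊆ A → ∀ y : RCG M,
      μ (treeCylEvent ↑S {v} y ∩ ⋂ j, treeCylEvent ∅ ↑(F j) y)
          * (μ (treeCylEvent ↑S {v} y)) ^ (k - 1)
        = ∏ j : Fin k, μ (treeCylEvent ↑S {v} y ∩ treeCylEvent ∅ ↑(F j) y)

/-- A random colored tree is vertex-Markov if the above holds with ambient set everything. -/
def vertexMarkovTree [MeasurableSpace M] (μ : Measure (RCG M)) : Prop :=
  vertexMarkovTreeOn Set.univ μ

/-! ### Random graphs with given degree sequences -/

/-- The set of simple graphs on `{1,…,n}` with degree sequence `dn`. -/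
def degSeqGraphs (n : ℕ) (dn : Fin n → ℕ) : Set (SimpleGraph (Fin n)) :=
  {G | ∀ v, (G.neighborSet v).ncard = dn v}

/-- The probability that a uniform random graph with degree sequence `dn` lies in `A`. -/
def PrD (n : ℕ) (dn : Fin n → ℕ) (A : Set (SimpleGraph (Fin n))) : ℝ :=
  ((degSeqGraphs n dn ∩ A).ncard : ℝ) / ((degSeqGraphs n dn).ncard : ℝ)

/-- `𝓕_G(μ,r,ε)` for a process `μ` over a unimodular Galton-Watson tree. -/
def FSetD [MeasurableSpace M] (μ : Measure (RCG M)) (r : ℕ) (ε : ℝ) {n : ℕ}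
    (G : SimpleGraph (Fin n)) : Set (Fin n → M) :=
  {f | levyProkhorovDist ((distrG G f).map (resS r)) (μ.map (resS r)) ≤ ε}

/-- `H_G(μ,r,ε) = (1/n) log |𝓕_G(μ,r,ε)|`. -/
def HGD [MeasurableSpace M] (μ : Measure (RCG M)) (r : ℕ) (ε : ℝ) {n : ℕ}
    (G : SimpleGraph (Fin n)) : EReal :=
  if FSetD μ r ε G = ∅ then ⊥
  else ((Real.log ((FSetD μ r ε G).ncard) / n : ℝ) : EReal)

/-- The `α`-quantile of `H_{G_n}(μ,r,ε)` for the uniform random graph with degree sequence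
`DN n`. -/
def hquantD [MeasurableSpace M] (DN : (n : ℕ) → Fin n → ℕ) (μ : Measure (RCG M)) (r : ℕ)
    (ε : ℝ) (α : ℝ) (n : ℕ) : EReal :=
  sSup {h : EReal | (h = ⊥ ∨ 0 ≤ h) ∧
    α ≤ PrD n (DN n) {G : SimpleGraph (Fin n) | h ≤ HGD μ r ε G}}

/-- `h̄(μ,r,α)` for the degree-sequence ensemble. -/
def hbarAD [MeasurableSpace M] (DN : (n : ℕ) → Fin n → ℕ) (μ : Measure (RCG M)) (r : ℕ)
    (α : ℝ) : EReal :=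
  ⨅ ε : {e : ℝ // 0 < e}, Filter.atTop.limsup (fun n => hquantD DN μ r ε.1 α n)

/-- `h̲(μ,r,α)` for the degree-sequence ensemble. -/
def hlowAD [MeasurableSpace M] (DN : (n : ℕ) → Fin n → ℕ) (μ : Measure (RCG M)) (r : ℕ)
    (α : ℝ) : EReal :=
  ⨅ ε : {e : ℝ // 0 < e}, Filter.atTop.liminf (fun n => hquantD DN μ r ε.1 α n)

/-- `h̄(μ,r)`: the common value of `h̄(μ,r,α)`, `0 < α < 1`. -/
def hbarRD [MeasurableSpace M] (DN : (n : ℕ) → Fin n → ℕ) (μ : Measure (RCG M)) (r : ℕ) :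
    EReal :=
  hbarAD DN μ r (1 / 2)

/-- `h̲(μ,r)`. -/
def hlowRD [MeasurableSpace M] (DN : (n : ℕ) → Fin n → ℕ) (μ : Measure (RCG M)) (r : ℕ) :
    EReal :=
  hlowAD DN μ r (1 / 2)

/-- The upper sofic entropy `h̄(μ) = lim_{r → ∞} h̄(μ,r)`. -/
def hbarD [MeasurableSpace M] (DN : (n : ℕ) → Fin n → ℕ) (μ : Measure (RCG M)) : EReal :=
  ⨅ r : ℕ, hbarRD DN μ r

/-- The lower sofic entropy `h̲(μ) = lim_{r → ∞} h̲(μ,r)`. -/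
def hlowD [MeasurableSpace M] (DN : (n : ℕ) → Fin n → ℕ) (μ : Measure (RCG M)) : EReal :=
  ⨅ r : ℕ, hlowRD DN μ r

/-- The hypotheses on the degree sequences: uniformly bounded by `Δ`, even sums, and
empirical distributions converging (weakly) to `π`. -/
def GoodDegSeq (π : ℕ → ℝ) (Δ : ℝ) (DN : (n : ℕ) → Fin n → ℕ) : Prop :=
  (∀ n v, (DN n v : ℝ) ≤ Δ) ∧ (∀ n, Even (∑ v : Fin n, DN n v)) ∧
  (∀ k : ℕ, Tendsto (fun n => (((Finset.univ.filter (fun v : Fin n => DN n v = k)).card : ℝ) / n))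
    atTop (nhds (π k)))

/-- The hypotheses on the degree distribution `π`: a probability mass function supported in
`{0,…,Δ}` with mean `dd > 0`. -/
def GoodPmf (π : ℕ → ℝ) (Δ : ℝ) (dd : ℝ) : Prop :=
  (∀ k, 0 ≤ π k) ∧ (∑' k : ℕ, π k) = 1 ∧ (∀ k : ℕ, (Δ : ℝ) < k → π k = 0) ∧
  (∑' k : ℕ, (k : ℝ) * π k) = dd ∧ 0 < dd


/-! ### Couplings -/

/-- `ν ∈ I_d(M × M)` is an invariant coupling of `μ` with itself: both coordinate marginal
processes of `ν` have law `μ`. -/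
def IsInvCoupling (d : ℕ) {M : Type*} [MeasurableSpace M] (μ : Measure (TdVertex d → M))
    (ν : Measure (TdVertex d → M × M)) : Prop :=
  ν ∈ InvMeas d (M × M) ∧ ν.map (fun x => fun v => (x v).1) = μ ∧
    ν.map (fun x => fun v => (x v).2) = μ

/-- The first coordinate marginal of a colored graph with colors in a product set. -/
def rcgFst {M₁ M₂ : Type*} (g : RCG (M₁ × M₂)) : RCG M₁ :=
  ⟨fun l => (g.col l).map Prod.fst, g.adj⟩

/-- The second coordinate marginal of a colored graph with colors in a product set. -/
def rcgSnd {M₁ M₂ : Type*} (g : RCG (M₁ × M₂)) : RCG M₂ :=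
  ⟨fun l => (g.col l).map Prod.snd, g.adj⟩

/-- `ν ∈ I_π(M × M)` is an invariant coupling of `μ ∈ I_π(M)` with itself. -/
def IsInvCouplingUGW (π : ℕ → ℝ) (dd : ℝ) {M : Type*} [MeasurableSpace M]
    (μ : Measure (RCG M)) (ν : Measure (RCG (M × M))) : Prop :=
  ν ∈ IPiMeas π dd (M × M) ∧ ν.map rcgFst = μ ∧ ν.map rcgSnd = μ

end TreeEntropy

set_option linter.unusedSectionVars false

namespace TreeEntropy

section
open Equiv (Perm apply_symm_apply equivCongr ofBijective prodCongrRight sum_comp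
  swap swap_apply_of_ne_of_ne symm_apply_apply symm_swap trans_apply)
open scoped Finset
open Finset (Ico abs_sum_le_sum_abs card_bij card_image_le card_image_of_injOn card_le_card
  card_le_card_of_injOn card_nsmul_le_sum card_product card_sigma card_union_le card_univ
  filter_filter mem_Ico mem_biUnion mem_coe mem_filter mem_image
  mem_product mem_sigma mem_union mem_union_left mem_union_right mem_univ
  mul_sum prod_congr prod_pos single_le_sum subset_univ sum_add_distrib
  sum_comm sum_congr sum_const sum_div sum_eq_single sum_eq_zero
  sum_le_card_nsmul sum_le_sum sum_mul sum_nonneg sum_pos sum_sub_distrib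
  univ)
open Fintype (card card_congr card_fin card_perm card_pos_iff card_prod
  card_subtype equivOfCardEq ofFinite sum_equiv sum_prod_type)
open Function (Injective Involutive)
open Real (exp exp_add exp_le_exp exp_log exp_neg exp_pos
  log log_div log_exp log_mul log_prod negMulLog)

/-- Half-edges. -/
notation:max "HE" n:max d:max => Fin n × Fin d

/-- Labelings of the half-edges. -/
notation:max "Labs" n:max d:max => Fin n → Perm (Fin d)

/-- Graphs on `n` vertices. -/
notation:max "Gr" n:max => SimpleGraph (Fin n)

/-- Maps from half-edges to half-edges. -/
abbrev HMap (n d : ℕ) := HE n d → HE n d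

/-- Automorphisms of `S_r`. -/
abbrev SrAut (d r : ℕ) := SrGraph d r ≃g SrGraph d r

/-- The marginal of `μ` on `S_r`. -/
local notation:max "srLaw" d:max r:max μ:max => restrictTo (SrSet d r) μ

/-- The marginal of `μ` on `E_r`. -/
local notation:max "erLaw" d:max r:max μ:max => restrictTo (ErSet d r) μ

/-- The factorial. -/
notation:10000 k "!" => Nat.factorial k

/-- Probability measures. -/
notation:max "IsProb" => IsProbabilityMeasure

/-! ### Counting words and bijections -/

lemma le_log_factorial (k : ℕ) : (k:ℝ) * log k - k ≤ log (k !) := by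
  induction k with
  | zero => simp
  | succ k ih =>
    rw [Nat.factorial_succ, Nat.cast_mul, log_mul (by positivity) (by positivity)]
    rcases Nat.eq_zero_or_pos k with rfl | hk
    · simp
    have hk' : (0:ℝ) < k := mod_cast hk
    have h1 : log ((k+1:ℕ):ℝ) - log k ≤ 1 / k := by
      rw [← log_div (by positivity) (by positivity)]
      refine (Real.log_le_sub_one_of_pos (by positivity)).trans (le_of_eq ?_)
      grind
    have h2 : (k:ℝ) * (log ((k+1:ℕ):ℝ) - log k) ≤ 1 := by
      calc _ ≤ (k:ℝ) * (1/k) := by gcongr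
        _ = 1 := by field_simp
    grind

lemma log_factorial_le (k : ℕ) : log (k !) ≤ (k:ℝ) * log k - k + 1 + 2 * log (k + 1) := by
  induction k with
  | zero => simp
  | succ k ih =>
    rw [Nat.factorial_succ, Nat.cast_mul, log_mul (by positivity) (by positivity)]
    rcases Nat.eq_zero_or_pos k with rfl | hk
    · simp; positivity
    have hk' : (0:ℝ) < k := mod_cast hk
    have h1 : 1 / ((k:ℝ) + 1) ≤ log ((k:ℝ) + 1) - log k := by
      rw [← log_div (by positivity) (by positivity)]
      refine le_trans (le_of_eq ?_) (Real.one_sub_inv_le_log_of_pos (by positivity))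
      field_simp; ring
    have h2 : 1 / ((k:ℝ) + 2) ≤ log ((k:ℝ) + 1 + 1) - log (k+1) := by
      rw [← log_div (by positivity) (by positivity)]
      refine le_trans (le_of_eq ?_) (Real.one_sub_inv_le_log_of_pos (by positivity))
      field_simp; ring
    have h3 : (1:ℝ) ≤ k * (1 / ((k:ℝ) + 1)) + 2 * (1 / ((k:ℝ) + 2)) := by
      rw [mul_one_div, mul_one_div, div_add_div _ _ (by positivity) (by positivity),
        le_div_iff₀ (by positivity)]
      nlinarith
    have h4 : (k:ℝ) * (1 / ((k:ℝ) + 1)) ≤ k * (log ((k:ℝ) + 1) - log k) := by gcongr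
    push_cast at *
    nlinarith

variable {α T : Type*} [Fintype α]

lemma mem_fil {α : Type*} [Fintype α] {p : α → Prop} [DecidablePred p] {x : α} :
    x ∈ univ.filter p ↔ p x :=
  Finset.mem_filter_univ x

/-- The number of occurrences of `c` in the word `w`. -/
def cnt (w : α → T) (c : T) : ℕ := #{a | w a = c}

/-- The empirical frequencies of the word `w`, normalized by `n`. -/
notation:max "freq" w:max n:max => fun c => (cnt w c : ℝ) / n

lemma sum_cnt [Fintype T] (w : α → T) : ∑ c, cnt w c = card α := by
  rw [← card_univ, Finset.card_eq_sum_card_fiberwise (f := w) (t := univ)]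
  · rfl
  · intro x _; simp

lemma sum_comp_eq_cnt [Fintype T] (w : α → T) (g : T → ℝ) :
    ∑ a, g (w a) = ∑ c, (cnt w c : ℝ) * g c := by
  rw [← Finset.sum_fiberwise (s := univ) (g := w)]
  refine sum_congr rfl fun c _ => ?_
  rw [sum_congr rfl (g := fun _ => g c) (fun x hx => by
    grind)]
  simp [cnt]

lemma cnt_comp_equiv {α β T : Type*} [Fintype α] [Fintype β] (t : β → T) (e : α ≃ β) (c : T) :
    cnt (t ∘ e) c = cnt t c := by
  unfold cnt
  refine card_bij (fun a _ => e a) ?_ ?_ ?_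
  · grind
  · simp_all
  · intro b hb; exact ⟨e.symm b, by simpa using hb, by simp⟩

lemma exists_equiv_comp_eq {α β T : Type*} [Fintype α] [Fintype β] (s : α → T) (t : β → T)
    (h : ∀ c, cnt s c = cnt t c) : ∃ e : α ≃ β, t ∘ e = s := by
  have h' : ∀ c, Nonempty ({a // s a = c} ≃ {b // t b = c}) := fun c => by
    refine ⟨equivOfCardEq ?_⟩
    rw [card_subtype, card_subtype]
    exact h c
  have e := fun c => Classical.choice (h' c)
  refine ⟨(Equiv.sigmaFiberEquiv s).symm.trans
    ((Equiv.sigmaCongrRight e).trans (Equiv.sigmaFiberEquiv t)), ?_⟩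
  funext a
  exact (e (s a) ⟨a, rfl⟩).2

lemma card_equiv_comp_eq {α β T : Type*} [Fintype α] [Fintype β] [Fintype T]
    (s : α → T) (t : β → T) (h : ∀ c, cnt s c = cnt t c) :
    card {e : α ≃ β // t ∘ e = s} = ∏ c, (cnt t c)! := by
  obtain ⟨e0, he0⟩ := exists_equiv_comp_eq s t h
  have h1 : card {g : Perm β // t ∘ g = t} = ∏ c, (cnt t c)! := by
    rw [DomMulAct.stabilizer_card t]
    refine prod_congr rfl fun c _ => ?_
    rw [card_subtype]; rfl
  rw [← h1]
  refine card_congr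
    { toFun := fun e => ⟨e0.symm.trans e.1, ?_⟩
      invFun := fun g => ⟨e0.trans g.1, ?_⟩
      left_inv := ?_
      right_inv := ?_ }
  · funext b
    have := congrFun e.2 (e0.symm b)
    aesop
  · funext a
    have := congrFun g.2 (e0 a)
    aesop
  · intro e; ext a; simp
  · intro g; ext a; simp

lemma card_words_mul [Fintype T] (w0 : α → T) :
    card {w : α → T // ∀ c, cnt w c = cnt w0 c} * ∏ c, (cnt w0 c)! = (card α)! := by
  rw [← card_perm, ← card_congr (Equiv.sigmaFiberEquiv
    (fun g : Perm α => (⟨w0 ∘ g, fun c => cnt_comp_equiv w0 g c⟩ :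
      {w : α → T // ∀ c, cnt w c = cnt w0 c})))]
  rw [Fintype.card_sigma]
  rw [sum_congr rfl (g := fun _ => ∏ c, (cnt w0 c)!)]
  · simp
  · intro w _
    rw [← card_equiv_comp_eq w.1 w0 w.2]
    aesop

/-- The entropy of a finite probability vector. -/
def ent {T : Type*} [Fintype T] (q : T → ℝ) : ℝ := ∑ c, negMulLog (q c)

lemma mul_ent_cnt {T : Type*} [Fintype T] (k : T → ℕ) (n : ℕ) (hn : 0 < n) (hk : ∑ c, k c = n) :
    (n:ℝ) * ent (fun c => (k c:ℝ) / n) = n * log n - ∑ c, (k c:ℝ) * log (k c) := by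
  have hn' : (0:ℝ) < n := mod_cast hn
  have h : ∀ c, (n:ℝ) * negMulLog ((k c:ℝ) / n)
      = (k c:ℝ) * log n - (k c:ℝ) * log (k c) := fun c => by
    rcases Nat.eq_zero_or_pos (k c) with h0 | h0
    · simp [h0]
    · have : (0:ℝ) < k c := mod_cast h0
      rw [negMulLog, log_div this.ne' hn'.ne']
      field_simp; ring
  rw [ent, mul_sum, sum_congr rfl fun c _ => h c, sum_sub_distrib, ← sum_mul, ← hk]
  push_cast; rfl

lemma log_prod_factorial_le {T : Type*} [Fintype T] (k : T → ℕ) (n : ℕ) (hn : 0 < n)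
    (hk : ∑ c, k c = n) :
    log (∏ c, ((k c)! : ℝ)) ≤ log (n !)
      - n * ent (fun c => (k c:ℝ) / n) + card T * (1 + 2 * log (n + 1)) := by
  rw [log_prod (fun c _ => by positivity), mul_ent_cnt k n hn hk]
  have h1 := le_log_factorial n
  have h2 : ∀ c, log ((k c)! : ℝ) ≤ (k c:ℝ) * log (k c) - k c + (1 + 2 * log (n + 1)) := fun c => by
    have h := log_factorial_le (k c)
    have hle : k c ≤ n := hk ▸ single_le_sum (f := k) (by simp) (mem_univ c)
    have : log ((k c:ℝ) + 1) ≤ log (n + 1) := Real.log_le_log (by positivity) (by simp_all)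
    linarith
  have h3 := sum_le_sum fun c (_ : c ∈ univ) => h2 c
  rw [sum_add_distrib, sum_sub_distrib] at h3
  simp only [sum_const, card_univ, nsmul_eq_mul] at h3
  have h4 : ∑ c, (k c:ℝ) = n := mod_cast hk
  linarith

lemma le_log_prod_factorial {T : Type*} [Fintype T] (k : T → ℕ) (n : ℕ) (hn : 0 < n)
    (hk : ∑ c, k c = n) :
    log (n !) - n * ent (fun c => (k c:ℝ) / n) - (1 + 2 * log (n + 1))
      ≤ log (∏ c, ((k c)! : ℝ)) := by
  rw [log_prod (fun c _ => by positivity), mul_ent_cnt k n hn hk]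
  have h1 := log_factorial_le n
  have h3 := sum_le_sum fun c (_ : c ∈ univ) => le_log_factorial (k c)
  rw [sum_sub_distrib] at h3
  have h4 : ∑ c, (k c:ℝ) = n := mod_cast hk
  linarith

lemma card_words_le [Fintype T] (q : T → ℝ) (hq : ∀ c, 0 ≤ q c)
    (hq1 : ∑ c, q c = 1) (S : Finset (α → T)) (x : ℝ)
    (hS : ∀ w ∈ S, exp (-x) ≤ ∏ a, q (w a)) : (#S : ℝ) ≤ exp x := by
  have h1 : ∑ w : α → T, ∏ a, q (w a) = 1 := by
    rw [← Fintype.prod_sum]; simp [hq1]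
  have h2 : (#S : ℝ) * exp (-x) ≤ 1 := by
    rw [← h1, ← nsmul_eq_mul, ← sum_const]
    refine (sum_le_sum hS).trans
      (Finset.sum_le_univ_sum_of_nonneg fun w => Finset.prod_nonneg fun a _ => hq _)
  rw [exp_neg, ← div_eq_mul_inv, div_le_one (exp_pos x)] at h2
  exact h2

lemma exists_word_of_cnt {T : Type*} [Fintype T] (m : ℕ) (k : T → ℕ) (hk : ∑ c, k c = m) :
    ∃ w : Fin m → T, ∀ c, cnt w c = k c := by
  have e : Fin m ≃ Σ c, Fin (k c) := equivOfCardEq (by simp [hk])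
  refine ⟨fun i => (e i).1, fun c => ?_⟩
  rw [show (fun i => (e i).1) = (Sigma.fst ∘ e) from rfl, cnt_comp_equiv, cnt, ← card_subtype]
  rw [card_congr (Equiv.sigmaSubtype c)]; simp

lemma exists_word_near {T : Type*} [Fintype T] (q : T → ℝ) (hq : ∀ c, 0 ≤ q c)
    (hq1 : ∑ c, q c = 1) (m : ℕ) :
    ∃ w : Fin m → T, ∀ c, |(cnt w c : ℝ) - m * q c| ≤ card T ∧ (q c = 0 → cnt w c = 0) := by
  obtain ⟨c0, hc0⟩ : ∃ c, q c ≠ 0 := by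
    by_contra h; simp_all
  set k0 : T → ℕ := fun c => ⌊(m:ℝ) * q c⌋₊ with hk0
  have hle : ∀ c, (k0 c:ℝ) ≤ m * q c := fun c => Nat.floor_le (by have := hq c; positivity)
  have hge : ∀ c, (m:ℝ) * q c - 1 ≤ k0 c := fun c => (Nat.sub_one_lt_floor _).le
  have hsum : ∑ c, (m:ℝ) * q c = m := by rw [← mul_sum, hq1, mul_one]
  have hs1 : ∑ c, (k0 c:ℝ) ≤ m := by rw [← hsum]; exact sum_le_sum fun c _ => hle c
  have hs2 : (m:ℝ) - card T ≤ ∑ c, (k0 c:ℝ) := by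
    have := sum_le_sum fun c (_ : c ∈ univ) => hge c
    simp_all
  have hs1' : ∑ c, k0 c ≤ m := mod_cast hs1
  set D : ℕ := m - ∑ c, k0 c with hD
  have hDr : (D:ℝ) ≤ card T := by
    rw [hD, Nat.cast_sub hs1', Nat.cast_sum]; linarith
  obtain ⟨w, hw⟩ := exists_word_of_cnt m (fun c => k0 c + if c = c0 then D else 0) (by
    rw [sum_add_distrib]; simp; omega)
  have hT : (1:ℝ) ≤ card T := by
    exact_mod_cast (card_pos_iff.mpr ⟨c0⟩ : 0 < card T)
  refine ⟨w, fun c => ⟨?_, fun h => ?_⟩⟩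
  · rw [hw, abs_le]
    have := hle c; have := hge c
    have hD0 : (0:ℝ) ≤ D := by positivity
    split_ifs <;> constructor <;> push_cast <;> linarith
  · have hne : c ≠ c0 := fun h' => hc0 (h' ▸ h)
    rw [hw]; simp [hne, hk0, h]

lemma exists_near_matching {α β T : Type*} [Fintype α] [Fintype β] [Fintype T]
    (hcard : card α = card β) (s : α → T) (t : β → T) :
    ∃ e : α ≃ β, (#{a | t (e a) ≠ s a} : ℝ) ≤ ∑ c, |(cnt s c : ℝ) - cnt t c| := by
  have : Nonempty (α ≃ β) := ⟨equivOfCardEq hcard⟩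
  obtain ⟨e, he⟩ := Finite.exists_min (fun e : α ≃ β => #{a | t (e a) ≠ s a})
  refine ⟨e, ?_⟩
  have key : ∀ x y : α, t (e x) ≠ s x → t (e y) = s x → s y = s x := fun x y hx hy => by
    by_contra hne
    have hxy : x ≠ y := by grind
    refine absurd (he ((swap x y).trans e)) (not_le.mpr (Finset.card_lt_card ?_))
    rw [Finset.ssubset_iff_of_subset]
    · refine ⟨x, by simpa using hx, ?_⟩
      grind
    grind
  have hsplit : #{a | t (e a) ≠ s a} = ∑ c, #{a | t (e a) ≠ s a ∧ s a = c} := by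
    rw [Finset.card_eq_sum_card_fiberwise (f := s) (t := univ) (by intro x _; simp)]
    simp only [filter_filter]
  rw [hsplit]; push_cast
  refine sum_le_sum fun c _ => ?_
  by_cases hc : ∃ x, t (e x) ≠ s x ∧ s x = c
  · obtain ⟨x, hx, rfl⟩ := hc
    have h1 : cnt t (s x) = #{a | t (e a) = s a ∧ s a = s x} := by
      rw [← cnt_comp_equiv t e, cnt]
      congr 1; grind
    have h2 : cnt s (s x) = #{a | t (e a) = s a ∧ s a = s x}
        + #{a | t (e a) ≠ s a ∧ s a = s x} := by
      rw [cnt, ← Finset.card_filter_add_card_filter_not (s := univ.filter fun a => s a = s x)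
        (p := fun a => t (e a) = s a)]
      simp only [filter_filter]
      congr 2 <;> ext a <;> simp [and_comm]
    aesop
  · push Not at hc
    rw [Finset.filter_false_of_mem (by grind)]
    simp

lemma card_hamming_ball_le [Fintype T] (w0 : α → T) (K : ℕ) : #{w : α → T |
      (univ.filter fun a => w a ≠ w0 a).card ≤ K}
      ≤ (card α * card T + 1) ^ K := by
  let upd : (Fin K → Option (α × T)) → (α → T) := fun u a =>
    if h : ∃ i c, u i = some (a, c) then h.choose_spec.choose else w0 a
  have hsurj : (univ.filter fun w : α → T =>
      #{a | w a ≠ w0 a} ≤ K) ⊆ univ.image upd := fun w hw => by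
    rw [mem_filter] at hw
    set B := univ.filter fun a => w a ≠ w0 a with hB
    obtain ⟨φ⟩ : Nonempty (B ↪ Fin K) :=
      Function.Embedding.nonempty_of_card_le (by simpa using hw.2)
    rw [mem_image]
    refine ⟨fun i => if h : ∃ b, φ b = i then some (h.choose.1, w h.choose.1) else none,
      mem_univ _, ?_⟩
    have hu : ∀ i a c, (if h : ∃ b, φ b = i then some (h.choose.1, w h.choose.1) else none)
        = some (a, c) → c = w a := fun i a c h => by
      split_ifs at h with h'
      grind
    funext a
    by_cases h : ∃ i c, (if h : ∃ b, φ b = i then some (h.choose.1, w h.choose.1) else none)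
        = some (a, c)
    · exact (dif_pos h).trans (hu _ _ _ h.choose_spec.choose_spec)
    · refine (dif_neg h).trans ?_
      by_contra hne
      have ha : a ∈ B := by grind
      have hex : ∃ b, φ b = φ ⟨a, ha⟩ := ⟨_, rfl⟩
      refine h ⟨φ ⟨a, ha⟩, w a, ?_⟩
      rw [dif_pos hex, φ.injective hex.choose_spec]
  refine (card_le_card hsurj).trans (card_image_le.trans (le_of_eq ?_))
  simp [Fintype.card_option]

/-! ### Concentration of measure on finite products and on permutations -/

/-- The average of a function on a finite type. -/
def avg {Ω : Type*} [Fintype Ω] (F : Ω → ℝ) : ℝ := (∑ ω, F ω) / card Ω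

/-- `F` is sub-Gaussian with variance proxy `2 K` under the uniform measure. -/
def SubG {Ω : Type*} [Fintype Ω] (K : ℝ) (F : Ω → ℝ) : Prop :=
  ∀ l : ℝ, ∑ ω, exp (l * (F ω - avg F)) ≤ card Ω * exp (K * l ^ 2)

lemma avg_comp_equiv {Ω Ω' : Type*} [Fintype Ω] [Fintype Ω'] (e : Ω' ≃ Ω) (F : Ω → ℝ) :
    avg (F ∘ e) = avg F := by
  unfold avg
  rw [card_congr e, ← sum_comp e]; rfl

lemma SubG.of_comp_equiv {Ω Ω' : Type*} [Fintype Ω] [Fintype Ω'] (e : Ω' ≃ Ω) {F : Ω → ℝ} {K : ℝ}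
    (h : SubG K (F ∘ e)) : SubG K F := fun l => by
  have := h l
  rw [avg_comp_equiv, card_congr e] at this
  rw [← sum_comp e]; exact this

lemma exp_le_cosh_add {x c l : ℝ} (hc : |x| ≤ c) (hc0 : 0 < c) :
    exp (l * x) ≤ Real.cosh (l * c) + x / c * Real.sinh (l * c) := by
  have h := abs_le.mp hc
  have h1 : 0 ≤ (1 + x / c) / 2 := by
    have : -1 ≤ x / c := by rw [le_div_iff₀ hc0]; linarith
    linarith
  have h2 : 0 ≤ (1 - x / c) / 2 := by
    have : x / c ≤ 1 := by rw [div_le_iff₀ hc0]; linarith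
    linarith
  have hconv := convexOn_exp.2 (Set.mem_univ (l * c)) (Set.mem_univ (-(l * c))) h1 h2 (by ring)
  have hx : ((1 + x / c) / 2) • (l * c) + ((1 - x / c) / 2) • (-(l * c)) = l * x := by
    simp only [smul_eq_mul]; field_simp; ring
  rw [hx] at hconv
  refine hconv.trans (le_of_eq ?_)
  rw [Real.cosh_eq, Real.sinh_eq]; simp only [smul_eq_mul]; ring

lemma sum_exp_centered_le {I : Type*} [Fintype I] (x : I → ℝ) (c : ℝ) (hx : ∀ i, |x i| ≤ c)
    (hs : ∑ i, x i = 0) (l : ℝ) :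
    ∑ i, exp (l * x i) ≤ card I * exp (c ^ 2 / 2 * l ^ 2) := by
  by_cases hI : Nonempty I
  · rcases (le_trans (abs_nonneg _) (hx hI.some)).eq_or_lt with h0 | h0
    · aesop
    · refine (sum_le_sum fun i _ => exp_le_cosh_add (hx i) h0).trans ?_
      rw [sum_add_distrib, ← sum_mul, ← sum_div, hs]
      simp only [zero_div, zero_mul, add_zero, sum_const, card_univ, nsmul_eq_mul]
      gcongr
      refine (Real.cosh_le_exp_half_sq _).trans (le_of_eq ?_)
      ring_nf
  simp_all

lemma SubG.prod {I Ω : Type*} [Fintype I] [Fintype Ω] [Nonempty Ω] {F : I × Ω → ℝ} {K c : ℝ}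
    (h : ∀ i, SubG K fun ω => F (i, ω))
    (hc : ∀ i j ω, |F (i, ω) - F (j, ω)| ≤ c) : SubG (K + c ^ 2 / 2) F := fun l => by
  set A : I → ℝ := fun i => avg fun ω => F (i, ω) with hA
  by_cases hI : Nonempty I
  swap
  · simp_all
  have hI0 : (0:ℝ) < card I := mod_cast Fintype.card_pos
  have hO0 : (0:ℝ) < card Ω := mod_cast Fintype.card_pos
  have hav : avg F = (∑ i, A i) / card I := by
    simp only [avg, hA, sum_prod_type, card_prod, ← sum_div]
    push_cast; field_simp
  have hAd : ∀ i j, |A i - A j| ≤ c := fun i j => by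
    simp only [hA, avg]
    rw [← sub_div, ← sum_sub_distrib, abs_div, abs_of_pos hO0, div_le_iff₀ hO0]
    refine (abs_sum_le_sum_abs _ _).trans ((sum_le_sum fun ω _ => hc i j ω).trans ?_)
    simp [mul_comm]
  have hx : ∀ i, |A i - avg F| ≤ c := fun i => by
    have : A i - avg F = (∑ j, (A i - A j)) / card I := by
      rw [hav, sum_sub_distrib]; simp; field_simp
    rw [this, abs_div, abs_of_pos hI0, div_le_iff₀ hI0]
    refine (abs_sum_le_sum_abs _ _).trans ((sum_le_sum fun j _ => hAd i j).trans ?_)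
    simp [mul_comm]
  have hs : ∑ i, (A i - avg F) = 0 := by
    rw [hav, sum_sub_distrib]; simp; field_simp; simp
  rw [sum_prod_type]
  calc ∑ i, ∑ ω, exp (l * (F (i, ω) - avg F))
      = ∑ i, exp (l * (A i - avg F)) * ∑ ω, exp (l * (F (i, ω) - A i)) := by
        refine sum_congr rfl fun i _ => ?_
        rw [mul_sum]
        refine sum_congr rfl fun ω _ => ?_
        rw [← exp_add]; ring_nf
    _ ≤ ∑ i, exp (l * (A i - avg F)) * (card Ω * exp (K * l ^ 2)) := by
        refine sum_le_sum fun i _ => ?_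
        exact mul_le_mul_of_nonneg_left (h i l) (exp_pos _).le
    _ ≤ (card I * exp (c ^ 2 / 2 * l ^ 2)) * (card Ω * exp (K * l ^ 2)) := by
        rw [← sum_mul]
        gcongr
        exact sum_exp_centered_le _ c hx hs l
    _ = _ := by
        rw [card_prod, add_mul, exp_add]; push_cast; ring

lemma SubG.perm_fin {c : ℝ} (N : ℕ) : ∀ F : Perm (Fin N) → ℝ,
    (∀ π a b, |F π - F (π * swap a b)| ≤ c) → SubG (2 * N * c ^ 2) F := by
  induction N with
  | zero =>
    intro F _ l
    have : avg F = F 1 := by simp [avg]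
    simp_all
  | succ N ih =>
    intro F hF
    have hL : ∀ π a b, |F π - F (swap a b * π)| ≤ c := fun π a b => by
      have := hF π (π⁻¹ a) (π⁻¹ b)
      rwa [← Equiv.swap_mul_eq_mul_swap] at this
    have hdec : ∀ i e, Perm.decomposeFin.symm (i, e)
        = swap 0 i * Perm.decomposeFin.symm ((0 : Fin (N+1)), e) := fun i e => by
      ext x
      refine Fin.cases ?_ (fun x => ?_) x <;> simp
    have hext : ∀ (e : Perm (Fin N)) a b, Perm.decomposeFin.symm ((0 : Fin (N+1)), e * swap a b)
        = Perm.decomposeFin.symm ((0 : Fin (N+1)), e) * swap a.succ b.succ := fun e a b => by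
      ext x
      refine Fin.cases ?_ (fun x => ?_) x
      · rw [Perm.mul_apply, swap_apply_of_ne_of_ne (Fin.succ_ne_zero a).symm
          (Fin.succ_ne_zero b).symm]; simp
      · rw [Perm.mul_apply, (Fin.succ_injective _).swap_apply]; simp
    have h := SubG.prod (F := F ∘ Perm.decomposeFin.symm) (K := 2 * N * c ^ 2) (c := 2 * c)
      (fun i => ih _ fun e a b => by
        simp only [Function.comp]
        rw [hdec i (e * _), hext, ← mul_assoc, ← hdec]; exact hF _ _ _)
      (fun i j e => by
        grind)
    have h' := h.of_comp_equiv
    grind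

lemma SubG.equiv {α β : Type*} [Fintype α] [Fintype β] (h : card α = card β)
    {c : ℝ} (F : (α ≃ β) → ℝ)
    (hF : ∀ π a b, |F π - F ((swap a b).trans π)| ≤ c) :
    SubG (2 * card α * c ^ 2) F := by
  let ea := Fintype.equivFin α
  let eb : β ≃ Fin (card α) := equivOfCardEq (by simp [h])
  refine SubG.of_comp_equiv (equivCongr ea eb).symm (SubG.perm_fin _ _ fun π a b => ?_)
  have := hF ((equivCongr ea eb).symm π) (ea.symm a) (ea.symm b)
  have he : (equivCongr ea eb).symm (π * swap a b)
      = (swap (ea.symm a) (ea.symm b)).trans ((equivCongr ea eb).symm π) := by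
    ext x
    simp only [Equiv.equivCongr_symm, Equiv.equivCongr_apply_apply, Perm.mul_apply,
      Equiv.symm_symm, trans_apply]
    grind
  grind

lemma SubG.pi_fin {K : Type*} [Fintype K] [Nonempty K] {c : ℝ} (N : ℕ) : ∀ F : (Fin N → K) → ℝ,
    (∀ w i k, |F w - F (Function.update w i k)| ≤ c) → SubG (N * (c ^ 2 / 2)) F := by
  induction N with
  | zero =>
    intro F _ l
    have : avg F = F default := by simp [avg]
    simp_all
  | succ N ih =>
    intro F hF
    have h := SubG.prod (F := F ∘ Fin.consEquiv (fun _ => K)) (K := N * (c ^ 2 / 2)) (c := c)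
      (fun i => ih _ fun w j k => by
        change |F (Fin.cons i w) - F (Fin.cons i (Function.update w j k))| ≤ c
        rw [Fin.cons_update]; exact hF _ _ _)
      (fun i j w => by
        change |F (Fin.cons i w) - F (Fin.cons j w)| ≤ c
        have := hF (Fin.cons i w) 0 j
        simp_all)
    have h' := h.of_comp_equiv
    grind

lemma SubG.tail {Ω : Type*} [Fintype Ω] {F : Ω → ℝ} {K : ℝ} (h : SubG K F) (hK : 0 < K) (t : ℝ)
    (ht : 0 ≤ t) :
    (#{ω | avg F + t ≤ F ω} : ℝ) ≤ card Ω * exp (-(t ^ 2 / (4 * K))) := by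
  set l := t / (2 * K) with hl
  have hl0 : 0 ≤ l := by positivity
  have h1 : (#{ω | avg F + t ≤ F ω} : ℝ) * exp (l * t) ≤ ∑ ω, exp (l * (F ω - avg F)) := by
    rw [← nsmul_eq_mul, ← sum_const]
    refine le_trans (sum_le_sum fun ω hω => ?_)
      (Finset.sum_le_univ_sum_of_nonneg fun ω => (exp_pos _).le)
    rw [mem_filter] at hω
    gcongr; linarith [hω.2]
  have h2 := h1.trans (h l)
  rw [← le_div_iff₀ (exp_pos _), mul_div_assoc, ← Real.exp_sub] at h2
  refine h2.trans (le_of_eq ?_)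
  congr 2
  grind

lemma SubG.neg {Ω : Type*} [Fintype Ω] {F : Ω → ℝ} {K : ℝ} (h : SubG K F) :
    SubG K fun ω => -F ω := fun l => by
  have := h (-l)
  have ha : avg (fun ω => -F ω) = -avg F := by simp [avg, neg_div]
  grind

lemma SubG.lower_tail {Ω : Type*} [Fintype Ω] {F : Ω → ℝ} {K : ℝ} (h : SubG K F) (hK : 0 < K)
    (t : ℝ) (ht : 0 ≤ t) :
    (#{ω | F ω ≤ avg F - t} : ℝ) ≤ card Ω * exp (-(t ^ 2 / (4 * K))) := by
  have ha : avg (fun ω => -F ω) = -avg F := by simp [avg, neg_div]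
  refine le_trans (le_of_eq ?_) (h.neg.tail hK t ht)
  rw [ha]
  congr 2; grind

/-! ### Lists labelling the vertices of the tree -/

lemma validTd_nil (d : ℕ) : ValidTd d [] := (rootTd d).2

lemma validTd_singleton {d j : ℕ} : ValidTd d [j] ↔ 1 ≤ j ∧ j ≤ d := by
  simp [ValidTd]

lemma validTd_cons_cons {d i j : ℕ} {l : List ℕ} :
    ValidTd d (i :: j :: l) ↔ (1 ≤ i ∧ i ≤ d - 1) ∧ ValidTd d (j :: l) := by
  simp only [ValidTd, List.dropLast_cons_cons, List.mem_cons, forall_eq_or_imp,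
    List.getLast?_cons_cons]
  tauto

lemma ValidTd.tail {d i : ℕ} {l : List ℕ} (h : ValidTd d (i :: l)) : ValidTd d l := by
  cases l with
  | nil => exact validTd_nil d
  | cons j l => exact (validTd_cons_cons.mp h).2

lemma ValidTd.suffix {d : ℕ} {l l' : List ℕ} (h : ValidTd d l) (hs : l' <:+ l) : ValidTd d l' := by
  induction l with
  | nil => grind
  | cons i l ih =>
    rcases List.suffix_cons_iff.mp hs with rfl | h'
    · exact h
    · exact ih h.tail h'

lemma ValidTd.mem {d : ℕ} {l : List ℕ} (h : ValidTd d l) : ∀ i ∈ l, 1 ≤ i ∧ i ≤ d := by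
  induction l with
  | nil => simp
  | cons j l ih =>
    intro i hi
    rcases List.mem_cons.mp hi with rfl | hi
    · cases l with
      | nil => exact validTd_singleton.mp h
      | cons k l => have := (validTd_cons_cons.mp h).1; omega
    · exact ih h.tail i hi

lemma finite_validTd (d R : ℕ) : {l : List ℕ | ValidTd d l ∧ l.length ≤ R}.Finite := by
  have h : {l : List (Fin (d+1)) | l.length ≤ R}.Finite := List.finite_length_le _ _
  refine (h.image (fun l => l.map Fin.val)).subset ?_
  rintro l ⟨hl, hR⟩
  refine ⟨l.map (fun i => Fin.ofNat (d+1) i), by simpa using hR, ?_⟩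
  simp only [List.map_map]
  refine (List.map_congr_left (g := id) fun i hi => ?_).trans (List.map_id l)
  have := hl.mem i hi
  simp_all

/-- The labels of the vertices of the ball `S_R`. -/
def ballL (d R : ℕ) : Finset (List ℕ) := (finite_validTd d R).toFinset

lemma mem_ballL {d R : ℕ} {l : List ℕ} : l ∈ ballL d R ↔ ValidTd d l ∧ l.length ≤ R := by
  simp [ballL]

lemma nil_mem_ballL (d R : ℕ) : [] ∈ ballL d R := mem_ballL.mpr ⟨validTd_nil d, by simp⟩

lemma ballL_mono {d R R' : ℕ} (h : R ≤ R') : ballL d R ⊆ ballL d R' := by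
  intro l; rw [mem_ballL, mem_ballL]; grind

lemma ballL_card_pos (d R : ℕ) : 0 < #(ballL d R) := Finset.card_pos.mpr ⟨_, nil_mem_ballL d R⟩

instance (d R : ℕ) : Finite ↥(SrSet d R) := by
  refine Finite.of_injective (β := ballL d R) (fun u => ⟨u.1.1, mem_ballL.mpr ⟨u.1.2, u.2⟩⟩) ?_
  intro u w h
  exact Subtype.ext (Subtype.ext (congrArg (fun z : ballL d R => z.1) h))

instance (d R : ℕ) : Finite ↥(ErSet d R) :=
  Finite.of_injective (fun u : ↥(ErSet d R) => (⟨u.1, ErSet_subset_SrSet d R u.2⟩ : ↥(SrSet d R)))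
    fun _ _ h => Subtype.ext (congrArg (fun z => z.1) h)

noncomputable instance (d R : ℕ) : Fintype ↥(SrSet d R) := ofFinite _
noncomputable instance (d R : ℕ) : Fintype ↥(ErSet d R) := ofFinite _

/-! ### The universal cover of a configuration -/

/-- The label of the half-edge followed by the step `j` when entering by the half-edge `a`. -/
def skipLab {d : ℕ} [NeZero d] (a : Option (Fin d)) (j : ℕ) : Fin d :=
  match a with
  | none => Fin.ofNat d (j - 1)
  | some a => Fin.ofNat d (if j - 1 < (a : ℕ) then j - 1 else j)

/-- The steps allowed when entering by the half-edge `a`. -/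
def ValidStep (d : ℕ) (a : Option (Fin d)) (j : ℕ) : Prop :=
  1 ≤ j ∧ (if a = none then j ≤ d else j ≤ d - 1)

lemma skipLab_injOn {d : ℕ} [NeZero d] {a : Option (Fin d)} {j j' : ℕ} (h : ValidStep d a j)
    (h' : ValidStep d a j') (he : skipLab a j = skipLab a j') : j = j' := by
  cases a with
  | none =>
    simp only [ValidStep, if_true, skipLab] at *
    have := congrArg Fin.val he
    simp only [Fin.ofNat] at this
    rw [Nat.mod_eq_of_lt (by omega), Nat.mod_eq_of_lt (by omega)] at this
    omega
  | some a =>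
    simp only [ValidStep, reduceCtorEq, if_false, skipLab] at *
    have := congrArg Fin.val he
    simp only [Fin.ofNat] at this
    have ha := a.2
    rw [Nat.mod_eq_of_lt (by split_ifs <;> omega), Nat.mod_eq_of_lt (by split_ifs <;> omega)] at this
    grind

lemma skipLab_ne {d : ℕ} [NeZero d] {a : Fin d} {j : ℕ} (h : ValidStep d (some a) j) :
    skipLab (some a) j ≠ a := by
  simp only [ValidStep, reduceCtorEq, if_false, skipLab] at *
  intro he
  have := congrArg Fin.val he
  simp only [Fin.ofNat] at this
  have ha := a.2
  rw [Nat.mod_eq_of_lt (by split_ifs <;> omega)] at this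
  grind

lemma exists_skipLab {d : ℕ} [NeZero d] {a : Option (Fin d)} {b : Fin d} (h : a ≠ some b) :
    ∃ j, ValidStep d a j ∧ skipLab a j = b := by
  have hb := b.2
  cases a with
  | none =>
    refine ⟨b + 1, by simp [ValidStep], ?_⟩
    simp only [skipLab, Nat.add_sub_cancel]
    simp_all
  | some a =>
    have hab : (a:ℕ) ≠ b := fun h' => h (by rw [Fin.ext h'])
    have ha := a.2
    rcases lt_or_gt_of_ne hab with h1 | h1
    · refine ⟨b, by simp [ValidStep]; omega, ?_⟩
      ext
      simp only [skipLab, Fin.ofNat]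
      rw [if_neg (by omega), Nat.mod_eq_of_lt hb]
    · refine ⟨b + 1, by simp [ValidStep]; omega, ?_⟩
      ext
      simp only [skipLab, Fin.ofNat]
      rw [if_pos (by omega), Nat.mod_eq_of_lt (by omega)]; omega

/-- The state (vertex and entering half-edge) reached from the vertex `v` following the list of
steps. -/
def st {d n : ℕ} [NeZero d] (ι : HMap n d) (v : Fin n) : List ℕ → Fin n × Option (Fin d)
  | [] => (v, none)
  | j :: l => ((ι ((st ι v l).1, skipLab (st ι v l).2 j)).1,
      some (ι ((st ι v l).1, skipLab (st ι v l).2 j)).2)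

/-- The vertex reached from `v` following the list of steps. -/
def pos {d n : ℕ} [NeZero d] (ι : HMap n d) (v : Fin n) (l : List ℕ) : Fin n := (st ι v l).1

/-- The half-edge followed at step `j` after the steps `l`. -/
def out {d n : ℕ} [NeZero d] (ι : HMap n d) (v : Fin n) (l : List ℕ) (j : ℕ) :
    HE n d := (pos ι v l, skipLab (st ι v l).2 j)

section
variable {d n : ℕ} [NeZero d] {ι ι' : HMap n d} {v : Fin n}

lemma st_cons (j : ℕ) (l : List ℕ) :
    st ι v (j :: l) = ((ι (out ι v l j)).1, some (ι (out ι v l j)).2) := rfl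

lemma pos_nil : pos ι v [] = v := rfl

lemma pos_cons (j : ℕ) (l : List ℕ) : pos ι v (j :: l) = (ι (out ι v l j)).1 := rfl

lemma validTd_cons_iff (ι : HMap n d) (v : Fin n) {j : ℕ} {l : List ℕ} :
    ValidTd d (j :: l) ↔ ValidTd d l ∧ ValidStep d (st ι v l).2 j := by
  cases l with
  | nil => simp [validTd_singleton, ValidStep, st, validTd_nil]
  | cons i l =>
    rw [validTd_cons_cons]
    simp only [ValidStep, st, reduceCtorEq, if_false]
    tauto

lemma st_congr {l : List ℕ} (h : ∀ j l', (j :: l') <:+ l → ι (out ι v l' j) = ι' (out ι v l' j)) :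
    st ι v l = st ι' v l := by
  induction l with
  | nil => rfl
  | cons j l ih =>
    have h1 := ih fun j' l' hs => h j' l' (hs.trans (List.suffix_cons j l))
    have h2 : out ι' v l j = out ι v l j := by simp only [out, pos, h1]
    rw [st_cons, st_cons, h2, h j l List.suffix_rfl]

/-- The ball of radius `k` around `B` in the multigraph of a configuration. -/
def nbhd (ι : HMap n d) (B : Finset (Fin n)) : ℕ → Finset (Fin n)
  | 0 => B
  | k + 1 => nbhd ι B k ∪ (nbhd ι B k ×ˢ (univ : Finset (Fin d))).image fun h => (ι h).1

lemma card_nbhd_le (ι : HMap n d) (B : Finset (Fin n)) (k : ℕ) :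
    #(nbhd ι B k) ≤ (d + 1) ^ k * #B := by
  induction k with
  | zero => simp [nbhd]
  | succ k ih =>
    refine (card_union_le _ _).trans ?_
    have h1 : #((nbhd ι B k ×ˢ (univ : Finset (Fin d))).image fun h => (ι h).1)
        ≤ #(nbhd ι B k) * d := card_image_le.trans (by simp)
    calc _ ≤ #(nbhd ι B k) + #(nbhd ι B k) * d := by gcongr
      _ = (d + 1) * #(nbhd ι B k) := by ring
      _ ≤ (d + 1) * ((d + 1) ^ k * #B) := by gcongr
      _ = _ := by ring

lemma nbhd_subset_succ (ι : HMap n d) (B : Finset (Fin n)) (k : ℕ) :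
    nbhd ι B k ⊆ nbhd ι B (k + 1) := Finset.subset_union_left

lemma nbhd_mono (ι : HMap n d) (B : Finset (Fin n)) {k k' : ℕ} (h : k ≤ k') :
    nbhd ι B k ⊆ nbhd ι B k' := by
  induction h with
  | refl => rfl
  | step _ ih => exact ih.trans (nbhd_subset_succ ι B _)

lemma mem_nbhd_succ {B : Finset (Fin n)} {k : ℕ} {u : Fin n} (hu : u ∈ nbhd ι B k) (i : Fin d) :
    (ι (u, i)).1 ∈ nbhd ι B (k + 1) :=
  mem_union_right _ (mem_image.mpr ⟨(u, i), by simpa using hu, rfl⟩)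

lemma mem_nbhd_of_pos (hι : Involutive ι) {B : Finset (Fin n)} {l : List ℕ} : ∀ {k : ℕ},
    pos ι v l ∈ nbhd ι B k → v ∈ nbhd ι B (k + l.length) := by
  induction l with
  | nil => intro k h; exact h
  | cons j l ih =>
    intro k h
    have h1 := mem_nbhd_succ h (ι (out ι v l j)).2
    rw [pos_cons, Prod.mk.eta, hι] at h1
    have := ih h1
    grind

lemma st_eq_of_notMem_nbhd (hι : Involutive ι) {B : Finset (Fin n)}
    (hB : ∀ u ∉ B, ∀ i, ι (u, i) = ι' (u, i)) {R : ℕ} (hv : v ∉ nbhd ι B R) {l : List ℕ}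
    (hl : l.length ≤ R) : st ι v l = st ι' v l := by
  refine st_congr fun j l' hs => hB _ (fun hmem => hv ?_) _
  have := mem_nbhd_of_pos (k := 0) hι hmem
  refine nbhd_mono ι B ?_ this
  grind

/-- The colouring of the ball `S_R` pulled back from `f` by the covering map at `v`. -/
def xcol {N : Type*} (R : ℕ) (ι : HMap n d) (f : Fin n → N) (v : Fin n) :
    ↥(SrSet d R) → N := fun u => f (pos ι v u.1.1)

/-- The vertex `v` has a tree-like neighborhood of radius `R`. -/
def TreeLike (R : ℕ) (ι : HMap n d) (v : Fin n) : Prop := Set.InjOn (pos ι v) (ballL d R)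

/-- The number of vertices whose neighborhood of radius `R` is not tree-like. -/
def badCount (R : ℕ) (ι : HMap n d) : ℕ := #{v | ¬ TreeLike R ι v}

lemma TreeLike.mono {R R' : ℕ} (hR : R ≤ R') (h : TreeLike R' ι v) : TreeLike R ι v :=
  Set.InjOn.mono (mod_cast ballL_mono hR) h

lemma xcol_eq_of_notMem_nbhd {N : Type*} (hι : Involutive ι) {B : Finset (Fin n)}
    (hB : ∀ u ∉ B, ∀ i, ι (u, i) = ι' (u, i)) {R : ℕ} (hv : v ∉ nbhd ι B R) (f : Fin n → N) :
    xcol R ι f v = xcol R ι' f v := by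
  funext u
  simp only [xcol, pos, st_eq_of_notMem_nbhd hι hB hv u.2]

lemma treeLike_iff_of_notMem_nbhd (hι : Involutive ι) {B : Finset (Fin n)}
    (hB : ∀ u ∉ B, ∀ i, ι (u, i) = ι' (u, i)) {R : ℕ} (hv : v ∉ nbhd ι B R) :
    TreeLike R ι v ↔ TreeLike R ι' v := by
  refine Set.EqOn.injOn_iff fun l hl => ?_
  simp only [pos, st_eq_of_notMem_nbhd hι hB hv (mem_ballL.mp hl).2]

end

/-- A configuration: a matching of the half-edges `HE n d`. -/
abbrev Conf (d n m : ℕ) : Type := (Fin m × Bool) ≃ HE n d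

/-- The involution exchanging the two halves of each edge. -/
def flipB {m : ℕ} (x : Fin m × Bool) : Fin m × Bool := (x.1, !x.2)

lemma flipB_flipB {m : ℕ} (x : Fin m × Bool) : flipB (flipB x) = x := by simp [flipB]

lemma flipB_ne {m : ℕ} (x : Fin m × Bool) : flipB x ≠ x := by
  intro h; have := congrArg Prod.snd h; simp [flipB] at this

/-- The involution of the half-edges defined by a configuration. -/
def iota {d n m : ℕ} (π : Conf d n m) (h : HE n d) : HE n d := π (flipB (π.symm h))

/-- The involution on half-edges of a configuration. -/
postfix:max "°" => iota

section
variable {d n m : ℕ}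

lemma iota_apply (π : Conf d n m) (x : Fin m × Bool) : π° (π x) = π (flipB x) := by
  simp [iota]

lemma iota_involutive (π : Conf d n m) : Involutive π° := by
  intro h; simp [iota, flipB_flipB]

lemma iota_ne (π : Conf d n m) (h : HE n d) : π° h ≠ h := fun he => by
  have := congrArg π.symm he
  simp only [iota, symm_apply_apply] at this
  exact flipB_ne _ this

lemma iota_trans (π : Conf d n m) (e : Perm HE n d) (h : HE n d) :
    (π.trans e)° h = e (π° (e.symm h)) := by
  simp [iota]

variable [NeZero d]

/-- The vertices incident to the edges modified by the exchange of two half-edges. -/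
def touched (π : Conf d n m) (g g' : HE n d) : Finset (Fin n) := {g.1, g'.1, (π° g).1, (π° g').1}

lemma card_touched_le (π : Conf d n m) (g g' : HE n d) : #(touched π g g') ≤ 4 :=
  Finset.card_le_four

lemma iota_swap_of_notMem (π : Conf d n m) (g g' h : HE n d) (h1 : h ≠ g) (h2 : h ≠ g')
    (h3 : h ≠ π° g) (h4 : h ≠ π° g') :
    (π.trans (swap g g'))° h = π° h := by
  rw [iota_trans, symm_swap, swap_apply_of_ne_of_ne h1 h2, swap_apply_of_ne_of_ne]
  · intro h; exact h3 (by rw [← h, iota_involutive])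
  · intro h; exact h4 (by rw [← h, iota_involutive])

lemma iota_swap_touched (π : Conf d n m) (g g' : HE n d) (u : Fin n)
    (hu : u ∉ touched π g g') (i : Fin d) :
    π° (u, i) = (π.trans (swap g g'))° (u, i) := by
  simp only [touched, Finset.mem_insert, Finset.mem_singleton, not_or] at hu
  symm
  apply iota_swap_of_notMem <;> rintro h
  · grind
  · grind
  · grind
  grind

lemma swap_trans_eq (π : Conf d n m) (a b : Fin m × Bool) :
    (swap a b).trans π = π.trans (swap (π a) (π b)) := by
  aesop

end

section
variable {d n m : ℕ} [NeZero d]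

lemma exists_collision {R : ℕ} {ι : HMap n d} {v : Fin n}
    (h : ¬ TreeLike R ι v) : ∃ l ∈ ballL d R, ∃ l' ∈ ballL d R, l' ≠ l ∧ pos ι v l' = pos ι v l ∧
      l'.length ≤ l.length ∧
      (∀ l₁ ∈ ballL d R, ∀ l₂ ∈ ballL d R, l₁.length < l.length → l₂.length < l.length →
        pos ι v l₁ = pos ι v l₂ → l₁ = l₂) ∧
      (∀ l₁ ∈ ballL d R, l₁.length < l'.length → pos ι v l₁ ≠ pos ι v l) := by
  let P : ℕ → Prop := fun k => ∃ l ∈ ballL d R, l.length = k ∧ ∃ l' ∈ ballL d R, l' ≠ l ∧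
    pos ι v l' = pos ι v l ∧ l'.length ≤ l.length
  have hP : ∃ k, P k := by
    simp only [TreeLike, Set.InjOn, not_forall] at h
    obtain ⟨l, hl, l', hl', he, hne⟩ := h
    rcases le_total l.length l'.length with hle | hle
    · aesop
    aesop
  obtain ⟨l, hl, hlk, l', hl', hne, he, hle⟩ := Nat.find_spec hP
  let Q : ℕ → Prop := fun k => ∃ l' ∈ ballL d R, l'.length = k ∧ l' ≠ l ∧
    pos ι v l' = pos ι v l ∧ l'.length ≤ l.length
  have hQ : ∃ k, Q k := ⟨_, l', hl', rfl, hne, he, hle⟩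
  obtain ⟨l₀, hl₀, hl₀k, hne₀, he₀, hle₀⟩ := Nat.find_spec hQ
  refine ⟨l, hl, l₀, hl₀, hne₀, he₀, hle₀, ?_, ?_⟩
  · intro l₁ h1 l₂ h2 hlt1 hlt2 h12
    by_contra hn
    rcases le_total l₁.length l₂.length with hh | hh
    · exact Nat.find_min hP (m := l₂.length) (by omega) ⟨l₂, h2, rfl, l₁, h1, hn, h12, hh⟩
    · exact Nat.find_min hP (m := l₁.length) (by omega)
        ⟨l₁, h1, rfl, l₂, h2, Ne.symm hn, h12.symm, hh⟩
  · intro l₁ h1 hlt he1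
    refine Nat.find_min hQ (m := l₁.length) (by omega) ⟨l₁, h1, rfl, ?_, he1, by omega⟩
    rintro rfl
    omega

lemma ballL_suffix {R : ℕ} {l l' : List ℕ} (h : l ∈ ballL d R) (hs : l' <:+ l) :
    l' ∈ ballL d R := by
  rw [mem_ballL] at *
  exact ⟨h.1.suffix hs, hs.length_le.trans h.2⟩

lemma exists_switch {R : ℕ} (π : Conf d n m) {v : Fin n} (h : ¬ TreeLike R π° v) :
    ∃ j l₀ l' a, (j :: l₀) ∈ ballL d R ∧ l' ∈ ballL d R ∧
      ∀ g : HE n d, g.1 ∉ (ballL d R).image (pos π° v) → (π.trans (swap (pos π° v l', a) g))°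
          (out (π.trans (swap (pos π° v l', a) g))° v l₀ j) = g ∧
        pos (π.trans (swap (pos π° v l', a) g))° v l' = pos π° v l' := by
  obtain ⟨l, hl, l', hl', hne, he, hle, hA, hB⟩ := exists_collision h
  obtain ⟨j, l₀, rfl⟩ : ∃ j l₀, l = j :: l₀ := by
    cases l with
    | nil => simp_all
    | cons j l₀ => grind
  set ι := π° with hι
  have hinv : Involutive ι := iota_involutive π
  set hh := out ι v l₀ j with hhh
  have hg1 : ι hh = (pos ι v l', (ι hh).2) := by
    rw [he]; rfl
  refine ⟨j, l₀, l', (ι hh).2, hl, hl', fun g hg => ?_⟩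
  rw [← hg1]
  have hl0 : l₀ ∈ ballL d R := ballL_suffix hl (List.suffix_cons _ _)
  have hvs : ValidStep d (st ι v l₀).2 j := ((validTd_cons_iff ι v).mp (mem_ballL.mp hl).1).2
  have hgpos : ∀ l₁ ∈ ballL d R, pos ι v l₁ ≠ g.1 := fun l₁ h1 h2 =>
    hg (mem_image.mpr ⟨l₁, h1, h2⟩)
  have hg2 : ∀ l₁ j₁, (j₁ :: l₁) ∈ ballL d R → out ι v l₁ j₁ ≠ g ∧ out ι v l₁ j₁ ≠ ι g := fun l₁ j₁ h1 => by
    refine ⟨fun h2 => hgpos l₁ (ballL_suffix h1 (List.suffix_cons _ _)) (congrArg Prod.fst h2),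
      fun h2 => hgpos _ h1 ?_⟩
    rw [pos_cons, h2, hinv]
  have key : ∀ h' : HE n d, h' ≠ g → h' ≠ ι g → h' ≠ hh → h' ≠ ι hh →
      ι h' = (π.trans (swap (ι hh) g))° h' := fun h' h1 h2 h3 h4 => by
    rw [iota_swap_of_notMem _ _ _ _ h4 h1 _ h2]
    change h' ≠ ι (ι hh)
    rwa [hinv]
  have hp0 : st ι v l₀ = st (π.trans (swap (ι hh) g))° v l₀ := by
    refine st_congr fun j₁ l₁ hs => ?_
    have hmem := ballL_suffix hl0 hs
    have hl1 : l₁ ∈ ballL d R := ballL_suffix hmem (List.suffix_cons _ _)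
    have hlen := hs.length_le
    simp only [List.length_cons] at hlen
    obtain ⟨h1, h2⟩ := hg2 l₁ j₁ hmem
    refine key _ h1 h2 (fun h3 => ?_) (fun h3 => ?_)
    · have := hA l₁ hl1 l₀ hl0 (by simp; omega) (by simp) (show (out ι v l₁ j₁).1 = hh.1 by rw [h3])
      subst this; omega
    · have h4 : pos ι v (j₁ :: l₁) = pos ι v l₀ := by
        rw [pos_cons, h3, hinv]; rfl
      have h5 := hA _ hmem _ hl0 (by simp; omega) (by simp) h4
      subst h5
      have h6 : (st ι v (j₁ :: l₁)).2 = some hh.2 := by rw [st_cons, h3, hinv]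
      rw [h6] at hvs
      apply skipLab_ne hvs
      rw [← h6]
      rfl
  have hp1 : st ι v l' = st (π.trans (swap (ι hh) g))° v l' := by
    refine st_congr fun j₁ l₁ hs => ?_
    have hmem := ballL_suffix hl' hs
    have hl1 : l₁ ∈ ballL d R := ballL_suffix hmem (List.suffix_cons _ _)
    have hlen := hs.length_le
    simp only [List.length_cons] at hlen hle
    obtain ⟨h1, h2⟩ := hg2 l₁ j₁ hmem
    refine key _ h1 h2 (fun h3 => ?_) (fun h3 => ?_)
    · have := hA l₁ hl1 l₀ hl0 (by simp; omega) (by simp) (show (out ι v l₁ j₁).1 = hh.1 by rw [h3])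
      subst this
      have h7 : (j₁ :: l₁) = l' := hs.eq_of_length (by simp; omega)
      have h8 : j₁ = j := skipLab_injOn
        (((validTd_cons_iff ι v).mp (mem_ballL.mp hmem).1).2) hvs (congrArg Prod.snd h3)
      grind
    · exact hB l₁ hl1 (by omega) (show (out ι v l₁ j₁).1 = (ι hh).1 by rw [h3])
  constructor
  · have h1 : out (π.trans (swap (ι hh) g))° v l₀ j = hh := by
      unfold out pos
      rw [← hp0]
      rfl
    rw [h1, iota_trans, symm_swap, swap_apply_of_ne_of_ne (iota_ne π hh).symm (hg2 _ _ hl).1, ← hι,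
      Equiv.swap_apply_left]
  · simp only [pos, ← hp1]

/-- Exchanging half-edges of the same type shows that few vertices are not tree-like. -/
lemma sum_badCount_mul_le {T : Type*} (R L : ℕ) (t : HE n d → T) (s : Fin m × Bool → T)
    (hL : ∀ h, L ≤ cnt t (t h)) :
    (∑ π ∈ univ.filter (fun π : Conf d n m => t ∘ π = s), badCount R π°) * (L - d * #(ballL d R))
      ≤ #{π : Conf d n m | t ∘ π = s} * (n * (#(ballL d R) ^ 2 * d)) := by
  set Ω := univ.filter (fun π : Conf d n m => t ∘ π = s) with hΩ
  set B := ballL d R with hBdef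
  have hex : ∀ (π : Conf d n m) (v : Fin n), ∃ z : (List ℕ × List ℕ) × Fin d,
      ¬ TreeLike R π° v → z.1.1 ∈ B ∧ z.1.2 ∈ B ∧
      ∀ g : HE n d, g.1 ∉ B.image (pos π° v) → (π.trans (swap (pos π° v z.1.2, z.2) g))°
          (out (π.trans (swap (pos π° v z.1.2, z.2) g))° v z.1.1.tail z.1.1.headI) = g ∧
        pos (π.trans (swap (pos π° v z.1.2, z.2) g))° v z.1.2 = pos π° v z.1.2 := fun π v => by
    by_cases h : TreeLike R π° v
    · aesop
    · obtain ⟨j, l₀, l', a, h1, h2, h3⟩ := exists_switch π h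
      exact ⟨((j :: l₀, l'), a), fun _ => ⟨h1, h2, h3⟩⟩
  choose z hz using hex
  let g₀ : Conf d n m → Fin n → HE n d := fun π v => (pos π° v (z π v).1.2, (z π v).2)
  let G : Conf d n m → Fin n → Finset HE n d := fun π v =>
    univ.filter fun g => t g = t (g₀ π v) ∧ g.1 ∉ B.image (pos π° v)
  have hG : ∀ π v, L - d * #B ≤ #(G π v) := fun π v => by
    have h1 : (univ.filter fun g => t g = t (g₀ π v)) ⊆ G π v ∪ (B.image (pos π° v)) ×ˢ univ := by
      grind
    have h2 := (card_le_card h1).trans (card_union_le _ _)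
    rw [card_product, card_univ, card_fin] at h2
    have h3 : #(B.image (pos π° v)) ≤ #B := card_image_le
    have h4 := hL (g₀ π v)
    have h5 : #(B.image (pos π° v)) * d ≤ d * #B := by
      rw [mul_comm]; gcongr
    have h6 : cnt t (t (g₀ π v)) = #{g | t g = t (g₀ π v)} := by
      rfl
    omega
  let A : Finset ((Conf d n m) × Fin n × HE n d) := univ.filter fun x =>
    x.1 ∈ Ω ∧ ¬ TreeLike R x.1° x.2.1 ∧ x.2.2 ∈ G x.1 x.2.1
  have hA1 : (∑ π ∈ Ω, badCount R π°) * (L - d * #B) ≤ #A := by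
    let S : Finset (Σ _ : Conf d n m, Σ _ : Fin n, HE n d) := Ω.sigma fun π =>
      (univ.filter fun v => ¬ TreeLike R π° v).sigma fun v => G π v
    have h1 : #S ≤ #A := by
      refine card_le_card_of_injOn (fun x => (x.1, x.2.1, x.2.2)) ?_ ?_
      · rintro ⟨π, v, g⟩ hx
        grind
      · rintro ⟨π, v, g⟩ _ ⟨π', v', g'⟩ _ h
        grind
    refine le_trans ?_ h1
    rw [card_sigma, sum_mul]
    refine sum_le_sum fun π _ => ?_
    rw [card_sigma, badCount, ← smul_eq_mul, ← sum_const]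
    exact sum_le_sum fun v _ => hG π v
  refine hA1.trans ?_
  have hcard : #(Ω ×ˢ ((univ : Finset (Fin n)) ×ˢ ((B ×ˢ B) ×ˢ
      (univ : Finset (Fin d))))) = #Ω * (n * (#B ^ 2 * d)) := by
    simp only [card_product, card_univ, card_fin]
    ring
  rw [← hcard]
  refine card_le_card_of_injOn
    (fun x => (x.1.trans (swap (g₀ x.1 x.2.1) x.2.2), x.2.1, z x.1 x.2.1)) ?_ ?_
  · rintro ⟨π, v, g⟩ hx
    rw [mem_coe, mem_filter] at hx
    obtain ⟨-, h1, h2, h3⟩ := hx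
    have h4 := hz π v h2
    rw [mem_coe]
    refine mem_product.mpr ⟨?_, mem_product.mpr ⟨mem_univ _,
      mem_product.mpr ⟨mem_product.mpr ⟨h4.1, h4.2.1⟩, mem_univ _⟩⟩⟩
    rw [hΩ, mem_filter] at h1 ⊢
    refine ⟨mem_univ _, ?_⟩
    have h5 := (mem_filter.mp h3).2.1
    rw [← h1.2]
    funext x
    simp only [Function.comp, trans_apply]
    rw [Equiv.swap_apply_def]
    split_ifs with h6 h7
    · rw [h6]; exact h5
    · grind
    · rfl
  · rintro ⟨π, v, g⟩ hx ⟨π', v', g'⟩ hx' he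
    rw [mem_coe, mem_filter] at hx hx'
    simp only [Prod.mk.injEq] at he
    obtain ⟨he1, rfl, he2⟩ := he
    have h1 := (hz π v hx.2.2.1).2.2 g (mem_filter.mp hx.2.2.2).2.2
    have h2 := (hz π' v hx'.2.2.1).2.2 g' (mem_filter.mp hx'.2.2.2).2.2
    change (π.trans (swap (g₀ π v) g))° _ = _ ∧ pos (π.trans (swap (g₀ π v) g))° _ _ = _ at h1
    change (π'.trans (swap (g₀ π' v) g'))° _ = _ ∧ pos (π'.trans (swap (g₀ π' v) g'))° _ _ = _ at h2
    have hgg : g = g' := by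
      rw [← h1.1, ← h2.1]
      change (π.trans (swap (g₀ π v) g))° (out (π.trans (swap (g₀ π v) g))° _ _ _) = (π'.trans (swap (g₀ π' v) g'))° (out (π'.trans (swap (g₀ π' v) g'))° _ _ _)
      rw [he1, he2]
    have hg0 : g₀ π v = g₀ π' v := by
      refine Prod.ext ?_ (show (z π v).2 = (z π' v).2 by rw [he2])
      change pos π° v (z π v).1.2 = pos π'° v (z π' v).1.2
      rw [← h1.2, ← h2.2]
      rw [he1, he2]
    have hπ : π = π' := by
      rw [hgg, hg0] at he1
      have := congrArg (fun e : Conf d n m => e.trans (swap (g₀ π' v) g')) he1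
      simpa [Equiv.trans_assoc] using this
    rw [hπ, hgg]

lemma sum_badCount_le (R : ℕ) (hn : 2 * #(ballL d R) ≤ n) :
    ∑ π : Conf d n m, badCount R π° ≤ 2 * #(ballL d R) ^ 2 * card (Conf d n m) := by
  have hd : 0 < d := Nat.pos_of_ne_zero (NeZero.ne d)
  have hB := ballL_card_pos d R
  have h := sum_badCount_mul_le (n := n) (m := m) R (n * d) (fun _ : HE n d => ())
    (fun _ => ()) (fun h => by simp [cnt])
  simp only [Function.comp_def, Finset.filter_true, card_univ] at h
  set S := ∑ π : Conf d n m, badCount R π°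
  set C := card (Conf d n m)
  have h1 : n * d ≤ 2 * (n * d - d * #(ballL d R)) := by
    have : d * (2 * #(ballL d R)) ≤ d * n := Nat.mul_le_mul_left d hn
    have e1 : d * (2 * #(ballL d R)) = 2 * (d * #(ballL d R)) := by ring
    have e2 : d * n = n * d := by ring
    omega
  have h2 : S * (n * d) ≤ (2 * #(ballL d R) ^ 2 * C) * (n * d) := by
    calc S * (n * d) ≤ S * (2 * (n * d - d * #(ballL d R))) := by gcongr
      _ = 2 * (S * (n * d - d * #(ballL d R))) := by ring
      _ ≤ 2 * (C * (n * (#(ballL d R) ^ 2 * d))) := by gcongr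
      _ = _ := by ring
  exact Nat.le_of_mul_le_mul_right h2 (by
    have : 0 < n := by omega
    positivity)

lemma card_nbhd_touched_le (R : ℕ) (π : Conf d n m) (g g' : HE n d) :
    #(nbhd π° (touched π g g') R) ≤ (d + 1) ^ R * 4 :=
  (card_nbhd_le _ _ _).trans (Nat.mul_le_mul_left _ (card_touched_le π g g'))

lemma badCount_swap_le (R : ℕ) (π : Conf d n m) (g g' : HE n d) :
    badCount R π° ≤ badCount R (π.trans (swap g g'))° + (d + 1) ^ R * 4 := by
  refine le_trans ?_ (Nat.add_le_add_left (card_nbhd_touched_le R π g g') _)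
  refine le_trans (card_le_card ?_) (card_union_le _ _)
  intro v hv
  rw [mem_union]
  by_cases hm : v ∈ nbhd π° (touched π g g') R
  · exact Or.inr hm
  · left
    rw [mem_filter] at hv ⊢
    refine ⟨mem_univ _, fun h => hv.2 ?_⟩
    exact (treeLike_iff_of_notMem_nbhd (iota_involutive π) (iota_swap_touched π g g') hm).mpr h

lemma trans_swap_trans_swap (π : Conf d n m) (g g' : HE n d) :
    (π.trans (swap g g')).trans (swap g g') = π := by
  ext x <;> simp

lemma abs_badCount_swap_le (R : ℕ) (π : Conf d n m) (a b : Fin m × Bool) :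
    |(badCount R π° : ℝ) - badCount R ((swap a b).trans π)°|
      ≤ (d + 1) ^ R * 4 := by
  rw [swap_trans_eq]
  have h1 := badCount_swap_le R π (π a) (π b)
  have h2 := badCount_swap_le R (π.trans (swap (π a) (π b))) (π a) (π b)
  rw [trans_swap_trans_swap] at h2
  have h1' : (badCount R π° : ℝ) ≤ badCount R (π.trans (swap (π a) (π b)))°
    + (d + 1) ^ R * 4 := mod_cast h1
  have h2' : (badCount R (π.trans (swap (π a) (π b)))° : ℝ) ≤ badCount R π°
    + (d + 1) ^ R * 4 := mod_cast h2
  rw [abs_le]; constructor <;> linarith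

lemma SubG.conf (hm : 2 * m = n * d) (F : Conf d n m → ℝ) {c : ℝ}
    (hF : ∀ (π : Conf d n m) a b, |F π - F ((swap a b).trans π)| ≤ c) :
    SubG (2 * (n * d) * c ^ 2) F := by
  have hcard : card (Fin m × Bool) = card HE n d := by
    simp; omega
  have hs := SubG.equiv (α := Fin m × Bool) (β := HE n d) hcard F (c := c)
    (fun π a b => by convert hF π a b)
  have hcd : (card (Fin m × Bool) : ℝ) = n * d := by rw [hcard]; simp
  rw [hcd] at hs
  convert hs

end

lemma card_badCount_ge (d R : ℕ) [NeZero d] {η : ℝ} (hη : 0 < η) : ∃ c > 0, ∃ n₀ : ℕ,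
    ∀ n ≥ n₀, ∀ m : ℕ, 2 * m = n * d → (#{π : Conf d n m | η * n ≤ badCount R π°} : ℝ)
        ≤ card (Conf d n m) * exp (-(c * n)) := by
  have hd : (0:ℝ) < d := mod_cast Nat.pos_of_ne_zero (NeZero.ne d)
  set B : ℕ := #(ballL d R) with hB
  set c₀ : ℝ := (d + 1) ^ R * 4 with hc₀
  have hc₀pos : 0 < c₀ := by positivity
  refine ⟨η ^ 2 / (32 * d * c₀ ^ 2), by positivity,
    max (max (2 * B) 1) ⌈4 * (B:ℝ) ^ 2 / η⌉₊, fun n hn m hm => ?_⟩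
  have hn1 : 2 * B ≤ n := le_trans (le_trans (le_max_left _ _) (le_max_left _ _)) hn
  have hn2 : 1 ≤ n := le_trans (le_trans (le_max_right _ _) (le_max_left _ _)) hn
  have hn3 : 4 * (B:ℝ) ^ 2 / η ≤ n := Nat.ceil_le.mp (le_trans (le_max_right _ _) hn)
  have hn0 : (0:ℝ) < n := mod_cast hn2
  have hs := SubG.conf hm (fun π => (badCount R π° : ℝ)) (c := c₀)
    (fun π a b => abs_badCount_swap_le R π a b)
  have hsum : (∑ π : Conf d n m, (badCount R π° : ℝ)) ≤ 2 * (B:ℝ) ^ 2 * card (Conf d n m) := by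
    exact_mod_cast sum_badCount_le (m := m) R hn1
  have havg : avg (fun π : Conf d n m => (badCount R π° : ℝ)) ≤ 2 * (B:ℝ) ^ 2 := by
    unfold avg
    rcases (Nat.cast_nonneg (α := ℝ) (card (Conf d n m))).eq_or_lt with h0 | h0
    · rw [← h0, div_zero]; positivity
    · rw [div_le_iff₀ h0]
      exact hsum
  have hK : 0 < 2 * ((n:ℝ) * d) * c₀ ^ 2 := by positivity
  have ht := SubG.tail hs hK (t := η / 2 * n) (by positivity)
  have hle : 4 * (B:ℝ) ^ 2 ≤ η * n := by
    have := (div_le_iff₀ hη).mp hn3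
    linarith
  have hexp : -((η / 2 * n) ^ 2 / (4 * (2 * ((n:ℝ) * d) * c₀ ^ 2)))
      = -(η ^ 2 / (32 * d * c₀ ^ 2) * n) := by
    field_simp
    ring
  rw [hexp] at ht
  refine le_trans ?_ ht
  refine Nat.cast_le.mpr (card_le_card fun π hπ => ?_)
  rw [mem_filter] at hπ ⊢
  exact ⟨hπ.1, by linarith [hπ.2]⟩

section
variable {d n m : ℕ}

/-- The half-edges which are part of a loop or a multiple edge. -/
def badH (ι : HMap n d) : Finset HE n d :=
  univ.filter fun h => (ι h).1 = h.1 ∨ ∃ h', h' ≠ h ∧ h'.1 = h.1 ∧ (ι h').1 = (ι h).1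

lemma mem_badH {ι : HMap n d} {h : HE n d} : h ∈ badH ι ↔
    (ι h).1 = h.1 ∨ ∃ h', h' ≠ h ∧ h'.1 = h.1 ∧ (ι h').1 = (ι h).1 := by
  rw [badH, mem_filter]; simp

lemma not_treeLike_of_mem_badH [NeZero d] {ι : HMap n d} {h : HE n d}
    (hh : h ∈ badH ι) : ¬ TreeLike 1 ι h.1 := by
  have hex : ∀ k : HE n d, ∃ j, [j] ∈ ballL d 1 ∧ pos ι k.1 [j] = (ι k).1 ∧
      skipLab (none : Option (Fin d)) j = k.2 := fun k => by
    obtain ⟨j, hj, hs⟩ := exists_skipLab (d := d) (a := none) (b := k.2) (by simp)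
    refine ⟨j, mem_ballL.mpr ⟨validTd_singleton.mpr (by simpa [ValidStep] using hj), by simp⟩, ?_, hs⟩
    rw [pos_cons, out, pos_nil]
    simp [st, hs]
  intro ht
  obtain ⟨j, hj, hp, hs⟩ := hex h
  rcases mem_badH.mp hh with h1 | ⟨h', hne, hv, he⟩
  · have := ht (mem_coe.mpr hj) (mem_coe.mpr (nil_mem_ballL d 1)) (by rw [hp, pos_nil, h1])
    simp at this
  · obtain ⟨j', hj', hp', hs'⟩ := hex h'
    rw [hv] at hp'
    have := ht (mem_coe.mpr hj) (mem_coe.mpr hj') (by rw [hp, hp', he])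
    rw [List.cons.injEq] at this
    rw [this.1, hs'] at hs
    exact hne (Prod.ext hv hs)

lemma card_badH_le [NeZero d] (ι : HMap n d) : #(badH ι) ≤ badCount 1 ι * d := by
  have : badH ι ⊆ (univ.filter fun v => ¬ TreeLike 1 ι v) ×ˢ (univ : Finset (Fin d)) := fun h hh => by
    refine mem_product.mpr ⟨?_, mem_univ _⟩
    rw [mem_filter]
    exact ⟨mem_univ _, not_treeLike_of_mem_badH hh⟩
  refine (card_le_card this).trans ?_
  rw [card_product]
  simp [badCount]

set_option maxHeartbeats 1000000 in
lemma exists_swap_card_badH_lt [NeZero d] (π : Conf d n m) (hne : (badH π°).Nonempty)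
    (hn : 4 * (d + 1) * d + #(badH π°) < n * d) :
    ∃ a b, #(badH (π.trans (swap a b))°) < #(badH π°) := by
  obtain ⟨h, hh⟩ := hne
  set ι := π° with hιdef
  have hinv : Involutive ι := iota_involutive π
  set W := nbhd ι {h.1, (ι h).1} 1 with hW
  have hWc : #W ≤ 2 * (d + 1) := by
    refine (card_nbhd_le _ _ _).trans ?_
    have : #({h.1, (ι h).1} : Finset (Fin n)) ≤ 2 := Finset.card_le_two
    rw [pow_one]; nlinarith
  have h0W : ∀ x ∈ ({h.1, (ι h).1} : Finset (Fin n)), x ∈ W := fun x hx => nbhd_subset_succ ι _ 0 hx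
  have hvW : h.1 ∈ W := h0W _ (by simp)
  have hwW : (ι h).1 ∈ W := h0W _ (by simp)
  have hnW : ∀ k : HE n d, k.1 = h.1 ∨ k.1 = (ι h).1 → (ι k).1 ∈ W := fun k hk => mem_nbhd_succ (ι := ι) (B := {h.1, (ι h).1}) (k := 0) (u := k.1)
      (by simpa [nbhd] using hk) k.2
  obtain ⟨g, hg1, hg2, hg3⟩ : ∃ g : HE n d, g.1 ∉ W ∧ (ι g).1 ∉ W ∧ (ι g).1 ≠ g.1 := by
    by_contra hcon
    push Not at hcon
    have hsub : (univ : Finset HE n d) ⊆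
        (W ×ˢ univ) ∪ ((W ×ˢ univ).image ι ∪ badH ι) := fun g _ => by
      rw [mem_union, mem_union]
      by_cases h1 : g.1 ∈ W
      · exact Or.inl (mem_product.mpr ⟨h1, mem_univ _⟩)
      · by_cases h2 : (ι g).1 ∈ W
        · exact Or.inr (Or.inl (mem_image.mpr ⟨ι g, mem_product.mpr ⟨h2, mem_univ _⟩, hinv g⟩))
        · exact Or.inr (Or.inr (mem_badH.mpr (Or.inl (hcon g h1 h2))))
    have hc := card_le_card hsub
    have hc1 := card_union_le (W ×ˢ (univ : Finset (Fin d))) ((W ×ˢ univ).image ι ∪ badH ι)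
    have hc2 := card_union_le ((W ×ˢ (univ : Finset (Fin d))).image ι) (badH ι)
    have hc3 : #((W ×ˢ (univ : Finset (Fin d))).image ι) ≤ #W * d := card_image_le.trans (by simp)
    have hc4 : #(W ×ˢ (univ : Finset (Fin d))) = #W * d := by simp
    have hc5 : #W * d ≤ 2 * (d + 1) * d := Nat.mul_le_mul_right d hWc
    have hc6 : #(univ : Finset HE n d) = n * d := by simp
    have hc7 : 4 * (d + 1) * d = 2 * (2 * (d + 1) * d) := by ring
    omega
  set ι' := (π.trans (swap (ι h) g))° with hι'
  have hhg : h ≠ g := fun e => hg1 (e ▸ hvW)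
  have hhιg : h ≠ ι g := fun e => hg2 (e ▸ hvW)
  have hιhg : ι h ≠ g := fun e => hg1 (e ▸ hwW)
  have hne1 : h ≠ ι h := (iota_ne π h).symm
  have hne2 : g ≠ ι g := (iota_ne π g).symm
  have hιhιg : ι h ≠ ι g := fun e => hhg (hinv.injective e)
  have e1 : ι' h = g := by
    rw [hι', iota_trans, symm_swap, swap_apply_of_ne_of_ne hne1 hhg, ← hιdef, Equiv.swap_apply_left]
  have e2 : ι' (ι h) = ι g := by
    rw [hι', iota_trans, symm_swap, Equiv.swap_apply_left, ← hιdef,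
      swap_apply_of_ne_of_ne hιhιg.symm hne2.symm]
  have hinv' : Involutive ι' := iota_involutive _
  have e3 : ι' g = h := by rw [← e1, hinv']
  have e4 : ι' (ι g) = ι h := by rw [← e2, hinv']
  have e5 : ∀ k, k ≠ h → k ≠ ι h → k ≠ g → k ≠ ι g → ι' k = ι k := fun k h1 h2 h3 h4 => by
    refine iota_swap_of_notMem π _ _ _ h2 h3 ?_ h4
    change k ≠ ι (ι h)
    rwa [hinv]
  have hQ : ∀ k, (k = h ∨ k = ι h ∨ k = g ∨ k = ι g) → k ∉ badH ι' := fun k hk hbad => by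
    have hnv : ∀ h', (h' ≠ h ∧ h' ≠ ι h ∧ h' ≠ g ∧ h' ≠ ι g) → (h'.1 ∈ ({h.1, (ι h).1} : Set _) →
        (ι' h').1 ∈ W) ∧ ((ι' h').1 ∈ ({h.1, (ι h).1} : Set _) → h'.1 ∈ W) := by
      rintro h' ⟨k1, k2, k3, k4⟩
      rw [e5 h' k1 k2 k3 k4]
      refine ⟨fun hm => hnW h' hm, fun hm => ?_⟩
      have := hnW (ι h') hm
      rwa [hinv] at this
    simp only [Set.mem_insert_iff, Set.mem_singleton_iff] at hnv
    rcases mem_badH.mp hbad with h1 | ⟨h', h2, h3, h4⟩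
    · rcases hk with rfl | rfl | rfl | rfl
      · rw [e1] at h1; exact hg1 (h1 ▸ hvW)
      · rw [e2] at h1; exact hg2 (h1 ▸ hwW)
      · rw [e3] at h1; exact hg1 (h1 ▸ hvW)
      · rw [e4] at h1; exact hg2 (h1 ▸ hwW)
    · by_cases hq : h' ≠ h ∧ h' ≠ ι h ∧ h' ≠ g ∧ h' ≠ ι g
      · obtain ⟨q1, q2⟩ := hnv h' hq
        rcases hk with rfl | rfl | rfl | rfl
        · exact hg1 (by rw [← e1, ← h4]; exact q1 (Or.inl h3))
        · exact hg2 (by rw [← e2, ← h4]; exact q1 (Or.inr h3))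
        · exact hg1 (by rw [← h3]; exact q2 (Or.inl (by rw [h4, e3])))
        · exact hg2 (by rw [← h3]; exact q2 (Or.inr (by rw [h4, e4])))
      · have hq' : h' = h ∨ h' = ι h ∨ h' = g ∨ h' = ι g := by tauto
        clear_value ι ι' W
        clear hnv hbad hq hinv' hnW h0W e5 hWc hn hW
        have n1 : g.1 ≠ h.1 := fun e => hg1 (e ▸ hvW)
        have n2 : g.1 ≠ (ι h).1 := fun e => hg1 (e ▸ hwW)
        have n3 : (ι g).1 ≠ h.1 := fun e => hg2 (e ▸ hvW)
        have n4 : (ι g).1 ≠ (ι h).1 := fun e => hg2 (e ▸ hwW)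
        rcases hk with rfl | rfl | rfl | rfl <;> rcases hq' with rfl | rfl | rfl | rfl
        · exact h2 rfl
        · rw [e1, e2] at h4; exact hg3 h4
        · exact n1 h3
        · exact n3 h3
        · rw [e1, e2] at h4; exact hg3 h4.symm
        · exact h2 rfl
        · exact n2 h3
        · exact n4 h3
        · exact n1 h3.symm
        · exact n2 h3.symm
        · exact h2 rfl
        · exact hg3 h3
        · exact n3 h3.symm
        · exact n4 h3.symm
        · exact hg3 h3.symm
        · exact h2 rfl
  refine ⟨ι h, g, Finset.card_lt_card ?_⟩
  refine Finset.ssubset_iff_of_subset ?_ |>.mpr ⟨h, hh, hQ h (Or.inl rfl)⟩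
  intro k hk
  have hkQ : ¬ (k = h ∨ k = ι h ∨ k = g ∨ k = ι g) := fun h' => hQ k h' hk
  push Not at hkQ
  have ek := e5 k hkQ.1 hkQ.2.1 hkQ.2.2.1 hkQ.2.2.2
  rcases mem_badH.mp hk with h1 | ⟨h', h2, h3, h4⟩
  · exact mem_badH.mpr (Or.inl (by rw [← ek, h1]))
  · have hQ' : ¬ (h' = h ∨ h' = ι h ∨ h' = g ∨ h' = ι g) := fun hq =>
      hQ h' hq (mem_badH.mpr (Or.inr ⟨k, h2.symm, h3.symm, h4.symm⟩))
    push Not at hQ'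
    have eh := e5 h' hQ'.1 hQ'.2.1 hQ'.2.2.1 hQ'.2.2.2
    exact mem_badH.mpr (Or.inr ⟨h', h2, h3, by rw [← ek, ← eh, h4]⟩)

/-- The configurations without loops and multiple edges. -/
def simpleConf (d n m : ℕ) : Finset (Conf d n m) := univ.filter fun π => badH π° = ∅

lemma card_badH_le_pow [NeZero d] (K : ℕ) (hn : 4 * (d + 1) * d + K < n * d) :
    #{π : Conf d n m | (badH π°).card ≤ K} ≤ (1 + (n * d) ^ 2) ^ K * #(simpleConf d n m) := by
  induction K with
  | zero => simp [simpleConf]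
  | succ K ih =>
    have ih := ih (by omega)
    set S := univ.filter fun π : Conf d n m => #(badH π°) ≤ K
    have hsub : (univ.filter fun π : Conf d n m => #(badH π°) ≤ K + 1) ⊆
        S ∪ (S ×ˢ (univ : Finset (HE n d × HE n d))).image
          (fun x => x.1.trans (swap x.2.1 x.2.2)) := fun π hπ => by
      rw [mem_filter] at hπ
      rw [mem_union]
      by_cases h0 : (badH π°).Nonempty
      · right
        obtain ⟨a, b, hab⟩ := exists_swap_card_badH_lt π h0 (by omega)
        refine mem_image.mpr ⟨(π.trans (swap a b), (a, b)), mem_product.mpr ⟨?_, mem_univ _⟩, ?_⟩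
        · rw [mem_filter]; exact ⟨mem_univ _, Nat.le_of_lt_succ (lt_of_lt_of_le hab hπ.2)⟩
        · ext x <;> simp
      · left
        rw [Finset.not_nonempty_iff_eq_empty] at h0
        rw [mem_filter]; exact ⟨mem_univ _, by simp [h0]⟩
    have h1 := (card_le_card hsub).trans (card_union_le _ _)
    have h2 : #((S ×ˢ (univ : Finset (HE n d × HE n d))).image
          (fun x => x.1.trans (swap x.2.1 x.2.2))) ≤ #S * (n * d) ^ 2 := by
      refine card_image_le.trans (le_of_eq ?_)
      rw [card_product, card_univ]
      congr 1
      simp [sq]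
    calc _ ≤ #S + #S * (n * d) ^ 2 := h1.trans (Nat.add_le_add_left h2 _)
      _ = (1 + (n * d) ^ 2) * #S := by ring
      _ ≤ (1 + (n * d) ^ 2) * ((1 + (n * d) ^ 2) ^ K * #(simpleConf d n m)) := by gcongr
      _ = _ := by ring

lemma card_conf_le_simple (d : ℕ) [NeZero d] : ∃ K n₀ : ℕ, ∀ n ≥ n₀, ∀ m : ℕ,
    card (Conf d n m) ≤ 2 * (1 + (n * d) ^ 2) ^ K * #(simpleConf d n m) := by
  have hd : 0 < d := Nat.pos_of_ne_zero (NeZero.ne d)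
  set B := #(ballL d 1) with hB
  refine ⟨4 * d * B ^ 2, max (2 * B) (4 * (d + 1) + 4 * B ^ 2 * d + 1), fun n hn m => ?_⟩
  have hn1 : 2 * B ≤ n := le_trans (le_max_left _ _) hn
  have hn2 : 4 * (d + 1) + 4 * B ^ 2 * d + 1 ≤ n := le_trans (le_max_right _ _) hn
  have h1 := sum_badCount_le (n := n) (m := m) (d := d) 1 hn1
  rw [← hB] at h1
  have h2 := card_badH_le_pow (n := n) (m := m) (d := d) (4 * d * B ^ 2) (by
    have : (4 * (d + 1) + 4 * B ^ 2 * d + 1) * d ≤ n * d := Nat.mul_le_mul_right d hn2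
    have h3 : 4 * d * B ^ 2 ≤ 4 * B ^ 2 * d * d := by nlinarith [Nat.zero_le (B ^ 2 * d)]
    nlinarith)
  set K := 4 * d * B ^ 2 with hK
  set S := univ.filter fun π : Conf d n m => #(badH π°) ≤ K
  have h3 : #(univ \ S) * (K + 1) ≤ 2 * B ^ 2 * card (Conf d n m) * d := by
    calc #(univ \ S) * (K + 1) = ∑ π ∈ univ \ S, (K + 1) := by simp
      _ ≤ ∑ π ∈ univ \ S, badCount 1 π° * d := by
          refine sum_le_sum fun π hπ => ?_
          have : ¬ #(badH π°) ≤ K := fun h => (Finset.mem_sdiff.mp hπ).2 (by rw [mem_filter]; exact ⟨mem_univ _, h⟩)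
          have := card_badH_le π°
          omega
      _ ≤ ∑ π : Conf d n m, badCount 1 π° * d := Finset.sum_le_sum_of_subset (subset_univ _)
      _ = (∑ π : Conf d n m, badCount 1 π°) * d := by rw [sum_mul]
      _ ≤ _ := Nat.mul_le_mul_right d h1
  have h4 : #(univ \ S) + #S = card (Conf d n m) := by
    rw [Finset.card_sdiff_add_card_eq_card (subset_univ _), card_univ]
  have h5 : 2 * #(univ \ S) ≤ card (Conf d n m) := by
    have h6 : #(univ \ S) * (2 * (K + 1)) ≤ card (Conf d n m) * (K + 1) := by
      have e1 : 2 * (2 * B ^ 2 * card (Conf d n m) * d) = card (Conf d n m) * K := by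
        rw [hK]; ring
      have e2 : card (Conf d n m) * (K + 1) = card (Conf d n m) * K + card (Conf d n m) := by ring
      have e3 : #(univ \ S) * (2 * (K + 1)) = 2 * (#(univ \ S) * (K + 1)) := by
        ring
      omega
    have h7 : (2 * #(univ \ S)) * (K + 1) ≤ card (Conf d n m) * (K + 1) := by
      calc _ = #(univ \ S) * (2 * (K + 1)) := by ring
        _ ≤ _ := h6
    exact Nat.le_of_mul_le_mul_right h7 (by omega)
  have h8 : card (Conf d n m) ≤ 2 * #S := by omega
  refine h8.trans ?_
  rw [mul_assoc]
  exact Nat.mul_le_mul_left 2 h2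

end

section
variable {d n m : ℕ}

/-- The graph of an involution of the half-edges. -/
def gr (ι : HMap n d) : Gr n where
  Adj u w := u ≠ w ∧ ((∃ i, (ι (u, i)).1 = w) ∧ ∃ i, (ι (w, i)).1 = u)
  symm := ⟨fun _ _ h => ⟨h.1.symm, h.2.2, h.2.1⟩⟩
  loopless := ⟨fun _ h => h.1 rfl⟩

/-- An involution of the half-edges without loops and multiple edges. -/
structure Simple (ι : HMap n d) : Prop where
  invol : Involutive ι
  noloop : ∀ h, (ι h).1 ≠ h.1
  inj : ∀ h h', h.1 = h'.1 → (ι h).1 = (ι h').1 → h = h'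

lemma Simple.adj_iff {ι : HMap n d} (hι : Simple ι) (u w : Fin n) :
    (gr ι).Adj u w ↔ ∃ i, (ι (u, i)).1 = w := by
  constructor
  · exact fun h => h.2.1
  · rintro ⟨i, rfl⟩
    refine ⟨(hι.noloop (u, i)).symm, ⟨i, rfl⟩, (ι (u, i)).2, ?_⟩
    rw [Prod.mk.eta, hι.invol]

lemma Simple.adj {ι : HMap n d} (hι : Simple ι) (h : HE n d) :
    (gr ι).Adj h.1 (ι h).1 := (hι.adj_iff _ _).mpr ⟨h.2, rfl⟩

lemma simple_iota_of_badH {π : Conf d n m} (h : badH π° = ∅) : Simple π° where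
  invol := iota_involutive π
  noloop k hk := by
    have : k ∈ badH π° := mem_badH.mpr (Or.inl hk)
    simp [h] at this
  inj k k' h1 h2 := by
    by_contra hne
    have : k ∈ badH π° := mem_badH.mpr (Or.inr ⟨k', Ne.symm hne, h1.symm, h2.symm⟩)
    simp [h] at this

lemma mem_simpleConf {π : Conf d n m} : π ∈ simpleConf d n m ↔ Simple π° := by
  rw [simpleConf, mem_filter]
  refine ⟨fun h => simple_iota_of_badH h.2, fun h => ⟨mem_univ _, ?_⟩⟩
  rw [Finset.eq_empty_iff_forall_notMem]
  intro k hk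
  rcases mem_badH.mp hk with h1 | ⟨k', h1, h2, h3⟩
  · exact h.noloop k h1
  · exact h1 (h.inj _ _ h2 h3)

lemma Simple.neighborSet_eq {ι : HMap n d} (hι : Simple ι) (u : Fin n) :
    (gr ι).neighborSet u = Set.range fun i => (ι (u, i)).1 := by
  ext w
  rw [SimpleGraph.mem_neighborSet, hι.adj_iff]; rfl

lemma Simple.injective {ι : HMap n d} (hι : Simple ι) (u : Fin n) :
    Injective fun i => (ι (u, i)).1 := fun i j hij => by
  have := hι.inj (u, i) (u, j) rfl hij
  exact (Prod.mk.injEq _ _ _ _ ▸ this).2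

lemma Simple.mem_regularGraphs {ι : HMap n d} (hι : Simple ι) :
    gr ι ∈ regularGraphs d n := fun u => by
  rw [hι.neighborSet_eq, ← Set.image_univ, Set.ncard_image_of_injective _ (hι.injective u)]
  simp [Set.ncard_univ]

lemma Simple.exists_relabel {ι ι' : HMap n d} (hι : Simple ι)
    (hι' : Simple ι') (hg : gr ι = gr ι') : ∃ ρ : Perm HE n d,
      (∀ h, (ρ h).1 = h.1) ∧ ∀ h, ι' (ρ h) = ρ (ι h) := by
  have hex : ∀ h : HE n d, ∃ g : HE n d, g.1 = h.1 ∧ (ι' g).1 = (ι h).1 := fun h => by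
    have := hι.adj h
    rw [hg, hι'.adj_iff] at this
    obtain ⟨i, hi⟩ := this
    exact ⟨(h.1, i), rfl, hi⟩
  choose ρ h1 h2 using hex
  have hinj : Injective ρ := fun a b hab => by
    refine hι.inj a b ?_ ?_
    · rw [← h1 a, ← h1 b, hab]
    · rw [← h2 a, ← h2 b, hab]
  refine ⟨ofBijective ρ (Finite.injective_iff_bijective.mp hinj), h1, fun h => ?_⟩
  simp only [Equiv.ofBijective_apply]
  refine hι'.inj _ _ ?_ ?_
  · rw [h2, h1]
  · rw [hι'.invol, h1, h2, hι.invol]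

lemma gr_eq_of_relabel {ι ι' : HMap n d} (ρ : Perm HE n d)
    (h1 : ∀ h, (ρ h).1 = h.1) (h2 : ∀ h, ι' (ρ h) = ρ (ι h)) : gr ι' = gr ι := by
  have key : ∀ u w, (∃ i, (ι' (u, i)).1 = w) ↔ ∃ i, (ι (u, i)).1 = w := fun u w => by
    constructor
    · rintro ⟨i, rfl⟩
      obtain ⟨g, hg⟩ := ρ.surjective (u, i)
      refine ⟨g.2, ?_⟩
      have : g.1 = u := by rw [← h1 g, hg]
      rw [← hg, h2, h1, ← this]
    · rintro ⟨i, rfl⟩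
      refine ⟨(ρ (u, i)).2, ?_⟩
      have : (ρ (u, i)).1 = u := h1 _
      have e : (u, (ρ (u, i)).2) = ρ (u, i) := Prod.ext this.symm rfl
      rw [e, h2, h1]
  ext u w
  simp only [gr, key]

lemma simple_of_relabel {ι ι' : HMap n d} (hι : Simple ι) (ρ : Perm HE n d)
    (h1 : ∀ h, (ρ h).1 = h.1) (h2 : ∀ h, ι' (ρ h) = ρ (ι h)) : Simple ι' where
  invol h := by
    obtain ⟨g, rfl⟩ := ρ.surjective h
    rw [h2, h2, hι.invol]
  noloop h := by
    obtain ⟨g, rfl⟩ := ρ.surjective h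
    rw [h2, h1, h1]; exact hι.noloop g
  inj h h' e1 e2 := by
    obtain ⟨g, rfl⟩ := ρ.surjective h
    obtain ⟨g', rfl⟩ := ρ.surjective h'
    rw [h1, h1] at e1
    rw [h2, h2, h1, h1] at e2
    rw [hι.inj g g' e1 e2]

lemma exists_conf_iota_eq (hm : 2 * m = n * d) {ι : HMap n d}
    (hι : Involutive ι) (hne : ∀ h, ι h ≠ h) : ∃ π : Conf d n m, π° = ι := by
  have hcard : card (Fin m × Bool) = card HE n d := by
    simp; omega
  let e0 : Conf d n m := equivOfCardEq hcard
  have key : ∀ s : Perm HE n d, (∀ h, s (s h) = h) → (∀ h, s h ≠ h) →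
      s.cycleType = Multiset.replicate (card HE n d / 2) 2 := fun s h1 h2 => by
    have hmem : ∀ k ∈ s.cycleType, k = 2 := fun k hk => by
      have hdvd := Perm.dvd_of_mem_cycleType hk
      have hpow : s ^ 2 = 1 := by
        ext h <;> simp [sq, h1]
      have hd2 := hdvd.trans (orderOf_dvd_of_pow_eq_one hpow)
      have := Perm.two_le_of_mem_cycleType hk
      exact le_antisymm (Nat.le_of_dvd (by norm_num) hd2) this
    rw [Multiset.eq_replicate]
    refine ⟨?_, hmem⟩
    have hsum := Perm.sum_cycleType s
    have hsup : s.support = univ := by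
      ext h; simp [h2]
    rw [hsup, card_univ, Multiset.eq_replicate_of_mem hmem, Multiset.sum_replicate,
      smul_eq_mul] at hsum
    omega
  have hc : IsConj ((iota_involutive e0).toPerm) (hι.toPerm) := by
    rw [Perm.isConj_iff_cycleType_eq,
      key (iota_involutive e0).toPerm (fun h => iota_involutive e0 h) (fun h => iota_ne e0 h),
      key hι.toPerm (fun h => hι h) hne]
  obtain ⟨c, hc⟩ := isConj_iff.mp hc
  refine ⟨e0.trans c, ?_⟩
  funext h
  rw [iota_trans]
  have := congrArg (fun s => s h) hc
  simpa using this

lemma exists_conf_of_mem_regularGraphs (hm : 2 * m = n * d) {G : Gr n}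
    (hG : G ∈ regularGraphs d n) : ∃ π : Conf d n m, Simple π° ∧ gr π° = G := by
  have hE : ∀ u, Nonempty (Fin d ≃ ↥(G.neighborSet u)) := fun u => by
    have : Nat.card ↥(G.neighborSet u) = d := hG u
    exact ⟨(Fintype.equivFinOfCardEq (by rw [← Nat.card_eq_fintype_card, this])).symm⟩
  let e : ∀ u, Fin d ≃ ↥(G.neighborSet u) := fun u => Classical.choice (hE u)
  let ι : HMap n d := fun h =>
    ((e h.1 h.2 : Fin n), (e (e h.1 h.2 : Fin n)).symm ⟨h.1, G.adj_symm (e h.1 h.2).2⟩)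
  have hadj : ∀ h, G.Adj h.1 (ι h).1 := fun h => (e h.1 h.2).2
  have hback : ∀ h, (e (ι h).1 (ι h).2 : Fin n) = h.1 := by
    intro h; simp [ι]
  have hinj : ∀ h h' : HE n d, h.1 = h'.1 → (ι h).1 = (ι h').1 → h = h' := by
    rintro ⟨u, i⟩ ⟨u', i'⟩ h1 h2
    obtain rfl : u = u' := h1
    have : e u i = e u i' := Subtype.ext h2
    rw [(e u).injective this]
  have hinv : Involutive ι := fun h => hinj _ _ (hback h) (hback (ι h))
  have hs : Simple ι := ⟨hinv, fun h h1 => (hadj h).ne h1.symm, hinj⟩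
  obtain ⟨π, hπ⟩ := exists_conf_iota_eq hm hinv (fun h h1 => hs.noloop h (by rw [h1]))
  refine ⟨π, hπ ▸ hs, ?_⟩
  rw [hπ]
  ext u w
  rw [hs.adj_iff]
  constructor
  · rintro ⟨i, rfl⟩; exact hadj (u, i)
  · intro h
    exact ⟨(e u).symm ⟨w, h⟩, by simp [ι]⟩

lemma exists_card_fiber (hm : 2 * m = n * d) : ∃ K : ℕ, 0 < K ∧ ∀ G ∈ regularGraphs d n,
    #((simpleConf d n m).filter fun π => gr π° = G) = K := by
  let A := {ρ : Perm HE n d // ∀ h, (ρ h).1 = h.1}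
  let C := {c : Perm (Fin m × Bool) // ∀ x, c (flipB x) = flipB (c x)}
  refine ⟨card (A × C), card_pos_iff.mpr ⟨(⟨1, fun _ => rfl⟩, ⟨1, fun _ => rfl⟩)⟩, fun G hG => ?_⟩
  obtain ⟨π₀, hs, hgr⟩ := exists_conf_of_mem_regularGraphs hm hG
  have hio : ∀ (π : Conf d n m) x, π° (π x) = π (flipB x) := by
    intro π x; simp [iota]
  let F : A × C → Conf d n m := fun x => x.2.1.trans (π₀.trans x.1.1)
  have hF : ∀ x h, (F x)° (x.1.1 h) = x.1.1 (π₀° h) := by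
    rintro ⟨⟨ρ, h1⟩, ⟨c, h2⟩⟩ h
    obtain ⟨y, rfl⟩ := π₀.surjective h
    obtain ⟨z, rfl⟩ := c.surjective y
    rw [hio]
    have := hio (F (⟨ρ, h1⟩, ⟨c, h2⟩)) z
    simp only [F, trans_apply] at this ⊢
    rw [this, h2]
  rw [← card_univ]
  symm
  refine card_bij (fun x _ => F x) ?_ ?_ ?_
  · intro x _
    rw [mem_filter, mem_simpleConf]
    exact ⟨simple_of_relabel hs x.1.1 x.1.2 (hF x), (gr_eq_of_relabel x.1.1 x.1.2 (hF x)).trans hgr⟩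
  · rintro ⟨⟨ρ, h1⟩, ⟨c, h2⟩⟩ _ ⟨⟨ρ', h1'⟩, ⟨c', h2'⟩⟩ _ hxy
    have hρ : ρ = ρ' := by
      ext1 h
      have e1 := hF (⟨ρ, h1⟩, ⟨c, h2⟩)
      have e2 := hF (⟨ρ', h1'⟩, ⟨c', h2'⟩)
      simp only at e1 e2 hxy
      refine (simple_of_relabel hs ρ h1 e1).inj _ _ ?_ ?_
      · rw [h1, h1']
      · rw [e1, hxy, e2, h1, h1']
    subst hρ
    have hc : c = c' := by
      ext1 y
      have := congrArg (fun e => e y) hxy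
      simpa [F] using this
    subst hc
    rfl
  · intro π hπ
    rw [mem_filter, mem_simpleConf] at hπ
    obtain ⟨ρ, h1, h2⟩ := hs.exists_relabel hπ.1 (hgr.trans hπ.2.symm)
    refine ⟨(⟨ρ, h1⟩, ⟨π.trans (ρ.symm.trans π₀.symm), fun x => ?_⟩), mem_univ _, ?_⟩
    · simp only [trans_apply]
      rw [Equiv.symm_apply_eq, ← hio]
      change _ = π₀° (ρ.symm (π x))
      rw [Equiv.symm_apply_eq, ← h2, apply_symm_apply]
    · ext x <;> simp [F]

lemma PrG_eq (hm : 2 * m = n * d) (A : Set (Gr n)) :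
    PrG d n A = (#((simpleConf d n m).filter fun π => gr π° ∈ A) : ℝ) / #(simpleConf d n m) := by
  obtain ⟨K, hK, hfib⟩ := exists_card_fiber (d := d) hm
  have key : ∀ B : Set (Gr n), #((simpleConf d n m).filter fun π => gr π° ∈ B)
        = (regularGraphs d n ∩ B).ncard * K := fun B => by
    rw [Finset.card_eq_sum_card_fiberwise (f := fun π => gr π°)
      (t := (regularGraphs d n ∩ B).toFinset), Set.ncard_eq_toFinset_card', Finset.sum_const_nat]
    · intro G hG
      rw [Set.mem_toFinset] at hG
      rw [← hfib G hG.1, filter_filter]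
      congr 1
      refine Finset.filter_congr fun π _ => ⟨fun h => h.2, fun h => ⟨?_, h⟩⟩
      rw [h]; exact hG.2
    · intro π hπ
      have hπ := mem_coe.mp hπ
      rw [mem_filter, mem_simpleConf] at hπ
      exact mem_coe.mpr (Set.mem_toFinset.mpr ⟨hπ.1.mem_regularGraphs, hπ.2⟩)
  have h1 := key A
  have h2 := key Set.univ
  simp only [Set.mem_univ, Finset.filter_true, Set.inter_univ] at h2
  have hK' : (K:ℝ) ≠ 0 := mod_cast hK.ne'
  rw [PrG, h1, h2]
  push_cast
  rw [mul_div_mul_right _ _ hK']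

end

section
variable {d : ℕ}

/-- Cyclic rotation of the root labels `1, …, a + 1` moving the label `a + 1` to the front. -/
def rot (a : ℕ) : Perm ℕ where
  toFun k := if k = 0 then 0 else if k = 1 then a + 1 else if k ≤ a + 1 then k - 1 else k
  invFun k := if k = 0 then 0 else if k = a + 1 then 1 else if k ≤ a then k + 1 else k
  left_inv k := by grind
  right_inv k := by grind

lemma rot_def (a k : ℕ) : rot a k =
    if k = 0 then 0 else if k = 1 then a + 1 else if k ≤ a + 1 then k - 1 else k := rfl

lemma rot_symm_def (a k : ℕ) : (rot a).symm k =
    if k = 0 then 0 else if k = a + 1 then 1 else if k ≤ a then k + 1 else k := rfl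

/-- Apply a permutation to the root step of a label. -/
def rootMap (s : ℕ → ℕ) : List ℕ → List ℕ
  | [] => []
  | [j] => [s j]
  | i :: j :: l => i :: rootMap s (j :: l)

lemma rootMap_cons (s : ℕ → ℕ) (i : ℕ) {l : List ℕ} (hl : l ≠ []) :
    rootMap s (i :: l) = i :: rootMap s l := by
  cases l with
  | nil => exact absurd rfl hl
  | cons j l => rfl

lemma rootMap_length (s : ℕ → ℕ) (l : List ℕ) : (rootMap s l).length = l.length := by
  induction l with
  | nil => rfl
  | cons i l ih =>
    by_cases hl : l = []
    · subst hl; rfl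
    · rw [rootMap_cons s i hl]; simp [ih]

lemma rootMap_child (s : ℕ → ℕ) (i : ℕ) (l : List ℕ) : ∃ k, rootMap s (i :: l) = k :: rootMap s l := by
  by_cases hl : l = []
  · subst hl; exact ⟨s i, rfl⟩
  · exact ⟨i, rootMap_cons s i hl⟩

lemma rootMap_eq_nil (s : ℕ → ℕ) {l : List ℕ} : rootMap s l = [] ↔ l = [] := by
  rw [← List.length_eq_zero_iff, rootMap_length, List.length_eq_zero_iff]

lemma rootMap_rootMap {s t : ℕ → ℕ} (h : ∀ k, t (s k) = k) (l : List ℕ) :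
    rootMap t (rootMap s l) = l := by
  induction l with
  | nil => rfl
  | cons i l ih =>
    by_cases hl : l = []
    · subst hl; simp [rootMap, h]
    · rw [rootMap_cons s i hl, rootMap_cons t i (by rwa [Ne, rootMap_eq_nil]), ih]

lemma validTd_rootMap {s : ℕ → ℕ} (h : ∀ k, 1 ≤ k → k ≤ d → 1 ≤ s k ∧ s k ≤ d) {l : List ℕ}
    (hl : ValidTd d l) : ValidTd d (rootMap s l) := by
  induction l with
  | nil => exact validTd_nil d
  | cons i l ih =>
    cases l with
    | nil =>
      rw [validTd_singleton] at hl
      exact validTd_singleton.mpr (h i hl.1 hl.2)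
    | cons j l =>
      rw [validTd_cons_cons] at hl
      rw [rootMap_cons s i (by simp)]
      obtain ⟨k, hk⟩ := rootMap_child s j l
      have := ih hl.2
      rw [hk] at this ⊢
      rw [validTd_cons_cons]
      exact ⟨hl.1, this⟩

/-- Exchange the two sides of the edge `{o, 1}`. -/
def flipL : List ℕ → List ℕ
  | [] => [1]
  | [j] => if j = 1 then [] else [j - 1, 1]
  | i :: j :: l => if j = 1 ∧ l = [] then [i + 1] else i :: flipL (j :: l)

lemma flipL_flipL {l : List ℕ} (hl : ValidTd d l) : flipL (flipL l) = l := by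
  induction l with
  | nil => simp [flipL]
  | cons i l ih =>
    cases l with
    | nil =>
      rw [validTd_singleton] at hl
      by_cases h1 : i = 1
      · subst h1; simp [flipL]
      · simp only [flipL, h1, if_false, and_self, if_true]
        rw [show i - 1 + 1 = i by omega]
    | cons j l =>
      rw [validTd_cons_cons] at hl
      by_cases h : j = 1 ∧ l = []
      · obtain ⟨rfl, rfl⟩ := h
        simp only [flipL, and_self, if_true]
        rw [if_neg (by omega)]
        simp
      · rw [flipL, if_neg h]
        have ih := ih hl.2
        cases l with
        | nil =>
          have hj : j ≠ 1 := fun e => h ⟨e, rfl⟩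
          simp only [flipL, hj, if_false] at ih ⊢
          simpa [flipL] using ih
        | cons k l =>
          rw [flipL] at ih ⊢
          split_ifs at ih ⊢ with h2
          · obtain ⟨rfl, rfl⟩ := h2
            rw [validTd_cons_cons] at hl
            have : j + 1 ≠ 1 := by omega
            simp only [flipL, this, and_true, if_false, Nat.add_sub_cancel]
          · obtain ⟨x, y, hxy⟩ : ∃ x y, flipL (k :: l) = x :: y := by
              cases l with
              | nil =>
                have : k ≠ 1 := fun e => h2 ⟨e, rfl⟩
                simp [flipL, this]
              | cons a l => rw [flipL]; split_ifs <;> simp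
            rw [hxy] at ih ⊢
            rw [flipL, if_neg (by simp), ih]

lemma flipL_child {i : ℕ} {l : List ℕ} (h : ValidTd d (i :: l)) :
    (∃ k, flipL (i :: l) = k :: flipL l) ∨ ∃ k, flipL l = k :: flipL (i :: l) := by
  cases l with
  | nil =>
    by_cases h1 : i = 1
    · right; subst h1; exact ⟨1, rfl⟩
    · left; exact ⟨i - 1, by simp [flipL, h1]⟩
  | cons j l =>
    left
    by_cases h1 : j = 1 ∧ l = []
    · obtain ⟨rfl, rfl⟩ := h1
      exact ⟨i + 1, by simp [flipL]⟩
    · exact ⟨i, by rw [flipL, if_neg h1]⟩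

lemma flipL_getLast (l : List ℕ) (hl : ValidTd d l) :
    (flipL l).getLast? = some 1 ↔ l.getLast? ≠ some 1 := by
  induction l with
  | nil => simp [flipL]
  | cons i l ih =>
    cases l with
    | nil =>
      by_cases h1 : i = 1
      · subst h1; simp [flipL]
      · simp [flipL, h1]
    | cons j l =>
      rw [validTd_cons_cons] at hl
      by_cases h1 : j = 1 ∧ l = []
      · obtain ⟨rfl, rfl⟩ := h1
        simp [flipL]; omega
      · have ih := ih hl.2
        rw [flipL, if_neg h1, List.getLast?_cons_cons]
        obtain ⟨x, y, hxy⟩ : ∃ x y, flipL (j :: l) = x :: y := by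
          cases l with
          | nil =>
            have : j ≠ 1 := fun e => h1 ⟨e, rfl⟩
            simp [flipL, this]
          | cons a l => rw [flipL]; split_ifs <;> simp
        rw [hxy] at ih ⊢
        rw [List.getLast?_cons_cons]; exact ih

lemma flipL_length (l : List ℕ) : (l.getLast? = some 1 → (flipL l).length + 1 = l.length) ∧
    (l.getLast? ≠ some 1 → (flipL l).length = l.length + 1) := by
  induction l with
  | nil => simp [flipL]
  | cons i l ih =>
    cases l with
    | nil =>
      by_cases h1 : i = 1
      · subst h1; simp [flipL]
      · simp [flipL, h1]
    | cons j l =>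
      rw [List.getLast?_cons_cons]
      by_cases h1 : j = 1 ∧ l = []
      · obtain ⟨rfl, rfl⟩ := h1
        simp [flipL]
      · rw [flipL, if_neg h1]
        simp only [List.length_cons] at ih ⊢
        constructor
        · intro h; have := ih.1 h; omega
        · intro h; have := ih.2 h; omega

lemma validTd_flipL (hd : 2 ≤ d) {l : List ℕ} (hl : ValidTd d l) : ValidTd d (flipL l) := by
  induction l with
  | nil => exact validTd_singleton.mpr ⟨le_rfl, by omega⟩
  | cons i l ih =>
    cases l with
    | nil =>
      rw [validTd_singleton] at hl
      by_cases h1 : i = 1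
      · subst h1; simpa [flipL] using validTd_nil d
      · simp only [flipL, h1, if_false]
        rw [validTd_cons_cons, validTd_singleton]; omega
    | cons j l =>
      rw [validTd_cons_cons] at hl
      by_cases h1 : j = 1 ∧ l = []
      · obtain ⟨rfl, rfl⟩ := h1
        simp only [flipL, and_self, if_true]
        rw [validTd_singleton]; omega
      · rw [flipL, if_neg h1]
        have ih := ih hl.2
        obtain ⟨x, y, hxy⟩ : ∃ x y, flipL (j :: l) = x :: y := by
          cases l with
          | nil =>
            have : j ≠ 1 := fun e => h1 ⟨e, rfl⟩
            simp [flipL, this]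
          | cons a l => rw [flipL]; split_ifs <;> simp
        rw [hxy] at ih ⊢
        rw [validTd_cons_cons]; exact ⟨hl.1, ih⟩

lemma rot_mem {a : Fin d} (k : ℕ) (h1 : 1 ≤ k) (h2 : k ≤ d) : 1 ≤ rot a k ∧ rot a k ≤ d := by
  have := a.2
  rw [rot_def]; split_ifs <;> omega

lemma rot_symm_mem {a : Fin d} (k : ℕ) (h1 : 1 ≤ k) (h2 : k ≤ d) :
    1 ≤ (rot a).symm k ∧ (rot a).symm k ≤ d := by
  have := a.2
  rw [rot_symm_def]; split_ifs <;> omega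

/-- The automorphism of `T_d` rotating the root labels. -/
def tdRot (a : Fin d) : TdGraph d ≃g TdGraph d where
  toFun v := ⟨rootMap (rot a) v.1, validTd_rootMap rot_mem v.2⟩
  invFun v := ⟨rootMap (rot a).symm v.1, validTd_rootMap rot_symm_mem v.2⟩
  left_inv v := Subtype.ext (rootMap_rootMap (fun k => (rot a).symm_apply_apply k) v.1)
  right_inv v := Subtype.ext (rootMap_rootMap (fun k => (rot a).apply_symm_apply k) v.1)
  map_rel_iff' := by
    have key : ∀ (s t : ℕ → ℕ) (_ : ∀ k, t (s k) = k) (v w : List ℕ),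
        (∃ i, rootMap s w = i :: rootMap s v) ↔ ∃ i, w = i :: v := fun s t h v w => by
      constructor
      · rintro ⟨i, hi⟩
        have := congrArg (rootMap t) hi
        obtain ⟨k, hk⟩ := rootMap_child t i (rootMap s v)
        rw [hk, rootMap_rootMap h, rootMap_rootMap h] at this
        exact ⟨k, this⟩
      · rintro ⟨i, rfl⟩
        exact rootMap_child s i v
    intro v w
    have h := fun k => (rot a).symm_apply_apply k
    exact or_congr (key _ _ h v.1 w.1) (key _ _ h w.1 v.1)

/-- The automorphism of `T_d` exchanging the two sides of the edge `{o, 1}`. -/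
def tdFlip (hd : 2 ≤ d) : TdGraph d ≃g TdGraph d where
  toFun v := ⟨flipL v.1, validTd_flipL hd v.2⟩
  invFun v := ⟨flipL v.1, validTd_flipL hd v.2⟩
  left_inv v := Subtype.ext (flipL_flipL v.2)
  right_inv v := Subtype.ext (flipL_flipL v.2)
  map_rel_iff' := by
    have key : ∀ v w : TdVertex d, (TdGraph d).Adj v w →
        (TdGraph d).Adj ⟨flipL v.1, validTd_flipL hd v.2⟩ ⟨flipL w.1, validTd_flipL hd w.2⟩ := by
      rintro ⟨v, hv⟩ ⟨w, hw⟩ (⟨i, h⟩ | ⟨i, h⟩)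
      · simp only at h; subst h
        exact flipL_child hw
      · simp only at h; subst h
        exact (flipL_child hv).symm
    intro v w
    refine ⟨fun h => ?_, key v w⟩
    have h2 := key ⟨flipL v.1, validTd_flipL hd v.2⟩ ⟨flipL w.1, validTd_flipL hd w.2⟩ h
    have e : ∀ x : TdVertex d, (⟨flipL (flipL x.1), validTd_flipL hd (validTd_flipL hd x.2)⟩ :
        TdVertex d) = x := fun x => Subtype.ext (flipL_flipL x.2)
    rwa [e, e] at h2

/-- Restriction of an automorphism of a graph to an invariant induced subgraph. -/
def restrictIso {V : Type*} {G : SimpleGraph V} (φ : G ≃g G) (S : Set V)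
    (h : ∀ v, v ∈ S ↔ φ v ∈ S) : G.induce S ≃g G.induce S where
  toEquiv := φ.toEquiv.subtypeEquiv h
  map_rel_iff' := by
    intro v w
    exact φ.map_rel_iff'

/-- The automorphism of `S_R` rotating the root labels. -/
def srRot (R : ℕ) (a : Fin d) : SrAut d R := restrictIso (tdRot a) (SrSet d R) (fun v => by
    change v.1.length ≤ R ↔ (rootMap (rot a) v.1).length ≤ R
    rw [rootMap_length])

lemma mem_ErSet {R : ℕ} {v : TdVertex d} :
    v ∈ ErSet d R ↔ v.1.length + 1 ≤ R ∨ (v.1.getLast? = some 1 ∧ v.1.length ≤ R) := Iff.rfl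

/-- The automorphism of `E_R` exchanging the two sides. -/
def erFlip (hd : 2 ≤ d) (R : ℕ) : ErGraph d R ≃g ErGraph d R :=
  restrictIso (tdFlip hd) (ErSet d R) (fun v => by
    change _ ↔ (flipL v.1).length + 1 ≤ R ∨ ((flipL v.1).getLast? = some 1 ∧ (flipL v.1).length ≤ R)
    rw [mem_ErSet, flipL_getLast v.1 v.2]
    have := flipL_length v.1
    by_cases h : v.1.getLast? = some 1
    · have := this.1 h
      simp only [h, true_and, ne_eq, not_true_eq_false, false_and, or_false]; omega
    · have := this.2 h
      simp only [h, false_and, or_false, ne_eq, not_false_eq_true, true_and]; omega)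

lemma erFlip_coe (hd : 2 ≤ d) (R : ℕ) (u : ErSet d R) :
    ((erFlip hd R u : ErSet d R) : TdVertex d).1 = flipL u.1.1 := rfl

lemma depth_iso {V : Type*} {G : SimpleGraph V} (δ : V → ℕ) (D : ℕ) (hD : ∀ v, δ v ≤ D)
    (h1 : ∀ v u u', 1 ≤ δ v → G.Adj v u → G.Adj v u' → δ u ≤ δ v → δ u' ≤ δ v → u = u')
    (h2 : ∀ v, ∀ s ≤ D, δ v < s → ∃ u u', u ≠ u' ∧ G.Adj v u ∧ G.Adj v u' ∧ δ u ≤ s ∧ δ u' ≤ s)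
    (φ : G ≃g G) (v : V) : δ (φ v) = δ v := by
  have key : ∀ φ : G ≃g G, ∀ k s, s + k = D → ∀ v, δ v ≤ s → δ (φ v) ≤ s := fun φ k => by
    induction k with
    | zero => intro s hs v _; rw [← add_zero s, hs]; exact hD _
    | succ k ih =>
      intro s hs v hv
      obtain ⟨u, u', hne, ha, ha', hu, hu'⟩ := h2 v (s + 1) (by omega) (by omega)
      have ih := ih (s + 1) (by omega)
      by_contra hcon
      have hφ : δ (φ v) = s + 1 := le_antisymm (ih v (by omega)) (by omega)
      exact hne (φ.injective (h1 (φ v) (φ u) (φ u') (by omega) (φ.map_adj_iff.mpr ha)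
        (φ.map_adj_iff.mpr ha') (by rw [hφ]; exact ih u hu) (by rw [hφ]; exact ih u' hu')))
  have h3 : δ (φ v) ≤ δ v := key φ (D - δ v) (δ v) (by have := hD v; omega) v le_rfl
  have h4 := key φ.symm (D - δ (φ v)) (δ (φ v)) (by have := hD (φ v); omega) (φ v) le_rfl
  rw [RelIso.symm_apply_apply] at h4
  omega

lemma validTd_cons_one (hd : 2 ≤ d) {l : List ℕ} (hl : ValidTd d l) : ValidTd d (1 :: l) := by
  cases l with
  | nil => exact validTd_singleton.mpr ⟨le_rfl, by omega⟩
  | cons j l => exact validTd_cons_cons.mpr ⟨⟨le_rfl, by omega⟩, hl⟩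

lemma validTd_cons_two (hd : 3 ≤ d) {l : List ℕ} (hl : ValidTd d l) : ValidTd d (2 :: l) := by
  cases l with
  | nil => exact validTd_singleton.mpr ⟨by omega, by omega⟩
  | cons j l => exact validTd_cons_cons.mpr ⟨⟨by omega, by omega⟩, hl⟩

lemma srIso_length (hd : 3 ≤ d) {R : ℕ} (φ : SrAut d R) (u : SrSet d R) :
    ((φ u : SrSet d R) : TdVertex d).1.length = u.1.1.length := by
  refine depth_iso (fun u : SrSet d R => u.1.1.length) R (fun u => u.2) ?_ ?_ φ u
  · rintro ⟨⟨v, hv⟩, hv'⟩ ⟨⟨u, hu⟩, hu'⟩ ⟨⟨u', hw⟩, hw'⟩ h1 ha ha' hl hl'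
    simp only at h1 hl hl'
    rcases ha with ⟨i, h⟩ | ⟨i, h⟩ <;> simp only [Function.Embedding.subtype_apply] at h
    · rw [h] at hl; simp at hl
    rcases ha' with ⟨i', h'⟩ | ⟨i', h'⟩ <;> simp only [Function.Embedding.subtype_apply] at h'
    · rw [h'] at hl'; simp at hl'
    have : u = u' := by rw [h] at h'; exact (List.cons.inj h').2
    subst this; rfl
  · rintro ⟨⟨v, hv⟩, hv'⟩ s hs h
    simp only at h
    refine ⟨⟨⟨1 :: v, validTd_cons_one (by omega) hv⟩, ?_⟩,
      ⟨⟨2 :: v, validTd_cons_two hd hv⟩, ?_⟩, ?_, Or.inl ⟨1, rfl⟩, Or.inl ⟨2, rfl⟩, ?_, ?_⟩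
    · change (1 :: v).length ≤ R; simp; omega
    · change (2 :: v).length ≤ R; simp; omega
    · intro he
      have := congrArg (fun x : SrSet d R => x.1.1) he
      simp at this
    · simp; omega
    · simp; omega

/-- The distance from the edge `{o, 1}`. -/
def edgeDepth (l : List ℕ) : ℕ := if l.getLast? = some 1 then l.length - 1 else l.length

lemma edgeDepth_cons (i : ℕ) {l : List ℕ} (h : i :: l ≠ [1]) :
    edgeDepth (i :: l) = edgeDepth l + 1 := by
  unfold edgeDepth
  cases l with
  | nil => simp at h ⊢; exact h
  | cons j l =>
    rw [List.getLast?_cons_cons]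
    split_ifs <;> simp

lemma mem_ErSet_iff_edgeDepth {R : ℕ} {v : TdVertex d} : v ∈ ErSet d R ↔ edgeDepth v.1 + 1 ≤ R := by
  rw [mem_ErSet]
  unfold edgeDepth
  split_ifs with h
  · have : v.1 ≠ [] := by rintro e; rw [e] at h; simp at h
    have := List.length_pos_iff.mpr this
    simp only [h, true_and]; omega
  · simp [h]

lemma erIso_depth (hd : 3 ≤ d) {R : ℕ} (φ : ErGraph d R ≃g ErGraph d R) (u : ErSet d R) :
    edgeDepth ((φ u : ErSet d R) : TdVertex d).1 = edgeDepth u.1.1 := by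
  refine depth_iso (fun u : ErSet d R => edgeDepth u.1.1) (R - 1)
    (fun u => by have := mem_ErSet_iff_edgeDepth.mp u.2; change edgeDepth u.1.1 ≤ R - 1; omega) ?_ ?_ φ u
  · rintro ⟨⟨v, hv⟩, hv'⟩ ⟨⟨u, hu⟩, hu'⟩ ⟨⟨u', hw⟩, hw'⟩ h1 ha ha' hl hl'
    simp only at h1 hl hl'
    have hv0 : v ≠ [] := by rintro rfl; simp [edgeDepth] at h1
    have key : ∀ (x : List ℕ) (i : ℕ), x = i :: v → edgeDepth x ≤ edgeDepth v → False := by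
      rintro x i rfl h
      rw [edgeDepth_cons i (by simp [hv0])] at h; omega
    rcases ha with ⟨i, h⟩ | ⟨i, h⟩ <;> simp only [Function.Embedding.subtype_apply] at h
    · exact (key _ _ h hl).elim
    rcases ha' with ⟨i', h'⟩ | ⟨i', h'⟩ <;> simp only [Function.Embedding.subtype_apply] at h'
    · exact (key _ _ h' hl').elim
    have : u = u' := by rw [h] at h'; exact (List.cons.inj h').2
    subst this; rfl
  · rintro ⟨⟨v, hv⟩, hv'⟩ s hs h
    simp only at h
    by_cases hv0 : v = []
    · subst hv0
      have h2 : edgeDepth [2] = 1 := by simp [edgeDepth]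
      have h1 : edgeDepth [1] = 0 := by simp [edgeDepth]
      refine ⟨⟨⟨[1], validTd_cons_one (by omega) hv⟩, ?_⟩,
        ⟨⟨[2], validTd_cons_two hd hv⟩, ?_⟩, ?_, Or.inl ⟨1, rfl⟩, Or.inl ⟨2, rfl⟩, ?_, ?_⟩
      · exact mem_ErSet_iff_edgeDepth.mpr (show edgeDepth [1] + 1 ≤ R by omega)
      · exact mem_ErSet_iff_edgeDepth.mpr (show edgeDepth [2] + 1 ≤ R by omega)
      · intro he
        have := congrArg (fun x : ErSet d R => x.1.1) he
        simp at this
      · simp only [h1]; omega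
      · simp only [h2]; omega
    · have hc : ∀ i, edgeDepth (i :: v) = edgeDepth v + 1 := fun i =>
        edgeDepth_cons i (by simp [hv0])
      refine ⟨⟨⟨1 :: v, validTd_cons_one (by omega) hv⟩, ?_⟩,
        ⟨⟨2 :: v, validTd_cons_two hd hv⟩, ?_⟩, ?_, Or.inl ⟨1, rfl⟩, Or.inl ⟨2, rfl⟩, ?_, ?_⟩
      · exact mem_ErSet_iff_edgeDepth.mpr (show edgeDepth (1 :: v) + 1 ≤ R by rw [hc]; omega)
      · exact mem_ErSet_iff_edgeDepth.mpr (show edgeDepth (2 :: v) + 1 ≤ R by rw [hc]; omega)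
      · intro he
        have := congrArg (fun x : ErSet d R => x.1.1) he
        simp at this
      · simp only [hc]; omega
      · simp only [hc]; omega

/-- Extension to all labels of a map `f` of the labels satisfying `P`. -/
def exL (P : List ℕ → Prop) (f : List ℕ → List ℕ) : List ℕ → List ℕ
  | [] => []
  | i :: l => if P (i :: l) then f (i :: l) else i :: exL P f l

lemma child_of_adj {P : List ℕ → Prop} (hP : ∀ i l, P (i :: l) → P l) {f : List ℕ → List ℕ}
    (hinj : ∀ l l', P l → P l' → f l = f l' → l = l') (hf0 : f [] = [])
    (hadj : ∀ i l, P (i :: l) → (∃ k, f (i :: l) = k :: f l) ∨ ∃ k, f l = k :: f (i :: l)) :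
    ∀ l i, P (i :: l) → ∃ k, f (i :: l) = k :: f l := fun l => by
  induction l with
  | nil =>
    intro i h
    rcases hadj i [] h with h1 | ⟨k, h1⟩
    · exact h1
    · rw [hf0] at h1; simp at h1
  | cons j l ih =>
    intro i h
    rcases hadj i (j :: l) h with h1 | ⟨k, h1⟩
    · exact h1
    · obtain ⟨k', hk'⟩ := ih j (hP _ _ h)
      rw [hk'] at h1
      have := hinj _ _ h (hP _ _ (hP _ _ h)) (List.cons.inj h1).2.symm
      have := congrArg List.length this
      simp at this
      omega

/-- A partial rooted automorphism of `T_d`, defined on the hereditary set `P`. -/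
structure PartialAut (d : ℕ) (P : List ℕ → Prop) (f : List ℕ → List ℕ) : Prop where
  root : f [] = []
  mapsTo : ∀ l, P l → P (f l)
  child : ∀ l i, P (i :: l) → ∃ k, f (i :: l) = k :: f l
  mem_of_mem : ∀ l i, ValidTd d (i :: l) → P (i :: exL P f l) → P (i :: l)

lemma validTd_cons_of_nil_iff {i : ℕ} {l l' : List ℕ} (h : ValidTd d (i :: l))
    (hl' : ValidTd d l') (he : l = [] ↔ l' = []) : ValidTd d (i :: l') := by
  cases l' with
  | nil =>
    have : l = [] := he.mpr rfl
    subst this; exact h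
  | cons k l' =>
    cases l with
    | nil => simp at he
    | cons j l =>
      rw [validTd_cons_cons] at h ⊢
      exact ⟨h.1, hl'⟩

variable {P : List ℕ → Prop} {f g : List ℕ → List ℕ}

lemma PartialAut.exL_of_mem (hf : PartialAut d P f) {l : List ℕ} (h : P l) : exL P f l = f l := by
  cases l with
  | nil => exact hf.root.symm
  | cons i l => simp [exL, h]

lemma PartialAut.exL_child (hP : ∀ i l, P (i :: l) → P l) (hf : PartialAut d P f) (i : ℕ)
    (l : List ℕ) : ∃ k, exL P f (i :: l) = k :: exL P f l := by
  by_cases h : P (i :: l)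
  · rw [hf.exL_of_mem h, hf.exL_of_mem (hP _ _ h)]
    exact hf.child l i h
  · exact ⟨i, by simp [exL, h]⟩

lemma PartialAut.exL_length (hP : ∀ i l, P (i :: l) → P l) (hf : PartialAut d P f)
    (l : List ℕ) : (exL P f l).length = l.length := by
  induction l with
  | nil => rfl
  | cons i l ih =>
    obtain ⟨k, hk⟩ := hf.exL_child hP i l
    rw [hk]; simp [ih]

lemma PartialAut.validTd_exL (hP : ∀ i l, P (i :: l) → P l) (hV : ∀ l, P l → ValidTd d l)
    (hf : PartialAut d P f) {l : List ℕ} (hl : ValidTd d l) : ValidTd d (exL P f l) := by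
  induction l with
  | nil => exact hl
  | cons i l ih =>
    by_cases h : P (i :: l)
    · rw [hf.exL_of_mem h]; exact hV _ (hf.mapsTo _ h)
    · simp only [exL, h, if_false]
      refine validTd_cons_of_nil_iff hl (ih hl.tail) ?_
      rw [← List.length_eq_zero_iff, ← List.length_eq_zero_iff, hf.exL_length hP]

lemma PartialAut.exL_exL (hf : PartialAut d P f)
    (hg : PartialAut d P g) (hgf : ∀ l, P l → g (f l) = l) {l : List ℕ} (hl : ValidTd d l) :
    exL P g (exL P f l) = l := by
  induction l with
  | nil => rfl
  | cons i l ih =>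
    by_cases h : P (i :: l)
    · rw [hf.exL_of_mem h, hg.exL_of_mem (hf.mapsTo _ h), hgf _ h]
    · have h2 : ¬ P (i :: exL P f l) := fun h3 => h (hf.mem_of_mem l i hl h3)
      simp only [exL, h, h2, if_false]
      rw [ih hl.tail]

lemma PartialAut.exists_extension (hP : ∀ i l, P (i :: l) → P l) (hV : ∀ l, P l → ValidTd d l)
    (hf : PartialAut d P f) (hg : PartialAut d P g) (hgf : ∀ l, P l → g (f l) = l)
    (hfg : ∀ l, P l → f (g l) = l) :
    ∃ Φ : TdGraph d ≃g TdGraph d, (∀ v, (Φ v).1.length = v.1.length) ∧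
      ∀ v : TdVertex d, P v.1 → (Φ v).1 = f v.1 := by
  have key : ∀ {f g : List ℕ → List ℕ}, PartialAut d P f → PartialAut d P g →
      (∀ l, P l → g (f l) = l) → ∀ v w : TdVertex d,
      (∃ i, exL P f w.1 = i :: exL P f v.1) ↔ ∃ i, w.1 = i :: v.1 := by
    intro f g hf hg hgf v w
    constructor
    · rintro ⟨i, hi⟩
      have := congrArg (exL P g) hi
      obtain ⟨k, hk⟩ := hg.exL_child hP i (exL P f v.1)
      rw [hk, hf.exL_exL hg hgf v.2, hf.exL_exL hg hgf w.2] at this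
      exact ⟨k, this⟩
    · rintro ⟨i, hi⟩
      rw [hi]; exact hf.exL_child hP i v.1
  refine ⟨⟨⟨fun v => ⟨exL P f v.1, hf.validTd_exL hP hV v.2⟩,
    fun v => ⟨exL P g v.1, hg.validTd_exL hP hV v.2⟩,
    fun v => Subtype.ext (hf.exL_exL hg hgf v.2),
    fun v => Subtype.ext (hg.exL_exL hf hfg v.2)⟩, ?_⟩, ?_, ?_⟩
  · intro v w
    exact or_congr (key hf hg hgf v w) (key hf hg hgf w v)
  · intro v; exact hf.exL_length hP v.1
  · intro v hv; exact hf.exL_of_mem hv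

/-- A partial self map of an induced subgraph of `T_d`, as a map of labels. -/
def toL {S : Set (TdVertex d)} (φ : S → S) (l : List ℕ) : List ℕ :=
  if h : ∃ hv : ValidTd d l, (⟨l, hv⟩ : TdVertex d) ∈ S then ((φ ⟨⟨l, h.1⟩, h.2⟩ : S) : TdVertex d).1
  else l

def MemL (S : Set (TdVertex d)) (l : List ℕ) : Prop :=
  ∃ hv : ValidTd d l, (⟨l, hv⟩ : TdVertex d) ∈ S

lemma toL_eq {S : Set (TdVertex d)} (φ : S → S) (u : S) : toL φ u.1.1 = (φ u).1.1 := by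
  unfold toL
  rw [dif_pos ⟨u.1.2, u.2⟩]
  rfl

lemma memL_coe {S : Set (TdVertex d)} (u : S) : MemL S u.1.1 := ⟨u.1.2, u.2⟩

lemma partialAut_toL {S : Set (TdVertex d)} (hP : ∀ i l, MemL S (i :: l) → MemL S l)
    (φ : (TdGraph d).induce S ≃g (TdGraph d).induce S) (h0 : toL φ [] = [])
    (hmem : (∀ l, MemL S l → (toL φ l).length = l.length) →
      (∀ l i, MemL S (i :: l) → ∃ k, toL φ (i :: l) = k :: toL φ l) →
      ∀ l i, ValidTd d (i :: l) → MemL S (i :: exL (MemL S) (toL φ) l) → MemL S (i :: l)) :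
    PartialAut d (MemL S) (toL φ) := by
  have hm : ∀ l, MemL S l → MemL S (toL φ l) := by
    rintro l ⟨hv, hl⟩
    have := toL_eq φ ⟨⟨l, hv⟩, hl⟩
    change toL φ l = _ at this
    rw [this]; exact memL_coe _
  have hinj : ∀ l l', MemL S l → MemL S l' → toL φ l = toL φ l' → l = l' := by
    rintro l l' ⟨hv, hl⟩ ⟨hv', hl'⟩ h
    have e := toL_eq φ ⟨⟨l, hv⟩, hl⟩
    have e' := toL_eq φ ⟨⟨l', hv'⟩, hl'⟩
    change toL φ l = _ at e
    change toL φ l' = _ at e'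
    rw [e, e'] at h
    have h2 : φ ⟨⟨l, hv⟩, hl⟩ = φ ⟨⟨l', hv'⟩, hl'⟩ := Subtype.ext (Subtype.ext h)
    exact congrArg (fun u : S => u.1.1) (φ.injective h2)
  have hc : ∀ l i, MemL S (i :: l) → ∃ k, toL φ (i :: l) = k :: toL φ l := by
    refine child_of_adj hP hinj h0 ?_
    intro i l h
    obtain ⟨hv, hl⟩ := h
    obtain ⟨hv', hl'⟩ := hP i l ⟨hv, hl⟩
    have e := toL_eq φ ⟨⟨i :: l, hv⟩, hl⟩
    have e' := toL_eq φ ⟨⟨l, hv'⟩, hl'⟩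
    change toL φ (i :: l) = _ at e
    change toL φ l = _ at e'
    rw [e, e']
    have ha : ((TdGraph d).induce S).Adj (⟨⟨l, hv'⟩, hl'⟩ : S) (⟨⟨i :: l, hv⟩, hl⟩ : S) :=
      Or.inl ⟨i, rfl⟩
    exact φ.map_adj_iff.mpr ha
  have hlen : ∀ l, MemL S l → (toL φ l).length = l.length := fun l => by
    induction l with
    | nil => intro _; rw [h0]
    | cons i l ih =>
      intro h
      obtain ⟨k, hk⟩ := hc l i h
      rw [hk]; simp [ih (hP _ _ h)]
  exact ⟨h0, hm, hc, hmem hlen hc⟩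

lemma toL_toL {S : Set (TdVertex d)} (φ ψ : S → S) (h : ∀ u, ψ (φ u) = u) (l : List ℕ)
    (hl : MemL S l) : toL ψ (toL φ l) = l := by
  obtain ⟨hv, hl⟩ := hl
  have e := toL_eq φ ⟨⟨l, hv⟩, hl⟩
  change toL φ l = _ at e
  rw [e, toL_eq, h]

lemma exists_extension_sr (hd : 3 ≤ d) {R : ℕ} (φ : SrAut d R) :
    ∃ Φ : TdGraph d ≃g TdGraph d, ∀ u : SrSet d R, Φ u.1 = (φ u).1 := by
  have hmemL : ∀ l, MemL (SrSet d R) l ↔ ValidTd d l ∧ l.length ≤ R := fun l => ⟨fun ⟨h1, h2⟩ => ⟨h1, h2⟩, fun ⟨h1, h2⟩ => ⟨h1, h2⟩⟩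
  have hP : ∀ i l, MemL (SrSet d R) (i :: l) → MemL (SrSet d R) l := fun i l h => by
    rw [hmemL] at h ⊢
    exact ⟨h.1.tail, by have := h.2; simp at this; omega⟩
  have h0 : ∀ φ : SrAut d R, toL φ [] = [] := fun φ => by
    have := toL_eq φ ⟨⟨[], validTd_nil d⟩, Nat.zero_le R⟩
    change toL φ [] = _ at this
    rw [this]
    have := srIso_length hd φ ⟨⟨[], validTd_nil d⟩, Nat.zero_le R⟩
    exact List.length_eq_zero_iff.mp this
  have hm : ∀ φ : SrAut d R, (∀ l, MemL (SrSet d R) l → (toL φ l).length = l.length) →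
      (∀ l i, MemL (SrSet d R) (i :: l) → ∃ k, toL φ (i :: l) = k :: toL φ l) →
      ∀ l i, ValidTd d (i :: l) → MemL (SrSet d R) (i :: exL (MemL (SrSet d R)) (toL φ) l) →
      MemL (SrSet d R) (i :: l) := fun φ h1 h2 l i hv h => by
    have hlen : ∀ l, (exL (MemL (SrSet d R)) (toL φ) l).length = l.length := fun l => by
      induction l with
      | nil => rfl
      | cons i l ih =>
        rw [exL]
        split_ifs with h
        · rw [h1 _ h]
        · simp [ih]
    rw [hmemL] at h ⊢
    refine ⟨hv, ?_⟩
    have := h.2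
    rw [List.length_cons, hlen] at this
    exact this
  obtain ⟨Φ, -, h⟩ := PartialAut.exists_extension hP (fun l h => h.1)
    (partialAut_toL hP φ (h0 φ) (hm φ)) (partialAut_toL hP φ.symm (h0 φ.symm) (hm φ.symm))
    (toL_toL _ _ φ.symm_apply_apply) (toL_toL _ _ φ.apply_symm_apply)
  refine ⟨Φ, fun u => Subtype.ext ?_⟩
  rw [h u.1 (memL_coe u), toL_eq]
  rfl

/-- Every automorphism of `E_R` fixing `o` and `1` is the restriction of an automorphism of `S_R`. -/
lemma exists_extension_er {R : ℕ} (hR : 1 ≤ R) (φ : ErGraph d R ≃g ErGraph d R)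
    (h0 : toL φ [] = []) (h1 : toL φ [1] = [1]) (hd : 1 ≤ d) :
    ∃ Φ : SrAut d R, ∀ u : ErSet d R, (Φ ⟨u.1, ErSet_subset_SrSet d R u.2⟩).1 = (φ u).1 := by
  have hmemL : ∀ l, MemL (ErSet d R) l ↔
      ValidTd d l ∧ (l.length + 1 ≤ R ∨ (l.getLast? = some 1 ∧ l.length ≤ R)) := fun l => ⟨fun ⟨h1, h2⟩ => ⟨h1, h2⟩, fun ⟨h1, h2⟩ => ⟨h1, h2⟩⟩
  have hn : MemL (ErSet d R) [] := (hmemL _).mpr ⟨validTd_nil d, Or.inl (by simpa using hR)⟩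
  have hP : ∀ i l, MemL (ErSet d R) (i :: l) → MemL (ErSet d R) l := fun i l h => by
    cases l with
    | nil => exact hn
    | cons j l =>
      rw [hmemL] at h ⊢
      refine ⟨h.1.tail, ?_⟩
      have := h.2
      rw [List.getLast?_cons_cons] at this
      simp only [List.length_cons] at this ⊢
      omega
  have hL1 : MemL (ErSet d R) [1] :=
    (hmemL _).mpr ⟨validTd_singleton.mpr ⟨le_rfl, hd⟩, Or.inr ⟨rfl, by simpa using hR⟩⟩
  have h0' : toL φ.symm [] = [] := by
    have := toL_toL _ _ φ.symm_apply_apply [] hn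
    rwa [h0] at this
  have h1' : toL φ.symm [1] = [1] := by
    have := toL_toL _ _ φ.symm_apply_apply [1] hL1
    rwa [h1] at this
  have hm : ∀ φ : ErGraph d R ≃g ErGraph d R, toL φ [] = [] → toL φ.symm [1] = [1] →
      (∀ l, MemL (ErSet d R) l → (toL φ l).length = l.length) →
      (∀ l i, MemL (ErSet d R) (i :: l) → ∃ k, toL φ (i :: l) = k :: toL φ l) →
      ∀ l i, ValidTd d (i :: l) → MemL (ErSet d R) (i :: exL (MemL (ErSet d R)) (toL φ) l) →
      MemL (ErSet d R) (i :: l) := fun φ h0 h1 hlen hc l i hv h => by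
    have key : ∀ l, (exL (MemL (ErSet d R)) (toL φ) l).length = l.length ∧
        ((exL (MemL (ErSet d R)) (toL φ) l).getLast? = some 1 → l.getLast? = some 1) := fun l => by
      induction l with
      | nil => simp [exL]
      | cons i l ih =>
        obtain ⟨k, hk⟩ : ∃ k, exL (MemL (ErSet d R)) (toL φ) (i :: l) =
            k :: exL (MemL (ErSet d R)) (toL φ) l := by
          rw [exL]
          split_ifs with h
          · obtain ⟨k, hk⟩ := hc l i h
            refine ⟨k, ?_⟩
            rw [hk]
            congr 1
            cases l with
            | nil => exact h0
            | cons j l => rw [exL, if_pos (hP _ _ h)]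
          · exact ⟨i, rfl⟩
        rw [hk]
        refine ⟨by simp [ih.1], fun hl => ?_⟩
        cases l with
        | nil =>
          by_cases h : MemL (ErSet d R) [i]
          · have hk : toL φ [i] = [k] := (if_pos h).symm.trans hk
            simp only [exL, List.getLast?_singleton, Option.some.injEq] at hl hk
            subst hl
            have := toL_toL _ _ φ.symm_apply_apply [i] h
            rw [hk, h1] at this
            rw [← this]; rfl
          · have hk : [i] = [k] := (if_neg h).symm.trans hk
            rw [hk]
            exact hl
        | cons j l =>
          rw [List.getLast?_cons_cons]
          apply ih.2
          obtain ⟨x, y, hxy⟩ : ∃ x y, exL (MemL (ErSet d R)) (toL φ) (j :: l) = x :: y := by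
            rcases h : exL (MemL (ErSet d R)) (toL φ) (j :: l) with _ | ⟨x, y⟩
            · have := ih.1; rw [h] at this; simp at this
            · exact ⟨x, y, rfl⟩
          rw [hxy] at hl ⊢
          rwa [List.getLast?_cons_cons] at hl
    rw [hmemL] at h ⊢
    refine ⟨hv, ?_⟩
    rcases h.2 with h | ⟨h, h'⟩
    · rw [List.length_cons, (key l).1] at h; exact Or.inl h
    · rw [List.length_cons, (key l).1] at h'
      refine Or.inr ⟨?_, h'⟩
      cases l with
      | nil => exact h
      | cons j l =>
        obtain ⟨x, y, hxy⟩ : ∃ x y, exL (MemL (ErSet d R)) (toL φ) (j :: l) = x :: y := by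
          rcases h : exL (MemL (ErSet d R)) (toL φ) (j :: l) with _ | ⟨x, y⟩
          · have := (key (j :: l)).1; rw [h] at this; simp at this
          · exact ⟨x, y, rfl⟩
        rw [List.getLast?_cons_cons]
        apply (key (j :: l)).2
        rw [hxy] at h ⊢
        rwa [List.getLast?_cons_cons] at h
  obtain ⟨Φ, hlen, h⟩ := PartialAut.exists_extension hP (fun l h => h.1)
    (partialAut_toL hP φ h0 (hm φ h0 h1')) (partialAut_toL hP φ.symm h0' (hm φ.symm h0' h1))
    (toL_toL _ _ φ.symm_apply_apply) (toL_toL _ _ φ.apply_symm_apply)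
  refine ⟨restrictIso Φ (SrSet d R) (fun v => ?_), fun u => Subtype.ext ?_⟩
  · change v.1.length ≤ R ↔ (Φ v).1.length ≤ R
    rw [hlen]
  · change (Φ u.1).1 = _
    rw [h u.1 (memL_coe u), toL_eq]
    rfl

end

section
variable {A B C : Type*} [Fintype A] [Fintype B]

/-- The pushforward of a vector. -/
def pf (f : A → B) (q : A → ℝ) (b : B) : ℝ := ∑ a, if f a = b then q a else 0

lemma pf_pf (f : A → B) (g : B → C) (q : A → ℝ) : pf g (pf f q) = pf (g ∘ f) q := by
  funext c
  unfold pf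
  have : ∀ b, (if g b = c then ∑ a, (if f a = b then q a else 0) else 0) =
      ∑ a, if f a = b ∧ g (f a) = c then q a else 0 := fun b => by
    by_cases h : g b = c
    · rw [if_pos h]
      refine sum_congr rfl fun a _ => ?_
      by_cases h2 : f a = b
      · simp [h2, h]
      · simp [h2]
    · rw [if_neg h]
      refine (sum_eq_zero fun a _ => ?_).symm
      rw [if_neg]
      rintro ⟨rfl, h2⟩; exact h h2
  simp only [this]
  rw [sum_comm]
  refine sum_congr rfl fun a _ => ?_
  by_cases h : g (f a) = c <;> simp [h]

lemma sum_pf (f : A → B) (q : A → ℝ) : ∑ b, pf f q b = ∑ a, q a := by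
  unfold pf
  rw [sum_comm]
  simp

lemma pf_nonneg (f : A → C) (q : A → ℝ) (hq : ∀ a, 0 ≤ q a) (b : C) : 0 ≤ pf f q b :=
  sum_nonneg fun a _ => by split_ifs <;> simp [hq]

lemma pf_equiv (e : A ≃ B) (q : A → ℝ) (b : B) : pf e q b = q (e.symm b) := by
  unfold pf
  simp_rw [← Equiv.eq_symm_apply]
  simp

lemma sum_abs_pf_sub_le (f : A → B) (q q' : A → ℝ) :
    ∑ b, |pf f q b - pf f q' b| ≤ ∑ a, |q a - q' a| := by
  calc ∑ b, |pf f q b - pf f q' b| ≤ ∑ b, pf f (fun a => |q a - q' a|) b := by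
        refine sum_le_sum fun b _ => ?_
        unfold pf
        rw [← sum_sub_distrib]
        refine (abs_sum_le_sum_abs _ _).trans (sum_le_sum fun a _ => ?_)
        split_ifs <;> simp
    _ = _ := sum_pf _ _

lemma cnt_eq_sum {A T : Type*} [Fintype A] (X : A → T) (c : T) :
    (cnt X c : ℝ) = ∑ a, if X a = c then (1:ℝ) else 0 := by
  simp [cnt]

lemma pf_cnt {T : Type*} [Fintype T] (X : A → T) (f : T → B) (n : ℝ) :
    pf f freq X n = freq (f ∘ X) n := by
  have : freq X n = pf X (fun _ => 1 / n) := by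
    funext c; simp only [cnt_eq_sum, pf, sum_div]
    refine sum_congr rfl fun a _ => by split_ifs <;> simp
  rw [this, pf_pf]
  funext c; simp only [cnt_eq_sum, pf, sum_div]
  refine sum_congr rfl fun a _ => by split_ifs <;> simp

end

section
variable {A B : Type*} [Fintype A] [Fintype B] [MeasurableSpace A] [MeasurableSpace B]
  [DiscreteMeasurableSpace A] [DiscreteMeasurableSpace B]

/-- The vector of point masses of a measure. -/
def vec (p : Measure A) (a : A) : ℝ := (p {a}).toReal

/-- The probability vector of the marginal of `μ` on `S_r`. -/
notation:max "srVec" d:max r:max μ:max => vec (restrictTo (SrSet d r) μ)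

lemma vec_nonneg (p : Measure A) (a : A) : 0 ≤ vec p a := ENNReal.toReal_nonneg

lemma toReal_measure_eq_sum (p : Measure A) [IsFiniteMeasure p] (s : Set A) :
    (p s).toReal = ∑ a, if a ∈ s then vec p a else 0 := by
  have h := measureReal_def p s
  rw [← h]
  have h2 : s = ((univ.filter fun a => a ∈ s : Finset A) : Set A) := by ext; simp
  conv_lhs => rw [h2]
  rw [← sum_measureReal_singleton, Finset.sum_filter]
  rfl

lemma sum_vec (p : Measure A) [IsProb p] : ∑ a, vec p a = 1 := by
  have := toReal_measure_eq_sum p Set.univ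
  simpa using this.symm

lemma vec_map (p : Measure A) [IsFiniteMeasure p] (f : A → B) : vec (p.map f) = pf f (vec p) := by
  funext b
  unfold vec
  rw [Measure.map_apply (measurable_of_finite f) (measurableSet_singleton b), toReal_measure_eq_sum]
  rfl

lemma eq_of_vec_eq {p p' : Measure A} [IsFiniteMeasure p] [IsFiniteMeasure p'] (h : vec p = vec p') :
    p = p' := by
  refine Measure.ext_of_singleton fun a => ?_
  exact (ENNReal.toReal_eq_toReal_iff' (measure_ne_top _ _) (measure_ne_top _ _)).mp (congrFun h a)

lemma shannon_eq_ent (p : Measure A) : shannon p = ent (vec p) := by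
  unfold shannon ent vec
  exact tsum_fintype _

lemma exists_measure_vec (q : A → ℝ) (hq : ∀ a, 0 ≤ q a) (hq1 : ∑ a, q a = 1) :
    ∃ p : Measure A, IsProb p ∧ vec p = q := by
  let p : Measure A := ∑ a, ENNReal.ofReal (q a) • Measure.dirac a
  have h : ∀ s, MeasurableSet s → p s = ∑ a, ENNReal.ofReal (q a) * s.indicator 1 a := fun s hs => by
    simp [p, Measure.finsetSum_apply, Measure.dirac_apply' _ hs]
  refine ⟨p, ⟨?_⟩, ?_⟩
  · rw [h _ MeasurableSet.univ]
    simp only [Set.indicator_univ, Pi.one_apply, mul_one]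
    rw [← ENNReal.ofReal_sum_of_nonneg (fun a _ => hq a), hq1, ENNReal.ofReal_one]
  · funext a
    unfold vec
    rw [h _ (measurableSet_singleton a), sum_eq_single a]
    · simp [hq]
    · intro b _ hb; simp [hb]
    · simp

end

/-- Colourings of `S_R` and of `E_R`. -/
abbrev Col (d R : ℕ) (N : Type) := ↥(SrSet d R) → N

abbrev ECol (d R : ℕ) (N : Type) := ↥(ErSet d R) → N

section
variable {d R : ℕ} {N : Type} [Fintype N]

/-- Restriction of a colouring to `E_R`. -/
def erest (x : Col d R N) : ECol d R N := fun u => x ⟨u.1, ErSet_subset_SrSet d R u.2⟩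

/-- The colouring of the neighbourhood of the `a`-th edge. -/
def etyp (R : ℕ) (a : Fin d) (x : Col d R N) : ECol d R N := erest fun v => x (srRot R a v)

/-- Switch the two sides of the edge `{o, 1}`. -/
def flipE (hd : 2 ≤ d) (e : ECol d R N) : ECol d R N := fun u => e (erFlip hd R u)

lemma erFlip_erFlip (hd : 2 ≤ d) (u : ErSet d R) : erFlip hd R (erFlip hd R u) = u := by
  apply Subtype.ext; apply Subtype.ext
  rw [erFlip_coe, erFlip_coe]
  exact flipL_flipL u.1.2

lemma flipE_flipE (hd : 2 ≤ d) (e : ECol d R N) : flipE hd (flipE hd e) = e := by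
  funext u; simp only [flipE, erFlip_erFlip]

/-- The vector of edge types. -/
def Tv (q : Col d R N → ℝ) : ECol d R N → ℝ := fun e => (1 / d) * ∑ a : Fin d, pf (etyp R a) q e

/-- The annealed entropy of a vector. -/
def entJ (q : Col d R N → ℝ) : ℝ := ent q - (d / 2 : ℝ) * ent (Tv q)

structure IsIdr (hd : 2 ≤ d) (q : Col d R N → ℝ) : Prop where
  nonneg : ∀ x, 0 ≤ q x
  sum_one : ∑ x, q x = 1
  inv : ∀ (φ : SrAut d R) x, q (fun v => x (φ v)) = q x
  flip : ∀ e, Tv q (flipE hd e) = Tv q e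

lemma pf_comp_iso (φ : SrAut d R) (q : Col d R N → ℝ) (x : Col d R N) :
    pf (fun (x : Col d R N) v => x (φ v)) q x = q (fun v => x (φ.symm v)) := by
  let e : Col d R N ≃ Col d R N :=
    ⟨fun x v => x (φ v), fun x v => x (φ.symm v), fun x => by simp, fun x => by simp⟩
  exact pf_equiv e q x

lemma Tv_eq_of_inv (hd : d ≠ 0) {q : Col d R N → ℝ}
    (h : ∀ (φ : SrAut d R) x, q (fun v => x (φ v)) = q x) : Tv q = pf erest q := by
  have h1 : ∀ a, pf (etyp R a) q = pf (erest (d := d) (R := R) (N := N)) q := fun a => by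
    have : (etyp R a : Col d R N → _) = erest ∘ fun x v => x (srRot R a v) := rfl
    rw [this, ← pf_pf]
    congr 1
    funext x
    rw [pf_comp_iso, h]
  funext e
  unfold Tv
  simp only [h1, sum_const, card_univ, card_fin, nsmul_eq_mul]
  have : (d:ℝ) ≠ 0 := mod_cast hd
  field_simp

variable [MeasurableSpace N] [DiscreteMeasurableSpace N]

lemma vec_restrictErOfSr (p : Measure (Col d R N)) [IsProb p] :
    vec (restrictErOfSr d R p) = pf erest (vec p) := vec_map p _

lemma inv_vec_iff (p : Measure (Col d R N)) [IsProb p] :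
    (∀ φ : SrAut d R, p.map (fun x => fun v => x (φ v)) = p) ↔
    ∀ (φ : SrAut d R) x, vec p (fun v => x (φ v)) = vec p x := by
  constructor
  · intro h φ x
    have := congrArg vec (h φ.symm)
    rw [vec_map] at this
    have h2 := congrFun this x
    rw [pf_comp_iso] at h2
    exact h2
  · intro h φ
    have := Measure.isFiniteMeasure_map p (fun (x : Col d R N) v => x (φ v))
    apply eq_of_vec_eq
    rw [vec_map]
    funext x
    rw [pf_comp_iso, h]

lemma mem_IdrMeas_iff (hd : 3 ≤ d) (hR : 1 ≤ R) (p : Measure (Col d R N))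
    [IsProb p] : p ∈ IdrMeas d R N ↔ IsIdr (by omega) (vec p) := by
  have hd2 : 2 ≤ d := by omega
  have hfl : ∀ q : ECol d R N → ℝ, ∀ e, pf (flipE hd2) q e = q (flipE hd2 e) := fun q e => pf_equiv ⟨flipE hd2, flipE hd2, flipE_flipE hd2, flipE_flipE hd2⟩ q e
  have hnode : node1 d = ⟨[1], validTd_singleton.mpr ⟨le_rfl, by omega⟩⟩ :=
    dif_pos (show 1 ≤ d by omega)
  constructor
  · rintro ⟨-, h1, h2⟩
    have h1 := (inv_vec_iff p).mp h1
    refine ⟨vec_nonneg p, sum_vec p, h1, fun e => ?_⟩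
    rw [Tv_eq_of_inv (by omega) h1]
    have := h2 (erFlip hd2 R) (fun hv => by rw [hnode]; rfl)
    have h3 := congrArg vec this
    have hf : IsFiniteMeasure (restrictErOfSr d R p) := Measure.isFiniteMeasure_map p _
    rw [vec_map, vec_restrictErOfSr] at h3
    have h4 := congrFun h3 e
    rw [← h4]
    exact (hfl _ e).symm.trans (by rw [h4]; exact h4)
  · intro h
    refine ⟨inferInstance, (inv_vec_iff p).mpr h.inv, fun ψ hψ => ?_⟩
    have hf : IsFiniteMeasure (restrictErOfSr d R p) := Measure.isFiniteMeasure_map p _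
    have hf2 := Measure.isFiniteMeasure_map (restrictErOfSr d R p) (fun (x : ECol d R N) v => x (ψ v))
    apply eq_of_vec_eq
    rw [vec_map, vec_restrictErOfSr]
    let o : ErSet d R := ⟨rootTd d, root_mem_Er d R hR⟩
    let o1 : ErSet d R := ⟨node1 d, node1_mem_Er d R hR⟩
    have ho : o.1.1 = [] := rfl
    have ho1 : o1.1.1 = [1] := congrArg Subtype.val hnode
    have hψo : ψ o = o1 := Subtype.ext (hψ _)
    have hfo : erFlip hd2 R o = o1 := by
      apply Subtype.ext; apply Subtype.ext; rw [erFlip_coe, ho1]; rfl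
    have hfo1 : erFlip hd2 R o1 = o := by rw [← hfo, erFlip_erFlip]
    have hψo1 : ψ o1 = o := by
      have h1 := erIso_depth hd ψ o1
      have h0 : edgeDepth o1.1.1 = 0 := by rw [ho1]; rfl
      rw [h0] at h1
      have h2 : ψ o1 ≠ o1 := fun e => by
        have := ψ.injective (e.trans hψo.symm)
        have := congrArg (fun u : ErSet d R => u.1.1) this
        simp only [ho, ho1] at this
        simp at this
      unfold edgeDepth at h1
      apply Subtype.ext; apply Subtype.ext
      rw [ho]
      split_ifs at h1 with h3
      · exfalso; apply h2
        apply Subtype.ext; apply Subtype.ext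
        rw [ho1]
        rcases h4 : (ψ o1).1.1 with _ | ⟨a, _ | ⟨b, l⟩⟩
        · rw [h4] at h3; simp at h3
        · rw [h4] at h3; simp at h3; rw [h3]
        · rw [h4] at h1; simp at h1
      · exact List.length_eq_zero_iff.mp h1
    have hχ0 : toL ((erFlip hd2 R).trans ψ) [] = [] := by
      have := toL_eq ((erFlip hd2 R).trans ψ) o
      rw [ho] at this
      rw [this, RelIso.trans_apply, hfo, hψo1]; rfl
    have hχ1 : toL ((erFlip hd2 R).trans ψ) [1] = [1] := by
      have := toL_eq ((erFlip hd2 R).trans ψ) o1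
      rw [ho1] at this
      rw [this, RelIso.trans_apply, hfo1, hψo, ho1]
    obtain ⟨Φ, hΦ⟩ := exists_extension_er hR _ hχ0 hχ1 (by omega)
    have hcomp : (fun (x : ECol d R N) v => x (ψ v)) ∘ erest =
        flipE hd2 ∘ erest ∘ fun (x : Col d R N) v => x (Φ v) := by
      funext x u
      simp only [Function.comp, erest, flipE]
      congr 1
      apply Subtype.ext
      rw [hΦ, RelIso.trans_apply, erFlip_erFlip]
    rw [pf_pf, hcomp, ← pf_pf, ← pf_pf]
    have : pf (fun (x : Col d R N) v => x (Φ v)) (vec p) = vec p := by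
      funext x; rw [pf_comp_iso, h.inv]
    rw [this]
    funext e
    rw [hfl, ← Tv_eq_of_inv (by omega) h.inv, h.flip]

lemma SigmaP_eq_entJ (hd : d ≠ 0) (p : Measure (Col d R N)) [IsProb p]
    (h : ∀ (φ : SrAut d R) x, vec p (fun v => x (φ v)) = vec p x) :
    SigmaP d R p = entJ (vec p) := by
  unfold SigmaP entJ
  rw [shannon_eq_ent, shannon_eq_ent, Tv_eq_of_inv hd h, vec_restrictErOfSr]

end

section
variable {d n : ℕ} [NeZero d]

lemma skipLab_rot (a : Fin d) {k : ℕ} (hk : 1 ≤ k) :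
    skipLab none (rot a (k + 1)) = skipLab (some a) k := by
  have := a.2
  apply Fin.ext
  simp only [skipLab, rot_def]
  rw [if_neg (by omega), if_neg (by omega)]
  by_cases h : k - 1 < a.1
  · rw [if_pos (by omega), if_pos h]; simp
  · rw [if_neg (by omega), if_neg h]; simp

lemma skipLab_none_succ (a : Fin d) : skipLab none (a.1 + 1) = a := by
  apply Fin.ext
  simp [skipLab]

lemma st_cons' (ι : HMap n d) (v : Fin n) (j : ℕ) (l : List ℕ) :
    st ι v (j :: l) = ((ι ((st ι v l).1, skipLab (st ι v l).2 j)).1,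
      some (ι ((st ι v l).1, skipLab (st ι v l).2 j)).2) := rfl

lemma rootMap_rot_append_one (a : ℕ) (i : ℕ) : rootMap (rot a) [i, 1] = [i, a + 1] := by
  rw [rootMap_cons _ _ (by simp)]; simp [rootMap, rot_def]

lemma st_rot_flip {ι : HMap n d} (hι : Involutive ι) (v : Fin n)
    (i : Fin d) (l : List ℕ) (hl : ValidTd d l) :
    (st ι v (rootMap (rot i) l)).1 = (st ι (ι (v, i)).1 (rootMap (rot (ι (v, i)).2) (flipL l))).1 ∧
    (l ≠ [] → l ≠ [1] → st ι v (rootMap (rot i) l) =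
      st ι (ι (v, i)).1 (rootMap (rot (ι (v, i)).2) (flipL l))) := by
  have hr1 : ∀ a : Fin d, rootMap (rot a) [1] = [a.1 + 1] := by
    intro a; simp [rootMap, rot_def]
  have hs1 : ∀ (v : Fin n) (a : Fin d), st ι v [a.1 + 1] = ((ι (v, a)).1, some (ι (v, a)).2) := fun v a => by
    rw [st_cons']
    have : st ι v [] = (v, none) := rfl
    rw [this]
    simp only [skipLab_none_succ]
  induction l with
  | nil =>
    refine ⟨?_, fun h => absurd rfl h⟩
    have h1 : flipL [] = [1] := rfl
    have h2 : rootMap (rot i) [] = [] := rfl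
    rw [h1, h2, hr1, hs1]
    change v = (ι (ι (v, i))).1
    rw [hι]
  | cons k l ih =>
    by_cases hl1 : k :: l = [1]
    · rw [hl1]
      refine ⟨?_, fun _ h => absurd rfl h⟩
      rw [hr1, hs1]; rfl
    suffices h : st ι v (rootMap (rot i) (k :: l)) =
        st ι (ι (v, i)).1 (rootMap (rot (ι (v, i)).2) (flipL (k :: l))) from
      ⟨congrArg Prod.fst h, fun _ _ => h⟩
    have ih := ih hl.tail
    by_cases h0 : l = []
    · subst h0
      have hk1 : k ≠ 1 := fun e => hl1 (by rw [e])
      rw [validTd_singleton] at hl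
      obtain ⟨k, rfl⟩ : ∃ k', k = k' + 1 := ⟨k - 1, by omega⟩
      have e1 : flipL [k + 1] = [k, 1] := by simp [flipL]; omega
      have e2 : rootMap (rot i) [k + 1] = [rot i (k + 1)] := rfl
      rw [e1, e2, rootMap_rot_append_one, st_cons', st_cons' ι _ k, hs1]
      have e3 : st ι v [] = (v, none) := rfl
      rw [e3]
      have e4 : ι ((ι (v, i)).1, (ι (v, i)).2) = (v, i) := hι (v, i)
      rw [e4]
      simp only [skipLab_rot i (show 1 ≤ k by omega)]
    · by_cases h1 : l = [1]
      · subst h1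
        rw [validTd_cons_cons] at hl
        have e1 : flipL [k, 1] = [k + 1] := by simp [flipL]
        have e2 : ∀ a : Fin d, rootMap (rot a) [k + 1] = [rot a (k + 1)] := fun _ => rfl
        rw [e1, e2, rootMap_rot_append_one, st_cons', st_cons' ι _ (rot _ _), hs1]
        have e3 : st ι (ι (v, i)).1 [] = ((ι (v, i)).1, none) := rfl
        rw [e3]
        simp only [skipLab_rot (ι (v, i)).2 hl.1.1]
      · have e1 : flipL (k :: l) = k :: flipL l := by
          cases l with
          | nil => exact absurd rfl h0
          | cons j l =>
            rw [flipL, if_neg]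
            rintro ⟨rfl, rfl⟩; exact h1 rfl
        have e2 : flipL l ≠ [] := fun e => by
          have := flipL_flipL hl.tail
          rw [e] at this
          exact h1 this.symm
        rw [e1, rootMap_cons _ _ h0, rootMap_cons _ _ e2, st_cons', st_cons', ih.2 h0 h1]

/-- The edge types of a family of colourings. -/
def tX {N : Type} [Fintype N] (R : ℕ) (X : Fin n → Col d R N) (h : HE n d) : ECol d R N :=
  etyp R h.2 (X h.1)

lemma tX_xcol {N : Type} [Fintype N] {ι : HMap n d} (hι : Involutive ι)
    (hd : 2 ≤ d) (R : ℕ) (f : Fin n → N) (h : HE n d) :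
    tX R (xcol R ι f) (ι h) = flipE hd (tX R (xcol R ι f) h) := by
  obtain ⟨v, i⟩ := h
  rw [← flipE_flipE hd (tX R (xcol R ι f) (ι (v, i)))]
  congr 1
  funext u
  change f (pos ι (ι (v, i)).1 (rootMap (rot (ι (v, i)).2) (flipL u.1.1))) =
    f (pos ι v (rootMap (rot i) u.1.1))
  congr 1
  exact (st_rot_flip hι v i u.1.1 u.1.2).1.symm

lemma getLast?_rootMap (s : ℕ → ℕ) (l : List ℕ) : (rootMap s l).getLast? = l.getLast?.map s := by
  induction l with
  | nil => rfl
  | cons i l ih =>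
    cases l with
    | nil => rfl
    | cons j l =>
      rw [rootMap_cons _ _ (by simp), List.getLast?_cons_cons]
      obtain ⟨k, hk⟩ := rootMap_child s j l
      rw [hk] at ih ⊢
      rw [List.getLast?_cons_cons, ih]

/-- A family of colourings which is consistent away from a set `B` of vertices comes from a
colouring of the vertices. -/
lemma eq_xcol_of_consistent {N : Type} [Fintype N] {ι : HMap n d}
    (hι : Involutive ι) (hd : 2 ≤ d) (R : ℕ) (X : Fin n → Col d R N) (B : Finset (Fin n))
    (hX : ∀ h : HE n d, h.1 ∉ B → tX R X (ι h) = flipE hd (tX R X h)) (v : Fin n)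
    (hv : v ∉ nbhd ι B R) :
    X v = xcol R ι (fun w => X w ⟨⟨[], validTd_nil d⟩, Nat.zero_le R⟩) v := by
  have key : ∀ k (v : Fin n), v ∉ nbhd ι B k → ∀ (l : List ℕ) (hl : ValidTd d l) (hR : l.length ≤ R),
      l.length ≤ k → X v ⟨⟨l, hl⟩, hR⟩ = X (pos ι v l) ⟨⟨[], validTd_nil d⟩, Nat.zero_le R⟩ := fun k => by
    induction k with
    | zero =>
      intro v hv l hl hR hk
      have : l = [] := List.length_eq_zero_iff.mp (by omega)
      subst this; rfl
    | succ k ih =>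
      intro v hv l hl hR hk
      by_cases h0 : l = []
      · subst h0; rfl
      obtain ⟨a, ha⟩ : ∃ a, l.getLast? = some a := ⟨_, List.getLast?_eq_some_getLast h0⟩
      have ha1 : 1 ≤ a ∧ a ≤ d := hl.2 a ha
      obtain ⟨i, rfl⟩ : ∃ i : Fin d, a = i.1 + 1 := ⟨⟨a - 1, by omega⟩, by simp; omega⟩
      set u := rootMap (rot i).symm l with hu
      have hul : rootMap (rot i) u = l := rootMap_rootMap (fun k => (rot i).apply_symm_apply k) l
      have huv : ValidTd d u := validTd_rootMap rot_symm_mem hl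
      have hu1 : u.getLast? = some 1 := by
        rw [hu, getLast?_rootMap, ha]; simp [rot_symm_def]
      have hulen : u.length = l.length := rootMap_length _ _
      have huE : (⟨u, huv⟩ : TdVertex d) ∈ ErSet d R :=
        mem_ErSet.mpr (Or.inr ⟨hu1, by change u.length ≤ R; omega⟩)
      have hflen := (flipL_length u).1 hu1
      have hvB : v ∉ B := fun h => hv (nbhd_mono ι B (Nat.zero_le _) h)
      have h1 := hX (v, i) hvB
      have h2 : tX R X (v, i) = flipE hd (tX R X (ι (v, i))) := by rw [h1, flipE_flipE]
      have h3 := congrFun h2 ⟨⟨u, huv⟩, huE⟩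
      set w := (ι (v, i)).1 with hw
      set l' := rootMap (rot (ι (v, i)).2) (flipL u) with hl'
      have hlen' : l'.length + 1 = l.length := by rw [hl', rootMap_length, hflen, hulen]
      have hl'v : ValidTd d l' := validTd_rootMap rot_mem (validTd_flipL hd huv)
      have hwB : w ∉ nbhd ι B k := fun h => by
        have := mem_nbhd_succ (ι := ι) h (ι (v, i)).2
        have e : ι (w, (ι (v, i)).2) = (v, i) := hι (v, i)
        rw [e] at this
        exact hv this
      have h4 := ih w hwB l' hl'v (by omega) (by omega)
      have h5 : pos ι v l = pos ι w l' := by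
        have := (st_rot_flip hι v i u huv).1
        rw [hul] at this
        exact this
      rw [h5, ← h4]
      have h6 : X v ⟨⟨rootMap (rot i) u, validTd_rootMap rot_mem huv⟩, by
          change (rootMap (rot i) u).length ≤ R; rw [hul]; exact hR⟩ = X v ⟨⟨l, hl⟩, hR⟩ := by
        congr 1
        exact Subtype.ext (Subtype.ext hul)
      rw [← h6]
      exact h3
  funext u
  exact key R v hv u.1.1 u.1.2 u.2 u.2

end

section
variable {α T : Type*} [Fintype α]

/-- A word on `Fin m` extended to both ends of `m` edges by an involution. -/
def sOf {m : ℕ} {E : Type*} (fl : E → E) (a : Fin m → E) (x : Fin m × Bool) : E :=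
  if x.2 then fl (a x.1) else a x.1

lemma prod_comp_cnt [Fintype T] (w : α → T) (q : T → ℝ) : ∏ a, q (w a) = ∏ c, q c ^ cnt w c := by
  rw [← Finset.prod_fiberwise (s := univ) (g := w)]
  refine prod_congr rfl fun c _ => ?_
  rw [prod_congr rfl (g := fun _ => q c) (fun x hx => by
    rw [(mem_filter.mp hx).2])]
  simp [cnt]

lemma prod_cnt_pow [Fintype T] (w : α → T) (h : 0 < card α) : ∏ a, ((cnt w (w a) : ℝ) / card α) =
      exp (-(card α * ent freq w (card α))) := by
  have h' : (0:ℝ) < card α := mod_cast h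
  have h0 : ∀ a, (0:ℝ) < (cnt w (w a) : ℝ) / card α := fun a => by
    have : 0 < cnt w (w a) := Finset.card_pos.mpr ⟨a, by simp⟩
    positivity
  rw [← exp_log (prod_pos fun a _ => h0 a), log_prod (fun a _ => (h0 a).ne'),
    sum_comp_eq_cnt w (fun c => log ((cnt w c : ℝ) / card α))]
  congr 1
  rw [ent, mul_sum, ← Finset.sum_neg_distrib]
  refine sum_congr rfl fun c _ => ?_
  rw [negMulLog]
  field_simp

lemma sum_cnt_div [Fintype T] (w : α → T) (h : 0 < card α) : ∑ c, (cnt w c : ℝ) / card α = 1 := by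
  have h' : (0:ℝ) < card α := mod_cast h
  rw [← sum_div, div_eq_one_iff_eq h'.ne']
  exact_mod_cast sum_cnt w

lemma card_words_cnt_le [DecidableEq α] [Fintype T] (w0 : α → T) (h : 0 < card α) :
    (#{w : α → T | cnt w = cnt w0} : ℝ) ≤ exp (card α * ent freq w0 (card α)) := by
  refine (le_of_eq ?_).trans (card_words_le freq w0 (card α)
    (fun c => by positivity) (sum_cnt_div w0 h)
    (univ.filter fun w : α → T => cnt w = cnt w0) _ fun w hw => ?_)
  · congr!
  have hw : cnt w = cnt w0 := (mem_filter.mp hw).2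
  rw [← hw, ← prod_cnt_pow w h]

lemma sum_exp_neg_ent_le [DecidableEq α] [Fintype T] (h : 0 < card α) :
    ∑ w : α → T, exp (-(card α * ent freq w (card α))) ≤ ((card α : ℝ) + 1) ^ card T := by
  let f : (α → T) → (T → Fin (card α + 1)) := fun w c =>
    ⟨cnt w c, Nat.lt_succ_of_le (by rw [cnt, ← card_univ]; exact card_le_card (Finset.filter_subset _ _))⟩
  have hf : ∀ w w', f w = f w' → cnt w = cnt w' := by
    intro w w' h; funext c; simpa [f] using congrFun h c
  rw [← Finset.sum_fiberwise (s := univ) (g := f)]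
  have : ((card α : ℝ) + 1) ^ card T = ∑ _k : T → Fin (card α + 1), (1:ℝ) := by simp
  rw [this]
  refine sum_le_sum fun k _ => ?_
  by_cases hk : ∃ w0, f w0 = k
  · obtain ⟨w0, rfl⟩ := hk
    have h1 : ∀ w ∈ univ.filter (fun w => f w = f w0), exp (-(card α * ent freq w (card α))) =
        exp (-(card α * ent freq w0 (card α))) := fun w hw => by
      rw [hf w w0 (mem_filter.mp hw).2]
    rw [sum_congr rfl h1, sum_const, nsmul_eq_mul, exp_neg]
    have h2 := card_words_cnt_le w0 h
    have h3 : (#{w | f w = f w0} : ℝ) ≤ (#{w : α → T | cnt w = cnt w0} : ℝ) := by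
      exact_mod_cast card_le_card fun w hw => by
        rw [mem_filter] at hw ⊢; exact ⟨hw.1, hf _ _ hw.2⟩
    rw [mul_inv_le_iff₀ (exp_pos _), one_mul]
    exact h3.trans h2
  · push Not at hk
    rw [sum_eq_zero]
    · norm_num
    · intro w hw; exact absurd (mem_filter.mp hw).2 (hk w)

lemma cnt_flip {α E : Type*} [Fintype α] {ι : α → α} (hι : Involutive ι) {fl : E → E}
    (hfl : Involutive fl) {t : α → E} (h : ∀ a, t (ι a) = fl (t a)) (e : E) :
    cnt t (fl e) = cnt t e := by
  unfold cnt
  refine card_bij (fun a _ => ι a) ?_ ?_ ?_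
  · intro a ha
    have ha := (mem_filter.mp ha).2
    refine mem_fil.mpr ?_
    rw [h, ha, hfl]
  · intro a _ b _ hab; exact hι.injective hab
  · intro b hb
    have hb := (mem_filter.mp hb).2
    exact ⟨ι b, mem_fil.mpr (by rw [h, hb]), hι b⟩

lemma card_le_sum_fibers {A B C : Type*} [Fintype A] [Fintype C] (Q : Finset (A × B))
    (g : A × B → C) (hinj : ∀ a b b', g (a, b) = g (a, b') → b = b') (P : C → Prop)
    (W : C → A → Prop) (h : ∀ x ∈ Q, P (g x) ∧ W (g x) x.1) :
    #Q ≤ ∑ c ∈ univ.filter P, #(univ.filter (W c)) := by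
  rw [← card_sigma]
  refine card_le_card_of_injOn (fun x => ⟨g x, x.1⟩) ?_ ?_
  · intro x hx
    exact mem_sigma.mpr ⟨mem_fil.mpr (h x hx).1, mem_fil.mpr (h x hx).2⟩
  · rintro ⟨a, b⟩ _ ⟨a', b'⟩ _ h
    simp only [Sigma.mk.injEq, heq_eq_eq] at h
    obtain ⟨h, rfl⟩ := h
    rw [hinj a b b' h]

lemma card_compatible_le {E : Type*} [Fintype E] {d n m : ℕ} (hm : 2 * m = n * d) (hm0 : 0 < m)
    {fl : E → E} (hfl : Involutive fl) (t : HE n d → E)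
    (Q : Finset (Conf d n m)) (hQ : ∀ π ∈ Q, ∀ h, t (π° h) = fl (t h)) :
    (#Q : ℝ) ≤ (n * d)! * exp (-(m * ent freq t (n * d : ℕ)) +
        card E * (1 + 2 * log ((n * d : ℕ) + 1))) := by
  have hN : 0 < n * d := by omega
  have hcard : card HE n d = n * d := by simp
  rcases Q.eq_empty_or_nonempty with rfl | hne
  · simp only [Finset.card_empty, Nat.cast_zero]; positivity
  have hsO : ∀ π : Conf d n m, (∀ h, t (π° h) = fl (t h)) →
      t ∘ π = sOf fl fun k => t (π (k, false)) := fun π h => by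
    funext ⟨k, b⟩
    cases b
    · rfl
    · have h1 := h (π (k, false))
      rw [iota_apply] at h1
      exact h1
  obtain ⟨π0, hπ0'⟩ := hne
  have hπ0 := hQ π0 hπ0'
  set q : E → ℝ := freq t (n * d : ℕ) with hq
  have hNr : (0:ℝ) < (n * d : ℕ) := mod_cast hN
  have hqfl : ∀ h, q (fl (t h)) = q (t h) := fun h => by
    have : cnt t (fl (t h)) = cnt t (t h) := cnt_flip (iota_involutive π0) hfl hπ0 _
    simp only [hq, this]
  set S : Finset (Fin m → E) := univ.filter fun a => cnt (sOf fl a) = cnt t with hS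
  have hS1 : (#S : ℝ) ≤ exp (m * ent q) := by
    refine card_words_le q (fun e => by positivity) (by have := sum_cnt_div t (by rw [hcard]; exact hN); rwa [hcard] at this) _ _ fun a ha => ?_
    have ha : cnt (sOf fl a) = cnt t := (mem_filter.mp ha).2
    have ha' : ∀ k, q (fl (a k)) = q (a k) := fun k => by
      have : 0 < cnt (sOf fl a) (a k) := Finset.card_pos.mpr ⟨(k, false), mem_fil.mpr rfl⟩
      rw [ha] at this
      obtain ⟨h, hh⟩ := Finset.card_pos.mp this
      rw [← (mem_filter.mp hh).2]; exact hqfl h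
    have h1 : ∏ x, q (sOf fl a x) = (∏ k, q (a k)) ^ 2 := by
      rw [Fintype.prod_prod_type, ← Finset.prod_pow]
      refine prod_congr rfl fun k _ => ?_
      rw [Fintype.prod_bool]
      simp [sOf, ha', sq]
    have h2 : ∏ x, q (sOf fl a x) = exp (-(m * ent q)) ^ 2 := by
      rw [prod_comp_cnt, ha, ← prod_comp_cnt t q]
      have := prod_cnt_pow t (by rw [hcard]; exact hN)
      rw [hcard] at this
      rw [this, ← Real.exp_nat_mul]
      congr 1
      have : ((n * d : ℕ) : ℝ) = 2 * m := by rw [← hm]; push_cast; ring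
      change -(((n * d : ℕ) : ℝ) * ent q) = _
      rw [this]; push_cast; ring
    rw [h1] at h2
    exact ((pow_left_inj₀ (Finset.prod_nonneg fun k _ => by positivity) (exp_pos _).le two_ne_zero).mp h2).ge
  have hS2 : (#Q : ℝ) ≤ #S * ∏ e, ((cnt t e)! : ℝ) := by
    have h1 : Q ⊆
        S.biUnion fun a => univ.filter fun π : Conf d n m => t ∘ π = sOf fl a := fun π hπ => by
      have hπ := hsO π (hQ π hπ)
      refine mem_biUnion.mpr ⟨fun k => t (π (k, false)), mem_fil.mpr ?_, mem_fil.mpr hπ⟩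
      rw [← hπ]
      funext e; exact cnt_comp_equiv t π e
    have h2 := (card_le_card h1).trans Finset.card_biUnion_le
    have h3 : ∀ a ∈ S, #{π : Conf d n m | t ∘ π = sOf fl a} = ∏ e, (cnt t e)! := fun a ha => by
      have := card_equiv_comp_eq (sOf fl a) t (congrFun (mem_filter.mp ha).2)
      rw [← this, card_subtype]
    rw [sum_congr rfl h3, sum_const, smul_eq_mul] at h2
    exact_mod_cast h2
  have hfac := log_prod_factorial_le (fun e => cnt t e) (n * d) hN (by rw [sum_cnt t, hcard])
  have hpos : (0:ℝ) < ∏ e, ((cnt t e)! : ℝ) := prod_pos fun e _ => by positivity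
  rw [Real.log_le_iff_le_exp hpos] at hfac
  refine hS2.trans ((mul_le_mul hS1 hfac hpos.le (exp_pos _).le).trans (le_of_eq ?_))
  have hf : (((n * d)! : ℕ) : ℝ) = exp (log ((n * d)!)) := (exp_log (by positivity)).symm
  rw [hf, ← exp_add, ← exp_add]
  have : ((n * d : ℕ) : ℝ) * ent q = 2 * (m * ent q) := by
    rw [← mul_assoc, ← hm]; push_cast; ring
  congr 1
  change m * ent q + (_ - ((n * d : ℕ) : ℝ) * ent q + _) = _ + (-(m * ent q) + _)
  rw [this]
  simp only [log_exp]
  ring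

lemma poly_le_exp (C : ℝ) (K : ℕ) {δ : ℝ} (hδ : 0 < δ) :
    ∀ᶠ n : ℕ in atTop, C * ((n : ℝ) + 1) ^ K ≤ exp (δ * n) := by
  have h := (isLittleO_pow_exp_pos_mul_atTop (k := K) hδ).def
    (c := ((|C| + 1) * 2 ^ K)⁻¹) (by positivity)
  filter_upwards [tendsto_natCast_atTop_atTop.eventually h, eventually_ge_atTop 1] with n hn h1
  have h1' : (1:ℝ) ≤ n := mod_cast h1
  rw [Real.norm_eq_abs, Real.norm_eq_abs, abs_of_pos (exp_pos _),
    abs_of_nonneg (by positivity), inv_mul_eq_div, le_div_iff₀ (by positivity)] at hn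
  refine le_trans ?_ hn
  calc C * ((n : ℝ) + 1) ^ K ≤ (|C| + 1) * (2 * (n:ℝ)) ^ K := by
        have := le_abs_self C
        gcongr <;> linarith
    _ = _ := by rw [mul_pow]; ring

variable {d n R : ℕ} [NeZero d] {N : Type} [Fintype N]

/-- The empirical distribution of the coloured neighbourhoods of radius `R`. -/
def phat (R : ℕ) (ι : HMap n d) (f : Fin n → N) : Col d R N → ℝ := freq (xcol R ι f) n

lemma cnt_tX (R : ℕ) (X : Fin n → Col d R N) (e : ECol d R N) :
    (cnt (tX R X) e : ℝ) / (n * d : ℕ) = Tv freq X n e := by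
  have h1 : ∀ a : Fin d, pf (etyp R a) freq X n e =
      (cnt (etyp R a ∘ X) e : ℝ) / n := fun a => congrFun (pf_cnt X (etyp R a) n) e
  have h2 : (cnt (tX R X) e : ℝ) = ∑ a : Fin d, (cnt (etyp R a ∘ X) e : ℝ) := by
    simp only [cnt_eq_sum]
    rw [Fintype.sum_prod_type_right]
    rfl
  unfold Tv
  simp only [h1]
  rw [← sum_div, ← h2]
  push_cast
  field_simp

lemma Tv_phat_flip {ι : HMap n d} (hι : Involutive ι) (hd : 2 ≤ d)
    (f : Fin n → N) (e : ECol d R N) : Tv (phat R ι f) (flipE hd e) = Tv (phat R ι f) e := by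
  unfold phat
  rw [← cnt_tX, ← cnt_tX]
  rw [cnt_flip hι (flipE_flipE hd) (tX_xcol hι hd R f)]

lemma root_xcol (ι : HMap n d) (f : Fin n → N) (v : Fin n) :
    xcol R ι f v ⟨⟨[], validTd_nil d⟩, Nat.zero_le R⟩ = f v := rfl

lemma card_entJ_le (hd : 2 ≤ d) {m : ℕ} (hm : 2 * m = n * d) (hn : 0 < n) (S : ℝ) :
    (#{x : Conf d n m × (Fin n → N) | entJ (phat R x.1° x.2) ≤ S} : ℝ) ≤
      (n * d)! * exp (n * S) * (((n : ℝ) + 1) ^ card (Col d R N) *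
        exp (card (ECol d R N) * (1 + 2 * log ((n * d : ℕ) + 1)))) := by
  have hm0 : 0 < m := by
    have : 0 < n * d := Nat.mul_pos hn (by omega)
    omega
  set P := exp (card (ECol d R N) * (1 + 2 * log ((n * d : ℕ) + 1))) with hP
  have h1 := card_le_sum_fibers (univ.filter fun x : Conf d n m × (Fin n → N) =>
      entJ (phat R x.1° x.2) ≤ S) (fun x => xcol R x.1° x.2)
      (fun π f f' h => by
        funext v
        rw [← root_xcol (R := R) π° f v, ← root_xcol (R := R) π° f' v]
        exact congrFun (congrFun h v) _)
      (fun X => entJ freq X n ≤ S)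
      (fun X π => ∀ h, tX R X (π° h) = flipE hd (tX R X h))
      (fun x hx => ⟨(mem_filter.mp hx).2, tX_xcol (iota_involutive x.1) hd R x.2⟩)
  have h2 : ∀ X : Fin n → Col d R N, entJ freq X n ≤ S →
      ∀ Q : Finset (Conf d n m), (∀ π ∈ Q, ∀ h, tX R X (π° h) = flipE hd (tX R X h)) →
      (#Q : ℝ) ≤ (n * d)! * exp (n * S) * P *
      exp (-(n * ent freq X n)) := fun X hX Q hQ => by
    refine (card_compatible_le hm hm0 (flipE_flipE hd) (tX R X) Q hQ).trans ?_
    have h3 : freq (tX R X) (n * d : ℕ) = Tv freq X n :=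
      funext (cnt_tX R X)
    rw [h3, exp_add, ← hP]
    have : (m : ℝ) = n * (d / 2) := by
      have : (2 * m : ℝ) = n * d := mod_cast hm
      linarith
    unfold entJ at hX
    have hn' : (0:ℝ) < n := mod_cast hn
    have h5 := mul_le_mul_of_nonneg_left hX hn'.le
    have h4 : -(m * ent (Tv freq X n)) ≤ n * S + -(n * ent freq X n) := by
      rw [this]; linarith
    calc _ ≤ ((n * d)! : ℝ) * (exp (n * S + -(n * ent freq X n)) * P) := by
          gcongr
      _ = _ := by rw [exp_add]; ring
  have h1' := (Nat.cast_le (α := ℝ)).mpr h1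
  rw [Nat.cast_sum] at h1'
  refine h1'.trans ?_
  calc _ ≤ _ := sum_le_sum fun X hX => h2 X (mem_filter.mp hX).2 _
        fun π hπ => ((@mem_filter _ _ (_) _ _).mp hπ).2
    _ ≤ ∑ X, (n * d)! * exp (n * S) * P * exp (-(n * ent freq X n)) :=
        Finset.sum_le_univ_sum_of_nonneg fun X => by positivity
    _ = (n * d)! * exp (n * S) * P * ∑ X : Fin n → Col d R N,
      exp (-(n * ent freq X n)) := by rw [mul_sum]
    _ ≤ (n * d)! * exp (n * S) * P * ((n : ℝ) + 1) ^ card (Col d R N) := by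
      have := sum_exp_neg_ent_le (α := Fin n) (T := Col d R N) (by simpa using hn)
      rw [card_fin] at this
      refine mul_le_mul_of_nonneg_left ?_ (by positivity)
      exact this
    _ = _ := by ring

lemma card_entJ_le_exp (d R : ℕ) [NeZero d] (N : Type) [Fintype N] (hd : 2 ≤ d) (S : ℝ) {δ : ℝ}
    (hδ : 0 < δ) : ∀ᶠ n : ℕ in atTop, ∀ m, 2 * m = n * d →
    (#{x : Conf d n m × (Fin n → N) | entJ (phat R x.1° x.2) ≤ S} : ℝ) ≤
      (n * d)! * exp (n * (S + δ)) := by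
  filter_upwards [eventually_gt_atTop 0, poly_le_exp
    (exp (card (ECol d R N)) * (d : ℝ) ^ (2 * card (ECol d R N)))
    (card (Col d R N) + 2 * card (ECol d R N)) hδ] with n hn hp m hm
  refine (card_entJ_le hd hm hn S).trans ?_
  rw [mul_assoc]
  refine mul_le_mul_of_nonneg_left ?_ (Nat.cast_nonneg _)
  rw [mul_add (n : ℝ), exp_add (n * S)]
  refine mul_le_mul_of_nonneg_left ?_ (exp_pos _).le
  rw [mul_comm (n : ℝ) δ]
  refine le_trans ?_ hp
  have h1 : (0:ℝ) < (n * d : ℕ) + 1 := by positivity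
  have h2 : exp (card (ECol d R N) * (1 + 2 * log ((n * d : ℕ) + 1))) =
      exp (card (ECol d R N)) * (((n * d : ℕ) : ℝ) + 1) ^ (2 * card (ECol d R N)) := by
    rw [mul_add, mul_one, exp_add]
    congr 1
    rw [← Real.rpow_natCast, Real.rpow_def_of_pos h1]
    congr 1
    push_cast; ring
  have h3 : ((n * d : ℕ) : ℝ) + 1 ≤ d * ((n : ℝ) + 1) := by
    have : (1:ℝ) ≤ d := mod_cast (by omega : 1 ≤ d)
    push_cast; nlinarith
  rw [h2, pow_add]
  calc _ ≤ ((n : ℝ) + 1) ^ card (Col d R N) * (exp (card (ECol d R N)) *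
        (d * ((n : ℝ) + 1)) ^ (2 * card (ECol d R N))) := by gcongr
    _ = _ := by rw [mul_pow]; ring

end

section

lemma exists_defect_bound {X : Type*} [TopologicalSpace X] {K : Set X} (hK : IsCompact K)
    {G F : X → ℝ} (hG : Continuous G) (hF : Continuous F) (hG0 : ∀ x, 0 ≤ G x) (s : ℝ)
    (h : ∀ x ∈ K, G x = 0 → F x ≤ s) {δ : ℝ} (hδ : 0 < δ) :
    ∃ η > 0, ∀ x ∈ K, G x ≤ η → F x ≤ s + δ := by
  have hK' : IsCompact (K ∩ {x | s + δ ≤ F x}) := hK.inter_right (isClosed_le continuous_const hF)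
  rcases (K ∩ {x | s + δ ≤ F x}).eq_empty_or_nonempty with he | hne
  · refine ⟨1, one_pos, fun x hx _ => ?_⟩
    by_contra hc
    have : x ∈ K ∩ {x | s + δ ≤ F x} := ⟨hx, (not_le.mp hc).le⟩
    rw [he] at this; exact this
  · obtain ⟨x0, hx0, hmin⟩ := hK'.exists_isMinOn hne hG.continuousOn
    have hpos : 0 < G x0 := by
      rcases (hG0 x0).lt_or_eq with h1 | h1
      · exact h1
      · have h2 := h x0 hx0.1 h1.symm
        have h3 : s + δ ≤ F x0 := hx0.2
        linarith
    refine ⟨G x0 / 2, half_pos hpos, fun x hx hGx => ?_⟩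
    by_contra hc
    have h4 : G x0 ≤ G x := hmin (show x ∈ K ∩ {x | s + δ ≤ F x} from ⟨hx, (not_le.mp hc).le⟩)
    linarith

variable {A B : Type*} [Fintype A] [Fintype B]

lemma continuous_pf (f : A → B) : Continuous fun q : A → ℝ => pf f q := by
  refine continuous_pi fun b => ?_
  unfold pf
  refine continuous_finsetSum _ fun a _ => ?_
  by_cases h : f a = b
  · simp only [h, if_true]; fun_prop
  · simp only [h, if_false]; fun_prop

lemma continuous_ent : Continuous fun q : A → ℝ => ent q := by
  unfold ent
  exact continuous_finsetSum _ fun a _ => Real.continuous_negMulLog.comp (continuous_apply a)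

variable {d R : ℕ} {N M : Type} [Fintype N] [Fintype M]

lemma continuous_Tv : Continuous fun q : Col d R N → ℝ => Tv q := by
  unfold Tv
  refine continuous_pi fun e => ?_
  refine continuous_const.mul (continuous_finsetSum _ fun a _ => ?_)
  exact (continuous_apply e).comp (continuous_pf _)

lemma continuous_entJ : Continuous fun q : Col d R N → ℝ => entJ q := by
  unfold entJ
  exact continuous_ent.sub (continuous_const.mul (continuous_ent.comp continuous_Tv))

instance finite_srIso (d R : ℕ) : Finite (SrAut d R) :=
  Finite.of_injective (fun φ => φ.toEquiv) RelIso.toEquiv_injective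

instance fintype_srIso (d R : ℕ) : Fintype (SrAut d R) := ofFinite _

/-- Symmetrization under the automorphisms of the ball. -/
def sym (q : Col d R N → ℝ) (x : Col d R N) : ℝ :=
  (∑ φ : SrAut d R, q fun v => x (φ v)) / card (SrAut d R)

lemma card_srIso_pos (d R : ℕ) : (0:ℝ) < card (SrAut d R) := by
  exact_mod_cast card_pos_iff.mpr ⟨RelIso.refl _⟩

lemma sym_inv (q : Col d R N → ℝ) (φ : SrAut d R) (x : Col d R N) :
    sym q (fun v => x (φ v)) = sym q x := by
  unfold sym
  congr 1
  exact sum_equiv ⟨fun ψ => ψ.trans φ, fun ψ => ψ.trans φ.symm,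
    fun ψ => by ext; simp, fun ψ => by ext; simp⟩ _ _ fun ψ => rfl

lemma sym_eq_of_inv {q : Col d R N → ℝ}
    (h : ∀ (φ : SrAut d R) x, q (fun v => x (φ v)) = q x) : sym q = q := by
  funext x
  unfold sym
  simp only [h, sum_const, card_univ, nsmul_eq_mul]
  field_simp [(card_srIso_pos d R).ne']

/-- The `ℓ¹` distance on finitely supported vectors. -/
def l1 (q q' : A → ℝ) : ℝ := ∑ a, |q a - q' a|

lemma l1_nonneg (q q' : A → ℝ) : 0 ≤ l1 q q' := sum_nonneg fun _ _ => abs_nonneg _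

lemma l1_comm (q q' : A → ℝ) : l1 q q' = l1 q' q := sum_congr rfl fun _ _ => abs_sub_comm _ _

lemma l1_triangle (q q' q'' : A → ℝ) : l1 q q'' ≤ l1 q q' + l1 q' q'' := by
  unfold l1
  rw [← sum_add_distrib]
  exact sum_le_sum fun a _ => abs_sub_le _ _ _

lemma l1_eq_zero {q q' : A → ℝ} (h : l1 q q' = 0) : q = q' := by
  funext a
  have := (Finset.sum_eq_zero_iff_of_nonneg (fun _ _ => abs_nonneg _)).mp h a (mem_univ a)
  linarith [abs_eq_zero.mp this]

lemma l1_self (q : A → ℝ) : l1 q q = 0 := by simp [l1]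

lemma l1_pf_le (f : A → B) (q q' : A → ℝ) : l1 (pf f q) (pf f q') ≤ l1 q q' :=
  sum_abs_pf_sub_le f q q'

lemma abs_sub_le_l1 (q q' : A → ℝ) (a : A) : |q a - q' a| ≤ l1 q q' :=
  single_le_sum (f := fun a => |q a - q' a|) (fun _ _ => abs_nonneg _) (mem_univ a)

lemma l1_sym_le (q q' : Col d R N → ℝ) : l1 (sym q) (sym q') ≤ l1 q q' := by
  have hc := card_srIso_pos d R
  have h1 : ∀ φ : SrAut d R,
      ∑ x : Col d R N, |q (fun v => x (φ v)) - q' (fun v => x (φ v))| = l1 q q' := fun φ =>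
    sum_equiv (Equiv.arrowCongr φ.toEquiv.symm (Equiv.refl N)) _ _ fun x => rfl
  have h2 : ∀ x, |sym q x - sym q' x| ≤
      (∑ φ : SrAut d R, |q (fun v => x (φ v)) - q' (fun v => x (φ v))|) /
        card (SrAut d R) := fun x => by
    unfold sym
    rw [← sub_div, abs_div, abs_of_pos hc, ← sum_sub_distrib]
    gcongr
    exact abs_sum_le_sum_abs _ _
  refine (sum_le_sum fun x _ => h2 x).trans ?_
  rw [← sum_div, sum_comm]
  simp only [h1, sum_const, card_univ, nsmul_eq_mul]
  rw [mul_div_cancel_left₀ _ hc.ne']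

lemma sym_pf_comp (a : N → M) (q : Col d R N → ℝ) :
    sym (pf (fun x : Col d R N => fun v => a (x v)) q) =
      pf (fun x : Col d R N => fun v => a (x v)) (sym q) := by
  funext y
  have h1 : ∀ φ : SrAut d R, pf (fun x : Col d R N => fun v => a (x v)) q (fun v => y (φ v)) =
      ∑ x : Col d R N, if (fun v => a (x v)) = y then q (fun v => x (φ v)) else 0 := fun φ => by
    unfold pf
    let e : Col d R N ≃ Col d R N := ⟨fun x v => x (φ.symm v), fun x v => x (φ v),
      fun x => by funext v; exact congrArg x (φ.symm_apply_apply v),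
      fun x => by funext v; exact congrArg x (φ.apply_symm_apply v)⟩
    refine sum_equiv e _ _ fun x => ?_
    have h2 : (fun v => a (e x v)) = y ↔ (fun v => a (x v)) = fun v => y (φ v) := by
      constructor
      · intro h; funext v
        rw [← congrFun h (φ v)]
        exact congrArg (fun u => a (x u)) (φ.symm_apply_apply v).symm
      · intro h; funext v
        exact (congrFun h (φ.symm v)).trans (congrArg y (φ.apply_symm_apply v))
    have h3 : (fun v => e x (φ v)) = x := e.symm_apply_apply x
    by_cases h4 : (fun v => a (x v)) = fun v => y (φ v)
    · rw [if_pos (h2.mpr h4), if_pos h4, h3]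
    · rw [if_neg (fun h => h4 (h2.mp h)), if_neg h4]
  unfold sym
  simp only [h1]
  rw [sum_comm, sum_div]
  unfold pf
  refine sum_congr rfl fun x _ => ?_
  split_ifs <;> simp

lemma continuous_l1 (p : A → ℝ) : Continuous fun q : A → ℝ => l1 q p := by
  unfold l1; fun_prop

lemma continuous_sym : Continuous fun q : Col d R N → ℝ => sym q := by
  unfold sym; fun_prop

/-- Probability vectors with edge marginal symmetric under the edge flip. -/
def KSet (hd : 2 ≤ d) (R : ℕ) (N : Type) [Fintype N] : Set (Col d R N → ℝ) :=
  {q | (∀ c, 0 ≤ q c) ∧ ∑ c, q c = 1 ∧ ∀ e, Tv q (flipE hd e) = Tv q e}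

lemma isCompact_KSet (hd : 2 ≤ d) (R : ℕ) (N : Type) [Fintype N] : IsCompact (KSet hd R N) := by
  have h1 : IsCompact (Set.univ.pi fun _ : Col d R N => Set.Icc (0:ℝ) 1) :=
    isCompact_univ_pi fun _ => isCompact_Icc
  refine h1.of_isClosed_subset ?_ ?_
  · have hT := continuous_Tv (d := d) (R := R) (N := N)
    have e : KSet hd R N = (⋂ c, {q | 0 ≤ q c}) ∩ ({q | ∑ c, q c = 1} ∩
        ⋂ e, {q | Tv q (flipE hd e) = Tv q e}) := by
      ext q; simp [KSet]
    rw [e]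
    refine IsClosed.inter (isClosed_iInter fun c => isClosed_le continuous_const
      (continuous_apply c)) (IsClosed.inter (isClosed_eq (by fun_prop) continuous_const)
      (isClosed_iInter fun e => isClosed_eq ((continuous_apply _).comp hT)
        ((continuous_apply _).comp hT)))
  · intro q hq c _
    refine ⟨hq.1 c, ?_⟩
    rw [← hq.2.1]
    exact single_le_sum (f := q) (fun c _ => hq.1 c) (mem_univ c)

lemma exists_near_entJ_le (hd : 2 ≤ d) {J : Type} [Fintype J] (a : J → N → M) (p : Col d R M → ℝ)
    (s : ℝ)
    (h : ∀ q : Col d R N → ℝ, IsIdr hd q →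
      (∀ j, pf (fun (x : Col d R N) v => a j (x v)) q = p) → entJ q ≤ s) {δ : ℝ} (hδ : 0 < δ) :
    ∃ η > 0, ∀ q ∈ KSet hd R N, l1 q (sym q) ≤ η →
      (∀ j, l1 (pf (fun (x : Col d R N) v => a j (x v)) q) p ≤ η) → entJ q ≤ s + δ := by
  obtain ⟨η, hη, hh⟩ := exists_defect_bound (isCompact_KSet hd R N)
    (G := fun q => l1 q (sym q) + ∑ j, l1 (pf (fun (x : Col d R N) v => a j (x v)) q) p)
    (F := entJ) (by
      refine Continuous.add ?_ (continuous_finsetSum _ fun j _ =>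
        (continuous_l1 p).comp (continuous_pf _))
      have := continuous_sym (d := d) (R := R) (N := N)
      unfold l1
      refine continuous_finsetSum _ fun x _ => ?_
      exact ((continuous_apply x).sub ((continuous_apply x).comp this)).abs)
    continuous_entJ
    (fun q => add_nonneg (l1_nonneg _ _) (sum_nonneg fun _ _ => l1_nonneg _ _)) s
    (fun q hq h0 => by
      have h1 := l1_nonneg q (sym q)
      have h2 : 0 ≤ ∑ j, l1 (pf (fun (x : Col d R N) v => a j (x v)) q) p :=
        sum_nonneg fun _ _ => l1_nonneg _ _
      have h3 : l1 q (sym q) = 0 := by linarith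
      have h4 : ∑ j, l1 (pf (fun (x : Col d R N) v => a j (x v)) q) p = 0 := by linarith
      have h5 := l1_eq_zero h3
      rw [Finset.sum_eq_zero_iff_of_nonneg (fun _ _ => l1_nonneg _ _)] at h4
      exact h q ⟨hq.1, hq.2.1, fun φ x => by rw [h5]; exact sym_inv q φ x, hq.2.2⟩
        fun j => l1_eq_zero (h4 j (mem_univ j))) hδ
  have hc : (0:ℝ) < card J + 1 := by positivity
  refine ⟨η / (card J + 1), div_pos hη hc, fun q hq h1 h2 => hh q hq ?_⟩
  calc _ ≤ η / (card J + 1) + ∑ _j : J, η / (card J + 1) :=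
        add_le_add h1 (sum_le_sum fun j _ => h2 j)
    _ = η := by
      rw [sum_const, card_univ, nsmul_eq_mul]
      field_simp
      ring

end

section
variable {α T : Type*} [Fintype α]

lemma sum_abs_cnt_sub_le [Fintype T] (x x' : α → T) (B : Finset α)
    (hB : ∀ a ∉ B, x a = x' a) : ∑ c, |(cnt x c : ℝ) - cnt x' c| ≤ 2 * #B := by
  have h1 : ∀ c, |(cnt x c : ℝ) - cnt x' c| ≤
      ∑ a ∈ B, ((if x a = c then (1:ℝ) else 0) + if x' a = c then (1:ℝ) else 0) := fun c => by
    rw [cnt_eq_sum, cnt_eq_sum, ← sum_sub_distrib]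
    rw [← Finset.sum_subset (subset_univ B)]
    · refine (abs_sum_le_sum_abs _ _).trans (sum_le_sum fun a _ => ?_)
      split_ifs <;> norm_num
    · intro a _ ha; rw [hB a ha, sub_self]
  refine (sum_le_sum fun c _ => h1 c).trans ?_
  rw [sum_comm]
  simp only [sum_add_distrib, Finset.sum_ite_eq, mem_univ, if_true, sum_const, nsmul_eq_mul]
  linarith

variable {d n m R : ℕ} [NeZero d] {N : Type} [Fintype N]

lemma l1_cnt_div_le [Fintype T] (x x' : α → T) (B : Finset α) (hB : ∀ a ∉ B, x a = x' a) (n : ℕ) :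
    l1 freq x n freq x' n ≤ 2 * #B / n := by
  unfold l1
  simp only [← sub_div, abs_div, Nat.abs_cast]
  rw [← sum_div]
  gcongr
  exact sum_abs_cnt_sub_le x x' B hB

lemma phat_nonneg (ι : HMap n d) (f : Fin n → N) (c : Col d R N) :
    0 ≤ phat R ι f c := by unfold phat; positivity

lemma sum_phat (hn : 0 < n) (ι : HMap n d) (f : Fin n → N) : ∑ c, phat R ι f c = 1 := by
  have := sum_cnt_div (xcol R ι f) (by simpa using hn)
  rwa [card_fin] at this

lemma phat_mem_KSet (hd : 2 ≤ d) (hn : 0 < n) (π : Conf d n m) (f : Fin n → N) :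
    phat R π° f ∈ KSet hd R N :=
  ⟨phat_nonneg _ f, sum_phat hn _ f, Tv_phat_flip (iota_involutive π) hd f⟩

lemma l1_phat_swap_le (π : Conf d n m) (a b : Fin m × Bool) (f : Fin n → N) :
    l1 (phat R π° f) (phat R ((swap a b).trans π)° f) ≤ 8 * (d + 1) ^ R / n := by
  rw [swap_trans_eq]
  refine (l1_cnt_div_le _ _ (nbhd π° (touched π (π a) (π b)) R) (fun v hv =>
    xcol_eq_of_notMem_nbhd (iota_involutive π) (iota_swap_touched π _ _) hv f) n).trans ?_
  have h := card_nbhd_touched_le R π (π a) (π b)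
  have h' : (#(nbhd π° (touched π (π a) (π b)) R) : ℝ) ≤ (d + 1) ^ R * 4 := by
    exact_mod_cast h
  exact div_le_div_of_nonneg_right (by linarith) (Nat.cast_nonneg _)

lemma card_le_of_hamming [Fintype T] (w0 : α → T) (K : ℕ)
    (S : Finset (α → T)) (hS : ∀ w ∈ S, #{a | w a ≠ w0 a} ≤ K) :
    #S ≤ (card α * card T + 1) ^ K :=
  (card_le_card fun w hw => (mem_fil.mpr (hS w hw))).trans (card_hamming_ball_le w0 K)

end

section

/-- Subexponential sequences. -/
def SubExp (f : ℕ → ℝ) : Prop := (∀ n, 0 ≤ f n) ∧ ∀ δ > 0, ∀ᶠ n : ℕ in atTop, f n ≤ exp (δ * n)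

lemma SubExp.mul {f g : ℕ → ℝ} (hf : SubExp f) (hg : SubExp g) : SubExp fun n => f n * g n := by
  refine ⟨fun n => mul_nonneg (hf.1 n) (hg.1 n), fun δ hδ => ?_⟩
  filter_upwards [hf.2 _ (half_pos hδ), hg.2 _ (half_pos hδ)] with n h1 h2
  calc f n * g n ≤ exp (δ / 2 * n) * exp (δ / 2 * n) :=
        mul_le_mul h1 h2 (hg.1 n) (exp_pos _).le
    _ = _ := by rw [← exp_add]; congr 1; ring

lemma subExp_poly {C : ℝ} (hC : 0 ≤ C) (K : ℕ) : SubExp fun n => C * ((n : ℝ) + 1) ^ K :=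
  ⟨fun n => by positivity, fun _ hδ => poly_le_exp C K hδ⟩

lemma SubExp.of_le {f g : ℕ → ℝ} (hg : SubExp g) (h0 : ∀ n, 0 ≤ f n) (h : ∀ n, f n ≤ g n) :
    SubExp f :=
  ⟨h0, fun δ hδ => (hg.2 δ hδ).mono fun n hn => (h n).trans hn⟩

lemma subExp_linear {a : ℝ} (ha : 0 ≤ a) (K : ℕ) : SubExp fun n => (a * n + 1) ^ K := by
  refine (subExp_poly (C := (a + 1) ^ K) (by positivity) K).of_le (fun n => by positivity)
    fun n => ?_
  rw [← mul_pow]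
  gcongr
  have : (0:ℝ) ≤ n := Nat.cast_nonneg n
  nlinarith

lemma exp_mul_log (K : ℕ) {x : ℝ} (hx : 0 ≤ x) :
    exp (K * (1 + 2 * log (x + 1))) = exp K * (x + 1) ^ (2 * K) := by
  rw [mul_add, mul_one, exp_add]
  congr 1
  rw [← Real.rpow_natCast, Real.rpow_def_of_pos (by positivity)]
  congr 1
  push_cast; ring

lemma subExp_exp_log {a : ℝ} (ha : 0 ≤ a) (K : ℕ) :
    SubExp fun n => exp (K * (1 + 2 * log (a * n + 1))) := by
  have h : (fun n : ℕ => exp (K * (1 + 2 * log (a * n + 1)))) =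
      fun n : ℕ => (exp K * ((n:ℝ) + 1) ^ 0) * (a * n + 1) ^ (2 * K) := by
    funext n; rw [exp_mul_log K (by positivity)]; simp
  rw [h]
  exact (subExp_poly (exp_pos _).le 0).mul (subExp_linear ha _)

lemma le_card_words {α T : Type*} [Fintype α] [Fintype T] (w0 : α → T) (h : 0 < card α) :
    exp (card α * ent freq w0 (card α)) ≤ card {w : α → T // ∀ c, cnt w c = cnt w0 c} *
        exp (card T * (1 + 2 * log (card α + 1))) := by
  have h1 := card_words_mul w0
  have h2 := log_prod_factorial_le (fun c => cnt w0 c) _ h (sum_cnt w0)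
  have hpos : (0:ℝ) < ∏ c, ((cnt w0 c)! : ℝ) := prod_pos fun e _ => by positivity
  have h3 : (card {w : α → T // ∀ c, cnt w c = cnt w0 c} : ℝ) *
      ∏ c, ((cnt w0 c)! : ℝ) = (card α)! := mod_cast h1
  rw [Real.log_le_iff_le_exp hpos] at h2
  have hf : (0:ℝ) < (card α)! := by positivity
  have h4 : ((card α)! : ℝ) ≤ card {w : α → T // ∀ c, cnt w c = cnt w0 c} *
      ((card α)! * exp (-(card α * ent freq w0 (card α))) *
      exp (card T * (1 + 2 * log (card α + 1)))) := by
    rw [← h3]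
    rw [h3]
    refine h3.symm.le.trans ?_
    refine mul_le_mul_of_nonneg_left (h2.trans (le_of_eq ?_)) (Nat.cast_nonneg _)
    rw [exp_add, sub_eq_add_neg, exp_add, exp_log hf]
  rw [exp_neg] at h4
  have hE := exp_pos (card α * ent freq w0 (card α))
  set A := exp (card α * ent freq w0 (card α))
  set D := exp (card T * (1 + 2 * log (card α + 1)))
  have h5 : A * (card α)! ≤ (card {w : α → T // ∀ c, cnt w c = cnt w0 c} * D) * (card α)! := by
    calc A * (card α)! ≤ A * (card {w : α → T // ∀ c, cnt w c = cnt w0 c} *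
      ((card α)! * A⁻¹ * D)) := by gcongr
      _ = _ := by field_simp
  exact le_of_mul_le_mul_right h5 hf

lemma sOf_inj {m : ℕ} {E : Type*} (fl : E → E) : Injective (sOf (m := m) fl) := fun a a' h => by
  funext k
  exact congrFun h (k, false)

lemma cnt_sOf {m : ℕ} {E : Type*} {fl : E → E} (hfl : Involutive fl) (a : Fin m → E)
    (e : E) : cnt (sOf fl a) e = cnt a e + cnt a (fl e) := by
  have h : ((cnt (sOf fl a) e : ℕ) : ℝ) = cnt a e + cnt a (fl e) := by
    simp only [cnt_eq_sum]
    rw [sum_prod_type, ← sum_add_distrib]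
    refine sum_congr rfl fun k _ => ?_
    rw [Fintype.sum_bool, add_comm]
    have : fl (a k) = e ↔ a k = fl e := hfl.eq_iff
    simp only [sOf, if_true, this]
    rfl
  exact_mod_cast h

lemma exists_family {E : Type*} [Fintype E] {m C : ℕ} {fl : E → E} (hfl : Involutive fl)
    {H : Type*} [Fintype H] (hH : card H = 2 * m) (a0 : Fin m → E) (t0 : H → E)
    (hC : ∑ e, |(cnt (sOf fl a0) e : ℝ) - cnt t0 e| ≤ C) :
    ∃ 𝒮 : Finset (Fin m × Bool → E), (∀ s ∈ 𝒮, (∀ e, cnt s e = cnt t0 e) ∧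
      ∃ a, #{x | s x ≠ sOf fl a x} ≤ C) ∧
      card {a : Fin m → E // ∀ e, cnt a e = cnt a0 e} ≤ #𝒮 * (2 * m * card E + 1) ^ C := by
  let 𝒮 : Finset (Fin m × Bool → E) := univ.filter fun s => (∀ e, cnt s e = cnt t0 e) ∧
      ∃ a, #{x | s x ≠ sOf fl a x} ≤ C
  refine ⟨𝒮, fun s hs => (mem_filter.mp hs).2, ?_⟩
  have h1 : ∀ a : {a : Fin m → E // ∀ e, cnt a e = cnt a0 e}, ∃ s ∈ 𝒮,
      #{x | s x ≠ sOf fl a.1 x} ≤ C := fun a => by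
    obtain ⟨e, he⟩ := exists_near_matching (α := Fin m × Bool) (β := H)
      (by rw [hH]; simp; ring) (sOf fl a.1) t0
    have h2 : ∀ e, cnt (sOf fl a.1) e = cnt (sOf fl a0) e := by
      intro e; rw [cnt_sOf hfl, cnt_sOf hfl, a.2, a.2]
    simp only [h2] at he
    have he' : #{x | (t0 ∘ e) x ≠ sOf fl a.1 x} ≤ C := by
      exact_mod_cast he.trans hC
    exact ⟨t0 ∘ e, mem_fil.mpr ⟨fun c => cnt_comp_equiv t0 e c, a.1, he'⟩, he'⟩
  choose g hg hg' using h1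
  rw [← card_univ]
  refine (Finset.card_le_mul_card_image_of_maps_to (f := g) (t := 𝒮) (fun a _ => hg a)
    ((2 * m * card E + 1) ^ C) fun s _ => ?_).trans (by rw [mul_comm])
  have h4 : card (Fin m × Bool) = 2 * m := by simp; ring
  rw [← h4]
  rw [← card_image_of_injOn (f := fun a => sOf fl a.1)
    (fun a _ a' _ h => Subtype.ext (sOf_inj fl h))]
  refine card_le_of_hamming s C _ fun w hw => ?_
  obtain ⟨a, ha, rfl⟩ := mem_image.mp hw
  have ha : g a = s := (mem_filter.mp ha).2
  have := hg' a
  rw [ha] at this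
  refine (le_of_eq ?_).trans this
  congr 1; ext x; simp [eq_comm]

end

section
variable {d n m R : ℕ} [NeZero d] {N : Type} [Fintype N]

lemma cnt_tX_congr (hn : 0 < n) (X X0 : Fin n → Col d R N) (h : ∀ c, cnt X c = cnt X0 c)
    (e : ECol d R N) : cnt (tX R X) e = cnt (tX R X0) e := by
  have h1 := cnt_tX R X e
  have h2 := cnt_tX R X0 e
  simp only [h] at h1
  rw [← h2] at h1
  have hpos : ((n * d : ℕ) : ℝ) ≠ 0 := by
    exact_mod_cast (Nat.mul_pos hn (Nat.pos_of_neZero d)).ne'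
  rw [div_left_inj' hpos] at h1
  exact_mod_cast h1

lemma card_ne_xcol_le (hd : 2 ≤ d) (X : Fin n → Col d R N) (π : Conf d n m)
    (a : Fin m → ECol d R N) (C : ℕ)
    (D : Finset (Fin m × Bool)) (hDC : #D ≤ C)
    (hD : ∀ x ∉ D, tX R X (π x) = sOf (flipE hd) a x) :
    ∃ B : Finset (Fin n), #B ≤ (d + 1) ^ R * (2 * C) ∧ ∀ v ∉ B, X v =
      xcol R π° (fun w => X w ⟨⟨[], validTd_nil d⟩, Nat.zero_le R⟩) v := by
  let B : Finset (Fin n) := (D.image fun x => (π x).1) ∪ (D.image fun x => (π (flipB x)).1)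
  have hB : #B ≤ 2 * C := by
    refine (card_union_le _ _).trans ?_
    have h1 := card_image_le (s := D) (f := fun x => (π x).1)
    have h2 := card_image_le (s := D) (f := fun x => (π (flipB x)).1)
    omega
  refine ⟨nbhd π° B R, (card_nbhd_le _ _ _).trans (Nat.mul_le_mul_left _ hB), fun v hv =>
    eq_xcol_of_consistent (iota_involutive π) hd R X B ?_ v hv⟩
  intro h hh
  obtain ⟨x, rfl⟩ := π.surjective h
  rw [iota_apply]
  have h1 : x ∉ D := fun hx => hh (mem_union_left _ (Finset.mem_image_of_mem _ hx))
  have h2 : flipB x ∉ D := fun hx => hh (mem_union_right _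
    (mem_image.mpr ⟨_, hx, by rw [flipB_flipB]⟩))
  rw [hD _ h1, hD _ h2]
  obtain ⟨k, b⟩ := x
  cases b <;> simp [sOf, flipB, flipE_flipE hd]

lemma card_good_conf (hn : 0 < n) {T : Type*} [Fintype T] (t : HE n d → T)
    (s : Fin m × Bool → T) (hs : ∀ c, cnt s c = cnt t c) (R' L b : ℕ)
    (hL : ∀ h, L ≤ cnt t (t h)) (hD : d * #(ballL d R') < L)
    (hb : 2 * (n * (#(ballL d R') ^ 2 * d)) ≤ b * (L - d * #(ballL d R')))
    (Ω' : Finset (Conf d n m))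
    (hΩ' : ∀ π : Conf d n m, t ∘ π = s → badCount R' π° ≤ b → π ∈ Ω') :
    ∏ c, (cnt t c)! ≤ 2 * #Ω' := by
  have h1 := sum_badCount_mul_le R' L t s hL
  set Ω := univ.filter (fun π : Conf d n m => t ∘ π = s) with hΩ
  have hc : ∏ c, (cnt t c)! = #Ω := by
    rw [← card_equiv_comp_eq s t hs]
    exact (@Nat.card_eq_fintype_card _ (_)).symm.trans
      (Nat.subtype_card Ω fun π => (@mem_filter _ _ (_) _ _).trans
        ⟨fun h => h.2, fun h => ⟨mem_univ _, h⟩⟩)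
  rw [hc]
  set D := L - d * #(ballL d R')
  have hD : 0 < D := Nat.sub_pos_of_lt hD
  set Q := n * (#(ballL d R') ^ 2 * d)
  have hQ : 0 < Q := Nat.mul_pos hn (Nat.mul_pos (pow_pos (ballL_card_pos d R') 2)
    (Nat.pos_of_neZero d))
  refine le_trans ?_ (Nat.mul_le_mul_left 2 (card_le_card
    (s := Ω.filter fun π => badCount R' π° ≤ b) fun π hπ =>
      hΩ' π (mem_filter.mp (mem_filter.mp hπ).1).2 (mem_filter.mp hπ).2))
  rw [← Finset.card_filter_add_card_filter_not (s := Ω) (fun π => badCount R' π° ≤ b)]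
  have h3 : #{π ∈ Ω | ¬ badCount R' π° ≤ b} * b ≤ ∑ π ∈ Ω, badCount R' π° := by
    rw [← smul_eq_mul]
    refine (card_nsmul_le_sum _ _ _ fun π hπ => ?_).trans
      (Finset.sum_le_sum_of_subset (Finset.filter_subset _ _))
    exact (not_le.mp (mem_filter.mp hπ).2).le
  have h4 := Finset.card_filter_add_card_filter_not (s := Ω) (fun π => badCount R' π° ≤ b)
  set u := #{π ∈ Ω | badCount R' π° ≤ b}
  set w := #{π ∈ Ω | ¬ badCount R' π° ≤ b}
  have hbD : 0 < b * D := lt_of_lt_of_le (by omega) hb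
  have h5 : (2 * w) * (b * D) ≤ #Ω * (b * D) := by
    calc (2 * w) * (b * D) = 2 * (w * b * D) := by ring
      _ ≤ 2 * (#Ω * Q) := Nat.mul_le_mul_left _ ((Nat.mul_le_mul_right _ h3).trans h1)
      _ = #Ω * (2 * Q) := by ring
      _ ≤ _ := Nat.mul_le_mul_left _ hb
  have := Nat.le_of_mul_le_mul_right h5 hbD
  omega

lemma lower_count (hd : 2 ≤ d) (hm : 2 * m = n * d) (hn : 0 < n) (X0 : Fin n → Col d R N)
    (a0 : Fin m → ECol d R N) (C R' L b : ℕ)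
    (hC : ∑ e, |(cnt (sOf (flipE hd) a0) e : ℝ) - cnt (tX R X0) e| ≤ C)
    (hL : ∀ e, cnt (tX R X0) e ≠ 0 → L ≤ cnt (tX R X0) e) (hD : d * #(ballL d R') < L)
    (hb : 2 * (n * (#(ballL d R') ^ 2 * d)) ≤ b * (L - d * #(ballL d R')))
    (Z : Finset (Conf d n m × (Fin n → N)))
    (hZ : ∀ π F, badCount R' π° ≤ b →
      l1 (phat R π° F) freq X0 n ≤ 2 * ((d + 1) ^ R * (2 * C) : ℕ) / n →
      (π, F) ∈ Z) :
    card {X : Fin n → Col d R N // ∀ c, cnt X c = cnt X0 c} *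
      card {a : Fin m → ECol d R N // ∀ e, cnt a e = cnt a0 e} *
      ∏ e, (cnt (tX R X0) e)! ≤
    2 * #Z * ((n * card (Col d R N) + 1) ^ ((d + 1) ^ R * (2 * C)) *
      (2 * m * card (ECol d R N) + 1) ^ C) := by
  obtain ⟨𝒮, h𝒮, hA⟩ := exists_family (flipE_flipE hd) (H := HE n d) (by simp [hm]) a0 (tX R X0) hC
  have hct := fun X (h : ∀ c, cnt X c = cnt X0 c) => cnt_tX_congr hn X X0 h
  set K := ∏ e, (cnt (tX R X0) e)! with hK
  let W : Finset (Fin n → Col d R N) := univ.filter fun X => ∀ c, cnt X c = cnt X0 c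
  have hW : card {X : Fin n → Col d R N // ∀ c, cnt X c = cnt X0 c} = #W := by
    rw [card_subtype]
  let Ω : (Fin n → Col d R N) → (Fin m × Bool → ECol d R N) → Finset (Conf d n m) := fun X s =>
    univ.filter fun π : Conf d n m => tX R X ∘ π = s ∧ badCount R' π° ≤ b
  have hΩ : ∀ X ∈ W, ∀ s ∈ 𝒮, K ≤ 2 * #(Ω X s) := fun X hX s hs => by
    have hX : ∀ c, cnt X c = cnt X0 c := (mem_filter.mp hX).2
    have hK' : K = ∏ e, (cnt (tX R X) e)! := prod_congr rfl fun e _ => by rw [hct X hX]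
    rw [hK']
    refine card_good_conf hn (tX R X) s (fun c => ((h𝒮 s hs).1 c).trans (hct X hX c).symm)
      R' L b (fun h => ?_) hD hb (Ω X s) fun π h1 h2 =>
        mem_fil.mpr ⟨h1, h2⟩
    · rw [hct X hX]
      refine hL _ ?_
      rw [← hct X hX]
      exact (Finset.card_pos.mpr ⟨h, (@mem_filter _ (fun a => tX R X a = tX R X h) (_) _ _).mpr
        ⟨mem_univ _, rfl⟩⟩).ne'
  let P : Finset (Σ _ : (Σ _ : Fin n → Col d R N, (Fin m × Bool → ECol d R N)), Conf d n m) :=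
    (W.sigma fun _ => 𝒮).sigma fun y => Ω y.1 y.2
  have hP : #W * #𝒮 * K ≤ 2 * #P := by
    rw [card_sigma, mul_sum]
    have : ∀ y ∈ W.sigma (fun _ => 𝒮), K ≤ 2 * #(Ω y.1 y.2) := fun y hy =>
      hΩ _ (mem_sigma.mp hy).1 _ (mem_sigma.mp hy).2
    refine le_trans ?_ (card_nsmul_le_sum _ _ _ this)
    rw [card_sigma, sum_const, smul_eq_mul, smul_eq_mul]
  let rt : ↥(SrSet d R) := ⟨⟨[], validTd_nil d⟩, Nat.zero_le R⟩
  set C4 := (d + 1) ^ R * (2 * C) with hC4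
  have hPs : ∀ y ∈ P, (∀ c, cnt y.1.1 c = cnt X0 c) ∧ badCount R' y.2° ≤ b ∧
      tX R y.1.1 ∘ y.2 = y.1.2 ∧ ∃ B : Finset (Fin n), #B ≤ C4 ∧ ∀ v ∉ B, y.1.1 v =
      xcol R y.2° (fun w => y.1.1 w rt) v := fun y hy => by
    have h1 := mem_sigma.mp hy
    have h2 := mem_sigma.mp h1.1
    have h3 := (mem_filter.mp h1.2).2
    obtain ⟨a, ha⟩ := (h𝒮 _ h2.2).2
    refine ⟨(mem_filter.mp h2.1).2, h3.2, h3.1, card_ne_xcol_le hd _ _ a C _ ha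
      fun x hx => (congrFun h3.1 x).trans (by_contra fun hne => hx
        ((@mem_filter _ _ (_) _ _).mpr ⟨mem_univ _, hne⟩))⟩
  have hmap : #P ≤ (n * card (Col d R N) + 1) ^ C4 * #Z := by
    refine Finset.card_le_mul_card_image_of_maps_to
      (f := fun y => (y.2, fun w => y.1.1 w rt)) (t := Z) ?_ _ ?_
    · intro y hy
      obtain ⟨h1, h2, -, B, hB, hB'⟩ := hPs y hy
      refine hZ _ _ h2 ?_
      have h5 := l1_cnt_div_le (xcol R y.2° (fun w => y.1.1 w rt)) y.1.1 B
        (fun v hv => (hB' v hv).symm) n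
      simp only [h1] at h5
      refine h5.trans ?_
      have : (#B : ℝ) ≤ C4 := mod_cast hB
      gcongr
    · rintro ⟨π, F⟩ -
      set S := P.filter fun y => (y.2, fun w => y.1.1 w rt) = (π, F)
      have hS : ∀ y ∈ S, y ∈ P ∧ y.2 = π ∧ (fun w => y.1.1 w rt) = F := fun y hy =>
        ⟨(mem_filter.mp hy).1, congrArg Prod.fst (mem_filter.mp hy).2,
          congrArg Prod.snd (mem_filter.mp hy).2⟩
      have hinj : Set.InjOn (fun y : (Σ _ : (Σ _ : Fin n → Col d R N,
          (Fin m × Bool → ECol d R N)), Conf d n m) => y.1.1) S := by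
        rintro ⟨⟨X, s⟩, π1⟩ hy ⟨⟨X', s'⟩, π2⟩ hy' (rfl : X = X')
        obtain ⟨h1, rfl, -⟩ := hS _ hy
        obtain ⟨h2, h3, -⟩ := hS _ hy'
        have h3 : π2 = π1 := h3
        subst h3
        have h4 := (hPs _ h1).2.2.1
        have h5 := (hPs _ h2).2.2.1
        have : s = s' := h4.symm.trans h5
        rw [this]
      rw [← card_image_of_injOn hinj]
      have := card_le_of_hamming (xcol R π° F) C4 (S.image fun y => y.1.1) ?_
      · simpa using this
      · intro X hX
        obtain ⟨y, hy, rfl⟩ := mem_image.mp hX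
        obtain ⟨h1, h2, h3⟩ := hS _ hy
        obtain ⟨-, -, -, B, hB, hB'⟩ := hPs y h1
        refine (card_le_card fun v hv => ?_).trans hB
        by_contra hvB
        refine ((@mem_filter _ _ (_) _ _).mp hv).2 ?_
        rw [← h2, ← h3]
        exact hB' v hvB
  rw [hW]
  calc #W * card {a : Fin m → ECol d R N // ∀ e, cnt a e = cnt a0 e} * K
      ≤ #W * (#𝒮 * (2 * m * card (ECol d R N) + 1) ^ C) * K := by gcongr
    _ = (#W * #𝒮 * K) * (2 * m * card (ECol d R N) + 1) ^ C := by ring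
    _ ≤ (2 * ((n * card (Col d R N) + 1) ^ C4 * #Z)) *
        (2 * m * card (ECol d R N) + 1) ^ C := Nat.mul_le_mul_right _ (hP.trans (Nat.mul_le_mul_left _ hmap))
    _ = _ := by ring

end

section
variable {d : ℕ} [NeZero d] {N : Type} [Fintype N]

lemma exists_l1_modulus {T : Type*} [Fintype T] {g : (T → ℝ) → ℝ} (hg : Continuous g) (q : T → ℝ)
    {ε : ℝ} (hε : 0 < ε) : ∃ κ > 0, ∀ x, l1 x q ≤ κ → |g x - g q| ≤ ε := by
  obtain ⟨κ, hκ, h⟩ := Metric.continuousAt_iff.mp hg.continuousAt ε hε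
  refine ⟨κ / 2, by positivity, fun x hx => (h ?_).le⟩
  rw [dist_pi_lt_iff hκ]
  intro a
  rw [Real.dist_eq]
  exact (abs_sub_le_l1 x q a).trans_lt (by linarith)

lemma l1_Tv_le {R : ℕ} (q q' : Col d R N → ℝ) (e : ECol d R N) :
    |Tv q e - Tv q' e| ≤ l1 q q' := by
  have hd : (0:ℝ) < d := mod_cast Nat.pos_of_neZero d
  unfold Tv
  rw [← mul_sub, ← sum_sub_distrib, abs_mul, abs_of_pos (by positivity : (0:ℝ) < 1 / d)]
  have h : |∑ a : Fin d, (pf (etyp R a) q e - pf (etyp R a) q' e)| ≤ d * l1 q q' := by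
    refine (abs_sum_le_sum_abs _ _).trans ?_
    refine (sum_le_card_nsmul _ _ (l1 q q') fun a _ =>
      (abs_sub_le_l1 _ _ e).trans (l1_pf_le _ _ _)).trans ?_
    simp
  calc (1 / d : ℝ) * _ ≤ 1 / d * (d * l1 q q') := by gcongr
    _ = l1 q q' := by field_simp

lemma Tv_nonneg {R : ℕ} {q : Col d R N → ℝ} (hq : ∀ c, 0 ≤ q c) (e : ECol d R N) : 0 ≤ Tv q e := by
  unfold Tv
  exact mul_nonneg (by positivity) (sum_nonneg fun a _ => pf_nonneg _ _ hq e)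

lemma sum_Tv {R : ℕ} (q : Col d R N → ℝ) : ∑ e, Tv q e = ∑ c, q c := by
  have hd : (0:ℝ) < d := mod_cast Nat.pos_of_neZero d
  unfold Tv
  rw [← mul_sum, sum_comm]
  simp only [sum_pf, sum_const, card_univ, card_fin, nsmul_eq_mul]
  field_simp

lemma exists_pos_le {T : Type*} [Fintype T] (q : T → ℝ) (hq : ∀ c, 0 ≤ q c) :
    ∃ κ > 0, ∀ c, q c ≠ 0 → κ ≤ q c := by
  have h : ∀ᶠ κ : ℝ in 𝓝[>] 0, ∀ c, q c ≠ 0 → κ ≤ q c := by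
    rw [eventually_all]
    intro c
    by_cases hc : q c = 0
    · simp [hc]
    · filter_upwards [Ioo_mem_nhdsGT ((hq c).lt_of_ne' hc)] with κ hκ _ using hκ.2.le
  obtain ⟨κ, hκ, h'⟩ := (h.and self_mem_nhdsWithin).exists
  grind

lemma exists_of_cnt_ne_zero {α T : Type*} [Fintype α] {w : α → T} {c : T} (h : cnt w c ≠ 0) :
    ∃ a, w a = c := by
  obtain ⟨a, ha⟩ := Finset.card_pos.mp (Nat.pos_of_ne_zero h)
  grind

lemma cnt_self_ne_zero {α T : Type*} [Fintype α] (w : α → T) (a : α) : cnt w (w a) ≠ 0 :=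
  (Finset.card_pos.mpr ⟨a, mem_filter (p := fun b => w b = w a).mpr ⟨mem_univ _, rfl⟩⟩).ne'

lemma le_cnt_tX {n R : ℕ} (X : Fin n → Col d R N) (h : HE n d) :
    cnt X (X h.1) ≤ cnt (tX R X) (tX R X h) := by
  refine card_le_card_of_injOn (fun v => (v, h.2)) (fun v hv => ?_) (fun v _ w _ hvw => ?_)
  · have hv : X v = X h.1 := ((@mem_filter _ _ (_) _ _).mp hv).2
    refine (@mem_filter _ (fun a => tX R X a = tX R X h) (_) _ _).mpr ⟨mem_univ _, ?_⟩
    simp [tX, hv]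
  grind

lemma l1_le_card_mul {T : Type*} [Fintype T] (q q' : T → ℝ) (K : ℝ)
    (h : ∀ c, |q c - q' c| ≤ K) : l1 q q' ≤ card T * K := by
  refine (sum_le_card_nsmul _ _ K fun c _ => h c).trans ?_
  simp

lemma l1_div_le {T : Type*} [Fintype T] {k : T → ℕ} {q : T → ℝ} {K : ℝ} {n : ℕ} (hn : 0 < n)
    (h : ∀ c, |(k c : ℝ) - n * q c| ≤ K) :
    l1 (fun c => (k c : ℝ) / n) q ≤ card T * K / n := by
  have hn' : (0:ℝ) < n := mod_cast hn
  rw [mul_div_assoc]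
  refine l1_le_card_mul _ _ _ fun c => ?_
  have : (k c : ℝ) / n - q c = (k c - n * q c) / n := by field_simp
  rw [this, abs_div, abs_of_pos hn']
  gcongr
  exact h c

lemma lower_bound_arith {n m d e1 e2 e3 A A2 K Z P1 P2 p3 Q F δ s : ℝ} (hP1 : 0 ≤ P1) (hP2 : 0 ≤ P2) (hF : 0 < F) (hK : 0 < K)
    (hm : 2 * m = n * d) (h1 : exp (n * e1) ≤ A * P1) (h2 : exp (m * e2) ≤ A2 * P2)
    (h3 : log F - n * d * e3 - p3 ≤ log K) (hc : A * A2 * K ≤ 2 * Z * Q)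
    (hG : P1 * P2 * exp p3 * (2 * Q) ≤ exp (δ * n)) (hZ : 0 ≤ Z)
    (hs : n * s + δ * n ≤ n * e1 + n * d / 2 * e2 - n * d * e3) :
    F * exp (n * s) ≤ Z := by
  have h3' : F * exp (-(n * d * e3)) ≤ K * exp p3 := by
    rw [Real.le_log_iff_exp_le hK] at h3
    calc F * exp (-(n * d * e3)) = exp (log F - n * d * e3 - p3) * exp p3 := by
          rw [← exp_add, ← exp_log hF, ← exp_add, log_exp]; ring_nf
      _ ≤ _ := by gcongr
  have h4 : F * exp (n * e1 + n * d / 2 * e2 - n * d * e3) ≤ Z * exp (δ * n) := by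
    calc F * exp (n * e1 + n * d / 2 * e2 - n * d * e3)
        = exp (n * e1) * exp (m * e2) * (F * exp (-(n * d * e3))) := by
          rw [sub_eq_add_neg, exp_add, exp_add, show n * d / 2 = m by linarith]; ring
      _ ≤ (A * P1) * (A2 * P2) * (K * exp p3) := by
          refine mul_le_mul (mul_le_mul h1 h2 (exp_pos _).le
            ((exp_pos _).le.trans h1)) h3' (by positivity) ?_
          exact mul_nonneg ((exp_pos _).le.trans h1) ((exp_pos _).le.trans h2)
      _ = (A * A2 * K) * (P1 * P2 * exp p3) := by ring
      _ ≤ (2 * Z * Q) * (P1 * P2 * exp p3) := by gcongr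
      _ = Z * (P1 * P2 * exp p3 * (2 * Q)) := by ring
      _ ≤ _ := by gcongr
  have h5 : F * exp (n * s) * exp (δ * n) ≤ Z * exp (δ * n) := by
    refine le_trans ?_ h4
    rw [mul_assoc, ← exp_add]
    gcongr
  exact le_of_mul_le_mul_right h5 (exp_pos _)

set_option maxHeartbeats 800000 in
theorem lower_bound (hd : 2 ≤ d) {R : ℕ} {q : Col d R N → ℝ} (hq : q ∈ KSet hd R N) (R' : ℕ)
    {δ η : ℝ} (hδ : 0 < δ) (hη : 0 < η) :
    ∀ᶠ n : ℕ in atTop, ∀ m, 2 * m = n * d → ∀ Z : Finset (Conf d n m × (Fin n → N)),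
      (∀ π F, (badCount R' π° : ℝ) ≤ η * n → l1 (phat R π° F) q ≤ η → (π, F) ∈ Z) →
      ((n * d)! : ℝ) * exp (n * (entJ q - δ)) ≤ #Z := by
  obtain ⟨hq0, hq1, hqf⟩ := hq
  have hd0 : 0 < d := Nat.pos_of_neZero d
  set T := card (Col d R N) with hT
  set E := card (ECol d R N) with hE
  obtain ⟨c1, hc1, hqmin⟩ := exists_pos_le q hq0
  obtain ⟨κ1, hκ1, hent1⟩ := exists_l1_modulus continuous_ent q (ε := δ / 8) (by positivity)
  obtain ⟨κ2, hκ2, hent2⟩ := exists_l1_modulus continuous_ent (Tv q) (ε := δ / (8 * d))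
    (by positivity)
  set C := E * (2 * E + d * (T * T)) with hC
  set C4 := (d + 1) ^ R * (2 * C) with hC4
  set Bl := #(ballL d R') with hBl
  obtain ⟨b, hb⟩ := exists_nat_ge (4 * ((Bl : ℝ) ^ 2 * d) / c1)
  have hsub : SubExp fun n => (exp (T * (1 + 2 * log (1 * n + 1))) *
      exp (E * (1 + 2 * log (d * n + 1)))) *
      exp ((1:ℕ) * (1 + 2 * log (d * n + 1))) * ((2 * ((n:ℝ) + 1) ^ 0) *
      (((T:ℝ) * n + 1) ^ C4 * (((d * E : ℕ) : ℝ) * n + 1) ^ C)) :=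
    (((subExp_exp_log zero_le_one T).mul (subExp_exp_log (Nat.cast_nonneg d) E)).mul
      (subExp_exp_log (Nat.cast_nonneg d) 1)).mul ((subExp_poly zero_le_two 0).mul
      ((subExp_linear (Nat.cast_nonneg T) C4).mul (subExp_linear (Nat.cast_nonneg _) C)))
  have hlarge : ∀ K : ℝ, ∀ᶠ n : ℕ in atTop, K ≤ n := fun K =>
    tendsto_natCast_atTop_atTop.eventually (eventually_ge_atTop K)
  filter_upwards [hsub.2 (δ / 2) (by positivity), eventually_ge_atTop 2,
    hlarge ((2 * (T + 1 + d * Bl) + 2) / c1), hlarge (b / η), hlarge ((2 * C4 + T * T) / η),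
    hlarge (T * T / κ1), hlarge (E * (T * T) / κ2), hlarge (E * E / κ2)] with n hG hn2 hnc hnb hnη hnκ1 hnκ2 hnE
  intro m hm Z hZ
  have hn : 0 < n := by omega
  have hn' : (0:ℝ) < n := mod_cast hn
  have hmn : n ≤ m := by have := Nat.mul_le_mul_left n hd; omega
  have hm0 : 0 < m := by omega
  have hm' : (0:ℝ) < m := mod_cast hm0
  have hmR : (2:ℝ) * m = n * d := mod_cast hm
  have hdR : (0:ℝ) < d := mod_cast hd0
  have hmnR : (n:ℝ) ≤ m := mod_cast hmn
  rw [div_le_iff₀ (by positivity)] at hnc hnb hnη hnκ1 hnκ2 hnE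
  obtain ⟨X0, hX0⟩ := exists_word_near q hq0 hq1 n
  obtain ⟨a0, ha0⟩ := exists_word_near (Tv q) (Tv_nonneg hq0) (by rw [sum_Tv, hq1]) m
  have hl1q : l1 freq X0 n q ≤ T * T / n := l1_div_le hn fun c => (hX0 c).1
  have hl1a : l1 freq a0 m (Tv q) ≤ E * E / m := l1_div_le hm0 fun c => (ha0 c).1
  have ht0 : ∀ e, |(cnt (tX R X0) e : ℝ) - (n * d : ℕ) * Tv q e| ≤ d * (T * T) := fun e => by
    have h1 := (l1_Tv_le freq X0 n q e).trans hl1q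
    rw [← cnt_tX] at h1
    have h2 : (cnt (tX R X0) e : ℝ) - (n * d : ℕ) * Tv q e =
        (n * d : ℝ) * ((cnt (tX R X0) e : ℝ) / (n * d : ℕ) - Tv q e) := by
      push_cast; field_simp
    rw [h2, abs_mul, abs_of_pos (by positivity)]
    calc (n * d : ℝ) * _ ≤ n * d * (T * T / n) := by gcongr
      _ = _ := by field_simp
  have hCle : ∑ e, |(cnt (sOf (flipE hd) a0) e : ℝ) - cnt (tX R X0) e| ≤ C := by
    have h1 : ∀ e, |(cnt (sOf (flipE hd) a0) e : ℝ) - cnt (tX R X0) e| ≤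
        2 * E + d * (T * T) := fun e => by
      have h2 := ht0 e
      have h3 := (ha0 e).1
      have h4 := (ha0 (flipE hd e)).1
      rw [hqf] at h4
      rw [cnt_sOf (flipE_flipE hd)]
      push_cast at h2 ⊢
      rw [← hmR] at h2
      rw [abs_le] at *
      grind
    refine (sum_le_card_nsmul _ _ _ fun e _ => h1 e).trans ?_
    rw [nsmul_eq_mul, hC]; push_cast; exact le_of_eq rfl
  set L := ⌊n * c1 - T⌋₊ with hL
  have hLge : n * c1 - T - 1 ≤ (L : ℝ) := (Nat.sub_one_lt_floor _).le
  have hLD : (n * c1) / 2 + d * Bl ≤ L := by linarith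
  have hLle : ∀ e, cnt (tX R X0) e ≠ 0 → L ≤ cnt (tX R X0) e := fun e he => by
    obtain ⟨h, rfl⟩ := exists_of_cnt_ne_zero he
    refine le_trans ?_ (le_cnt_tX X0 h)
    have h0 : cnt X0 (X0 h.1) ≠ 0 := cnt_self_ne_zero X0 h.1
    have h1 := hqmin (X0 h.1) fun h => h0 ((hX0 _).2 h)
    have h2 := (abs_le.mp (hX0 (X0 h.1)).1).1
    have h3 := mul_le_mul_of_nonneg_left h1 hn'.le
    refine Nat.floor_le_of_le ?_
    linarith
  have hDlt : d * Bl < L := by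
    have : (d * Bl : ℝ) < L := lt_of_lt_of_le
      (lt_add_of_pos_left _ (half_pos (mul_pos hn' hc1))) hLD
    exact_mod_cast this
  have hbL : 2 * (n * (Bl ^ 2 * d)) ≤ b * (L - d * Bl) := by
    have h1 : ((2 * (n * (Bl ^ 2 * d)) : ℕ) : ℝ) ≤ ((b * (L - d * Bl) : ℕ) : ℝ) := by
      push_cast [Nat.cast_sub hDlt.le]
      rw [div_le_iff₀ hc1] at hb
      calc (2 * (n * (Bl ^ 2 * d)) : ℝ) = (4 * (Bl ^ 2 * d)) * n / 2 := by ring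
        _ ≤ (b * c1) * n / 2 := by gcongr
        _ = b * (n * c1 / 2) := by ring
        _ ≤ b * (L - d * Bl) := by gcongr; linarith
    exact_mod_cast h1
  have hcount := lower_count hd hm hn X0 a0 C R' L b hCle hLle hDlt hbL Z fun π F h1 h2 => by
    refine hZ π F ?_ ?_
    · have : (badCount R' π° : ℝ) ≤ b := mod_cast h1
      linarith
    · refine (l1_triangle _ freq X0 n _).trans ?_
      have : (2 * ((d + 1) ^ R * (2 * C) : ℕ) / n : ℝ) + T * T / n ≤ η := by
        rw [← add_div, div_le_iff₀ hn']
        linarith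
      linarith
  have hw1 := le_card_words X0 (by simpa using hn)
  have hw2 := le_card_words a0 (by simpa using hm0)
  rw [card_fin, ← @Nat.card_eq_fintype_card _ (_)] at hw1 hw2
  rw [← @Nat.card_eq_fintype_card {X : Fin n → Col d R N // ∀ c, cnt X c = cnt X0 c} (_),
    ← @Nat.card_eq_fintype_card {a : Fin m → ECol d R N // ∀ e, cnt a e = cnt a0 e} (_)] at hcount
  have hw3 := le_log_prod_factorial (fun e => cnt (tX R X0) e) (n * d) (Nat.mul_pos hn hd0)
    (by rw [sum_cnt]; simp)
  have hKpos : (0:ℝ) < ∏ e, ((cnt (tX R X0) e)! : ℝ) := prod_pos fun e _ => by positivity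
  have hfac : (0:ℝ) < ((n * d)! : ℝ) := by positivity
  have hTv : freq (tX R X0) (n * d : ℕ) = Tv freq X0 n :=
    funext fun e => cnt_tX R X0 e
  rw [hTv] at hw3
  have he1 := (abs_le.mp (hent1 _ (hl1q.trans ((div_le_iff₀ hn').mpr (by linarith))))).1
  have he2 := (abs_le.mp (hent2 _ (hl1a.trans ((div_le_iff₀ hm').mpr
    (hnE.trans ((mul_le_mul_of_nonneg_right hmnR hκ2.le).trans (mul_comm _ _).le)))))).1
  have he3 := (abs_le.mp (hent2 (Tv freq X0 n) ?_)).2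
  · refine lower_bound_arith (m := m) (d := d) (δ := δ / 2)
      (e3 := ent (Tv freq X0 n)) (exp_pos _).le
      (exp_pos _).le hfac hKpos hmR hw1 hw2 (p3 := 1 + 2 * log ((n * d : ℕ) + 1))
      (Q := ((T:ℝ) * n + 1) ^ C4 * (((d * E : ℕ) : ℝ) * n + 1) ^ C) ?_ ?_ ?_ (Nat.cast_nonneg _) ?_
    · exact_mod_cast hw3
    · have := (Nat.cast_le (α := ℝ)).mpr hcount
      push_cast at this
      rw [hmR] at this
      grind
    · refine le_trans (le_of_eq_of_le ?_ (mul_le_mul_of_nonneg_right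
        (mul_le_mul_of_nonneg_right (mul_le_mul_of_nonneg_left (?_ : exp (E * (1 + 2 * log (m + 1))) ≤ exp (E * (1 + 2 * log (d * n + 1)))) (exp_pos (T * (1 + 2 * log (1 * n + 1)))).le)
        (exp_pos ((1:ℕ) * (1 + 2 * log (d * n + 1)))).le) ?_)) hG
      · grind
      · have : (m:ℝ) ≤ d * n := by grind
        gcongr
      · positivity
    · have h1 : entJ q = ent q - d / 2 * ent (Tv q) := rfl
      rw [h1]
      have h2 : (d:ℝ) * (δ / (8 * d)) = δ / 8 := by field_simp
      have h3 : (d:ℝ) * -(δ / (8 * d)) ≤ d * (ent freq a0 m - ent (Tv q)) :=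
        mul_le_mul_of_nonneg_left he2 hdR.le
      have h4 : (d:ℝ) * (ent (Tv freq X0 n) - ent (Tv q)) ≤ d * (δ / (8 * d)) :=
        mul_le_mul_of_nonneg_left he3 hdR.le
      have h5 : ent q - d / 2 * ent (Tv q) - δ + δ / 2 ≤ ent freq X0 n +
          d / 2 * ent freq a0 m - d * ent (Tv freq X0 n) := by
        linarith
      have h6 := mul_le_mul_of_nonneg_left h5 hn'.le
      linarith
  · refine (l1_le_card_mul _ _ _ fun e => (l1_Tv_le _ q e).trans hl1q).trans ?_
    rw [← mul_div_assoc, div_le_iff₀ hn']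
    linarith

end

section
variable {d n : ℕ} [NeZero d] {ι ι' : HMap n d} {v : Fin n} {R : ℕ}

lemma Simple.adj_pos_cons (hι : Simple ι) (v : Fin n) (j : ℕ) (l : List ℕ) :
    (gr ι).Adj (pos ι v l) (pos ι v (j :: l)) := hι.adj (out ι v l j)

lemma Simple.exists_of_adj_pos (hι : Simple ι) {l : List ℕ} (hl : ValidTd d l) {x : Fin n}
    (h : (gr ι).Adj (pos ι v l) x) :
    (∃ j l₀, l = j :: l₀ ∧ x = pos ι v l₀) ∨ ∃ j, ValidTd d (j :: l) ∧ x = pos ι v (j :: l) := by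
  obtain ⟨i, hi⟩ := (hι.adj_iff _ _).mp h
  by_cases hb : (st ι v l).2 = some i
  · left
    cases l with
    | nil => simp [st] at hb
    | cons j l₀ =>
      refine ⟨j, l₀, rfl, ?_⟩
      rw [st_cons] at hb
      have hb' : (ι (out ι v l₀ j)).2 = i := by simpa using hb
      have : ((pos ι v (j :: l₀), i) : HE n d) = ι (out ι v l₀ j) := by
        rw [pos_cons, ← hb']
      rw [this, hι.invol] at hi
      exact hi.symm
  · right
    obtain ⟨j, hj, hs⟩ := exists_skipLab hb
    refine ⟨j, (validTd_cons_iff ι v).mpr ⟨hl, hj⟩, ?_⟩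
    rw [pos_cons, out, hs, hi]

lemma Simple.exists_pos_eq_iff (hι : Simple ι) (k : ℕ) (x : Fin n) :
    (∃ l ∈ ballL d k, pos ι v l = x) ↔ ∃ p : (gr ι).Walk v x, p.length ≤ k := by
  induction k generalizing x with
  | zero =>
    constructor
    · rintro ⟨l, hl, rfl⟩
      have : l = [] := List.length_eq_zero_iff.mp (Nat.le_zero.mp (mem_ballL.mp hl).2)
      subst this
      exact ⟨SimpleGraph.Walk.nil, le_rfl⟩
    · rintro ⟨p, hp⟩
      have := SimpleGraph.Walk.eq_of_length_eq_zero (Nat.le_zero.mp hp)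
      exact ⟨[], nil_mem_ballL d 0, this⟩
  | succ k ih =>
    constructor
    · rintro ⟨l, hl, rfl⟩
      obtain ⟨hv, hlen⟩ := mem_ballL.mp hl
      cases l with
      | nil => exact ⟨SimpleGraph.Walk.nil, Nat.zero_le _⟩
      | cons j l =>
        obtain ⟨p, hp⟩ := (ih (pos ι v l)).mp ⟨l, mem_ballL.mpr ⟨hv.tail, by simpa using hlen⟩, rfl⟩
        exact ⟨p.concat (hι.adj_pos_cons v j l), by rw [SimpleGraph.Walk.length_concat]; omega⟩
    · rintro ⟨p, hp⟩
      have hq : p.reverse.length ≤ k + 1 := by rwa [SimpleGraph.Walk.length_reverse]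
      generalize p.reverse = q at hq
      cases q with
      | nil => exact ⟨[], nil_mem_ballL d _, rfl⟩
      | cons hadj q' =>
        rw [SimpleGraph.Walk.length_cons] at hq
        obtain ⟨l, hl, hlx⟩ := (ih _).mpr ⟨q'.reverse, by
          rw [SimpleGraph.Walk.length_reverse]; omega⟩
        obtain ⟨hv, hlen⟩ := mem_ballL.mp hl
        subst hlx
        rcases hι.exists_of_adj_pos hv hadj.symm with ⟨j, l₀, rfl, hx⟩ | ⟨j, hj, hx⟩
        · refine ⟨l₀, mem_ballL.mpr ⟨hv.tail, ?_⟩, hx.symm⟩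
          simp only [List.length_cons] at hlen; omega
        · refine ⟨j :: l, mem_ballL.mpr ⟨hj, ?_⟩, hx.symm⟩
          simp only [List.length_cons]; omega

lemma Simple.reachable_pos (hι : Simple ι) (v : Fin n) (l : List ℕ) :
    (gr ι).Reachable v (pos ι v l) := by
  induction l with
  | nil => exact SimpleGraph.Reachable.refl _
  | cons j l ih => exact ih.trans (hι.adj_pos_cons v j l).reachable

lemma Simple.dist_pos (hι : Simple ι) (hT : TreeLike R ι v) {l : List ℕ} (hl : l ∈ ballL d R) :
    (gr ι).dist v (pos ι v l) = l.length := by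
  obtain ⟨hv, hlen⟩ := mem_ballL.mp hl
  apply le_antisymm
  · obtain ⟨p, hp⟩ := (hι.exists_pos_eq_iff l.length (pos ι v l)).mp
      ⟨l, mem_ballL.mpr ⟨hv, le_rfl⟩, rfl⟩
    exact (SimpleGraph.dist_le p).trans hp
  · obtain ⟨p, hp⟩ := (hι.reachable_pos v l).exists_walk_length_eq_dist
    obtain ⟨l', hl', he⟩ := (hι.exists_pos_eq_iff _ (pos ι v l)).mpr ⟨p, le_rfl⟩
    obtain ⟨hv', hlen'⟩ := mem_ballL.mp hl'
    by_contra hlt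
    have : l' = l := hT (mem_ballL.mpr ⟨hv', by omega⟩) hl he
    subst this; omega

lemma Simple.exists_pos_eq (hι : Simple ι) {x : Fin n} {k : ℕ} (hx : (gr ι).Reachable v x)
    (hk : (gr ι).dist v x ≤ k) : ∃ l ∈ ballL d k, pos ι v l = x := by
  obtain ⟨p, hp⟩ := hx.exists_walk_length_eq_dist
  exact (hι.exists_pos_eq_iff k x).mpr ⟨p, hp.trans_le hk⟩

lemma Simple.adj_pos_iff (hι : Simple ι) (hT : TreeLike R ι v) {l l' : List ℕ}
    (hl : l ∈ ballL d R) (hl' : l' ∈ ballL d R) (hlt : l.length < R) :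
    (gr ι).Adj (pos ι v l) (pos ι v l') ↔ (∃ j, l' = j :: l) ∨ ∃ j, l = j :: l' := by
  obtain ⟨hv, hlen⟩ := mem_ballL.mp hl
  constructor
  · intro h
    rcases hι.exists_of_adj_pos hv h with ⟨j, l₀, rfl, hx⟩ | ⟨j, hj, hx⟩
    · right
      refine ⟨j, ?_⟩
      have : l' = l₀ := hT hl' (mem_ballL.mpr ⟨hv.tail, by simp at hlen; omega⟩) hx
      rw [this]
    · left
      exact ⟨j, hT hl' (mem_ballL.mpr ⟨hj, by simp; omega⟩) hx⟩
  · rintro (⟨j, rfl⟩ | ⟨j, rfl⟩)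
    · exact hι.adj_pos_cons v j l
    · exact (hι.adj_pos_cons v j l').symm

lemma Simple.image_pos_eq (hι : Simple ι) (hι' : Simple ι') (hg : gr ι = gr ι') (k : ℕ) :
    (ballL d k).image (pos ι v) = (ballL d k).image (pos ι' v) := by
  ext x
  rw [mem_image, mem_image, hι.exists_pos_eq_iff, hι'.exists_pos_eq_iff, hg]

lemma Simple.treeLike_of_gr_eq (hι : Simple ι) (hι' : Simple ι') (hg : gr ι = gr ι')
    (hT : TreeLike R ι v) : TreeLike R ι' v := by
  have h1 := card_image_of_injOn hT
  rw [hι.image_pos_eq hι' hg] at h1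
  exact Finset.card_image_iff.mp h1

lemma Simple.badCount_eq_of_gr_eq (hι : Simple ι) (hι' : Simple ι') (hg : gr ι = gr ι') (R : ℕ) :
    badCount R ι = badCount R ι' := by
  unfold badCount
  congr 1
  ext v
  simp only [mem_filter, mem_univ, true_and, not_iff_not]
  exact ⟨hι.treeLike_of_gr_eq hι' hg, hι'.treeLike_of_gr_eq hι hg.symm⟩

lemma Simple.srGraph_adj_iff (hι : Simple ι) (hT : TreeLike R ι v) (a b : ↥(SrSet d R)) :
    (SrGraph d R).Adj a b ↔
      ((gr ι).Adj (pos ι v a.1.1) (pos ι v b.1.1) ∧ a.1.1.length ≠ b.1.1.length) := by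
  have hmem : ∀ u : ↥(SrSet d R), u.1.1 ∈ ballL d R := fun u => mem_ballL.mpr ⟨u.1.2, u.2⟩
  have ha := (mem_ballL.mp (hmem a)).2
  have hb := (mem_ballL.mp (hmem b)).2
  have h0 : (SrGraph d R).Adj a b ↔ (∃ j, b.1.1 = j :: a.1.1) ∨ ∃ j, a.1.1 = j :: b.1.1 := by
    change (∃ j, _) ∨ (∃ j, _) ↔ _
    exact Iff.rfl
  rw [h0]
  by_cases hR : a.1.1.length < R
  · rw [hι.adj_pos_iff hT (hmem a) (hmem b) hR]
    refine ⟨fun h => ⟨h, ?_⟩, fun h => h.1⟩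
    rcases h with ⟨j, h⟩ | ⟨j, h⟩ <;> rw [h] <;> simp
  · by_cases hR' : b.1.1.length < R
    · rw [SimpleGraph.adj_comm, hι.adj_pos_iff hT (hmem b) (hmem a) hR', or_comm]
      refine ⟨fun h => ⟨h, ?_⟩, fun h => h.1⟩
      rcases h with ⟨j, h⟩ | ⟨j, h⟩ <;> rw [h] <;> simp
    · constructor
      · rintro (⟨j, h⟩ | ⟨j, h⟩) <;>
        · have := congrArg List.length h
          simp only [List.length_cons] at this; omega
      · intro h; omega

lemma exists_chart_iso (hι : Simple ι) (hι' : Simple ι') (hg : gr ι = gr ι')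
    (hT : TreeLike R ι v) : ∃ γ : SrAut d R,
      ∀ u : ↥(SrSet d R), pos ι' v u.1.1 = pos ι v (γ u).1.1 := by
  have hT' := hι.treeLike_of_gr_eq hι' hg hT
  have hmem : ∀ u : ↥(SrSet d R), u.1.1 ∈ ballL d R := fun u => mem_ballL.mpr ⟨u.1.2, u.2⟩
  have hex : ∀ u : ↥(SrSet d R), ∃ w : ↥(SrSet d R), pos ι' v u.1.1 = pos ι v w.1.1 := fun u => by
    have : pos ι' v u.1.1 ∈ (ballL d R).image (pos ι v) := by
      rw [hι.image_pos_eq hι' hg]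
      exact Finset.mem_image_of_mem _ (hmem u)
    obtain ⟨l, hl, he⟩ := mem_image.mp this
    exact ⟨⟨⟨l, (mem_ballL.mp hl).1⟩, (mem_ballL.mp hl).2⟩, he.symm⟩
  choose γ hγ using hex
  have hinj : Injective γ := fun u u' h => by
    have : u.1.1 = u'.1.1 := hT' (hmem u) (hmem u') (by rw [hγ, hγ, h])
    exact Subtype.ext (Subtype.ext this)
  have hlen : ∀ u, (γ u).1.1.length = u.1.1.length := fun u => by
    rw [← hι.dist_pos hT (hmem (γ u)), ← hγ, hg, hι'.dist_pos hT' (hmem u)]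
  refine ⟨⟨ofBijective γ (Finite.injective_iff_bijective.mp hinj), ?_⟩, hγ⟩
  intro a b
  change (SrGraph d R).Adj (γ a) (γ b) ↔ _
  rw [hι.srGraph_adj_iff hT, hι'.srGraph_adj_iff hT', ← hγ, ← hγ, hlen, hlen, hg]

lemma st_of_intertwine (hι : Simple ι) (hι' : Simple ι') (θ : Fin n → Fin n)
    (hθ : ∀ l, ValidTd d l → l.length < R → ∀ k,
      (ι' (θ (pos ι v l), k)).1 = θ (ι (pos ι v l, k)).1) {l : List ℕ} (hl : ValidTd d l)
    (hR : l.length ≤ R) :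
    pos ι' (θ v) l = θ (pos ι v l) ∧ (l.length < R → (st ι' (θ v) l).2 = (st ι v l).2) := by
  induction l with
  | nil => exact ⟨rfl, fun _ => rfl⟩
  | cons j l ih =>
    have hR' : l.length < R := by simpa using hR
    obtain ⟨h1, h2⟩ := ih hl.tail hR'.le
    have h2 := h2 hR'
    have ho : out ι' (θ v) l j = (θ (pos ι v l), (out ι v l j).2) := by
      rw [out, out, h1, h2]
    have hp : pos ι' (θ v) (j :: l) = θ (pos ι v (j :: l)) := by
      rw [pos_cons, ho, hθ l hl.tail hR']; rfl
    refine ⟨hp, fun hlt => ?_⟩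
    refine congrArg some (hι'.injective (θ (pos ι v (j :: l))) ?_)
    change (ι' (θ (pos ι v (j :: l)), (ι' (out ι' (θ v) l j)).2)).1
      = (ι' (θ (pos ι v (j :: l)), (ι (out ι v l j)).2)).1
    rw [hθ _ hl hlt (ι (out ι v l j)).2]
    have e1 : ((θ (pos ι v (j :: l)), (ι' (out ι' (θ v) l j)).2) : HE n d)
        = ι' (out ι' (θ v) l j) := by rw [← hp, pos_cons]
    have e2 : ((pos ι v (j :: l), (ι (out ι v l j)).2) : HE n d)
        = ι (out ι v l j) := by rw [pos_cons]
    rw [e1, e2, hι'.invol, hι.invol, ho]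
    rfl

end

section
variable {d n : ℕ} [NeZero d] {Ω N : Type} [Fintype Ω] [Fintype N]

/-- A family of labelings of the half-edges of a graph which is stable, up to a permutation of
the index set, under the partial automorphisms of the graph. -/
structure Equivar (G : Gr n) (ι : Ω → HMap n d) : Prop where
  simple : ∀ ω, Simple (ι ω)
  gr_eq : ∀ ω, gr (ι ω) = G
  act : ∀ (θ : Perm (Fin n)) (I : Finset (Fin n)), (∀ w ∈ I, θ w ∈ I) →
    (∀ w ∈ I, ∀ x, G.Adj w x → G.Adj (θ w) (θ x)) →
    ∃ e : Ω ≃ Ω, ∀ ω, ∀ w ∈ I, ∀ k, (ι (e ω) (θ w, k)).1 = θ (ι ω (w, k)).1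

variable {G : Gr n} {ι : Ω → HMap n d} {v : Fin n} {R : ℕ}

lemma Equivar.exists_equiv (hd : 3 ≤ d) (h : Equivar G ι) (ω₀ : Ω) (hT : TreeLike R (ι ω₀) v)
    (g : Ω → (SrAut d R))
    (hg : ∀ ω u, pos (ι ω) v u.1.1 = pos (ι ω₀) v (g ω u).1.1)
    (γ : SrAut d R) : ∃ e : Ω ≃ Ω, ∀ ω, g (e ω) = (g ω).trans γ := by
  let P : ↥(SrSet d R) → Fin n := fun u => pos (ι ω₀) v u.1.1
  have hP : Injective P := fun u u' hu => Subtype.ext (Subtype.ext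
    (hT (mem_ballL.mpr ⟨u.1.2, u.2⟩) (mem_ballL.mpr ⟨u'.1.2, u'.2⟩) hu))
  let θ : Perm (Fin n) := Perm.extendDomain γ.toEquiv (Equiv.ofInjective P hP)
  have hθ : ∀ u, θ (P u) = P (γ u) := fun u =>
    Perm.extendDomain_apply_image γ.toEquiv (Equiv.ofInjective P hP) u
  let I : Finset (Fin n) := (univ.filter fun u : ↥(SrSet d R) => u.1.1.length < R).image P
  have hI : ∀ w, w ∈ I ↔ ∃ u : ↥(SrSet d R), u.1.1.length < R ∧ P u = w := fun w => by
    simp [I]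
  have hv : θ v = v := by
    have h0 : v = P ⟨rootTd d, Nat.zero_le _⟩ := rfl
    rw [h0, hθ]
    congr 1
    have := srIso_length hd γ ⟨rootTd d, Nat.zero_le _⟩
    exact Subtype.ext (Subtype.ext (List.length_eq_zero_iff.mp (this.trans rfl)))
  obtain ⟨e, he⟩ := h.act θ I (by
    intro w hw
    obtain ⟨u, hu, rfl⟩ := (hI w).mp hw
    rw [hθ]
    exact (hI _).mpr ⟨γ u, by rw [srIso_length hd]; exact hu, rfl⟩) (by
    intro w hw x hx
    obtain ⟨u, hu, rfl⟩ := (hI w).mp hw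
    rw [← h.gr_eq ω₀] at hx ⊢
    have hS := h.simple ω₀
    have key : ∀ u' : ↥(SrSet d R), (SrGraph d R).Adj u u' → (gr (ι ω₀)).Adj (θ (P u)) (θ (P u')) := fun u' ha => by
      rw [hθ, hθ]
      exact ((hS.srGraph_adj_iff hT _ _).mp (γ.map_adj_iff.mpr ha)).1
    rcases hS.exists_of_adj_pos u.1.2 hx with ⟨j, l₀, hl, rfl⟩ | ⟨j, hj, rfl⟩
    · have hval : ValidTd d l₀ := by have := u.1.2; rw [hl] at this; exact this.tail
      have hl2 : l₀.length ≤ R := by rw [hl] at hu; simp at hu; omega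
      refine key ⟨⟨l₀, hval⟩, hl2⟩ ((hS.srGraph_adj_iff hT _ _).mpr ⟨hx, ?_⟩)
      rw [hl]; simp
    · refine key ⟨⟨j :: u.1.1, hj⟩, ?_⟩ ((hS.srGraph_adj_iff hT _ _).mpr ⟨hx, ?_⟩)
      · change (j :: u.1.1).length ≤ R
        simpa using hu
      · simp)
  refine ⟨e, fun ω => ?_⟩
  ext1 u
  apply hP
  have := (st_of_intertwine (h.simple ω) (h.simple (e ω)) θ (R := R) (v := v) (by
    intro l hl hlt k
    refine he ω _ ((hI _).mpr ⟨g ω ⟨⟨l, hl⟩, hlt.le⟩, ?_, ?_⟩) k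
    · rw [srIso_length hd]; exact hlt
    · exact (hg ω ⟨⟨l, hl⟩, hlt.le⟩).symm) u.1.2 u.2).1
  rw [hv, hg (e ω) u, hg ω u] at this
  exact this.trans (hθ _)

lemma Equivar.sum_chart (hd : 3 ≤ d) (h : Equivar G ι) (ω₀ : Ω) (hT : TreeLike R (ι ω₀) v)
    (f : Fin n → N) (H : Col d R N → ℝ) :
    (∑ ω, H (xcol R (ι ω) f v)) * card (SrAut d R)
      = card Ω * ∑ γ : SrAut d R, H fun u => xcol R (ι ω₀) f v (γ u) := by
  have hex := fun ω => exists_chart_iso (h.simple ω₀) (h.simple ω)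
    ((h.gr_eq ω₀).trans (h.gr_eq ω).symm) hT
  choose g hg using hex
  have hH : ∀ ω, H (xcol R (ι ω) f v) = H fun u => xcol R (ι ω₀) f v (g ω u) := fun ω => by
    congr 1
    funext u
    exact congrArg f (hg ω u)
  have h1 : ∀ γ : SrAut d R, ∑ ω, H (xcol R (ι ω) f v)
      = ∑ ω, H fun u => xcol R (ι ω₀) f v (γ (g ω u)) := fun γ => by
    obtain ⟨e, he⟩ := h.exists_equiv hd ω₀ hT g hg γ
    rw [← sum_comp e]
    refine sum_congr rfl fun ω _ => ?_
    rw [hH, he]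
    rfl
  have h2 : ∀ ω, ∑ γ : SrAut d R, H (fun u => xcol R (ι ω₀) f v (γ (g ω u)))
      = ∑ γ : SrAut d R, H fun u => xcol R (ι ω₀) f v (γ u) := fun ω =>
    sum_equiv (Equiv.mulRight (g ω)) _ _ fun γ => rfl
  calc _ = ∑ _γ : SrAut d R, ∑ ω, H (xcol R (ι ω) f v) := by
        rw [sum_const, card_univ, nsmul_eq_mul, mul_comm]
    _ = ∑ γ : SrAut d R, ∑ ω, H (fun u => xcol R (ι ω₀) f v (γ (g ω u))) :=
        sum_congr rfl fun γ _ => h1 γ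
    _ = _ := by
        rw [sum_comm, sum_congr rfl fun ω _ => h2 ω, sum_const, card_univ, nsmul_eq_mul]

lemma sum_sym_phat_mul (R : ℕ) (ι : HMap n d) (f : Fin n → N)
    (H : Col d R N → ℝ) : ∑ c, sym (phat R ι f) c * H c
      = (∑ v, (∑ γ : SrAut d R, H fun u => xcol R ι f v (γ u)) / card (SrAut d R)) / n := by
  have h1 : ∀ γ : SrAut d R, ∑ c, phat R ι f (fun u => c (γ u)) * H c
        = (∑ v, H fun u => xcol R ι f v (γ.symm u)) / n := fun γ => by
    have : ∀ c, phat R ι f (fun u => c (γ u)) * H c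
        = (cnt (xcol R ι f) (fun u => c (γ u)) * H c) / n := fun c => by
      rw [phat]; ring
    rw [sum_congr rfl fun c _ => this c, ← sum_div]
    congr 1
    rw [sum_comp_eq_cnt (xcol R ι f) fun c => H fun u => c (γ.symm u)]
    refine sum_equiv (Equiv.arrowCongr γ.toEquiv.symm (Equiv.refl N)) _ _ fun c => ?_
    congr 2
    funext u
    exact congrArg c (γ.apply_symm_apply u).symm
  have h2 : ∀ c, sym (phat R ι f) c * H c = (∑ γ : SrAut d R, phat R ι f (fun u => c (γ u)) * H c)
        / card (SrAut d R) := fun c => by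
    rw [sym, ← sum_mul]; ring
  rw [sum_congr rfl fun c _ => h2 c, ← sum_div, sum_comm,
    sum_congr rfl fun γ _ => h1 γ, ← sum_div, sum_comm, ← sum_div,
    div_right_comm]
  rw [div_div, div_div]
  congr 1
  rw [sum_comm, sum_comm (s := univ (α := Fin n))]
  exact sum_equiv ⟨RelIso.symm, RelIso.symm, fun _ => rfl, fun _ => rfl⟩ _ _ fun γ => rfl

lemma Equivar.abs_avg_sub_le (hd : 3 ≤ d) (h : Equivar G ι) (ω₀ : Ω) (f : Fin n → N)
    (H : Col d R N → ℝ) (h0 : ∀ c, 0 ≤ H c) (h1 : ∀ c, H c ≤ 1) :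
    |(∑ ω, (∑ v, H (xcol R (ι ω) f v)) / n) / card Ω - ∑ c, sym (phat R (ι ω₀) f) c * H c|
      ≤ (badCount R (ι ω₀) : ℝ) / n := by
  have hΩ : (0:ℝ) < card Ω := mod_cast card_pos_iff.mpr ⟨ω₀⟩
  have hΓ := card_srIso_pos d R
  rw [sum_sym_phat_mul, ← sum_div, div_right_comm, ← sub_div, abs_div, Nat.abs_cast,
    sum_comm, sum_div, ← sum_sub_distrib]
  gcongr
  refine (abs_sum_le_sum_abs _ _).trans ?_
  have hb : ∀ v, |(∑ ω, H (xcol R (ι ω) f v)) / card Ω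
      - (∑ γ : SrAut d R, H fun u => xcol R (ι ω₀) f v (γ u)) / card (SrAut d R)|
      ≤ if ¬ TreeLike R (ι ω₀) v then 1 else 0 := fun v => by
    by_cases hT : TreeLike R (ι ω₀) v
    · rw [if_neg (not_not.mpr hT)]
      have := h.sum_chart hd ω₀ hT f H
      have e : (∑ ω, H (xcol R (ι ω) f v)) / card Ω
        = (∑ γ : SrAut d R, H fun u => xcol R (ι ω₀) f v (γ u))
        / card (SrAut d R) := by
        rw [div_eq_div_iff hΩ.ne' hΓ.ne', this, mul_comm]
      rw [e, sub_self, abs_zero]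
    · rw [if_pos hT]
      have b1 : ∀ (A : Type) [Fintype A] (F : A → ℝ), (∀ a, 0 ≤ F a) → (∀ a, F a ≤ 1) →
          0 ≤ (∑ a, F a) / card A ∧ (∑ a, F a) / card A ≤ 1 := fun A _ F hF0 hF1 => by
        refine ⟨div_nonneg (sum_nonneg fun a _ => hF0 a) (Nat.cast_nonneg _), ?_⟩
        apply div_le_one_of_le₀ _ (Nat.cast_nonneg _)
        refine (sum_le_sum fun a _ => hF1 a).trans ?_
        simp
      have c1 := b1 Ω (fun ω => H (xcol R (ι ω) f v)) (fun _ => h0 _) (fun _ => h1 _)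
      have c2 := b1 (SrAut d R) (fun γ => H fun u => xcol R (ι ω₀) f v (γ u))
        (fun _ => h0 _) (fun _ => h1 _)
      rw [abs_le]
      constructor <;> linarith [c1.1, c1.2, c2.1, c2.2]
  refine (sum_le_sum fun v _ => hb v).trans ?_
  rw [badCount, Finset.sum_boole]

end

section
variable {d n m R : ℕ} [NeZero d] {N : Type} [Fintype N]

/-- The configuration obtained by permuting the half-edges at each vertex. -/
def twist (π : Conf d n m) (ρ : Labs n d) : Conf d n m := π.trans (prodCongrRight ρ)

lemma iota_twist (π : Conf d n m) (ρ : Labs n d) (u : Fin n) (i : Fin d) :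
    (twist π ρ)° (u, i) = ((π° (u, (ρ u).symm i)).1,
      ρ (π° (u, (ρ u).symm i)).1 (π° (u, (ρ u).symm i)).2) := by
  rw [twist, iota_trans]; rfl

lemma twist_simple {π : Conf d n m} (h : Simple π°) (ρ : Labs n d) : Simple (twist π ρ)° :=
  simple_of_relabel h (prodCongrRight ρ) (fun _ => rfl) fun h => by
    rw [twist, iota_trans, symm_apply_apply]

lemma gr_twist (π : Conf d n m) (ρ : Labs n d) : gr (twist π ρ)° = gr π° :=
  gr_eq_of_relabel (prodCongrRight ρ) (fun _ => rfl) fun h => by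
    rw [twist, iota_trans, symm_apply_apply]

lemma twist_one (π : Conf d n m) : twist π (fun _ => Equiv.refl _) = π := by
  ext1 x; rfl

lemma twist_injective (ρ : Labs n d) : Injective fun π : Conf d n m => twist π ρ := fun π π' h => by
  ext1 x
  exact (prodCongrRight ρ).injective (Equiv.congr_fun h x)

lemma twist_equivar {π : Conf d n m} (h : Simple π°) :
    Equivar (gr π°) fun ρ : Labs n d => (twist π ρ)° where
  simple := twist_simple h
  gr_eq := gr_twist π
  act θ I hI hadj := by
    have hB : ∀ w, ∃ B : Perm (Fin d), w ∈ I → ∀ i,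
        (π° (θ w, B i)).1 = θ (π° (w, i)).1 := fun w => by
      by_cases hw : w ∈ I
      · have hex : ∀ i, ∃ b, (π° (θ w, b)).1 = θ (π° (w, i)).1 := fun i =>
          (h.adj_iff _ _).mp (hadj w hw _ (h.adj (w, i)))
        choose b hb using hex
        have hinj : Injective b := fun i j hij => by
          apply h.injective w
          apply θ.injective
          change θ (π° (w, i)).1 = θ (π° (w, j)).1
          rw [← hb, ← hb, hij]
        exact ⟨ofBijective b (Finite.injective_iff_bijective.mp hinj), fun _ => hb⟩
      · exact ⟨Equiv.refl _, fun h => absurd h hw⟩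
    choose B hB using hB
    let e : Labs n d → Labs n d := fun ρ u =>
      if θ.symm u ∈ I then (B (θ.symm u)).symm.trans (ρ (θ.symm u)) else ρ u
    have hpos : ∀ ρ w, w ∈ I → e ρ (θ w) = (B w).symm.trans (ρ w) := fun ρ w hw => by
      simp only [e, symm_apply_apply]
      rw [if_pos hw]
    have hinj : Injective e := fun ρ ρ' hρ => by
      funext u
      by_cases hu : u ∈ I
      · have := congrFun hρ (θ u)
        rw [hpos _ _ hu, hpos _ _ hu] at this
        ext1 i
        have := Equiv.congr_fun this (B u i)
        simpa using this
      · have hu' : θ.symm u ∉ I := fun h' => hu (by simpa using hI _ h')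
        have := congrFun hρ u
        simp only [e] at this
        rwa [if_neg hu', if_neg hu'] at this
    refine ⟨ofBijective e (Finite.injective_iff_bijective.mp hinj), fun ρ w hw k => ?_⟩
    change ((twist π (e ρ))° (θ w, k)).1 = _
    rw [iota_twist, iota_twist]
    change (π° (θ w, (e ρ (θ w)).symm k)).1 = θ (π° (w, (ρ w).symm k)).1
    rw [hpos ρ w hw, ← hB w hw]
    rfl

lemma l1_phat_twist_le (π : Conf d n m) (ρ : Labs n d) (w : Fin n)
    (k : Perm (Fin d)) (f : Fin n → N) :
    l1 (phat R (twist π ρ)° f) (phat R (twist π (Function.update ρ w k))° f)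
      ≤ 2 * (d + 1) ^ (R + 1) / n := by
  set ι := (twist π ρ)° with hι
  have hinv : Involutive ι := iota_involutive _
  have hB : ∀ u ∉ nbhd ι {w} 1, ∀ i,
      ι (u, i) = (twist π (Function.update ρ w k))° (u, i) := fun u hu i => by
    have hu' : u ≠ w := fun h => hu (nbhd_subset_succ ι {w} 0 (by simp [h, nbhd]))
    have h2 : (ι (u, i)).1 ≠ w := fun h => by
      apply hu
      have : ι (w, (ι (u, i)).2) = (u, i) := by
        rw [← h]; exact hinv _
      rw [nbhd, mem_union]
      right
      rw [mem_image]
      exact ⟨(w, (ι (u, i)).2), by simp [nbhd], by rw [this]⟩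
    rw [hι, iota_twist] at h2 ⊢
    rw [iota_twist, Function.update_of_ne hu', Function.update_of_ne h2]
  refine (l1_cnt_div_le _ _ (nbhd ι (nbhd ι {w} 1) R) (fun v hv =>
    xcol_eq_of_notMem_nbhd hinv hB hv f) n).trans ?_
  have h1 := card_nbhd_le ι (nbhd ι {w} 1) R
  have h2 := card_nbhd_le ι {w} 1
  have h3 : #(nbhd ι (nbhd ι {w} 1) R) ≤ (d + 1) ^ (R + 1) := by
    refine h1.trans ?_
    rw [pow_succ]
    exact Nat.mul_le_mul_left _ (by simpa using h2)
  gcongr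
  exact_mod_cast h3

lemma sym_phat_near (hd : 3 ≤ d) {π : Conf d n m} (h : Simple π°) (f : Fin n → N) (c : Col d R N) :
    |avg (fun ρ : Labs n d => phat R (twist π ρ)° f c)
      - sym (phat R π° f) c| ≤ (badCount R π° : ℝ) / n := by
  have := (twist_equivar h).abs_avg_sub_le (R := R) hd (fun _ => Equiv.refl _) f
    (fun x => if x = c then 1 else 0) (fun x => by split_ifs <;> simp)
    (fun x => by split_ifs <;> simp)
  rw [twist_one] at this
  convert this using 3
  · unfold avg
    congr 1
    refine sum_congr rfl fun ρ _ => ?_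
    rw [Finset.sum_boole]
    change (cnt _ c : ℝ) / n = _
    unfold cnt
    congr!
  · simp

lemma card_near_sym_of_simple (hd : 3 ≤ d) (R : ℕ) (N : Type) [Fintype N] {κ : ℝ} (hκ : 0 < κ) :
    ∃ η > 0, ∀ᶠ n : ℕ in atTop, ∀ m (π : Conf d n m), Simple π° →
      (badCount R π° : ℝ) ≤ η * n → ∀ f : Fin n → N, ∀ Q : Finset Labs n d,
      (∀ ρ, l1 (phat R (twist π ρ)° f) (sym (phat R π° f)) ≤ κ → ρ ∈ Q) →
      (card Labs n d : ℝ) ≤ 2 * #Q := by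
  set T := card (Col d R N) with hTdef
  set κ' := κ / (T + 1) with hκ'
  have hκ'0 : 0 < κ' := by positivity
  set C : ℝ := 2 * (d + 1) ^ (R + 1) with hC
  have hC0 : 0 < C := by positivity
  have hlim : ∀ᶠ n : ℕ in atTop, (2 * T : ℝ) * exp (-((κ' / 2) ^ 2 / (2 * C ^ 2) * n)) ≤ 1 / 2 := by
    have h1 : Tendsto (fun n : ℕ => exp (-((κ' / 2) ^ 2 / (2 * C ^ 2) * n))) atTop (𝓝 0) := by
      refine Real.tendsto_exp_neg_atTop_nhds_zero.comp ?_
      exact Tendsto.const_mul_atTop (by positivity) tendsto_natCast_atTop_atTop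
    have h2 := h1.const_mul (2 * T : ℝ)
    rw [mul_zero] at h2
    exact h2.eventually_le_const (by norm_num)
  refine ⟨κ' / 2, by positivity, ?_⟩
  filter_upwards [hlim, eventually_gt_atTop 0] with n hn hn0 m π hs hb f Q hQ
  have hnR : (0:ℝ) < n := mod_cast hn0
  let F : Col d R N → Labs n d → ℝ := fun c ρ => phat R (twist π ρ)° f c
  have hF : ∀ c, SubG (n * ((C / n) ^ 2 / 2)) (F c) := fun c =>
    SubG.pi_fin n (F c) fun ρ w k =>
      (abs_sub_le_l1 _ _ c).trans (l1_phat_twist_le π ρ w k f)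
  have hK : (0:ℝ) < n * ((C / n) ^ 2 / 2) := by positivity
  have hexp : (κ' / 2) ^ 2 / (4 * (n * ((C / n) ^ 2 / 2))) = (κ' / 2) ^ 2 / (2 * C ^ 2) * n := by
    field_simp; ring
  have hcov : (univ : Finset Labs n d) ⊆ Q ∪ univ.biUnion fun c =>
      (univ.filter fun ρ => avg (F c) + κ' / 2 ≤ F c ρ) ∪
        univ.filter fun ρ => F c ρ ≤ avg (F c) - κ' / 2 := fun ρ _ => by
    rw [mem_union]
    by_contra hcon
    push Not at hcon
    obtain ⟨hq, hbig⟩ := hcon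
    apply hq
    apply hQ
    have hc : ∀ c, |phat R (twist π ρ)° f c - sym (phat R π° f) c| ≤ κ' := fun c => by
      have h1 : ¬ (avg (F c) + κ' / 2 ≤ F c ρ) := fun h' => hbig
        (mem_biUnion.mpr ⟨c, mem_univ _, mem_union_left _ (mem_fil.mpr h')⟩)
      have h2 : ¬ (F c ρ ≤ avg (F c) - κ' / 2) := fun h' => hbig
        (mem_biUnion.mpr ⟨c, mem_univ _, mem_union_right _ (mem_fil.mpr h')⟩)
      have h3 : |avg (F c) - sym (phat R π° f) c| ≤ κ' / 2 :=
        (sym_phat_near hd hs f c).trans ((div_le_iff₀ hnR).mpr hb)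
      change |F c ρ - _| ≤ _
      rw [abs_le] at h3 ⊢
      constructor <;> linarith [h3.1, h3.2]
    refine (l1_le_card_mul _ _ κ' hc).trans ?_
    rw [hκ', mul_div_assoc', div_le_iff₀ (by positivity)]
    nlinarith
  have hcard := (card_le_card hcov).trans (card_union_le _ _)
  have hbi : (#(univ.biUnion fun c =>
      (univ.filter fun ρ => avg (F c) + κ' / 2 ≤ F c ρ) ∪
        univ.filter fun ρ => F c ρ ≤ avg (F c) - κ' / 2) : ℝ)
      ≤ ∑ _c : Col d R N, (2 * (card Labs n d * exp (-((κ' / 2) ^ 2 / (2 * C ^ 2) * n)))) := by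
    refine (Nat.cast_le.mpr Finset.card_biUnion_le).trans ?_
    rw [Nat.cast_sum]
    refine sum_le_sum fun c _ => ?_
    refine (Nat.cast_le.mpr (card_union_le _ _)).trans ?_
    have e1 := (hF c).tail hK (κ' / 2) (by positivity)
    have e2 := (hF c).lower_tail hK (κ' / 2) (by positivity)
    rw [hexp] at e1 e2
    push_cast
    linarith
  rw [sum_const, card_univ, nsmul_eq_mul] at hbi
  have hcard' : (card Labs n d : ℝ) ≤ #Q + T * (2 * (card Labs n d *
      exp (-((κ' / 2) ^ 2 / (2 * C ^ 2) * n)))) := by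
    have h1 := (Nat.cast_le (α := ℝ)).mpr hcard
    rw [card_univ, Nat.cast_add] at h1
    exact h1.trans (add_le_add_right hbi _)
  have hΩ0 : (0:ℝ) ≤ card Labs n d := Nat.cast_nonneg _
  have h5 := mul_le_mul_of_nonneg_left hn hΩ0
  have h6 : (T:ℝ) * (2 * (card Labs n d * exp (-((κ' / 2) ^ 2 / (2 * C ^ 2) * n))))
    = card Labs n d * ((2 * T : ℝ) * exp (-((κ' / 2) ^ 2 / (2 * C ^ 2) * n))) := by ring
  rw [h6] at hcard'
  linarith

lemma exists_simple_near (π : Conf d n m) (hn : 4 * (d + 1) * d + #(badH π°) < n * d) :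
    ∃ π' : Conf d n m, Simple π'° ∧ ∀ (F : Conf d n m → ℝ) (c : ℝ),
      (∀ (π : Conf d n m) a b, |F π - F ((swap a b).trans π)| ≤ c) →
        |F π - F π'| ≤ #(badH π°) * c := by
  induction hk : #(badH π°) using Nat.strong_induction_on generalizing π with
  | _ k ih =>
    by_cases hne : (badH π°).Nonempty
    · obtain ⟨a, b, hab⟩ := exists_swap_card_badH_lt π hne hn
      obtain ⟨π', hs, hF⟩ := ih _ (hk ▸ hab) (π.trans (swap a b)) (by omega) rfl
      refine ⟨π', hs, fun F c hc => ?_⟩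
      have h1 := hc π (π.symm a) (π.symm b)
      rw [swap_trans_eq, apply_symm_apply, apply_symm_apply] at h1
      have h2 := hF F c hc
      have hc0 : 0 ≤ c := (abs_nonneg _).trans h1
      have h3 : (#(badH (π.trans (swap a b))°) : ℝ) + 1 ≤ k := by
        exact_mod_cast Nat.succ_le_of_lt (hk ▸ hab)
      calc |F π - F π'| ≤ _ := abs_sub_le _ (F (π.trans (swap a b))) _
        _ ≤ c + _ := add_le_add h1 h2
        _ = ((#(badH (π.trans (swap a b))°) : ℝ) + 1) * c := by ring
        _ ≤ k * c := by gcongr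
    · rw [Finset.not_nonempty_iff_eq_empty] at hne
      refine ⟨π, mem_simpleConf.mp (by rw [simpleConf, mem_filter]; simp [hne]), fun F c hc => ?_⟩
      rw [hne] at hk
      simp [← hk]

lemma card_near_sym (hd : 3 ≤ d) (hR : 1 ≤ R) (N : Type) [Fintype N] {κ : ℝ} (hκ : 0 < κ) :
    ∃ η > 0, ∀ᶠ n : ℕ in atTop, ∀ m (π : Conf d n m),
      (badCount R π° : ℝ) ≤ η * n → ∀ f : Fin n → N, ∀ Q : Finset Labs n d,
      (∀ ρ, l1 (phat R (twist π ρ)° f) (sym (phat R π° f)) ≤ κ → ρ ∈ Q) →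
      (card Labs n d : ℝ) ≤ 2 * #Q := by
  obtain ⟨η, hη, hev⟩ := card_near_sym_of_simple (d := d) hd R N (by positivity : 0 < κ / 2)
  set C : ℝ := 8 * (d + 1) ^ R with hC
  have hC0 : 0 < C := by positivity
  have hd0 : (0:ℝ) < d := mod_cast (by omega : 0 < d)
  have hR1 : ∀ (n m : ℕ) (π : Conf d n m), (#(badH π°) : ℝ) ≤ badCount R π° * d := fun n m π => by
    have h1 : badCount 1 π° ≤ badCount R π° :=
      card_le_card fun v hv => mem_fil.mpr (fun h => (mem_filter.mp hv).2 (h.mono hR))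
    exact_mod_cast (card_badH_le π°).trans (Nat.mul_le_mul_right d h1)
  set η' := min (η / (1 + d * C)) (min (κ / (4 * (d * C))) (1 / 2)) with hη'
  have hη'0 : 0 < η' := by positivity
  have e1 : η' * (1 + d * C) ≤ η := by
    rw [← le_div_iff₀ (by positivity)]; exact min_le_left _ _
  have e2 : η' * (4 * (d * C)) ≤ κ := by
    rw [← le_div_iff₀ (by positivity)]; exact (min_le_right _ _).trans (min_le_left _ _)
  have e3 : η' ≤ 1 / 2 := (min_le_right _ _).trans (min_le_right _ _)
  refine ⟨η', hη'0, ?_⟩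
  filter_upwards [hev, eventually_gt_atTop (8 * (d + 1))] with n hn hn0 m π hb f Q hQ
  have hnR : (8 * (d + 1) : ℝ) < n := mod_cast hn0
  have hn1 : (0:ℝ) < n := by linarith
  have hbad : (#(badH π°) : ℝ) ≤ η' * n * d := (hR1 n m π).trans (by gcongr)
  have hlt : 4 * (d + 1) * d + #(badH π°) < n * d := by
    have : (4 * (d + 1) * d + #(badH π°) : ℝ) < n * d := by
      have h1 : η' * n * d ≤ 1 / 2 * n * d := by gcongr
      have h2 := mul_lt_mul_of_pos_right hnR hd0
      linarith
    exact_mod_cast this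
  obtain ⟨π', hs, hF⟩ := exists_simple_near π hlt
  have hb' : (badCount R π'° : ℝ) ≤ η * n := by
    have h1 := hF (fun π => badCount R π°) _ (abs_badCount_swap_le R)
    have h2 : (#(badH π°) : ℝ) * ((d + 1) ^ R * 4) ≤ η' * n * d * C := by
      rw [hC]
      refine mul_le_mul hbad ?_ (by positivity) (by positivity)
      nlinarith [pow_pos (by positivity : (0:ℝ) < d + 1) R]
    have h3 := mul_le_mul_of_nonneg_right e1 hn1.le
    have h4 := (abs_le.mp h1).1
    linarith
  have hl : ∀ ρ, l1 (phat R (twist π ρ)° f) (phat R (twist π' ρ)° f) ≤ κ / 4 := fun ρ => by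
    have h1 := hF (fun π'' => l1 (phat R (twist π ρ)° f) (phat R (twist π'' ρ)° f))
      (C / n) (fun π'' a b => by
        have h2 : l1 (phat R (twist π'' ρ)° f)
            (phat R (twist ((swap a b).trans π'') ρ)° f) ≤ C / n :=
          l1_phat_swap_le (twist π'' ρ) a b f
        have h3 := l1_triangle (phat R (twist π ρ)° f) (phat R (twist π'' ρ)° f)
          (phat R (twist ((swap a b).trans π'') ρ)° f)
        have h4 := l1_triangle (phat R (twist π ρ)° f)
          (phat R (twist ((swap a b).trans π'') ρ)° f) (phat R (twist π'' ρ)° f)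
        rw [l1_comm (phat R (twist ((swap a b).trans π'') ρ)° f) (phat R (twist π'' ρ)° f)] at h4
        rw [abs_le]
        constructor <;> linarith)
    simp only [l1_self, zero_sub, abs_neg] at h1
    refine (le_abs_self _).trans (h1.trans ?_)
    rw [mul_div_assoc', div_le_iff₀ hn1]
    have h5 := mul_le_mul_of_nonneg_right hbad hC0.le
    have h6 := mul_le_mul_of_nonneg_right e2 hn1.le
    linarith
  refine hn m π' hs hb' f Q fun ρ hρ => hQ ρ ?_
  have h1 := hl (fun _ => Equiv.refl _)
  rw [twist_one, twist_one] at h1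
  have h2 := l1_sym_le (phat R π° f) (phat R π'° f)
  rw [l1_comm (sym (phat R π° f)) (sym (phat R π'° f))] at h2
  have h3 := l1_triangle (phat R (twist π ρ)° f) (phat R (twist π' ρ)° f) (sym (phat R π° f))
  have h4 := l1_triangle (phat R (twist π' ρ)° f) (sym (phat R π'° f)) (sym (phat R π° f))
  have h5 := hl ρ
  linarith

lemma card_le_two_mul_of_twist (hd : 3 ≤ d) (hR : 1 ≤ R) (N : Type) [Fintype N] {κ : ℝ} (hκ : 0 < κ) :
    ∃ η > 0, ∀ᶠ n : ℕ in atTop, ∀ m (Z Z' : Finset (Conf d n m × (Fin n → N))),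
      (∀ x ∈ Z, (badCount R x.1° : ℝ) ≤ η * n ∧
        ∀ π', l1 (phat R π'° x.2) (sym (phat R x.1° x.2)) ≤ κ → (π', x.2) ∈ Z') →
      (#Z : ℝ) ≤ 2 * #Z' := by
  obtain ⟨η, hη, hev⟩ := card_near_sym (d := d) hd hR N hκ
  refine ⟨η, hη, ?_⟩
  filter_upwards [hev] with n hn m Z Z' hZ
  set Ω := Labs n d
  let S : Finset ((Conf d n m × (Fin n → N)) × Ω) :=
    (Z ×ˢ univ).filter fun y => (twist y.1.1 y.2, y.1.2) ∈ Z'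
  have h1 : #S ≤ #Z' * card Ω := by
    rw [← card_univ, ← card_product]
    refine card_le_card_of_injOn (fun y => ((twist y.1.1 y.2, y.1.2), y.2)) ?_ ?_
    · intro y hy
      exact mem_product.mpr ⟨(mem_filter.mp hy).2, mem_univ _⟩
    · rintro ⟨⟨π, f⟩, ρ⟩ _ ⟨⟨π', f'⟩, ρ'⟩ _ h
      simp only [Prod.mk.injEq] at h
      obtain ⟨⟨h1, h2⟩, h3⟩ := h
      subst h2 h3
      rw [twist_injective ρ h1]
  have h2 : (#Z : ℝ) * card Ω ≤ 2 * #S := by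
    have : #S = ∑ x ∈ Z, #{ρ : Ω | (twist x.1 ρ, x.2) ∈ Z'} := by
      simp only [S, Finset.card_filter]
      rw [Finset.sum_product]
    rw [this, Nat.cast_sum, mul_sum, ← nsmul_eq_mul]
    refine card_nsmul_le_sum _ _ _ fun x hx => ?_
    obtain ⟨hb, hx'⟩ := hZ x hx
    exact hn m x.1 hb x.2 _ fun ρ hρ =>
      mem_fil.mpr (hx' _ hρ)
  have h3 : (0:ℝ) < card Ω := mod_cast Fintype.card_pos
  have h4 : (#S : ℝ) ≤ #Z' * card Ω := mod_cast h1
  refine le_of_mul_le_mul_right ?_ h3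
  linarith

lemma pf_phat {M : Type} [Fintype M] (ι : HMap n d) (a : N → M)
    (f : Fin n → N) : pf (fun (x : Col d R N) v => a (x v)) (phat R ι f)
      = phat R ι (a ∘ f) := pf_cnt _ _ _

/-- The moment bound: the number of colored configurations whose symmetrized local
statistics are close to a prescribed one. -/
lemma card_moment_le (hd : 3 ≤ d) (hR : 1 ≤ R) {M J : Type} [Fintype M] [Fintype J] (a : J → N → M)
    (p : Col d R M → ℝ) (s : ℝ)
    (h : ∀ q : Col d R N → ℝ, IsIdr (by omega : 2 ≤ d) q →
      (∀ j, pf (fun (x : Col d R N) v => a j (x v)) q = p) → entJ q ≤ s) {δ : ℝ} (hδ : 0 < δ) :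
    ∃ η > 0, ∀ᶠ n : ℕ in atTop, ∀ m, 2 * m = n * d → ∀ Z : Finset (Conf d n m × (Fin n → N)),
      (∀ x ∈ Z, (badCount R x.1° : ℝ) ≤ η * n ∧ ∀ j, l1 (sym (phat R x.1° (a j ∘ x.2))) p ≤ η) →
      (#Z : ℝ) ≤ (n * d)! * exp (n * (s + δ)) := by
  obtain ⟨η₀, hη₀, hnear⟩ := exists_near_entJ_le (by omega : 2 ≤ d) a p s h (half_pos (half_pos hδ))
  obtain ⟨η₁, hη₁, hrel⟩ := card_le_two_mul_of_twist (d := d) hd hR N (half_pos hη₀)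
  refine ⟨min (η₀ / 2) η₁, lt_min (half_pos hη₀) hη₁, ?_⟩
  filter_upwards [hrel, card_entJ_le_exp d R N (by omega) (s + δ / 2 / 2) (half_pos (half_pos hδ)),
    eventually_gt_atTop 0, poly_le_exp 2 0 (half_pos hδ)] with n h1 h2 hn0 h3 m hm Z hZ
  have h4 := h1 m Z (univ.filter fun x : Conf d n m × (Fin n → N) =>
      entJ (phat R x.1° x.2) ≤ s + δ / 2 / 2) (by
    intro x hx
    obtain ⟨hb, hj⟩ := hZ x hx
    refine ⟨hb.trans (by gcongr; exact min_le_right _ _), fun π' hπ' => ?_⟩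
    refine mem_fil.mpr ?_
    refine hnear _ (phat_mem_KSet _ hn0 π' x.2) ?_ fun j => ?_
    · have e1 := l1_triangle (phat R π'° x.2) (sym (phat R x.1° x.2)) (sym (phat R π'° x.2))
      have e2 := l1_sym_le (sym (phat R x.1° x.2)) (phat R π'° x.2)
      rw [sym_eq_of_inv (sym_inv _), l1_comm (sym (phat R x.1° x.2)) (phat R π'° x.2)] at e2
      linarith
    · have e1 := l1_triangle (pf (fun (x : Col d R N) v => a j (x v)) (phat R π'° x.2))
        (pf (fun (x : Col d R N) v => a j (x v)) (sym (phat R x.1° x.2))) p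
      have e2 := (l1_pf_le (fun (x : Col d R N) v => a j (x v)) (phat R π'° x.2)
        (sym (phat R x.1° x.2))).trans hπ'
      have e3 := (hj j).trans (min_le_left _ _)
      rw [← pf_phat, sym_pf_comp] at e3
      linarith)
  refine h4.trans ?_
  have h5 := h2 m hm
  have h6 : (n:ℝ) * (s + δ / 2 / 2 + δ / 2 / 2) + δ / 2 * n = n * (s + δ) := by ring
  have h7 : (2:ℝ) ≤ exp (δ / 2 * n) := by
    have := h3
    simp only [pow_zero, mul_one] at this
    exact (by simpa [mul_comm] using this)
  calc (2:ℝ) * _ ≤ exp (δ / 2 * n) * ((n * d)! *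
        exp (n * (s + δ / 2 / 2 + δ / 2 / 2))) := by
        refine mul_le_mul h7 h5 (Nat.cast_nonneg _) (Real.exp_nonneg _)
    _ = (n * d)! * exp (n * (s + δ)) := by
        rw [← h6, exp_add]; ring

end

section
variable {d n : ℕ} [NeZero d]

lemma exists_labeling {G : Gr n} (N : Fin n → Fin d → Fin n)
    (hinj : ∀ w, Injective (N w)) (hr : ∀ w x, G.Adj w x ↔ ∃ k, N w k = x) :
    ∃ ι : HE n d → HE n d, Simple ι ∧ gr ι = G ∧ ∀ w k, (ι (w, k)).1 = N w k := by
  have hex : ∀ h : HE n d, ∃ k, N (N h.1 h.2) k = h.1 := fun h =>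
    (hr _ _).mp ((hr _ _).mpr ⟨h.2, rfl⟩).symm
  choose b hb using hex
  let ι : HMap n d := fun h => (N h.1 h.2, b h)
  have hS : Simple ι := by
    refine ⟨fun h => ?_, fun h he => ?_, fun h h' h1 h2 => ?_⟩
    · have h1 : (ι (ι h)).1 = h.1 := hb h
      refine Prod.ext h1 (hinj h.1 ?_)
      have h2 := hb (ι h)
      change N (N (ι h).1 (ι h).2) (ι (ι h)).2 = N h.1 h.2 at h2
      change N (ι (ι h)).1 (ι (ι h)).2 = N h.1 h.2 at h2
      rw [h1] at h2
      exact h2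
    · exact ((hr h.1 h.1).mpr ⟨h.2, he⟩).ne rfl
    · refine Prod.ext h1 (hinj h.1 ?_)
      change N h.1 h.2 = N h'.1 h'.2 at h2
      rw [h2, h1]
  refine ⟨ι, hS, ?_, fun w k => rfl⟩
  ext u w
  rw [hS.adj_iff, hr]

/-- The neighbors of `w` in `G`, transported by the priority permutation. -/
def nbrs (G : Gr n) (σ : Perm (Fin n)) (w : Fin n) : Finset (Fin n) :=
  (univ.filter fun x => G.Adj w x).map σ.toEmbedding

lemma card_nbrs {G : Gr n} (hG : G ∈ regularGraphs d n) (σ : Perm (Fin n))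
    (w : Fin n) : #(nbrs G σ w) = d := by
  rw [nbrs, Finset.card_map, ← hG w, ← Set.ncard_coe_finset]
  congr 1
  ext x
  simp

lemma mem_nbrs {G : Gr n} {σ : Perm (Fin n)} {w y : Fin n} :
    y ∈ nbrs G σ w ↔ G.Adj w (σ.symm y) := by
  rw [nbrs, Finset.mem_map_equiv, mem_filter]
  simp

/-- The neighbors of `w`, sorted by priority. -/
def nbSort {G : Gr n} (hG : G ∈ regularGraphs d n) (σ : Perm (Fin n))
    (w : Fin n) (k : Fin d) : Fin n :=
  σ.symm ((nbrs G σ w).orderEmbOfFin (card_nbrs hG σ w) k)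

variable {G : Gr n} (hG : G ∈ regularGraphs d n)

lemma nbSort_mono (σ : Perm (Fin n)) (w : Fin n) :
    StrictMono fun k => σ (nbSort hG σ w k) := fun i j h => by
  simp only [nbSort, apply_symm_apply]
  exact ((nbrs G σ w).orderEmbOfFin (card_nbrs hG σ w)).strictMono h

lemma nbSort_injective (σ : Perm (Fin n)) (w : Fin n) : Injective (nbSort hG σ w) := fun _ _ h =>
  (nbSort_mono hG σ w).injective (congrArg σ h)

lemma adj_iff_nbSort (σ : Perm (Fin n)) (w x : Fin n) : G.Adj w x ↔ ∃ k, nbSort hG σ w k = x := by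
  have h1 := Finset.range_orderEmbOfFin (nbrs G σ w) (card_nbrs hG σ w)
  have h2 : G.Adj w x ↔ σ x ∈ nbrs G σ w := by rw [mem_nbrs, symm_apply_apply]
  rw [h2, ← mem_coe, ← h1, Set.mem_range]
  simp only [nbSort, Equiv.symm_apply_eq]

lemma nbSort_unique (σ : Perm (Fin n)) (w : Fin n) (g : Fin d → Fin n)
    (hg : ∀ k, G.Adj w (g k)) (hm : StrictMono fun k => σ (g k)) : g = nbSort hG σ w := by
  have := Finset.orderEmbOfFin_unique (card_nbrs hG σ w) (f := fun k => σ (g k))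
    (fun k => by rw [mem_nbrs, symm_apply_apply]; exact hg k) hm
  funext k
  rw [nbSort, Equiv.eq_symm_apply]
  exact congrFun this k

/-- The labeling of the half-edges by priority. -/
def sortLab (σ : Perm (Fin n)) : HMap n d :=
  (exists_labeling (nbSort hG σ) (nbSort_injective hG σ) (adj_iff_nbSort hG σ)).choose

lemma sortLab_simple (σ : Perm (Fin n)) : Simple (sortLab hG σ) :=
  (exists_labeling (nbSort hG σ) (nbSort_injective hG σ) (adj_iff_nbSort hG σ)).choose_spec.1

lemma gr_sortLab (σ : Perm (Fin n)) : gr (sortLab hG σ) = G :=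
  (exists_labeling (nbSort hG σ) (nbSort_injective hG σ) (adj_iff_nbSort hG σ)).choose_spec.2.1

lemma sortLab_fst (σ : Perm (Fin n)) (w : Fin n) (k : Fin d) :
    (sortLab hG σ (w, k)).1 = nbSort hG σ w k :=
  (exists_labeling (nbSort hG σ) (nbSort_injective hG σ) (adj_iff_nbSort hG σ)).choose_spec.2.2 w k

lemma sortLab_mono (σ : Perm (Fin n)) (w : Fin n) :
    StrictMono fun k => σ (sortLab hG σ (w, k)).1 := by
  simp only [sortLab_fst]
  exact nbSort_mono hG σ w

lemma sortLab_equivar : Equivar G (sortLab hG) where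
  simple := sortLab_simple hG
  gr_eq := gr_sortLab hG
  act θ I _ hadj := by
    refine ⟨Equiv.mulRight θ⁻¹, fun σ w hw k => ?_⟩
    rw [sortLab_fst, sortLab_fst]
    refine congrFun (nbSort_unique hG _ (θ w) (fun k => θ (nbSort hG σ w k)) (fun k => ?_) ?_).symm k
    · exact hadj w hw _ ((adj_iff_nbSort hG σ w _).mpr ⟨k, rfl⟩)
    · intro i j hij
      simpa using nbSort_mono hG σ w hij

end

section
variable {d n : ℕ} [NeZero d] {M : Type}

lemma length_filter_takeWhile {α : Type} [Fintype α] (L : List α) (hnd : L.Nodup) (key : α → ℕ)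
    (hs : L.Pairwise fun a b => key a ≤ key b) (P : α → Bool) {w : α} (hw : w ∈ L)
    (hinj : ∀ x ∈ L, P x = true → key x = key w → x = w) (S : Finset α)
    (hS : ∀ x, x ∈ S ↔ x ∈ L ∧ P x = true ∧ key x < key w) (D : α → Bool)
    (hD : ∀ x, D x = true ↔ x ≠ w) : ((L.takeWhile D).filter P).length = #S := by
  obtain ⟨L₁, L₂, rfl⟩ := List.append_of_mem hw
  have hnd' := hnd
  rw [List.nodup_append] at hnd
  have h1 : (L₁ ++ w :: L₂).takeWhile D = L₁ := by
    rw [List.takeWhile_append_of_pos]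
    · have : ¬ D w = true := fun h => (hD w).mp h rfl
      simp [this]
    · intro a ha
      exact (hD a).mpr <| by simpa using hnd.2.2 a ha w (by simp)
  rw [h1, ← List.toFinset_card_of_nodup (hnd.1.filter _)]
  congr 1
  ext x
  rw [List.mem_toFinset, List.mem_filter, hS]
  rw [List.pairwise_append] at hs
  constructor
  · rintro ⟨hx, hP⟩
    have hxL : x ∈ L₁ ++ w :: L₂ := List.mem_append_left _ hx
    refine ⟨hxL, hP, lt_of_le_of_ne (hs.2.2 x hx w (by simp)) fun he => ?_⟩
    exact hnd.2.2 x hx w (by simp) (hinj x hxL hP he)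
  · rintro ⟨hx, hP, hlt⟩
    refine ⟨?_, hP⟩
    rcases List.mem_append.mp hx with h | h
    · exact h
    · rcases List.mem_cons.mp h with h | h
      · rw [h] at hlt; exact absurd hlt (lt_irrefl _)
      · have := (List.pairwise_cons.mp hs.2.1).1 x h
        omega

variable {G : Gr n} {v : Fin n} {σ : Perm (Fin n)}

lemma mem_bfsLayer (k : ℕ) (w : Fin n) :
    w ∈ bfsLayer G v σ k ↔ G.Reachable v w ∧ G.dist v w = k := by
  cases k with
  | zero =>
    rw [bfsLayer, List.mem_singleton]
    constructor
    · rintro rfl; exact ⟨SimpleGraph.Reachable.refl _, by simp⟩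
    · rintro ⟨h1, h2⟩; exact (h1.dist_eq_zero_iff.mp h2).symm
  | succ k => simp [bfsLayer]

lemma nodup_bfsLayer (k : ℕ) : (bfsLayer G v σ k).Nodup := by
  cases k with
  | zero => simp [bfsLayer]
  | succ k =>
    rw [bfsLayer]
    exact (List.mergeSort_perm _ _).nodup_iff.mpr ((List.nodup_finRange n).filter _)

lemma length_of_bfsPathAux (k : ℕ) : ∀ (w : Fin n) (l : List ℕ),
    bfsPathAux G v σ k w = some l → l.length = k := by
  induction k with
  | zero =>
    intro w l h
    simp only [bfsPathAux] at h
    split_ifs at h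
    · simp at h; simp [← h]
  | succ k ih =>
    intro w l h
    simp only [bfsPathAux] at h
    split at h
    · simp at h
    · rw [Option.map_eq_some_iff] at h
      obtain ⟨pl, h1, rfl⟩ := h
      simp [ih _ _ h1]

/-- The sorting key used in the layers of the breadth-first search. -/
def bfsKey (G : Gr n) (v : Fin n) (σ : Perm (Fin n)) (k : ℕ) (w : Fin n) : ℕ :=
  ((bfsLayer G v σ k).idxOf
    (((bfsLayer G v σ k).find? (fun u => decide (G.Adj u w))).getD v)) * n + (σ w : ℕ)

lemma pairwise_bfsLayer (k : ℕ) : (bfsLayer G v σ (k + 1)).Pairwise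
    fun a b => bfsKey G v σ k a ≤ bfsKey G v σ k b := by
  rw [bfsLayer]
  have := List.pairwise_mergeSort (le := fun a b : Fin n =>
      decide (bfsKey G v σ k a ≤ bfsKey G v σ k b))
    (fun a b c h1 h2 => by
      simp only [decide_eq_true_eq] at *; omega)
    (fun a b => by
      simp only [Bool.or_eq_true, decide_eq_true_eq]; omega)
    ((List.finRange n).filter (fun w => decide (G.Reachable v w ∧ G.dist v w = k + 1)))
  exact this.imp fun h => by simpa using h

end

lemma skipLab_lt {d : ℕ} [NeZero d] {a : Option (Fin d)} {j j' : ℕ} (h : ValidStep d a j)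
    (h' : ValidStep d a j') (hlt : j < j') : skipLab a j < skipLab a j' := by
  rcases a with _ | a
  · simp only [ValidStep, if_true, skipLab] at *
    rw [Fin.lt_def]
    simp only [Fin.ofNat]
    rw [Nat.mod_eq_of_lt (by omega), Nat.mod_eq_of_lt (by omega)]
    omega
  · simp only [ValidStep, reduceCtorEq, if_false, skipLab] at *
    rw [Fin.lt_def]
    simp only [Fin.ofNat]
    rw [Nat.mod_eq_of_lt (by split_ifs <;> omega), Nat.mod_eq_of_lt (by split_ifs <;> omega)]
    split_ifs <;> omega

lemma find?_eq_some_of_unique {α : Type} {L : List α} {P : α → Bool} {a : α} (ha : a ∈ L)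
    (hP : P a = true) (hu : ∀ b ∈ L, P b = true → b = a) : L.find? P = some a := by
  cases hf : L.find? P with
  | none => exact absurd hP (by simpa using List.find?_eq_none.mp hf a ha)
  | some b => rw [hu b (List.mem_of_find?_eq_some hf) (List.find?_some hf)]

section
variable {d n R : ℕ} [NeZero d] {M : Type} {G : Gr n} (hG : G ∈ regularGraphs d n)
  {v : Fin n} {σ : Perm (Fin n)} (hT : TreeLike R (sortLab hG σ) v)

include hT

lemma find_bfsLayer {j : ℕ} {l : List ℕ} (hl : j :: l ∈ ballL d R) :
    (bfsLayer G v σ l.length).find? (fun u => decide (G.Adj u (pos (sortLab hG σ) v (j :: l))))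
      = some (pos (sortLab hG σ) v l) := by
  have hs := sortLab_simple hG σ
  have hg := gr_sortLab hG σ
  obtain ⟨h1, h2⟩ := mem_ballL.mp hl
  have hl0 : l ∈ ballL d R := mem_ballL.mpr ⟨h1.tail, by simp at h2; omega⟩
  refine find?_eq_some_of_unique ?_ ?_ fun u hu hadj => ?_
  · rw [mem_bfsLayer]
    have a1 := hs.reachable_pos v l
    have a2 := hs.dist_pos hT hl0
    rw [hg] at a1 a2
    exact ⟨a1, a2⟩
  · have := hs.adj_pos_cons v j l
    rw [hg] at this
    simpa using this
  · rw [mem_bfsLayer] at hu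
    obtain ⟨l', hl', rfl⟩ := hs.exists_pos_eq (v := v) (x := u) (k := l.length) (by rw [hg]; exact hu.1)
      (by rw [hg]; exact hu.2.le)
    have hlen := (mem_ballL.mp hl').2
    have hl'R : l' ∈ ballL d R := mem_ballL.mpr ⟨(mem_ballL.mp hl').1, by simp at h2; omega⟩
    have e1 : l'.length = l.length := by
      have := hs.dist_pos hT hl'R
      rw [hg] at this
      exact this.symm.trans hu.2
    have hadj' : (gr (sortLab hG σ)).Adj (pos (sortLab hG σ) v l')
        (pos (sortLab hG σ) v (j :: l)) := by rw [hg]; simpa using hadj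
    rcases (hs.adj_pos_iff hT hl'R hl (by simp at h2; omega)).mp hadj' with ⟨j', h⟩ | ⟨j', h⟩
    · rw [(List.cons.inj h).2]
    · rw [h] at e1; simp at e1; omega

lemma bfsKey_pos {l : List ℕ} {x : Fin n}
    (hx : (bfsLayer G v σ l.length).find? (fun u => decide (G.Adj u x))
      = some (pos (sortLab hG σ) v l)) : bfsKey G v σ l.length x
      = (bfsLayer G v σ l.length).idxOf (pos (sortLab hG σ) v l) * n + (σ x : ℕ) := by
  rw [bfsKey, hx]; rfl

lemma bfsPathAux_pos (l : List ℕ) (hl : l ∈ ballL d R) :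
    bfsPathAux G v σ l.length (pos (sortLab hG σ) v l) = some l := by
  have hs := sortLab_simple hG σ
  have hg := gr_sortLab hG σ
  induction l with
  | nil => simp [bfsPathAux, pos_nil]
  | cons j l ih =>
    obtain ⟨h1, h2⟩ := mem_ballL.mp hl
    have hl0 : l ∈ ballL d R := mem_ballL.mpr ⟨h1.tail, by simp at h2; omega⟩
    have hfind := find_bfsLayer hG hT hl
    have hstep := ((validTd_cons_iff (sortLab hG σ) v).mp h1).2
    have hlay : ∀ j', j' :: l ∈ ballL d R →
        pos (sortLab hG σ) v (j' :: l) ∈ bfsLayer G v σ (l.length + 1) := fun j' hj' => by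
      rw [mem_bfsLayer]
      have a1 := hs.reachable_pos v (j' :: l)
      have a2 := hs.dist_pos hT hj'
      rw [hg] at a1 a2
      exact ⟨a1, a2⟩
    have hsig : ∀ j', ValidTd d (j' :: l) → (j' < j ↔
        σ (pos (sortLab hG σ) v (j' :: l)) < σ (pos (sortLab hG σ) v (j :: l))) := fun j' hj' => by
      have hstep' := ((validTd_cons_iff (sortLab hG σ) v).mp hj').2
      have hm := sortLab_mono hG σ (pos (sortLab hG σ) v l)
      rw [pos_cons, pos_cons, out, out]
      refine Iff.trans ?_ (hm.lt_iff_lt (a := skipLab (st (sortLab hG σ) v l).2 j')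
        (b := skipLab (st (sortLab hG σ) v l).2 j)).symm
      refine ⟨skipLab_lt hstep' hstep, fun h => ?_⟩
      rcases lt_trichotomy j' j with h' | h' | h'
      · exact h'
      · rw [h'] at h; exact absurd h (lt_irrefl _)
      · exact absurd (skipLab_lt hstep hstep' h') h.asymm
    have hball : ∀ j', ValidTd d (j' :: l) → j' :: l ∈ ballL d R := fun j' h =>
      mem_ballL.mpr ⟨h, by simpa using h2⟩
    have hcount : (((bfsLayer G v σ (l.length + 1)).takeWhile
        (fun w' => w' ≠ pos (sortLab hG σ) v (j :: l))).filter
        (fun w' => (bfsLayer G v σ l.length).find? (fun u => decide (G.Adj u w'))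
          = some (pos (sortLab hG σ) v l))).length = j - 1 := by
      rw [length_filter_takeWhile _ (nodup_bfsLayer _) (bfsKey G v σ l.length)
        (pairwise_bfsLayer _) _ (hlay j hl) (fun x _ hP hk => ?_)
        ((Ico 1 j).image fun j' => pos (sortLab hG σ) v (j' :: l)) (fun x => ?_) _
        (fun x => decide_eq_true_iff)]
      · rw [card_image_of_injOn, Nat.card_Ico]
        intro a ha b hb hab
        have hv : ∀ a ∈ Ico 1 j, ValidTd d (a :: l) := fun a ha => by
          rw [mem_Ico] at ha
          refine (validTd_cons_iff (sortLab hG σ) v).mpr ⟨h1.tail, ha.1, ?_⟩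
          have := hstep.2
          split_ifs at this ⊢ <;> omega
        exact (List.cons.inj (hT (hball _ (hv a ha)) (hball _ (hv b hb)) hab)).1
      · rw [decide_eq_true_eq] at hP
        rw [bfsKey_pos hG hT hP, bfsKey_pos hG hT hfind] at hk
        exact σ.injective (Fin.ext (by omega))
      · rw [mem_image]
        constructor
        · rintro ⟨j', hj', rfl⟩
          rw [mem_Ico] at hj'
          have hv : ValidTd d (j' :: l) := by
            refine (validTd_cons_iff (sortLab hG σ) v).mpr ⟨h1.tail, hj'.1, ?_⟩
            have := hstep.2
            split_ifs at this ⊢ <;> omega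
          have hf := find_bfsLayer hG hT (hball _ hv)
          refine ⟨hlay _ (hball _ hv), by rw [decide_eq_true_eq]; exact hf, ?_⟩
          rw [bfsKey_pos hG hT hf, bfsKey_pos hG hT hfind]
          have := Fin.lt_def.mp ((hsig j' hv).mp hj'.2)
          omega
        · rintro ⟨hx, hP, hk⟩
          rw [decide_eq_true_eq] at hP
          rw [bfsKey_pos hG hT hP, bfsKey_pos hG hT hfind] at hk
          have hadj : G.Adj (pos (sortLab hG σ) v l) x := by simpa using List.find?_some hP
          have hadj' : (gr (sortLab hG σ)).Adj (pos (sortLab hG σ) v l) x := by rwa [hg]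
          rcases hs.exists_of_adj_pos h1.tail hadj' with ⟨j', l₀, h, rfl⟩ | ⟨j', hv, rfl⟩
          · exfalso
            rw [mem_bfsLayer] at hx
            have hl₀ : l₀ ∈ ballL d R := by
              subst h
              exact mem_ballL.mpr ⟨h1.tail.tail, by simp at h2; omega⟩
            have := hs.dist_pos hT hl₀
            rw [hg, hx.2, h] at this
            simp at this; omega
          · refine ⟨j', mem_Ico.mpr
              ⟨((validTd_cons_iff (sortLab hG σ) v).mp hv).2.1, (hsig j' hv).mpr ?_⟩, rfl⟩
            exact Fin.lt_def.mpr (by omega)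
    rw [List.length_cons, bfsPathAux, hfind]
    simp only
    rw [hcount, ih hl0, Option.map_some]
    have := hstep.1
    rw [show 1 + (j - 1) = j by omega]

lemma bfsPath_eq_some_iff {l : List ℕ} (hl : l.length ≤ R) (w : Fin n) :
    bfsPath G v σ w = some l ↔ ValidTd d l ∧ w = pos (sortLab hG σ) v l := by
  have hs := sortLab_simple hG σ
  have hg := gr_sortLab hG σ
  have key : ∀ l ∈ ballL d R, bfsPath G v σ (pos (sortLab hG σ) v l) = some l := fun l hl => by
    have a1 := hs.reachable_pos v l
    have a2 := hs.dist_pos hT hl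
    rw [hg] at a1 a2
    rw [bfsPath, if_pos a1, a2, bfsPathAux_pos hG hT l hl]
  constructor
  · intro h
    have h0 := h
    rw [bfsPath] at h
    split_ifs at h with hr
    have hlen := length_of_bfsPathAux _ _ _ h
    obtain ⟨l', hl', rfl⟩ := hs.exists_pos_eq (v := v) (x := w) (k := R) (by rw [hg]; exact hr)
      (by rw [hg, ← hlen]; exact hl)
    rw [key l' hl'] at h0
    obtain rfl := Option.some.inj h0
    exact ⟨(mem_ballL.mp hl').1, rfl⟩
  · rintro ⟨h, rfl⟩
    exact key l (mem_ballL.mpr ⟨h, hl⟩)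

omit hT in
/-- On a tree-like ball, breadth-first search reads off the chart. -/
lemma resS_bfsRCG (hT' : TreeLike (R + 1) (sortLab hG σ) v) (f : Fin n → M) :
    resS R (bfsRCG G f v σ) = iotaSr d R (xcol R (sortLab hG σ) f v) := by
  have hg := gr_sortLab hG σ
  have hs := sortLab_simple hG σ
  have hT := hT'.mono (Nat.le_succ R)
  apply RCG.ext
  · funext l
    simp only [resS, bfsRCG, iotaSr]
    by_cases hl : l.length ≤ R
    · rw [if_pos hl]
      by_cases hv : ValidTd d l
      · have hex : ∃ w, bfsPath G v σ w = some l := ⟨_, (bfsPath_eq_some_iff hG hT hl _).mpr ⟨hv, rfl⟩⟩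
        rw [dif_pos hex, dif_pos ⟨hv, hl⟩, ((bfsPath_eq_some_iff hG hT hl _).mp hex.choose_spec).2]
        rfl
      · rw [dif_neg, dif_neg (fun h => hv h.1)]
        rintro ⟨w, hw⟩
        exact hv ((bfsPath_eq_some_iff hG hT hl _).mp hw).1
    · rw [if_neg hl, dif_neg (fun h => hl h.2)]
  · funext ⟨l, l'⟩
    simp only [resS, bfsRCG, iotaSr]
    by_cases hl : l.length ≤ R ∧ l'.length ≤ R
    · rw [if_pos hl]
      congr 1
      rw [eq_iff_iff]
      constructor
      · rintro ⟨w₁, w₂, h1, h2, hadj⟩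
        obtain ⟨v1, rfl⟩ := (bfsPath_eq_some_iff hG hT hl.1 _).mp h1
        obtain ⟨v2, rfl⟩ := (bfsPath_eq_some_iff hG hT hl.2 _).mp h2
        refine ⟨v1, v2, hl.1, hl.2, ?_⟩
        refine (hs.adj_pos_iff hT' (mem_ballL.mpr ⟨v1, by omega⟩) (mem_ballL.mpr ⟨v2, by omega⟩)
          (by omega)).mp (by rw [hg]; exact hadj)
      · rintro ⟨v1, v2, -, -, h⟩
        refine ⟨_, _, (bfsPath_eq_some_iff hG hT hl.1 _).mpr ⟨v1, rfl⟩,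
          (bfsPath_eq_some_iff hG hT hl.2 _).mpr ⟨v2, rfl⟩, ?_⟩
        have := (hs.adj_pos_iff hT' (mem_ballL.mpr ⟨v1, by omega⟩)
          (mem_ballL.mpr ⟨v2, by omega⟩) (by omega)).mpr h
        rwa [hg] at this
    · rw [if_neg hl, if_neg]
      rintro ⟨-, -, h1, h2, -⟩
      exact hl ⟨h1, h2⟩

end

section
variable {M : Type}

lemma resS_resS {k R : ℕ} (h : k ≤ R) (g : RCG M) : resS k (resS R g) = resS k g := by
  refine RCG.ext ?_ ?_
  · funext l
    simp only [resS]
    split_ifs <;> first | rfl | omega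
  · funext p
    simp only [resS]
    split_ifs <;> first | rfl | omega

lemma resS_eq_of_dist_lt {R : ℕ} {g g' : RCG M} (h : dist g g' < (2:ℝ)⁻¹ ^ R) :
    resS R g = resS R g' := by
  by_contra hne
  refine absurd h (not_lt.mpr ?_)
  have hs : Summable (fun r : ℕ => if resS r g = resS r g' then (0:ℝ) else (2:ℝ)⁻¹ ^ r) :=
    Summable.of_nonneg_of_le (fun r => by split_ifs <;> positivity)
      (fun r => by split_ifs <;> first | positivity | exact le_rfl)
      (summable_geometric_of_lt_one (by norm_num) (by norm_num : (2:ℝ)⁻¹ < 1))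
  have := hs.le_tsum R (fun r _ => by split_ifs <;> positivity)
  rwa [if_neg hne] at this

lemma dist_le_of_resS_eq {R : ℕ} {g g' : RCG M} (h : resS R g = resS R g') :
    dist g g' ≤ (2:ℝ)⁻¹ ^ R := by
  have hg := summable_geometric_of_lt_one (by norm_num) (by norm_num : (2:ℝ)⁻¹ < 1)
  have h0 : ∀ r ≤ R, resS r g = resS r g' := fun r hr => by
    rw [← resS_resS hr g, h, resS_resS hr]
  have hs : Summable (fun r : ℕ => if r ≤ R then (0:ℝ) else (2:ℝ)⁻¹ ^ r) :=
    Summable.of_nonneg_of_le (fun r => by split_ifs <;> positivity)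
      (fun r => by split_ifs <;> first | positivity | exact le_rfl) hg
  have hle : dist g g' ≤ ∑' r : ℕ, if r ≤ R then (0:ℝ) else (2:ℝ)⁻¹ ^ r := by
    refine Summable.tsum_le_tsum (fun r => ?_) ?_ hs
    · by_cases hr : r ≤ R
      · rw [if_pos (h0 r hr), if_pos hr]
      · rw [if_neg hr]
        split_ifs <;> first | positivity | exact le_rfl
    · exact Summable.of_nonneg_of_le (fun r => by split_ifs <;> positivity)
        (fun r => by split_ifs <;> first | positivity | exact le_rfl) hg
  refine hle.trans ?_
  rw [← hs.sum_add_tsum_nat_add (R + 1),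
    sum_eq_zero fun r hr => if_pos (by simpa [Nat.lt_succ_iff] using hr), zero_add,
    tsum_congr fun r => if_neg (show ¬ r + (R + 1) ≤ R by omega)]
  simp_rw [pow_add]
  rw [tsum_mul_right, tsum_geometric_of_lt_one (by norm_num) (by norm_num)]
  refine le_of_eq ?_
  norm_num
  ring

lemma measurableSet_resS (R : ℕ) (A : Set (RCG M)) : MeasurableSet {g | resS R g ∈ A} := by
  refine IsOpen.measurableSet (Metric.isOpen_iff.mpr fun g hg => ⟨(2:ℝ)⁻¹ ^ R, by positivity,
    fun g' hg' => ?_⟩)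
  change resS R g' ∈ A
  rw [resS_eq_of_dist_lt (Metric.mem_ball.mp hg')]
  exact hg

lemma measurable_resS (R : ℕ) : Measurable (resS R : RCG M → RCG M) :=
  fun A _ => measurableSet_resS R A

variable {n d : ℕ} [NeZero d] {ι ι' : HMap n d} {R : ℕ}

lemma abs_sum_sub_le_badCount (a b : Fin n → ℝ) (h : ∀ v, TreeLike R ι v → a v = b v)
    (h1 : ∀ v, |a v - b v| ≤ 1) : |∑ v, a v - ∑ v, b v| ≤ badCount R ι := by
  rw [← sum_sub_distrib, badCount, Finset.card_filter]
  push_cast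
  refine (abs_sum_le_sum_abs _ _).trans (sum_le_sum fun v _ => ?_)
  by_cases hv : TreeLike R ι v
  · rw [h v hv, sub_self, abs_zero, if_neg (not_not.mpr hv)]
  · rw [if_pos hv]
    exact h1 v

lemma abs_sub_le_one {x y : ℝ} (hx : 0 ≤ x ∧ x ≤ 1) (hy : 0 ≤ y ∧ y ≤ 1) : |x - y| ≤ 1 := by
  rw [abs_le]
  constructor <;> linarith [hx.1, hx.2, hy.1, hy.2]

variable [Fintype M]

lemma abs_sym_phat_sub_le (hι : Simple ι) (hι' : Simple ι') (hg : gr ι = gr ι') (f : Fin n → M)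
    (H : Col d R M → ℝ) (h01 : ∀ c, 0 ≤ H c ∧ H c ≤ 1) :
    |∑ c, sym (phat R ι' f) c * H c - ∑ c, sym (phat R ι f) c * H c| ≤ (badCount R ι : ℝ) / n := by
  rw [sum_sym_phat_mul, sum_sym_phat_mul, ← sub_div, abs_div, Nat.abs_cast]
  gcongr
  have hK : (0:ℝ) < card (SrAut d R) := by
    exact_mod_cast card_srIso_pos d R
  have hI : ∀ (j : HMap n d) v, 0 ≤ (∑ γ : SrAut d R, H fun u => xcol R j f v (γ u))
        / card (SrAut d R) ∧
      (∑ γ : SrAut d R, H fun u => xcol R j f v (γ u)) / card (SrAut d R) ≤ 1 := fun j v =>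
    ⟨div_nonneg (sum_nonneg fun γ _ => (h01 _).1) hK.le, (div_le_one hK).mpr
      ((sum_le_sum fun γ _ => (h01 _).2).trans (by simp))⟩
  refine abs_sum_sub_le_badCount _ _ (fun v hv => ?_) fun v => abs_sub_le_one (hI _ v) (hI _ v)
  obtain ⟨γ₀, hγ⟩ := exists_chart_iso hι hι' hg hv
  congr 1
  refine sum_equiv ⟨fun γ => γ.trans γ₀, fun γ => γ.trans γ₀.symm, fun γ => ?_,
    fun γ => ?_⟩ _ _ fun γ => ?_
  · exact RelIso.ext fun u => γ₀.symm_apply_apply _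
  · exact RelIso.ext fun u => γ₀.apply_symm_apply _
  · congr 1
    funext u
    exact congrArg f (hγ (γ u))

lemma distrG_apply_toReal (G : Gr n) (f : Fin n → M) {S : Set (RCG M)}
    (hS : MeasurableSet S) : (distrG G f S).toReal
      = (∑ σ : Perm (Fin n), (∑ v, if bfsRCG G f v σ ∈ S then (1:ℝ) else 0) / n)
        / card (Perm (Fin n)) := by
  have h1 : ∀ v, distrAt G f v S = ((Nat.factorial n : ℝ≥0∞))⁻¹ *
      ∑ σ : Perm (Fin n), if bfsRCG G f v σ ∈ S then 1 else 0 := fun v => by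
    rw [distrAt, Measure.smul_apply, Measure.finsetSum_apply, smul_eq_mul]
    congr 1
    refine sum_congr rfl fun σ _ => ?_
    rw [Measure.dirac_apply' _ hS, Set.indicator_apply]
    rfl
  have hf : ((Nat.factorial n : ℝ≥0∞))⁻¹ ≠ ⊤ := by
    simp [Nat.factorial_ne_zero]
  rw [distrG, Measure.smul_apply, Measure.finsetSum_apply, smul_eq_mul, ENNReal.toReal_mul,
    sum_congr rfl fun v _ => h1 v, ENNReal.toReal_sum fun v _ => ENNReal.mul_ne_top hf
      (ENNReal.sum_ne_top.mpr fun σ _ => by split_ifs <;> simp), card_perm,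
      card_fin]
  have h2 : ∀ v, ((∑ σ : Perm (Fin n), if bfsRCG G f v σ ∈ S then (1:ℝ≥0∞) else 0)).toReal
      = ∑ σ : Perm (Fin n), if bfsRCG G f v σ ∈ S then (1:ℝ) else 0 := fun v => by
    rw [ENNReal.toReal_sum fun σ _ => by split_ifs <;> simp]
    refine sum_congr rfl fun σ _ => ?_
    split_ifs <;> simp
  simp only [ENNReal.toReal_mul, ENNReal.toReal_inv, ENNReal.toReal_natCast, h2]
  rw [← mul_sum, sum_comm, ← sum_div, div_eq_inv_mul, div_eq_inv_mul]
  ring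

/-- The empirical distribution of the local statistics is the symmetrised chart distribution. -/
theorem abs_distrG_sub_le (hd : 3 ≤ d) (hι : Simple ι) (f : Fin n → M) (A : Set (RCG M)) :
    |(distrG (gr ι) f {g | resS R g ∈ A}).toReal
        - ∑ c, sym (phat R ι f) c * (if iotaSr d R c ∈ A then 1 else 0)|
      ≤ 3 * (badCount (R + 1) ι : ℝ) / n := by
  have hG := hι.mem_regularGraphs
  set H : Col d R M → ℝ := fun c => if iotaSr d R c ∈ A then 1 else 0 with hH
  have h01 : ∀ c, 0 ≤ H c ∧ H c ≤ 1 := fun c => by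
    simp only [hH]
    split_ifs <;> norm_num
  have hbad : ∀ σ, badCount (R + 1) (sortLab hG σ) = badCount (R + 1) ι := fun σ =>
    (sortLab_simple hG σ).badCount_eq_of_gr_eq hι (gr_sortLab hG σ) _
  have hmono : ∀ ι : HE n d → HE n d, (badCount R ι : ℝ) / n ≤ badCount (R + 1) ι / n := fun ι => by
    gcongr
    exact card_le_card fun v hv => (@mem_filter _ _ (_) _ _).mpr
      ⟨mem_univ _, fun h => ((@mem_filter _ _ (_) _ _).mp hv).2 (h.mono (Nat.le_succ R))⟩
  have e1 := (sortLab_equivar hG).abs_avg_sub_le hd 1 f H (fun c => (h01 c).1) fun c => (h01 c).2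
  have e2 := abs_sym_phat_sub_le hι (sortLab_simple hG 1) (gr_sortLab hG 1).symm f H h01
  have e3 : |(distrG (gr ι) f {g | resS R g ∈ A}).toReal
      - (∑ σ, (∑ v, H (xcol R (sortLab hG σ) f v)) / n) / card (Perm (Fin n))|
      ≤ (badCount (R + 1) ι : ℝ) / n := by
    rw [distrG_apply_toReal _ _ (measurableSet_resS R A), ← sub_div, ← sum_sub_distrib,
      abs_div, Nat.abs_cast]
    have hc : (0:ℝ) < card (Perm (Fin n)) := mod_cast Fintype.card_pos
    rw [div_le_iff₀ hc]
    refine (abs_sum_le_sum_abs _ _).trans ((sum_le_card_nsmul _ _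
      ((badCount (R + 1) ι : ℝ) / n) fun σ _ => ?_).trans ?_)
    · rw [← sub_div, abs_div, Nat.abs_cast]
      gcongr
      rw [← hbad σ]
      refine abs_sum_sub_le_badCount _ _ (fun v hv => ?_) fun v => abs_sub_le_one ?_ (h01 _)
      · simp only [hH, Set.mem_ofPred_eq, resS_bfsRCG hG hv f]
      · split_ifs <;> norm_num
    · rw [nsmul_eq_mul, card_univ, mul_comm]
  have h4 := (hmono _).trans_eq (congrArg (fun k : ℕ => (k:ℝ) / n) (hbad 1))
  have h5 := hmono ι
  rw [abs_le] at *
  rw [show 3 * (badCount (R + 1) ι : ℝ) / n = 3 * ((badCount (R + 1) ι : ℝ) / n) by ring]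
  constructor <;> linarith [e1.1, e1.2, e2.1, e2.2, e3.1, e3.2]

end

section
variable {d : ℕ} {M : Type} [Fintype M] [MeasurableSpace M] [DiscreteMeasurableSpace M]
  {μ : Measure (TdVertex d → M)} {S : Set (TdVertex d)}

lemma measurable_restr {I : Type} (g : I → TdVertex d) :
    Measurable fun (x : TdVertex d → M) i => x (g i) :=
  measurable_pi_lambda _ fun i => measurable_pi_apply (g i)

lemma isProb_restrictTo [IsProb μ] : IsProb (restrictTo S μ) :=
  Measure.isProbabilityMeasure_map (measurable_restr _).aemeasurable

lemma vec_restrictTo [Finite S] (y : TdVertex d → M) :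
    vec (restrictTo S μ) (fun v => y v.1) = (μ (cylEvent S y)).toReal := by
  unfold vec restrictTo
  rw [Measure.map_apply (measurable_restr _) (measurableSet_singleton _)]
  congr 2
  ext x
  exact ⟨fun h v hv => congrFun h ⟨v, hv⟩, fun h => funext fun v => h v.1 v.2⟩

lemma integrable_log_cyl [IsProb μ] [Finite S] :
    Integrable (fun y => log (μ (cylEvent S y)).toReal) μ ∧
    shannon (restrictTo S μ) = -∫ y, log (μ (cylEvent S y)).toReal ∂μ ∧
    ∀ᵐ y ∂μ, 0 < (μ (cylEvent S y)).toReal := by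
  have hp : IsProb (restrictTo S μ) := isProb_restrictTo
  simp_rw [← vec_restrictTo]
  have := ofFinite S
  set g : (S → M) → ℝ := fun c => log (vec (restrictTo S μ) c) with hg
  have hm : AEMeasurable (fun (x : TdVertex d → M) (v : S) => x v.1) μ :=
    (measurable_restr _).aemeasurable
  have hi : Integrable g (restrictTo S μ) := Integrable.of_finite
  refine ⟨(integrable_map_measure hi.1 hm).mp hi, ?_, ?_⟩
  · rw [show ∫ y, log (vec (restrictTo S μ) fun v => y v.1) ∂μ = ∫ c, g c ∂(restrictTo S μ)
      from (integral_map hm hi.1).symm, integral_fintype hi, ← Finset.sum_neg_distrib]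
    refine (tsum_fintype _).trans (sum_congr rfl fun c _ => ?_)
    simp only [negMulLog, hg, vec, smul_eq_mul, measureReal_def]
    ring
  · have : ∀ᵐ c ∂(restrictTo S μ), 0 < vec (restrictTo S μ) c := by
      rw [ae_iff, ← Set.biUnion_of_singleton {c | ¬ 0 < vec (restrictTo S μ) c},
        measure_biUnion_null_iff (Set.to_countable _)]
      intro c hc
      have h0 := le_antisymm (not_lt.mp hc) (vec_nonneg _ c)
      exact ((ENNReal.toReal_eq_zero_iff _).mp h0).resolve_right (measure_ne_top _ _)
    exact ae_of_ae_map hm this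

lemma shannon_preimage (hμ : μ ∈ InvMeas d M) [Finite S] (φ : TdGraph d ≃g TdGraph d)
    {S' : Set (TdVertex d)} (h : ∀ v, v ∈ S' ↔ φ v ∈ S) :
    shannon (restrictTo S' μ) = shannon (restrictTo S μ) := by
  have hprob := hμ.1
  have hp : IsProb (restrictTo S μ) := isProb_restrictTo
  have := ofFinite S
  let e : S' ≃ S := φ.toEquiv.subtypeEquiv h
  have := Fintype.ofEquiv S e.symm
  let E : (S → M) ≃ (S' → M) := ⟨fun c v => c (e v), fun c v => c (e.symm v), fun c => by simp,
    fun c => by simp⟩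
  have h1 : restrictTo S' μ = (restrictTo S μ).map E := by
    conv_lhs => rw [← hμ.2 φ]
    unfold restrictTo
    rw [Measure.map_map (measurable_restr _) (measurable_restr _),
      Measure.map_map .of_discrete (measurable_restr _)]
    rfl
  rw [h1, shannon_eq_ent, shannon_eq_ent, vec_map]
  exact sum_equiv E.symm _ _ fun b => congrArg _ (pf_equiv E _ b)

lemma restrictTo_map_iso (hμ : μ ∈ InvMeas d M) (Φ : TdGraph d ≃g TdGraph d) (ψ : S → S)
    (h : ∀ u : S, Φ u.1 = (ψ u).1) [Finite S] :
    (restrictTo S μ).map (fun x v => x (ψ v)) = restrictTo S μ := by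
  conv_rhs => rw [← hμ.2 Φ]
  unfold restrictTo
  rw [Measure.map_map (measurable_restr _) (measurable_restr _),
    Measure.map_map .of_discrete (measurable_restr _)]
  congr 1
  funext x v
  exact congrArg x (h v).symm

lemma restrictErOfSr_restrictTo (R : ℕ) : restrictErOfSr d R (srLaw d R μ) = erLaw d R μ := by
  unfold restrictErOfSr restrictTo
  rw [Measure.map_map .of_discrete (measurable_restr _)]
  rfl

lemma restrictTo_mem_IdrMeas (hd : 3 ≤ d) (hμ : μ ∈ InvMeas d M) {R : ℕ} (hR : 1 ≤ R) :
    srLaw d R μ ∈ IdrMeas d R M := by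
  have hprob := hμ.1
  have hd2 : 2 ≤ d := by omega
  have hp : IsProb (srLaw d R μ) := isProb_restrictTo
  have hinv := (inv_vec_iff (srLaw d R μ)).mp fun φ => by
    obtain ⟨Φ, hΦ⟩ := exists_extension_sr hd φ
    exact restrictTo_map_iso hμ Φ φ hΦ
  refine (mem_IdrMeas_iff hd hR _).mpr ⟨vec_nonneg _, sum_vec _, hinv, fun e => ?_⟩
  have hpE : IsProb (erLaw d R μ) := isProb_restrictTo
  have h1 := congrFun (congrArg vec (restrictTo_map_iso hμ (S := ErSet d R) (tdFlip hd2)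
    (erFlip hd2 R) fun u => rfl)) e
  rw [vec_map] at h1
  rw [Tv_eq_of_inv (by omega) hinv, ← vec_restrictErOfSr, restrictErOfSr_restrictTo, ← h1]
  exact (pf_equiv ⟨flipE hd2, flipE hd2, flipE_flipE hd2, flipE_flipE hd2⟩ _ e).symm

lemma treeDist_nil (l : List ℕ) : treeDist l [] = l.length := by simp [treeDist]

lemma treeDist_singleton (l : List ℕ) (i : ℕ) :
    treeDist l [i] = if l.getLast? = some i then l.length - 1 else l.length + 1 := by
  rw [List.getLast?_eq_head?_reverse, ← l.length_reverse]
  simp only [treeDist]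
  cases h : l.reverse with
  | nil => simp [← l.length_reverse, h]
  | cons a t =>
    by_cases hai : a = i <;> simp [← l.length_reverse, h, hai]

set_option maxHeartbeats 800000 in
/-- Submodularity holds with equality across an edge. -/
lemma shannon_union_add_inter {r : ℕ} [IsProb μ] (hMar : rMarkov r μ) (i : ℕ) (hi : ValidTd d [i])
    {U V : Set (TdVertex d)} [Finite U] [Finite V]
    (hUV : ∀ v : TdVertex d, v.1.getLast? = some i → v ∈ U → v ∈ V)
    (hVU : ∀ v : TdVertex d, v.1.getLast? ≠ some i → v ∈ V → v ∈ U)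
    (hC : ∀ v : TdVertex d, v.1.length + 1 ≤ r ∨ (v.1.getLast? = some i ∧ v.1.length ≤ r) →
      v ∈ U ∧ v ∈ V) :
    shannon (restrictTo (U ∪ V) μ) + shannon (restrictTo (U ∩ V) μ)
      = shannon (restrictTo U μ) + shannon (restrictTo V μ) := by
  set u : TdVertex d := ⟨[i], hi⟩
  set C := edgeBall r u (rootTd d) with hCdef
  have hlast : ∀ v : TdVertex d, v.1.getLast? = some i → 1 ≤ v.1.length := fun v h =>
    List.length_pos_iff.mpr fun h0 => by rw [h0] at h; cases h
  have hside1 : ∀ v : TdVertex d, v.1.getLast? = some i → v ∈ sideOf u (rootTd d) := fun v h => by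
    change treeDist v.1 [i] < treeDist v.1 []
    have := hlast v h
    rw [treeDist_nil, treeDist_singleton, if_pos h]
    omega
  have hside2 : ∀ v : TdVertex d, v.1.getLast? ≠ some i → v ∈ sideOf (rootTd d) u := fun v h => by
    change treeDist v.1 [] < treeDist v.1 [i]
    rw [treeDist_nil, treeDist_singleton, if_neg h]
    omega
  have hCU : ∀ v ∈ C, v ∈ U ∧ v ∈ V := fun v hv => hC v <| by
    change treeDist v.1 [i] + 1 ≤ r ∨ treeDist v.1 [] + 1 ≤ r at hv
    rw [treeDist_nil, treeDist_singleton] at hv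
    split_ifs at hv with h
    · have := hlast v h
      by_cases h' : v.1.length + 1 ≤ r
      · exact Or.inl h'
      · exact Or.inr ⟨h, by omega⟩
    · left; omega
  have hCfin : Finite C := Set.Finite.subset (Set.toFinite U) fun v hv => (hCU v hv).1
  set A : Set (TdVertex d) := {v | v.1.getLast? = some i} with hA
  have key : ∀ S : Set (TdVertex d), C ⊆ S → Finite S →
      shannon (restrictTo S μ) + shannon (restrictTo C μ)
        = shannon (restrictTo (S ∩ A ∪ C) μ) + shannon (restrictTo (S ∩ Aᶜ ∪ C) μ) := fun S hS hfin => by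
    have hf1 : (S ∩ A).Finite := Set.Finite.subset (Set.toFinite S) Set.inter_subset_left
    have hf2 : (S ∩ Aᶜ).Finite := Set.Finite.subset (Set.toFinite S) Set.inter_subset_left
    have i1 : Finite ↥(S ∩ A ∪ C) := (hf1.union (Set.toFinite C)).to_subtype
    have i2 : Finite ↥(S ∩ Aᶜ ∪ C) := (hf2.union (Set.toFinite C)).to_subtype
    obtain ⟨I1, e1, p1⟩ := integrable_log_cyl (μ := μ) (S := S)
    obtain ⟨I2, e2, p2⟩ := integrable_log_cyl (μ := μ) (S := C)
    obtain ⟨I3, e3, p3⟩ := integrable_log_cyl (μ := μ) (S := S ∩ A ∪ C)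
    obtain ⟨I4, e4, p4⟩ := integrable_log_cyl (μ := μ) (S := S ∩ Aᶜ ∪ C)
    rw [e1, e2, e3, e4, ← neg_add, ← neg_add, ← integral_add I1 I2, ← integral_add I3 I4]
    congr 1
    refine integral_congr_ae ?_
    filter_upwards [p1, p2, p3, p4] with y h1 h2 h3 h4
    change log _ + log _ = log _ + log _
    rw [← log_mul h1.ne' h2.ne', ← log_mul h3.ne' h4.ne', ← ENNReal.toReal_mul,
      ← ENNReal.toReal_mul]
    have := hMar u (rootTd d) trivial trivial (Or.inr ⟨i, rfl⟩) hf1.toFinset hf2.toFinset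
      (fun v hv => ⟨hside1 v (hf1.mem_toFinset.mp hv).2, trivial⟩)
      (fun v hv => ⟨hside2 v (hf2.mem_toFinset.mp hv).2, trivial⟩) y
    rw [Set.inter_univ, hf1.coe_toFinset, hf2.coe_toFinset, Set.inter_union_compl,
      Set.union_eq_left.mpr hS] at this
    rw [this]
  have hfU := Set.toFinite U
  have hfV := Set.toFinite V
  have k1 := key (U ∪ V) (fun v hv => Or.inl (hCU v hv).1) (hfU.union hfV).to_subtype
  have k2 := key (U ∩ V) hCU (hfU.inter_of_left _).to_subtype
  have k3 := key U (fun v hv => (hCU v hv).1) inferInstance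
  have k4 := key V (fun v hv => (hCU v hv).2) inferInstance
  rw [show (U ∪ V) ∩ A = V ∩ A from Set.ext fun v =>
      ⟨fun h => ⟨h.1.elim (hUV v h.2) id, h.2⟩, fun h => ⟨.inr h.1, h.2⟩⟩,
    show (U ∪ V) ∩ Aᶜ = U ∩ Aᶜ from Set.ext fun v =>
      ⟨fun h => ⟨h.1.elim id (hVU v h.2), h.2⟩, fun h => ⟨.inl h.1, h.2⟩⟩] at k1
  rw [show (U ∩ V) ∩ A = U ∩ A from Set.ext fun v =>
      ⟨fun h => ⟨h.1.1, h.2⟩, fun h => ⟨⟨h.1, hUV v h.2 h.1⟩, h.2⟩⟩,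
    show (U ∩ V) ∩ Aᶜ = V ∩ Aᶜ from Set.ext fun v =>
      ⟨fun h => ⟨h.1.2, h.2⟩, fun h => ⟨⟨hVU v h.2 h.1, h.1⟩, h.2⟩⟩] at k2
  linarith

lemma getLast?_rot (a : Fin d) (l : List ℕ) :
    (rootMap (rot a) l).getLast? = some (a + 1 : ℕ) ↔ l.getLast? = some 1 := by
  rw [getLast?_rootMap]
  cases l.getLast? with
  | none => simp
  | some k =>
    simp only [Option.map_some, Option.some.injEq]
    exact ⟨fun h => (rot a).injective h, fun h => by rw [h]; rfl⟩

lemma SigmaR_succ (hd : 3 ≤ d) {r R : ℕ} (hμ : μ ∈ InvMeas d M) (hMar : rMarkov r μ) (hR : r ≤ R) :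
    SigmaR d (R + 1) μ = SigmaR d R μ := by
  have hprob := hμ.1
  let E : ℕ → Set (TdVertex d) := fun i =>
    {v | v.1.length + 1 ≤ R ∨ (v.1.getLast? = some i ∧ v.1.length ≤ R)}
  let V : ℕ → Set (TdVertex d) := fun i =>
    {v | v.1.length + 1 ≤ R ∨ (v.1.getLast? = some i ∧ v.1.length ≤ R + 1)}
  let U : ℕ → Set (TdVertex d) := fun k =>
    {v | v.1.length ≤ R ∨ (v.1.length ≤ R + 1 ∧ ∃ j ≤ k, v.1.getLast? = some j)}
  have hlast : ∀ (v : TdVertex d) j, v.1.getLast? = some j → 1 ≤ j ∧ j ≤ d ∧ 1 ≤ v.1.length :=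
    fun v j h => ⟨(v.2.2 j h).1, (v.2.2 j h).2, List.length_pos_iff.mpr fun h0 => by
      rw [h0] at h; cases h⟩
  have hfin : ∀ S : Set (TdVertex d), (∀ v ∈ S, v.1.length ≤ R + 1) → Finite S := fun S hS =>
    Set.Finite.subset (Set.toFinite (SrSet d (R + 1))) hS
  have hU : ∀ k, Finite (U k) := fun k => hfin _ fun v hv => by
    rcases hv with h | h <;> omega
  have hV : ∀ k, Finite (V k) := fun k => hfin _ fun v hv => by
    rcases hv with h | h <;> omega
  have hE : ∀ k, Finite (E k) := fun k => hfin _ fun v hv => by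
    rcases hv with h | h <;> omega
  have step : ∀ k < d, shannon (restrictTo (U (k + 1)) μ)
      = shannon (restrictTo (U k) μ) + (shannon (srLaw d R μ)
        - shannon (erLaw d R μ)) := fun k hk => by
    have h1 := shannon_union_add_inter hMar (k + 1) (validTd_singleton.mpr ⟨by omega, by omega⟩)
      (U := U k) (V := V (k + 1))
      (fun v hl hv => Or.inr ⟨hl, by rcases hv with h | h <;> omega⟩)
      (fun v hl hv => Or.inl (by
        rcases hv with h | h
        · omega
        · exact absurd h.1 hl))
      (fun v hv => by
        rcases hv with h | h
        · exact ⟨Or.inl (by omega), Or.inl (by omega)⟩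
        · exact ⟨Or.inl (by omega), Or.inr ⟨h.1, by omega⟩⟩)
    have e1 : U k ∪ V (k + 1) = U (k + 1) := by
      ext v
      constructor
      · rintro ((h | ⟨h, j, hj, hj'⟩) | (h | ⟨h, h'⟩))
        · exact Or.inl h
        · exact Or.inr ⟨h, j, by omega, hj'⟩
        · exact Or.inl (by omega)
        · exact Or.inr ⟨h', _, le_rfl, h⟩
      · rintro (h | ⟨h, j, hj, hj'⟩)
        · exact Or.inl (Or.inl h)
        · rcases Nat.lt_or_eq_of_le hj with hlt | rfl
          · exact Or.inl (Or.inr ⟨h, j, by omega, hj'⟩)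
          · exact Or.inr (Or.inr ⟨hj', h⟩)
    have e2 : U k ∩ V (k + 1) = E (k + 1) := by
      ext v
      constructor
      · rintro ⟨h1, h | ⟨h, h'⟩⟩
        · exact Or.inl h
        · rcases h1 with h1 | ⟨h1, j, hj, hj'⟩
          · exact Or.inr ⟨h, h1⟩
          · rw [h, Option.some.injEq] at hj'
            omega
      · rintro (h | ⟨h, h'⟩)
        · exact ⟨Or.inl (by omega), Or.inl h⟩
        · exact ⟨Or.inl h', Or.inr ⟨h, by omega⟩⟩
    have e3 : shannon (restrictTo (E (k + 1)) μ) = shannon (erLaw d R μ) :=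
      (shannon_preimage hμ (tdRot ⟨k, hk⟩) fun v => by
        change v.1.length + 1 ≤ R ∨ (v.1.getLast? = some 1 ∧ v.1.length ≤ R) ↔
          (rootMap (rot k) v.1).length + 1 ≤ R ∨
            ((rootMap (rot k) v.1).getLast? = some (k + 1) ∧ (rootMap (rot k) v.1).length ≤ R)
        rw [rootMap_length, getLast?_rot ⟨k, hk⟩]).symm
    have e4 : shannon (restrictTo (V (k + 1)) μ) = shannon (restrictTo (V 1) μ) :=
      (shannon_preimage hμ (tdRot ⟨k, hk⟩) fun v => by
        change v.1.length + 1 ≤ R ∨ (v.1.getLast? = some 1 ∧ v.1.length ≤ R + 1) ↔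
          (rootMap (rot k) v.1).length + 1 ≤ R ∨
            ((rootMap (rot k) v.1).getLast? = some (k + 1) ∧ (rootMap (rot k) v.1).length ≤ R + 1)
        rw [rootMap_length, getLast?_rot ⟨k, hk⟩]).symm
    have e5 : shannon (srLaw d R μ) = shannon (restrictTo (V 1) μ) :=
      shannon_preimage hμ (tdFlip (by omega)) fun v => by
        change v.1.length ≤ R ↔ (flipL v.1).length + 1 ≤ R ∨
          ((flipL v.1).getLast? = some 1 ∧ (flipL v.1).length ≤ R + 1)
        rw [flipL_getLast v.1 v.2]
        by_cases h : v.1.getLast? = some 1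
        · have := (flipL_length v.1).1 h
          simp only [h, ne_eq, not_true_eq_false, false_and, or_false]; omega
        · have := (flipL_length v.1).2 h
          simp only [h, ne_eq, not_false_eq_true, true_and]; omega
    rw [e1, e2, e3, e4, ← e5] at h1
    linarith
  have hU0 : U 0 = SrSet d R := Set.ext fun v => ⟨fun h => h.elim id fun ⟨_, j, hj, hj'⟩ => by
    have := (hlast v j hj').1
    omega, Or.inl⟩
  have hU1 : U 1 = ErSet d (R + 1) := by
    ext v
    constructor
    · rintro (h | ⟨h, j, hj, hj'⟩)
      · exact Or.inl (by omega)
      · have := (hlast v j hj').1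
        exact Or.inr ⟨by rw [hj', show j = 1 by omega], h⟩
    · rintro (h | ⟨h, h'⟩)
      · exact Or.inl (by omega)
      · exact Or.inr ⟨h', 1, le_rfl, h⟩
  have hUd : U d = SrSet d (R + 1) := by
    ext v
    constructor
    · rintro (h | ⟨h, -⟩)
      · exact Nat.le_succ_of_le h
      · exact h
    · intro h
      by_cases hv : v.1.length ≤ R
      · exact Or.inl hv
      · cases hl : v.1.getLast? with
        | none => exact absurd (by rw [List.getLast?_eq_none_iff.mp hl]; exact Nat.zero_le _) hv
        | some j => exact Or.inr ⟨h, j, (hlast v j hl).2.1, hl⟩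
  have hk : ∀ k ≤ d, shannon (restrictTo (U k) μ) = shannon (srLaw d R μ)
      + k * (shannon (srLaw d R μ) - shannon (erLaw d R μ)) := fun k => by
    induction k with
    | zero => intro _; rw [hU0]; simp
    | succ k ih => intro hk; rw [step k hk, ih (by omega)]; push_cast; ring
  have h1 := hk 1 (by omega)
  have h2 := hk d le_rfl
  rw [hU1] at h1
  rw [hUd] at h2
  unfold SigmaR
  rw [h1, h2]
  push_cast
  ring

lemma entJ_restrictTo (hd : 3 ≤ d) {r R : ℕ} (hr : 1 ≤ r) (hμ : μ ∈ InvMeas d M)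
    (hMar : rMarkov r μ) (hR : r ≤ R) : entJ (srVec d R μ) = SigmaR d r μ := by
  have hprob := hμ.1
  have hp : IsProb (srLaw d R μ) := isProb_restrictTo
  rw [← SigmaP_eq_entJ (by omega) _
    ((mem_IdrMeas_iff hd (hr.trans hR) _).mp (restrictTo_mem_IdrMeas hd hμ (hr.trans hR))).inv,
    SigmaP, restrictErOfSr_restrictTo]
  induction R, hR using Nat.le_induction with
  | base => rfl
  | succ R hR ih => exact (SigmaR_succ hd hμ hMar hR).trans (ih isProb_restrictTo)

end

section
variable {M : Type}

lemma isProb_distrG [Fintype M] {n : ℕ} (hn : 0 < n) (G : Gr n) (f : Fin n → M) :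
    IsProb (distrG G f) := by
  have h := distrG_apply_toReal G f MeasurableSet.univ
  have hn' : (n:ℝ) ≠ 0 := by positivity
  have hc : (card (Perm (Fin n)) : ℝ) ≠ 0 := mod_cast Fintype.card_ne_zero
  simp only [Set.mem_univ, if_true, sum_const, card_univ, card_fin,
    nsmul_eq_mul, mul_one, div_self hn', div_self hc] at h
  exact ⟨(ENNReal.toReal_eq_one_iff _).mp h⟩

lemma abs_sub_le_of_levyProkhorovDist {ν₁ ν₂ : Measure (RCG M)} [IsFiniteMeasure ν₁]
    [IsFiniteMeasure ν₂] {r : ℕ} {ε : ℝ} (hε : 0 < ε) (hεr : 2 * ε ≤ (2:ℝ)⁻¹ ^ r)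
    (h : levyProkhorovDist (ν₁.map (resS r)) (ν₂.map (resS r)) ≤ ε) (A : Set (RCG M)) :
    |(ν₁ {g | resS r g ∈ A}).toReal - (ν₂ {g | resS r g ∈ A}).toReal| ≤ 2 * ε := by
  have := Measure.isFiniteMeasure_map ν₁ (resS r)
  have := Measure.isFiniteMeasure_map ν₂ (resS r)
  have hB := measurableSet_resS r A
  have hlt : levyProkhorovEDist (ν₁.map (resS r)) (ν₂.map (resS r)) < ENNReal.ofReal (2 * ε) :=
    (ENNReal.lt_ofReal_iff_toReal_lt (levyProkhorovEDist_ne_top _ _)).mpr (h.trans_lt (by linarith))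
  have hth : Metric.thickening (ENNReal.ofReal (2 * ε)).toReal {g | resS r g ∈ A}
      ⊆ {g | resS r g ∈ A} := by
    rw [ENNReal.toReal_ofReal (by linarith)]
    intro g hg
    obtain ⟨g', hg', hd⟩ := Metric.mem_thickening_iff.mp hg
    change resS r g ∈ A
    rw [resS_eq_of_dist_lt (hd.trans_le hεr)]
    exact hg'
  have hm (ν : Measure (RCG M)) : ν.map (resS r) {g | resS r g ∈ A} = ν {g | resS r g ∈ A} := by
    rw [Measure.map_apply (measurable_resS r) hB]
    congr 1
    ext g
    change resS r (resS r g) ∈ A ↔ _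
    rw [resS_resS le_rfl]
    rfl
  have h1 := (left_measure_le_of_levyProkhorovEDist_lt hlt hB).trans
    (add_le_add_left (measure_mono hth) _)
  have h2 := (right_measure_le_of_levyProkhorovEDist_lt hlt hB).trans
    (add_le_add_left (measure_mono hth) _)
  rw [hm, hm] at h1 h2
  have key {a b : ℝ≥0∞} (ha : b ≠ ∞) (hab : a ≤ b + ENNReal.ofReal (2 * ε)) :
      a.toReal ≤ b.toReal + 2 * ε := by
    have := ENNReal.toReal_mono (ENNReal.add_ne_top.mpr ⟨ha, ENNReal.ofReal_ne_top⟩) hab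
    rwa [ENNReal.toReal_add ha ENNReal.ofReal_ne_top, ENNReal.toReal_ofReal (by linarith)] at this
  have h3 := key (measure_ne_top _ _) h1
  have h4 := key (measure_ne_top _ _) h2
  exact abs_le.mpr ⟨by linarith, by linarith⟩

lemma le_add_ofReal_of_abs_sub_le {a b : ℝ≥0∞} (ha : a ≠ ∞) (hb : b ≠ ∞) {ε ε' : ℝ} (hε : ε ≤ ε')
    (h : |a.toReal - b.toReal| ≤ ε) : a ≤ b + ENNReal.ofReal ε' := by
  have hε0 := (abs_nonneg _).trans (h.trans hε)
  rw [← ENNReal.ofReal_toReal ha, ← ENNReal.ofReal_toReal hb,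
    ← ENNReal.ofReal_add ENNReal.toReal_nonneg hε0]
  exact ENNReal.ofReal_le_ofReal (by linarith [(abs_le.mp h).2])

lemma levyProkhorovDist_map_le {ν₁ ν₂ : Measure (RCG M)} [IsProb ν₁]
    [IsProb ν₂] {R : ℕ} {ε : ℝ} (hε : 0 < ε) (hεR : (2:ℝ)⁻¹ ^ R ≤ ε)
    (h : ∀ A : Set (RCG M),
      |(ν₁ {g | resS R g ∈ A}).toReal - (ν₂ {g | resS R g ∈ A}).toReal| ≤ ε)
    {T : RCG M → RCG M} (hT : Measurable T)
    (hTR : ∀ g g', resS R g = resS R g' → dist (T g) (T g') ≤ (2:ℝ)⁻¹ ^ R) :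
    levyProkhorovDist (ν₁.map T) (ν₂.map T) ≤ ε := by
  have := Measure.isProbabilityMeasure_map (μ := ν₁) hT.aemeasurable
  have := Measure.isProbabilityMeasure_map (μ := ν₂) hT.aemeasurable
  refine levyProkhorovDist_le_of_forall_le _ _ hε.le fun ε' B hε' hB => ?_
  rw [Measure.map_apply hT hB, Measure.map_apply hT Metric.isOpen_thickening.measurableSet]
  obtain ⟨A, hA⟩ : ∃ A : Set (RCG M), ∀ k, k ∈ A ↔ ∃ g, T g ∈ B ∧ resS R g = k :=
    ⟨{k | ∃ g, T g ∈ B ∧ resS R g = k}, fun k => Iff.rfl⟩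
  have h1 : T ⁻¹' B ⊆ {g | resS R g ∈ A} := fun g hg => (hA _).mpr ⟨g, hg, rfl⟩
  have h2 : {g | resS R g ∈ A} ⊆ T ⁻¹' Metric.thickening ε' B := fun g hg => by
    obtain ⟨g', hg', he⟩ := (hA _).mp hg
    have hlt := (hTR g g' he.symm).trans_lt (hεR.trans_lt hε')
    rw [Set.mem_preimage, Metric.mem_thickening_iff]
    exact ⟨T g', hg', hlt⟩
  have h3 := le_add_ofReal_of_abs_sub_le (measure_ne_top ν₁ _) (measure_ne_top ν₂ _) hε'.le (h A)
  exact (measure_mono h1).trans (h3.trans (add_le_add (measure_mono h2) le_rfl))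

variable {d : ℕ}

lemma iotaSr_injective (R : ℕ) : Injective (iotaSr d R : Col d R M → RCG M) := fun c c' h => by
  funext v
  have h1 := congrFun (congrArg RCG.col h) v.1.1
  have h2 : ValidTd d v.1.1 ∧ v.1.1.length ≤ R := ⟨v.1.2, v.2⟩
  simp only [iotaSr, dif_pos h2] at h1
  exact Option.some.inj h1

lemma resS_iotaTd (R : ℕ) (x : TdVertex d → M) :
    resS R (iotaTd d x) = iotaSr d R fun v => x v.1 := by
  refine RCG.ext ?_ ?_
  · funext l
    simp only [resS, iotaTd, iotaSr]
    by_cases h1 : l.length ≤ R <;> by_cases h2 : ValidTd d l <;> simp [h1, h2]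
  · funext p
    simp only [resS, iotaTd, iotaSr]
    split_ifs <;> first | rfl | tauto

variable [Fintype M] [MeasurableSpace M] [DiscreteMeasurableSpace M] {μ : Measure (TdVertex d → M)}

lemma preimage_iotaTd (R : ℕ) (A : Set (RCG M)) :
    iotaTd d ⁻¹' {g | resS R g ∈ A} = (fun (x : TdVertex d → M) (v : SrSet d R) => x v.1) ⁻¹'
      {c | iotaSr d R c ∈ A} := by
  ext x
  change resS R (iotaTd d x) ∈ A ↔ _
  rw [resS_iotaTd]
  rfl

lemma measurable_iotaTd : Measurable (iotaTd d : (TdVertex d → M) → RCG M) := by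
  refine measurable_of_isOpen fun U hU => ?_
  have : U = ⋃ R : ℕ, {g | resS R g ∈ {k | ∀ g', resS R g' = k → g' ∈ U}} := by
    ext g
    refine ⟨fun hg => ?_, fun hg => ?_⟩
    · obtain ⟨ε, hε, hb⟩ := Metric.isOpen_iff.mp hU g hg
      obtain ⟨R, hR⟩ := exists_pow_lt_of_lt_one hε (by norm_num : (2:ℝ)⁻¹ < 1)
      exact Set.mem_iUnion.mpr ⟨R, fun g' hg' =>
        hb (Metric.mem_ball.mpr ((dist_le_of_resS_eq hg').trans_lt hR))⟩
    · obtain ⟨R, hR⟩ := Set.mem_iUnion.mp hg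
      exact hR g rfl
  rw [this, Set.preimage_iUnion]
  refine MeasurableSet.iUnion fun R => ?_
  rw [preimage_iotaTd]
  exact measurable_restr _ .of_discrete

lemma lawTd_apply_toReal [IsProb μ] (R : ℕ) (A : Set (RCG M)) :
    (lawTd d μ {g | resS R g ∈ A}).toReal
      = ∑ c, srVec d R μ c * (if iotaSr d R c ∈ A then 1 else 0) := by
  have : IsProb (srLaw d R μ) := isProb_restrictTo
  rw [lawTd, Measure.map_apply measurable_iotaTd (measurableSet_resS R A), preimage_iotaTd,
    ← Measure.map_apply (measurable_restr _) .of_discrete]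
  change (srLaw d R μ {c | iotaSr d R c ∈ A}).toReal = _
  rw [toReal_measure_eq_sum]
  refine sum_congr rfl fun c _ => ?_
  by_cases h : iotaSr d R c ∈ A
  · exact (if_pos h).trans (by rw [if_pos h, mul_one])
  · exact (if_neg h).trans (by rw [if_neg h, mul_zero])

variable [NeZero d] {n : ℕ} {ι : HMap n d}

lemma abs_distrG_sub_lawTd_le [IsProb μ] (hd : 3 ≤ d) (hι : Simple ι)
    (f : Fin n → M) (R : ℕ) (A : Set (RCG M)) :
    |(distrG (gr ι) f {g | resS R g ∈ A}).toReal - (lawTd d μ {g | resS R g ∈ A}).toReal|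
      ≤ 3 * (badCount (R + 1) ι : ℝ) / n + l1 (sym (phat R ι f)) (srVec d R μ) := by
  refine (abs_sub_le _ _ _).trans (add_le_add (abs_distrG_sub_le hd hι f A) ?_)
  rw [lawTd_apply_toReal, ← sum_sub_distrib]
  refine (abs_sum_le_sum_abs _ _).trans (sum_le_sum fun c _ => ?_)
  split_ifs <;> simp

lemma l1_sym_phat_le [IsProb μ] (hd : 3 ≤ d) (hι : Simple ι) (f : Fin n → M)
    {R : ℕ} {a : ℝ} (h : ∀ A : Set (RCG M), |(distrG (gr ι) f {g | resS R g ∈ A}).toReal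
      - (lawTd d μ {g | resS R g ∈ A}).toReal| ≤ a) :
    l1 (sym (phat R ι f)) (srVec d R μ)
      ≤ card (Col d R M) * (3 * (badCount (R + 1) ι : ℝ) / n + a) := by
  refine l1_le_card_mul _ _ _ fun c => ?_
  obtain ⟨A, hA⟩ : ∃ A : Set (RCG M), A = {iotaSr d R c} := ⟨_, rfl⟩
  have hs (q : Col d R M → ℝ) : ∑ c', q c' * (if iotaSr d R c' ∈ A then 1 else 0) = q c := by
    rw [sum_eq_single c, if_pos (by simp [hA]), mul_one]
    · intro c' _ hc'
      rw [if_neg fun h => hc' (iotaSr_injective R (by simpa [hA] using h)), mul_zero]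
    · simp
  have h1 := abs_distrG_sub_le (R := R) hd hι f A
  have h2 := h A
  rw [lawTd_apply_toReal, hs] at h2
  rw [hs, abs_sub_comm] at h1
  exact (abs_sub_le _ _ _).trans (add_le_add h1 h2)

end

section

lemma exists_finset {α : Type*} [Fintype α] (p : α → Prop) : ∃ S : Finset α, ∀ x, x ∈ S ↔ p x :=
  ⟨univ.filter p, by simp⟩

lemma exists_finset₂ {α β : Type*} [Fintype α] [Fintype β] (p : α → β → Prop) :
    ∃ S : Finset (α × β), ∀ a b, (a, b) ∈ S ↔ p a b :=
  ⟨univ.filter fun x => p x.1 x.2, by simp⟩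

lemma card_conf {d n m : ℕ} (hm : 2 * m = n * d) : card (Conf d n m) = (n * d)! := by
  have e : Conf d n m := equivOfCardEq (by simp; omega)
  have := Fintype.card_equiv e
  simp only [card_prod, card_fin, Fintype.card_bool] at this
  rw [← hm, mul_comm 2 m, ← this]

lemma badCount_mono {d n : ℕ} [NeZero d] {ι : HMap n d} {R R' : ℕ}
    (h : R ≤ R') : badCount R ι ≤ badCount R' ι :=
  card_le_card fun v hv => by
    simp only [mem_filter, mem_univ, true_and] at hv ⊢
    exact fun h' => hv (h'.mono h)

/-- The section of a finite set of pairs over a first coordinate. -/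
def fib {A B : Type*} [Fintype B] (Z : Finset (A × B)) (a : A) : Finset B :=
  univ.filter fun b => (a, b) ∈ Z

lemma mem_fib {A B : Type*} [Fintype B] {Z : Finset (A × B)} {a : A} {b : B} :
    b ∈ fib Z a ↔ (a, b) ∈ Z := by simp [fib]

lemma sum_card_fib {A B : Type*} [Fintype A] [Fintype B] (Z : Finset (A × B)) :
    ∑ a, (#(fib Z a) : ℝ) = #Z := by
  rw [Finset.card_eq_sum_card_fiberwise (f := Prod.fst) (t := univ) (by simp)]
  push_cast
  refine sum_congr rfl fun a _ => ?_
  congr 1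
  refine card_bij (fun b _ => (a, b)) (fun b hb => ?_) (fun b _ b' _ h => (Prod.ext_iff.mp h).2)
    fun x hx => ?_
  · exact mem_filter.mpr ⟨mem_fib.mp hb, rfl⟩
  · obtain ⟨h1, h2⟩ := mem_filter.mp hx
    exact ⟨x.2, mem_fib.mpr (by rw [← h2]; exact h1), by rw [← h2]⟩

lemma PrG_le_of_card (d : ℕ) [NeZero d] {a : ℝ} (ha : 0 < a) : ∀ᶠ n : ℕ in atTop, ∀ m, 2 * m = n * d →
    ∀ (A : Set (Gr n)) (B : Finset (Conf d n m)),
      (∀ π : Conf d n m, Simple π° → gr π° ∈ A → π ∈ B) →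
      (#B : ℝ) ≤ 3 * (card (Conf d n m) * exp (-(a * n))) →
      PrG d n A ≤ exp (-(a / 2 * n)) ∧ 1 - exp (-(a / 2 * n)) ≤ PrG d n Aᶜ := by
  obtain ⟨K, n₀, hK⟩ := card_conf_le_simple d
  filter_upwards [eventually_ge_atTop n₀,
    poly_le_exp (6 * (1 + (d:ℝ) ^ 2) ^ K) (2 * K) (half_pos ha)] with n hn hp m hm A B hAB hB
  have h1 : (card (Conf d n m) : ℝ)
      ≤ 2 * (1 + (n * d) ^ 2) ^ K * #(simpleConf d n m) := mod_cast hK n hn m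
  have hc : (0:ℝ) < card (Conf d n m) := by
    rw [card_conf hm]
    exact_mod_cast Nat.factorial_pos _
  have hs : (0:ℝ) < #(simpleConf d n m) := by
    rcases (Nat.cast_nonneg (α := ℝ) #(simpleConf d n m)).eq_or_lt with h | h
    · rw [← h, mul_zero] at h1
      exact absurd h1 (not_le.mpr hc)
    · exact h
  have h2 : 3 * (card (Conf d n m) * exp (-(a * n)))
      ≤ exp (-(a / 2 * n)) * #(simpleConf d n m) := by
    have h3 : (1 + ((n:ℝ) * d) ^ 2) ^ K ≤ (1 + (d:ℝ) ^ 2) ^ K * ((n:ℝ) + 1) ^ (2 * K) := by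
      rw [pow_mul, ← mul_pow]
      refine pow_le_pow_left₀ (by positivity) ?_ K
      have : (0:ℝ) ≤ n := Nat.cast_nonneg n
      have : (0:ℝ) ≤ (d:ℝ) ^ 2 := by positivity
      nlinarith
    have h4 : exp (-(a / 2 * n)) = exp (a / 2 * n) * exp (-(a * n)) := by
      rw [← exp_add]
      congr 1
      ring
    rw [h4]
    calc _ ≤ 3 * ((2 * ((1 + (d:ℝ) ^ 2) ^ K * ((n:ℝ) + 1) ^ (2 * K)) * #(simpleConf d n m))
          * exp (-(a * n))) := by
          gcongr
          exact h1.trans (by gcongr)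
      _ = (6 * (1 + (d:ℝ) ^ 2) ^ K * ((n:ℝ) + 1) ^ (2 * K)) * exp (-(a * n))
          * #(simpleConf d n m) := by ring
      _ ≤ _ := by gcongr
  have h5 : PrG d n A ≤ exp (-(a / 2 * n)) := by
    rw [PrG_eq hm, div_le_iff₀ hs]
    refine le_trans ?_ (hB.trans h2)
    exact_mod_cast card_le_card fun π hπ => hAB π
      (mem_simpleConf.mp (mem_filter.mp hπ).1) (mem_filter.mp hπ).2
  refine ⟨h5, ?_⟩
  have h6 : PrG d n A + PrG d n Aᶜ = 1 := by
    rw [PrG_eq hm, PrG_eq hm, ← add_div, div_eq_one_iff_eq hs.ne']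
    have := Finset.card_filter_add_card_filter_not (s := simpleConf d n m) (fun π => gr π° ∈ A)
    rw [← this]
    push_cast
    congr!
  linarith

variable {d : ℕ} {M : Type} [Fintype M] [MeasurableSpace M] [DiscreteMeasurableSpace M]
  {μ : Measure (TdVertex d → M)} [NeZero d]

set_option maxHeartbeats 800000 in
theorem PrG_HG_lt (hd : 3 ≤ d) {r : ℕ} (hr : 1 ≤ r) [IsProb μ] {s : ℝ}
    (hs : entJ (srVec d r μ) ≤ s) {δ : ℝ} (hδ : 0 < δ) :
    ∃ ε > 0, ∀ᶠ n : ℕ in atTop, ∀ m, 2 * m = n * d →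
      PrG d n {G | ((s + 2 * δ : ℝ) : EReal) ≤ HG d μ r ε G} < 1 / 2 := by
  obtain ⟨η, hη, hZ⟩ := card_moment_le (N := M) (J := Unit) hd hr (fun _ => id)
    (srVec d r μ) s (fun q _ h => by
      have h1 : q = srVec d r μ := by
        rw [← h ()]
        funext b
        exact ((sum_eq_single b (fun x _ hx => if_neg hx)
          (fun h => absurd (mem_univ b) h)).trans (if_pos rfl)).symm
      rw [h1]
      exact hs) hδ
  obtain ⟨N, hN⟩ : ∃ N : ℝ, N = card (Col d r M) := ⟨_, rfl⟩
  have hN0 : 0 ≤ N := hN ▸ Nat.cast_nonneg _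
  obtain ⟨η', hη'⟩ : ∃ η', η' = η / (6 * (N + 1)) := ⟨_, rfl⟩
  have hη'0 : 0 < η' := by rw [hη']; positivity
  have hη'1 : 6 * (N + 1) * η' = η := by rw [hη']; field_simp
  obtain ⟨ε, hε, hε1, hε2⟩ : ∃ ε > 0, 2 * ε ≤ (2:ℝ)⁻¹ ^ r ∧ ε ≤ η' :=
    ⟨min ((2:ℝ)⁻¹ ^ r / 2) η', by positivity, by linarith [min_le_left ((2:ℝ)⁻¹ ^ r / 2) η'],
      min_le_right _ _⟩
  obtain ⟨c, hc, n₀, hbad⟩ := card_badCount_ge d (r + 1) hη'0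
  have ha : 0 < min c δ := lt_min hc hδ
  refine ⟨ε, hε, ?_⟩
  have hexp : ∀ᶠ n : ℕ in atTop, exp (-(min c δ / 2 * n)) < 1 / 2 := by
    have h0 : Tendsto (fun n : ℕ => exp (-(min c δ / 2 * n))) atTop (𝓝 0) :=
      Real.tendsto_exp_neg_atTop_nhds_zero.comp
        (tendsto_natCast_atTop_atTop.const_mul_atTop (half_pos ha))
    exact h0.eventually_lt_const (by norm_num)
  filter_upwards [hZ, PrG_le_of_card d ha, eventually_ge_atTop n₀, hexp, eventually_gt_atTop 0]
    with n hZ hPr hn hexp hn0 m hm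
  have hn' : (0:ℝ) < n := mod_cast hn0
  obtain ⟨Z, hZdef⟩ : ∃ Z : Finset (Conf d n m × (Fin n → M)), ∀ x, x ∈ Z ↔ Simple x.1° ∧
      (badCount (r + 1) x.1° : ℝ) ≤ η' * n ∧ x.2 ∈ FSet d μ r ε (gr x.1°) :=
    exists_finset _
  have hZc := hZ m hm Z fun x hx => by
    obtain ⟨h1, h2, h3⟩ := (hZdef x).mp hx
    have h4 := isProb_distrG hn0 (gr x.1°) x.2
    have h5 : IsProb (lawTd d μ) := Measure.isProbabilityMeasure_map measurable_iotaTd.aemeasurable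
    refine ⟨?_, fun _ => ?_⟩
    · refine (Nat.cast_le.mpr (badCount_mono (Nat.le_succ r))).trans (h2.trans ?_)
      gcongr
      nlinarith
    · refine (l1_sym_phat_le hd h1 x.2 (abs_sub_le_of_levyProkhorovDist hε hε1 h3)).trans ?_
      have h6 : 3 * (badCount (r + 1) x.1° : ℝ) / n ≤ 3 * η' := by
        rw [div_le_iff₀ hn']
        linarith
      rw [← hN, ← hη'1]
      nlinarith
  obtain ⟨B₁, hB₁⟩ : ∃ B : Finset (Conf d n m), ∀ π, π ∈ B ↔ Simple π° ∧
      (badCount (r + 1) π° : ℝ) ≤ η' * n ∧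
      ((s + 2 * δ : ℝ) : EReal) ≤ HG d μ r ε (gr π°) :=
    exists_finset _
  have hfib : ∀ π ∈ B₁, exp (n * (s + 2 * δ)) ≤ #(fib Z π) := fun π hπ => by
    obtain ⟨h1, h2, h3⟩ := (hB₁ π).mp hπ
    have h4 : FSet d μ r ε (gr π°) = ↑(fib Z π) := by
      ext f
      rw [mem_coe, mem_fib, hZdef]
      exact ⟨fun h => ⟨h1, h2, h⟩, fun h => h.2.2⟩
    rw [HG, h4, Set.ncard_coe_finset] at h3
    by_cases h5 : ((fib Z π : Finset (Fin n → M)) : Set (Fin n → M)) = ∅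
    · rw [if_pos h5] at h3
      exact absurd h3 (not_le.mpr (EReal.bot_lt_coe _))
    · rw [if_neg h5, EReal.coe_le_coe_iff, le_div_iff₀ hn'] at h3
      have h6 : (0:ℝ) < #(fib Z π) := by
        exact_mod_cast Finset.card_pos.mpr
          (Finset.coe_nonempty.mp (Set.nonempty_iff_ne_empty.mpr h5))
      rw [← Real.le_log_iff_exp_le h6]
      linarith
  have hB : (#B₁ : ℝ) ≤ card (Conf d n m) * exp (-(min c δ * n)) := by
    have h1 : (#B₁ : ℝ) * exp (n * (s + 2 * δ)) ≤ #Z := by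
      rw [← sum_card_fib, ← nsmul_eq_mul]
      exact (card_nsmul_le_sum _ _ _ hfib).trans
        (Finset.sum_le_sum_of_subset_of_nonneg (subset_univ _)
          fun _ _ _ => Nat.cast_nonneg _)
    rw [card_conf hm]
    refine le_of_mul_le_mul_right (h1.trans (hZc.trans ?_)) (exp_pos (n * (s + 2 * δ)))
    rw [mul_assoc, ← exp_add]
    gcongr
    nlinarith [mul_le_mul_of_nonneg_right (min_le_right c δ) hn'.le]
  refine lt_of_le_of_lt (hPr m hm _ (B₁ ∪ univ.filter fun π =>
    η' * (n:ℝ) ≤ badCount (r + 1) π°) (fun π h1 h2 => ?_) ?_).1 hexp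
  · rcases le_total (badCount (r + 1) π° : ℝ) (η' * n) with h3 | h3
    · exact mem_union_left _ ((hB₁ π).mpr ⟨h1, h3, h2⟩)
    · exact mem_union_right _ (mem_fil.mpr h3)
  · have h1 := hbad n hn m hm
    have h2 : card (Conf d n m) * exp (-(c * n)) ≤ card (Conf d n m) * exp (-(min c δ * n)) := by
      gcongr
      exact min_le_left _ _
    have h3 : (0:ℝ) ≤ card (Conf d n m) * exp (-(min c δ * n)) := by positivity
    refine (Nat.cast_le.mpr (card_union_le _ _)).trans ?_
    push_cast
    linarith

end

section

lemma exp_mul_exp_le {a b c : ℝ} (h : a + b ≤ c) : exp a * exp b ≤ exp c := by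
  rwa [← exp_add, exp_le_exp]

lemma card_fib_sq {A V M : Type*} [Fintype V] [DecidableEq V] [Fintype M]
    {Z : Finset (A × (V → M))} {W : Finset (A × (V → M × M))}
    (hW : ∀ a f, (a, f) ∈ W ↔ (a, fun v => (f v).1) ∈ Z ∧ (a, fun v => (f v).2) ∈ Z) (a : A) :
    #(fib W a) = #(fib Z a) ^ 2 := by
  rw [sq, ← card_product]
  refine Finset.card_bij' (fun f _ => (fun v => (f v).1, fun v => (f v).2))
    (fun g _ v => (g.1 v, g.2 v)) (fun f hf => ?_) (fun g hg => ?_) (fun _ _ => rfl) (fun _ _ => rfl)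
  · obtain ⟨h1, h2⟩ := (hW a f).mp (mem_fib.mp hf)
    exact mem_product.mpr ⟨mem_fib.mpr h1, mem_fib.mpr h2⟩
  · obtain ⟨h1, h2⟩ := mem_product.mp hg
    exact mem_fib.mpr ((hW a _).mpr ⟨mem_fib.mp h1, mem_fib.mp h2⟩)

lemma card_ge_of_moments {A : Type*} [Fintype A] [Nonempty A] {Y : A → ℝ}
    {e e₂ : ℝ} (he : 0 ≤ e) (h1 : card A * e ≤ ∑ a, Y a)
    (h2 : ∑ a, Y a ^ 2 ≤ card A * e₂) (S : Finset A) (hS : ∀ a, e / 2 ≤ Y a → a ∈ S) :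
    card A * e ^ 2 ≤ 4 * e₂ * #S := by
  have hc : (0:ℝ) < card A := mod_cast Fintype.card_pos
  have h3 : ∑ a ∈ Sᶜ, Y a ≤ card A * (e / 2) := by
    refine (sum_le_card_nsmul _ _ (e / 2) fun a ha => ?_).trans ?_
    · by_contra h
      exact Finset.mem_compl.mp ha (hS a (not_le.mp h).le)
    · rw [nsmul_eq_mul]
      gcongr
      exact Finset.card_le_univ _
  have h4 : card A * (e / 2) ≤ ∑ a ∈ S, Y a := by
    rw [← Finset.sum_add_sum_compl S] at h1
    linarith
  have h5 : (∑ a ∈ S, Y a) ^ 2 ≤ #S * (card A * e₂) :=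
    sq_sum_le_card_mul_sum_sq.trans (mul_le_mul_of_nonneg_left
      ((Finset.sum_le_sum_of_subset_of_nonneg (subset_univ S)
        fun a _ _ => sq_nonneg (Y a)).trans h2) (Nat.cast_nonneg _))
  have h6 := pow_le_pow_left₀ (by positivity) h4 2
  refine le_of_mul_le_mul_left ?_ hc
  nlinarith

lemma log_sum_exp_sub_le {B : Type*} [Fintype B] [Nonempty B] {a b : B → ℝ} {c : ℝ}
    (h : ∀ f, |a f - b f| ≤ c) :
    log (∑ f, exp (-a f)) - log (∑ f, exp (-b f)) ≤ c := by
  have hp (a : B → ℝ) : 0 < ∑ f, exp (-a f) := sum_pos (fun f _ => exp_pos _) Finset.univ_nonempty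
  have h1 : ∑ f, exp (-a f) ≤ exp c * ∑ f, exp (-b f) := by
    rw [mul_sum]
    refine sum_le_sum fun f _ => ?_
    rw [← exp_add]
    exact exp_le_exp.mpr (by linarith [(abs_le.mp (h f)).1])
  have h2 := Real.log_le_log (hp a) h1
  rw [log_mul (exp_pos c).ne' (hp b).ne', log_exp] at h2
  linarith

variable {d : ℕ} [NeZero d] {M : Type} [Fintype M]

/-- Restriction of a coloring of a ball to a smaller ball. -/
def rst {r R : ℕ} (h : r ≤ R) (x : Col d R M) : Col d r M :=
  fun v => x ⟨v.1, le_trans v.2 h⟩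

lemma pf_rst_phat {r R n : ℕ} (h : r ≤ R) (ι : HMap n d) (f : Fin n → M) :
    pf (rst h) (phat R ι f) = phat r ι f := pf_cnt _ _ _

/-- No coupling of `p` with itself has entropy larger than `2 * s`. -/
abbrev CouplingBound (hd : 3 ≤ d) {r : ℕ} (p : Col d r M → ℝ) (s : ℝ) : Prop :=
  ∀ q : Col d r (M × M) → ℝ, IsIdr (by omega : 2 ≤ d) q →
    pf (fun x v => (x v).1) q = p → pf (fun x v => (x v).2) q = p → entJ q ≤ 2 * s

/-- Second moment bound: with at least an exponentially small probability there are many good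
colorings. -/
lemma many_colorings (hd : 3 ≤ d) {r R : ℕ} (hr : 1 ≤ r) (hrR : r ≤ R) {q : Col d R M → ℝ}
    (hq : q ∈ KSet (by omega : 2 ≤ d) R M) (hsym : sym (pf (rst hrR) q) = pf (rst hrR) q)
    (h : CouplingBound hd (pf (rst hrR) q) (entJ q)) {δ η₀ : ℝ} (hδ : 0 < δ) (hη₀ : 0 < η₀) :
    ∀ᶠ n : ℕ in atTop, ∀ m, 2 * m = n * d → ∀ S : Finset (Conf d n m),
      (∀ (π : Conf d n m) (T : Finset (Fin n → M)), (∀ f ∈ T, l1 (phat R π° f) q ≤ η₀) →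
        exp (n * (entJ q - δ)) / 2 ≤ #T → π ∈ S) →
      card (Conf d n m) * exp (-(3 * δ * n)) ≤ 4 * #S := by
  obtain ⟨η, hη, hW⟩ := card_moment_le (N := M × M) (J := Bool) hd hr
    (fun j x => cond j x.1 x.2) (pf (rst hrR) q) (2 * entJ q)
    (fun q₂ h1 h2 => h q₂ h1 (h2 true) (h2 false)) hδ
  filter_upwards [hW, lower_bound (by omega : 2 ≤ d) hq r hδ (lt_min hη hη₀)] with n hW hZ m hm S hS
  obtain ⟨Z, hZdef⟩ : ∃ Z : Finset (Conf d n m × (Fin n → M)), ∀ π f, (π, f) ∈ Z ↔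
      (badCount r π° : ℝ) ≤ min η η₀ * n ∧ l1 (phat R π° f) q ≤ min η η₀ :=
    exists_finset₂ _
  obtain ⟨W, hWdef⟩ : ∃ W : Finset (Conf d n m × (Fin n → M × M)), ∀ π f, (π, f) ∈ W ↔
      (π, fun v => (f v).1) ∈ Z ∧ (π, fun v => (f v).2) ∈ Z :=
    exists_finset₂ _
  have hZc := hZ m hm Z fun π f h1 h2 => (hZdef π f).mpr ⟨h1, h2⟩
  have hmem (π : Conf d n m) (f : Fin n → M) (hf : (π, f) ∈ Z) :
      l1 (sym (phat r π° f)) (pf (rst hrR) q) ≤ η := by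
    rw [← hsym, ← pf_rst_phat hrR]
    exact (l1_sym_le _ _).trans ((l1_pf_le _ _ _).trans
      (((hZdef π f).mp hf).2.trans (min_le_left _ _)))
  have hWc := hW m hm W fun x hx => by
    obtain ⟨h1, h2⟩ := (hWdef x.1 x.2).mp hx
    refine ⟨((hZdef _ _).mp h1).1.trans (by gcongr; exact min_le_left _ _), fun j => ?_⟩
    cases j
    · exact hmem _ _ h2
    · exact hmem _ _ h1
  have : Nonempty (Conf d n m) := card_pos_iff.mp (by
    rw [card_conf hm]; exact Nat.factorial_pos _)
  have hWs : ∑ π, (#(fib Z π) : ℝ) ^ 2 = #W := by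
    rw [← sum_card_fib]
    exact sum_congr rfl fun π _ => by rw [card_fib_sq hWdef]; push_cast; rfl
  rw [← card_conf hm] at hZc hWc
  rw [← sum_card_fib] at hZc
  rw [← hWs] at hWc
  have key := card_ge_of_moments (exp_pos _).le hZc hWc S fun π hπ =>
    hS π (fib Z π) (fun f hf => ((hZdef π f).mp (mem_fib.mp hf)).2.trans (min_le_right _ _)) hπ
  rw [← Real.exp_nat_mul] at key
  have h5 : exp ((2 : ℕ) * (n * (entJ q - δ)))
      = exp (-(3 * δ * n)) * exp (n * (2 * entJ q + δ)) := by
    rw [← exp_add]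
    congr 1
    push_cast
    ring
  rw [h5] at key
  exact le_of_mul_le_mul_right (by linarith) (exp_pos (n * (2 * entJ q + δ)))

set_option maxHeartbeats 800000 in
/-- Concentration upgrades the second moment bound to an overwhelming probability. -/
theorem card_few_colorings_le (hd : 3 ≤ d) {r R : ℕ} (hr : 1 ≤ r) (hrR : r ≤ R) {q : Col d R M → ℝ}
    [Nonempty M]
    (hq : q ∈ KSet (by omega : 2 ≤ d) R M) (hsym : sym (pf (rst hrR) q) = pf (rst hrR) q)
    (h : CouplingBound hd (pf (rst hrR) q) (entJ q)) {κ θ : ℝ} (hκ : 0 < κ) (hθ : 0 < θ) (hθ3 : 3 * θ ≤ 1) :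
    ∃ c > 0, ∀ᶠ n : ℕ in atTop, ∀ m, 2 * m = n * d → ∀ B : Finset (Conf d n m),
      (∀ π ∈ B, ∀ T : Finset (Fin n → M), (∀ f, f ∈ T ↔ l1 (phat R π° f) q ≤ κ) →
        (#T : ℝ) < exp (n * (entJ q - 4 * θ))) →
      (#B : ℝ) ≤ card (Conf d n m) * exp (-(c * n)) := by
  have hlogM : 0 ≤ log (card M) := Real.log_nonneg (by
    exact_mod_cast Fintype.card_pos)
  have hM : (0:ℝ) < card M := mod_cast Fintype.card_pos
  have hd0 : (0:ℝ) < d := mod_cast (by omega : 0 < d)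
  obtain ⟨s, hs⟩ : ∃ s, s = entJ q := ⟨_, rfl⟩
  obtain ⟨β, hβ, hβκ⟩ : ∃ β > 0, β * κ = log (card M) + |s| + 2 :=
    ⟨(log (card M) + |s| + 2) / κ, by positivity, by field_simp⟩
  obtain ⟨c₀, hc₀, hc₀'⟩ : ∃ c₀ > 0, c₀ = β * (8 * ((d:ℝ) + 1) ^ R) := ⟨_, by positivity, rfl⟩
  obtain ⟨γ, hγ, hγ'⟩ : ∃ γ > 0, γ * (8 * d * c₀ ^ 2) = θ ^ 2 :=
    ⟨θ ^ 2 / (8 * d * c₀ ^ 2), by positivity, by field_simp⟩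
  obtain ⟨δ, hδ, hδθ, hδγ⟩ : ∃ δ > 0, 4 * δ ≤ θ ∧ 4 * δ ≤ γ :=
    ⟨min θ γ / 4, by positivity, by linarith [min_le_left θ γ], by linarith [min_le_right θ γ]⟩
  obtain ⟨η₀, hη₀, hη₀'⟩ : ∃ η₀ > 0, β * η₀ = θ / 4 := ⟨θ / 4 / β, by positivity, by field_simp⟩
  have hlin {a : ℝ} (ha : 0 < a) (b : ℝ) : ∀ᶠ n : ℕ in atTop, b < exp (a * n) :=
    (Real.tendsto_exp_atTop.comp
      (tendsto_natCast_atTop_atTop.const_mul_atTop ha)).eventually_gt_atTop b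
  refine ⟨γ, hγ, ?_⟩
  filter_upwards [many_colorings hd hr hrR hq hsym h hδ hη₀, eventually_gt_atTop 0,
    hlin (by positivity : 0 < γ / 4) 4, hlin (by positivity : 0 < θ / 4) 2, hlin one_pos 2]
    with n hS hn0 hn1 hn2 hn3 m hm B hB
  have hn : (0:ℝ) < n := mod_cast hn0
  have hC : (0:ℝ) < card (Conf d n m) := by
    rw [card_conf hm]
    exact_mod_cast Nat.factorial_pos _
  obtain ⟨Y, hY⟩ : ∃ Y : Conf d n m → ℝ, ∀ π,
    Y π = ∑ f : Fin n → M, exp (-(β * n * l1 (phat R π° f) q)) := ⟨_, fun _ => rfl⟩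
  have hYpos (π) : 0 < Y π := by
    rw [hY]
    exact sum_pos (fun f _ => exp_pos _) Finset.univ_nonempty
  have hlip (π : Conf d n m) (a b : Fin m × Bool) :
      |log (Y π) - log (Y ((swap a b).trans π))| ≤ c₀ := by
    have h1 (f : Fin n → M) : |β * n * l1 (phat R π° f) q
        - β * n * l1 (phat R ((swap a b).trans π)° f) q| ≤ c₀ := by
      have h2 := l1_phat_swap_le (R := R) π a b f
      have h3 := l1_triangle (phat R π° f) (phat R ((swap a b).trans π)° f) q
      have h4 := l1_triangle (phat R ((swap a b).trans π)° f) (phat R π° f) q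
      rw [l1_comm (phat R ((swap a b).trans π)° f) (phat R π° f)] at h4
      have h5 : |l1 (phat R π° f) q - l1 (phat R ((swap a b).trans π)° f) q|
          ≤ 8 * ((d:ℝ) + 1) ^ R / n := abs_le.mpr ⟨by linarith, by linarith⟩
      rw [← mul_sub, abs_mul, abs_of_pos (mul_pos hβ hn), hc₀']
      refine (mul_le_mul_of_nonneg_left h5 (mul_pos hβ hn).le).trans (le_of_eq ?_)
      field_simp
    rw [hY, hY]
    exact abs_le.mpr ⟨by linarith [log_sum_exp_sub_le fun f => (abs_sub_comm _ _).trans_le (h1 f)],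
      log_sum_exp_sub_le h1⟩
  have hsub := SubG.conf hm (fun π => log (Y π)) hlip
  have hK : 0 < 2 * ((n:ℝ) * d) * c₀ ^ 2 := by positivity
  have hexp : (θ * n) ^ 2 / (4 * (2 * ((n:ℝ) * d) * c₀ ^ 2)) = γ * n := by
    rw [div_eq_iff (by positivity), mul_pow, ← hγ']
    ring
  have htail := hsub.tail hK (θ * n) (by positivity)
  have hlow := hsub.lower_tail hK (θ * n) (by positivity)
  rw [hexp] at htail hlow
  have havg : n * (s - 2 * θ) ≤ avg fun π => log (Y π) := by
    by_contra! hlt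
    have h1 := hS m hm (univ.filter fun π =>
      (avg fun π => log (Y π)) + θ * n ≤ log (Y π)) fun π T hT hTc => by
        refine mem_fil.mpr ?_
        have h2 : exp (n * (s - θ)) ≤ Y π := by
          calc exp (n * (s - θ)) ≤ exp (n * (s - δ)) / 2 * exp (-(θ / 4 * n)) := by
                have h3 : exp (n * (s - θ)) = exp (n * (s - θ * 3 / 4)) / exp (θ / 4 * n) := by
                  rw [← Real.exp_sub]; congr 1; ring
                rw [h3, exp_neg, div_mul_eq_mul_div, div_eq_mul_inv, mul_div_right_comm]
                gcongr ?_ * _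
                rw [le_div_iff₀ two_pos]
                refine (mul_le_mul_of_nonneg_left hn2.le (exp_pos _).le).trans ?_
                exact exp_mul_exp_le (by nlinarith)
            _ ≤ #T * exp (-(θ / 4 * n)) := by
                gcongr
                rw [hs]
                exact hTc
            _ ≤ ∑ f ∈ T, exp (-(β * n * l1 (phat R π° f) q)) := by
                rw [← nsmul_eq_mul]
                refine card_nsmul_le_sum _ _ _ fun f hf => exp_le_exp.mpr ?_
                rw [← hη₀']
                nlinarith [mul_le_mul_of_nonneg_left (hT f hf) (mul_pos hβ hn).le]
            _ ≤ Y π := by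
                rw [hY]
                exact Finset.sum_le_sum_of_subset_of_nonneg (subset_univ _)
                  fun _ _ _ => (exp_pos _).le
        have h4 := (Real.le_log_iff_exp_le (hYpos π)).mpr h2
        linarith
    have h2 := h1.trans (mul_le_mul_of_nonneg_left htail (by norm_num))
    have h3 : exp (-(3 * δ * n)) ≤ 4 * exp (-(γ * n)) :=
      le_of_mul_le_mul_left (h2.trans_eq (by ring)) hC
    have h4 : exp (γ / 4 * n) * exp (-(γ * n)) ≤ exp (-(3 * δ * n)) := exp_mul_exp_le (by nlinarith)
    exact absurd (h4.trans h3) (not_le.mpr (mul_lt_mul_of_pos_right hn1 (exp_pos _)))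
  refine le_trans (Nat.cast_le.mpr (card_le_card fun π hπ =>
    mem_fil.mpr ?_)) hlow
  by_contra! hlt
  have h1 : exp (n * (s - 3 * θ)) < Y π := (Real.lt_log_iff_exp_lt (hYpos π)).mp (by linarith)
  obtain ⟨T, hT⟩ : ∃ T : Finset (Fin n → M), ∀ f, f ∈ T ↔ l1 (phat R π° f) q ≤ κ := exists_finset _
  have h2 := hB π hπ T hT
  have h3 : Y π ≤ #T + exp (-(n * (|s| + 2))) := by
    rw [hY, ← Finset.sum_add_sum_compl T]
    refine add_le_add ?_ ?_
    · refine (sum_le_card_nsmul _ _ 1 fun f _ => Real.exp_le_one_iff.mpr ?_).trans (by simp)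
      have := l1_nonneg (phat R π° f) q
      nlinarith [mul_nonneg (mul_pos hβ hn).le this]
    · refine (sum_le_card_nsmul _ _ (exp (-(β * n * κ))) fun f hf =>
        exp_le_exp.mpr ?_).trans ?_
      · have := not_le.mp fun h => Finset.mem_compl.mp hf ((hT f).mpr h)
        nlinarith [mul_le_mul_of_nonneg_left this.le (mul_pos hβ hn).le]
      · have h4 : (#Tᶜ : ℝ) ≤ exp (n * log (card M)) := by
          rw [mul_comm, Real.exp_mul, exp_log hM, Real.rpow_natCast]
          have := Finset.card_le_univ Tᶜ
          rw [Fintype.card_fun, card_fin] at this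
          exact_mod_cast this
        rw [nsmul_eq_mul]
        refine (mul_le_mul_of_nonneg_right h4 (exp_pos _).le).trans ?_
        refine exp_mul_exp_le (le_of_eq ?_)
        linear_combination -(n:ℝ) * hβκ
  have h4 : 2 * exp (-(n * (|s| + 2))) ≤ exp (n * (s - 3 * θ)) := by
    refine (mul_le_mul_of_nonneg_right hn3.le (exp_pos _).le).trans ?_
    refine exp_mul_exp_le ?_
    nlinarith [neg_abs_le s]
  have h5 : 2 * exp (n * (s - 4 * θ)) ≤ exp (n * (s - 3 * θ)) := by
    refine (mul_le_mul_of_nonneg_right hn2.le (exp_pos _).le).trans ?_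
    exact exp_mul_exp_le (by nlinarith)
  rw [← hs] at h2
  linarith

end

section
variable {d : ℕ} {M : Type} [Fintype M] [MeasurableSpace M] [DiscreteMeasurableSpace M]
  {μ : Measure (TdVertex d → M)}

lemma pf_rst_vec_restrictTo [NeZero d] [IsProb μ] {r R : ℕ} (h : r ≤ R) :
    pf (rst h) (srVec d R μ) = srVec d r μ := by
  have := isProb_restrictTo (μ := μ) (S := SrSet d R)
  rw [← vec_map]
  congr 1
  exact Measure.map_map (measurable_of_finite _) (measurable_restr _)

lemma PrG_mono {n : ℕ} {A B : Set (Gr n)} (h : A ⊆ B) : PrG d n A ≤ PrG d n B := by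
  unfold PrG
  gcongr
  exact Set.toFinite _

lemma PrG_le_one {n : ℕ} (A : Set (Gr n)) : PrG d n A ≤ 1 := by
  unfold PrG
  refine div_le_one_of_le₀ ?_ (Nat.cast_nonneg _)
  gcongr
  · exact Set.toFinite _
  · exact Set.inter_subset_left

instance : (goodFilter d).NeBot := by
  refine frequently_mem_iff_neBot.mp ?_
  refine (frequently_atTop.mpr fun a => ⟨2 * (a + d + 1), by omega, ?_⟩)
  exact ⟨by omega, by rw [mul_assoc]; exact even_two_mul _⟩

lemma eventually_goodFilter {P : ℕ → Prop}
    (h : ∀ᶠ n in atTop, ∀ m, 2 * m = n * d → P n) : ∀ᶠ n in goodFilter d, P n := by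
  refine eventually_inf_principal.mpr (h.mono fun n hn hg => ?_)
  obtain ⟨m, hm⟩ := hg.2
  exact hn m (by omega)

/-- With overwhelming probability a random regular graph carries many colorings whose local
statistics are close to those of the process. -/
theorem PrG_many_typical [NeZero d] (hd : 3 ≤ d) {r R : ℕ} (hr : 1 ≤ r) (hrR : r ≤ R)
    (hμ : μ ∈ InvMeas d M) (hMar : rMarkov r μ)
    (h : CouplingBound hd (srVec d r μ) (entJ (srVec d r μ)))
    {ε θ : ℝ} (hε : 0 < ε) (hθ : 0 < θ) (hθ3 : 3 * θ ≤ 1) :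
    ∃ a > 0, ∀ᶠ n : ℕ in goodFilter d, 1 - exp (-(a * n)) ≤ PrG d n {G | ∃ T : Finset (Fin n → M),
        exp (n * (entJ (srVec d r μ) - 4 * θ)) ≤ #T ∧
        ∀ f ∈ T, ∀ A : Set (RCG M), |(distrG G f {g | resS R g ∈ A}).toReal
          - (lawTd d μ {g | resS R g ∈ A}).toReal| ≤ ε} := by
  have hprob : IsProb μ := hμ.1
  have : Nonempty M := by
    obtain ⟨x⟩ := μ.nonempty_of_neZero
    exact ⟨x (rootTd d)⟩
  have hpr := isProb_restrictTo (μ := μ) (S := SrSet d r)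
  have hpR := isProb_restrictTo (μ := μ) (S := SrSet d R)
  have hIr := (mem_IdrMeas_iff hd hr _).mp (restrictTo_mem_IdrMeas hd hμ hr)
  have hIR := (mem_IdrMeas_iff hd (hr.trans hrR) _).mp (restrictTo_mem_IdrMeas hd hμ (hr.trans hrR))
  have hs : entJ (srVec d R μ) = entJ (srVec d r μ) := by
    rw [entJ_restrictTo hd hr hμ hMar hrR, entJ_restrictTo hd hr hμ hMar le_rfl]
  have hrst := pf_rst_vec_restrictTo (μ := μ) hrR
  obtain ⟨c, hc, hfew⟩ := card_few_colorings_le hd hr hrR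
    (q := srVec d R μ) ⟨hIR.nonneg, hIR.sum_one, hIR.flip⟩
    (by rw [hrst]; exact sym_eq_of_inv hIr.inv) (by rw [hrst, hs]; exact h)
    (half_pos hε) hθ hθ3
  obtain ⟨c', hc', n₀, hbad⟩ := card_badCount_ge d (R + 1) (by positivity : 0 < ε / 6)
  refine ⟨min c c' / 2, by positivity, eventually_goodFilter ?_⟩
  filter_upwards [hfew, eventually_ge_atTop n₀, eventually_gt_atTop 0,
    PrG_le_of_card d (lt_min hc hc')] with n hfew hn hn0 hPr m hm
  have hn' : (0:ℝ) < n := mod_cast hn0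
  rw [hs] at hfew
  obtain ⟨B, hB⟩ : ∃ B : Finset (Conf d n m), ∀ π, π ∈ B ↔ ∀ T : Finset (Fin n → M),
      (∀ f, f ∈ T ↔ l1 (phat R π° f) (srVec d R μ) ≤ ε / 2) →
        (#T : ℝ) < exp (n * (entJ (srVec d r μ) - 4 * θ)) :=
    exists_finset _
  have hBc := hfew m hm B fun π hπ => (hB π).mp hπ
  have hbc := hbad n hn m hm
  rw [← compl_compl {G | _}]
  refine (hPr m hm _ (B ∪ univ.filter fun π =>
    ε / 6 * (n:ℝ) ≤ badCount (R + 1) π°) (fun π h1 h2 => ?_) ?_).2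
  · by_contra hcon
    rw [mem_union, not_or, hB, mem_filter] at hcon
    obtain ⟨h3, h4⟩ := hcon
    refine h2 ?_
    push Not at h3
    obtain ⟨T, hT, hTc⟩ := h3
    refine Set.mem_ofPred_eq ▸ ⟨T, hTc, fun f hf A => ?_⟩
    have h5 : (badCount (R + 1) π° : ℝ) ≤ ε / 6 * n := le_of_not_ge fun h => h4 ⟨mem_univ _, h⟩
    have h6 := (l1_sym_le (phat R π° f) (srVec d R μ)).trans ((hT f).mp hf)
    rw [sym_eq_of_inv hIR.inv] at h6
    have h7 : 3 * (badCount (R + 1) π° : ℝ) / n ≤ ε / 2 := by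
      rw [div_le_iff₀ hn']
      linarith
    exact (abs_distrG_sub_lawTd_le hd h1 f R A).trans (by linarith)
  · have h1 {x : ℝ} (hx : min c c' ≤ x) : card (Conf d n m) * exp (-(x * n))
        ≤ card (Conf d n m) * exp (-(min c c' * n)) := by
      gcongr
    have h3 : (0:ℝ) ≤ card (Conf d n m) * exp (-(min c c' * n)) := by positivity
    refine (Nat.cast_le.mpr (card_union_le _ _)).trans ?_
    push_cast
    linarith [h1 (min_le_left c c'), h1 (min_le_right c c')]

theorem le_hlow [NeZero d] (hd : 3 ≤ d) {r : ℕ} (hr : 1 ≤ r)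
    (hμ : μ ∈ InvMeas d M) (hMar : rMarkov r μ)
    (h : CouplingBound hd (srVec d r μ) (entJ (srVec d r μ))) :
    ((entJ (srVec d r μ) : ℝ) : EReal) ≤ hlow d μ := by
  have hprob : IsProb μ := hμ.1
  have hlaw : IsProb (lawTd d μ) := Measure.isProbabilityMeasure_map measurable_iotaTd.aemeasurable
  obtain ⟨s, hs⟩ : ∃ s, s = entJ (srVec d r μ) := ⟨_, rfl⟩
  rw [← hs]
  refine le_iInf fun r' => le_iInf fun ⟨ε, hε⟩ => EReal.ge_of_forall_gt_iff_ge.mp fun z hz => ?_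
  have hz : z < s := EReal.coe_lt_coe_iff.mp hz
  obtain ⟨k, hk⟩ := exists_pow_lt_of_lt_one hε (by norm_num : (2⁻¹ : ℝ) < 1)
  obtain ⟨R, hrR, hr'R, hkR⟩ : ∃ R, r ≤ R ∧ r' ≤ R ∧ k ≤ R := ⟨r + r' + k, by omega⟩
  have hRε : (2⁻¹ : ℝ) ^ R ≤ ε := (pow_le_pow_of_le_one (by norm_num) (by norm_num) hkR).trans hk.le
  obtain ⟨θ, hθ, hθ3, hθz⟩ : ∃ θ > 0, 3 * θ ≤ 1 ∧ z ≤ s - 4 * θ :=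
    ⟨min (1 / 3) ((s - z) / 4), lt_min (by norm_num) (by linarith),
      by linarith [min_le_left (1 / 3) ((s - z) / 4)],
      by linarith [min_le_right (1 / 3) ((s - z) / 4)]⟩
  obtain ⟨a, ha, hev⟩ := PrG_many_typical hd hr hrR hμ hMar h hε hθ hθ3
  rw [← hs] at hev
  refine le_liminf_of_le (f := goodFilter d) ?_ ?_
  · isBoundedDefault
  have hlim : Tendsto (fun n : ℕ => exp (-(a * n))) atTop (𝓝 0) :=
    Real.tendsto_exp_neg_atTop_nhds_zero.comp (tendsto_natCast_atTop_atTop.const_mul_atTop ha)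
  have h2 : ∀ᶠ n : ℕ in atTop, exp (-(a * n)) < 1 / 2 ∧ 0 < n :=
    (hlim.eventually_lt_const (by norm_num)).and (eventually_gt_atTop 0)
  filter_upwards [hev, h2.filter_mono inf_le_left] with n h3 ⟨h4, hn⟩
  have hn' : (0:ℝ) < n := mod_cast hn
  refine le_trans (EReal.coe_le_coe_iff.mpr (le_max_left z 0)) (le_sSup ⟨Or.inr
    (EReal.coe_nonneg.mpr (le_max_right z 0)), le_trans (by linarith) (h3.trans (PrG_mono ?_))⟩)
  rintro G ⟨T, hT, hTA⟩
  have hsub : (T : Set (Fin n → M)) ⊆ FSet d μ r' ε G := fun f hf => by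
    have := isProb_distrG hn G f
    refine levyProkhorovDist_map_le hε hRε (hTA f hf) (measurable_resS r') fun g g' hg => ?_
    rw [← resS_resS hr'R g, hg, resS_resS hr'R, dist_self]
    positivity
  have hTc : (#T : ℝ) ≤ (FSet d μ r' ε G).ncard := by
    rw [← Set.ncard_coe_finset T]
    exact_mod_cast Set.ncard_le_ncard hsub (Set.toFinite _)
  have hpos : (0:ℝ) < (FSet d μ r' ε G).ncard := (exp_pos _).trans_le (hT.trans hTc)
  have hne : FSet d μ r' ε G ≠ ∅ := fun h => by simp [h] at hpos
  rw [Set.mem_ofPred_eq, HG, if_neg hne]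
  refine EReal.coe_le_coe_iff.mpr (max_le ?_ ?_)
  · rw [le_div_iff₀ hn', mul_comm]
    refine le_trans (mul_le_mul_of_nonneg_left hθz hn'.le) ?_
    exact (Real.le_log_iff_exp_le hpos).mpr (hT.trans hTc)
  · exact div_nonneg (Real.log_nonneg (mod_cast hpos)) hn'.le

theorem hbar_le [NeZero d] (hd : 3 ≤ d) {r : ℕ} (hr : 1 ≤ r) [IsProb μ] :
    hbar d μ ≤ ((entJ (srVec d r μ) : ℝ) : EReal) := by
  refine EReal.le_of_forall_lt_iff_le.mp fun z hz => ?_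
  have hz := EReal.coe_lt_coe_iff.mp hz
  obtain ⟨ε, hε, hev⟩ := PrG_HG_lt (μ := μ) hd hr le_rfl (half_pos (sub_pos.mpr hz))
  refine iInf_le_of_le r (iInf_le_of_le ⟨ε, hε⟩ (limsup_le_of_le (f := goodFilter d) ?_ ?_))
  · isBoundedDefault
  refine eventually_goodFilter (hev.mono fun n hn m hm => sSup_le fun x hx => ?_)
  by_contra! hlt
  refine absurd (hx.2.trans (PrG_mono fun G hG => ?_)) (not_le.mpr (hn m hm))
  rw [mul_div_cancel₀ _ two_ne_zero, add_sub_cancel]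
  exact hlt.le.trans hG

theorem stronglyTypical_of_coupling [NeZero d] (hd : 3 ≤ d) {r : ℕ} (hr : 1 ≤ r)
    (hμ : μ ∈ InvMeas d M) (hMar : rMarkov r μ)
    (h : CouplingBound hd (srVec d r μ) (entJ (srVec d r μ))) :
    StronglyTypical d μ := by
  have hprob : IsProb μ := hμ.1
  have hlaw : IsProb (lawTd d μ) := Measure.isProbabilityMeasure_map measurable_iotaTd.aemeasurable
  refine ⟨fun _ => 1, fun ε hε => ?_, tendsto_const_nhds⟩
  obtain ⟨k, hk⟩ := exists_pow_lt_of_lt_one hε (by norm_num : (2⁻¹ : ℝ) < 1)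
  have hRε : (2⁻¹ : ℝ) ^ (r + k) ≤ ε :=
    (pow_le_pow_of_le_one (by norm_num) (by norm_num) (by omega)).trans hk.le
  obtain ⟨a, ha, hev⟩ := PrG_many_typical hd hr (Nat.le_add_right r k) hμ hMar h hε
    (by norm_num : (0:ℝ) < 1 / 3) (by norm_num)
  have hlim : Tendsto (fun n : ℕ => 1 - exp (-(a * n))) (goodFilter d) (𝓝 1) := by
    have h1 : Tendsto (fun n : ℕ => exp (-(a * n))) atTop (𝓝 0) :=
      Real.tendsto_exp_neg_atTop_nhds_zero.comp (tendsto_natCast_atTop_atTop.const_mul_atTop ha)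
    have h2 := h1.const_sub 1
    rw [sub_zero] at h2
    exact h2.mono_left inf_le_left
  refine tendsto_of_tendsto_of_tendsto_of_le_of_le' hlim tendsto_const_nhds ?_
    (Eventually.of_forall fun n => PrG_le_one _)
  filter_upwards [hev, (eventually_gt_atTop 0).filter_mono inf_le_left] with n h3 hn
  refine h3.trans (PrG_mono ?_)
  rintro G ⟨T, hT, hTA⟩
  obtain ⟨f, hf⟩ : T.Nonempty := Finset.card_pos.mp (mod_cast (exp_pos _).trans_le hT)
  have := isProb_distrG hn G f
  have h1 := levyProkhorovDist_map_le hε hRε (hTA f hf) measurable_id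
    fun g g' hg => dist_le_of_resS_eq hg
  rw [Measure.map_id, Measure.map_id] at h1
  exact ⟨f, h1⟩

end

end

end TreeEntropy

namespace TreeEntropy

/-- Let `r ≥ 1` and `p ∈ I_{d,r}(M)`.  If for every coupling
`q ∈ I_{d,r}(M×M)` of `p` and `p` one has `Σ(q) ≤ 2 Σ(p)`, then
`h̲(μ(p)) = h̄(μ(p)) = Σ(p)` and the `r`-Markov process `μ(p)` is strongly typical.
(Here `μ(p)` is the unique `r`-Markov element of `I_d(M)` with marginal `p` on `S_r`.) -/
theorem edge_markov_strongly_typical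
    (d : ℕ) (hd : 3 ≤ d) (M : Type) [Fintype M] [MeasurableSpace M]
    [DiscreteMeasurableSpace M]
    (r : ℕ) (hr : 1 ≤ r) (p : Measure (↥(SrSet d r) → M)) (hp : p ∈ IdrMeas d r M)
    (hcoup : ∀ q : Measure (↥(SrSet d r) → M × M), q ∈ IdrMeas d r (M × M) →
      q.map (fun x => fun v => (x v).1) = p → q.map (fun x => fun v => (x v).2) = p →
      SigmaP d r q ≤ 2 * SigmaP d r p)
    (μ : Measure (TdVertex d → M)) (hμ : μ ∈ InvMeas d M) (hMar : rMarkov r μ)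
    (hmarg : restrictTo (SrSet d r) μ = p) :
    hlow d μ = hbar d μ ∧ hbar d μ = ((SigmaP d r p : ℝ) : EReal) ∧
    StronglyTypical d μ := by
  have hprob : IsProbabilityMeasure μ := hμ.1
  have : NeZero d := ⟨by omega⟩
  have hpr : IsProbabilityMeasure p := hmarg ▸ isProb_restrictTo
  have hI := (mem_IdrMeas_iff hd hr p).mp hp
  have hs : SigmaP d r p = entJ (vec p) := SigmaP_eq_entJ (by omega) p hI.inv
  have h (q₂ : Col d r (M × M) → ℝ) (hq₂ : IsIdr (by omega : 2 ≤ d) q₂)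
      (h1 : pf (fun x v => (x v).1) q₂ = vec (restrictTo (SrSet d r) μ))
      (h2 : pf (fun x v => (x v).2) q₂ = vec (restrictTo (SrSet d r) μ)) :
      entJ q₂ ≤ 2 * entJ (vec (restrictTo (SrSet d r) μ)) := by
    rw [hmarg] at h1 h2 ⊢
    obtain ⟨q, hq, rfl⟩ := exists_measure_vec q₂ hq₂.nonneg hq₂.sum_one
    have h3 (f : Col d r (M × M) → Col d r M) (hf : pf f (vec q) = vec p) : q.map f = p := by
      have := Measure.isProbabilityMeasure_map (μ := q) (f := f)
        (measurable_of_finite f).aemeasurable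
      exact eq_of_vec_eq ((vec_map q f).trans hf)
    have h4 := hcoup q ((mem_IdrMeas_iff hd hr q).mpr hq₂) (h3 _ h1) (h3 _ h2)
    rwa [SigmaP_eq_entJ (by omega) q hq₂.inv, hs] at h4
  have hlo := le_hlow hd hr hμ hMar h
  have hup := hbar_le (μ := μ) hd hr
  have hle : hlow d μ ≤ hbar d μ := iInf_mono fun _ => iInf_mono fun _ => liminf_le_limsup
  rw [hmarg, ← hs] at hlo hup
  exact ⟨hle.antisymm (hup.trans hlo), hup.antisymm (hlo.trans hle),
    stronglyTypical_of_coupling hd hr hμ hMar h⟩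

end TreeEntropy
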